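/- Let p be a prime, K a field of characteristic p, and n ≥ 1. Let Ω¹(W_n(K)) be the module of absolute Kähler differentials of the ring W_n(K) of p-typical truncated Witt vectors of length n, and let G_n be the quotient of Ω¹(W_n(K)) by the subgroup generated by all elements Fa·db − a·dVb (a, b ∈ W_n(K), F the Frobenius, V the Verschiebung) and all elements ℘([a])·[b]^{−1}·d[b] (a ∈ K, b ∈ K^×, [·] the Teichmüller lift K → W_n(K), ℘ = F − id). Then the assignment a·db ↦ ((a,b))_{p^n} induces a well-defined group isomorphism α_{p^n} : G_n → Br(K)[p^n] onto the p^n-torsion subgroup of the Brauer group of K. -/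

import Mathlib

noncomputable section

/-- The product `∏ i, x i ^ e i` over the support of `e`, with factors multiplied in
increasing order of the index. -/
def ordProd {σ M : Type*} [LinearOrder σ] [Monoid M] (x : σ → M) (e : σ →₀ ℕ) : M :=
  ((e.support.sort (· ≤ ·)).map fun i => x i ^ e i).prod

/-- Evaluation of a multivariate polynomial in a (possibly noncommutative) algebra:
each monomial is evaluated as the ordered product of the powers of the substituted
values, the variables being multiplied in increasing order of their (linearly ordered)
index. -/
def pEval {σ R A : Type*} [LinearOrder σ] [CommSemiring R] [Semiring A] [Algebra R A]
    (x : σ → A) (q : MvPolynomial σ R) : A :=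
  q.support.sum fun e => MvPolynomial.coeff e q • ordProd x e

/-- Evaluation of an integral polynomial in the commuting variables `X_d` (`d : ℕ+`, left
summand) and `Y_e` (`e : ℕ+`, right summand), substituting `x d` for `X_d` and `y e` for
`Y_e`; in each monomial all `X`-factors (in increasing index order) are multiplied to the
left of all `Y`-factors (in increasing index order), as appropriate for a polynomial in
`ℤ[X][Y]`. -/
def cEval {A : Type*} [Ring A] (x y : ℕ+ → A) (q : MvPolynomial (ℕ+ ⊕ₗ ℕ+) ℤ) : A :=
  pEval (fun v => Sum.elim x y (ofLex v)) q

/-- The `k`-th ghost value `w_k(g) = ∑_{d ∣ k} d · (g d)^(k/d)`. -/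
def ghost {A : Type*} [Ring A] (g : ℕ+ → A) (k : ℕ+) : A :=
  ∑ d ∈ (k : ℕ).divisors.attach,
    ((d : ℕ) : A) * g ⟨(d : ℕ), Nat.pos_of_mem_divisors d.2⟩ ^ ((k : ℕ) / (d : ℕ))

/-- The generator `x_d` of the free algebra underlying `B(ℚ)`. -/
def bXf (d : ℕ+) : FreeAlgebra ℚ (ℕ+ ⊕ ℕ+) := FreeAlgebra.ι ℚ (Sum.inl d)

/-- The generator `y_e` of the free algebra underlying `B(ℚ)`. -/
def bYf (e : ℕ+) : FreeAlgebra ℚ (ℕ+ ⊕ ℕ+) := FreeAlgebra.ι ℚ (Sum.inr e)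

/-- The defining relations of `B(ℚ)`: `[w_k(x), w_l(x)] = 0`, `[w_k(y), w_l(y)] = 0` and
`[w_l(y), w_k(x)] = δ_{k,l}·k` for all `k, l ≥ 1`. -/
inductive BRel : FreeAlgebra ℚ (ℕ+ ⊕ ℕ+) → FreeAlgebra ℚ (ℕ+ ⊕ ℕ+) → Prop
  | xx (k l : ℕ+) : BRel (ghost bXf k * ghost bXf l) (ghost bXf l * ghost bXf k)
  | yy (k l : ℕ+) : BRel (ghost bYf k * ghost bYf l) (ghost bYf l * ghost bYf k)
  | yx (k l : ℕ+) : BRel (ghost bYf l * ghost bXf k)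
      (ghost bXf k * ghost bYf l + if k = l then ((k : ℕ) : FreeAlgebra ℚ (ℕ+ ⊕ ℕ+)) else 0)

/-- The universal algebra `B(ℚ)`. -/
abbrev BQ : Type := RingQuot BRel

/-- The generator `x_d` of `B(ℚ)`. -/
def bx (d : ℕ+) : BQ := RingQuot.mkAlgHom ℚ BRel (bXf d)

/-- The generator `y_e` of `B(ℚ)`. -/
def by' (e : ℕ+) : BQ := RingQuot.mkAlgHom ℚ BRel (bYf e)

/-- `c` is a family of polynomials `c_{m,n}` as in the paper: `c m n` is an integral
polynomial in the variables `X_d` (`d` a proper divisor of `m`) and `Y_e` (`e` a proper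
divisor of `n`) such that `[y_n, x_m] = c_{m,n}(x, y)` holds in `B(ℚ)`. -/
def IsCFamily (c : ℕ+ → ℕ+ → MvPolynomial (ℕ+ ⊕ₗ ℕ+) ℤ) : Prop :=
  ∀ m n : ℕ+,
    (∀ v ∈ (c m n).vars,
      (∃ d : ℕ+, (d : ℕ) ∣ (m : ℕ) ∧ d ≠ m ∧ ofLex v = Sum.inl d) ∨
      (∃ e : ℕ+, (e : ℕ) ∣ (n : ℕ) ∧ e ≠ n ∧ ofLex v = Sum.inr e)) ∧
    cEval bx by' (c m n) = by' n * bx m - bx m * by' n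


/-- `p ^ i` as a positive natural number. -/
def ppow (p i : ℕ) : ℕ+ := (p ^ i).toPNat'

/-- Substitution of the generators `x_0, …, x_{m-1}` for the variables `X_{p^0}, …, X_{p^{m-1}}`
(the variable `X_{p^r}` is sent to `x_r`). -/
def sxm (R : Type*) [CommRing R] (p m n : ℕ) : ℕ+ → FreeAlgebra R (Fin m ⊕ Fin n) :=
  fun d => if h : padicValNat p (d : ℕ) < m
    then FreeAlgebra.ι R (Sum.inl ⟨padicValNat p (d : ℕ), h⟩) else 0

/-- Substitution of the generators `y_0, …, y_{n-1}` for the variables `Y_{p^0}, …, Y_{p^{n-1}}`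
(the variable `Y_{p^s}` is sent to `y_s`). -/
def syn (R : Type*) [CommRing R] (p m n : ℕ) : ℕ+ → FreeAlgebra R (Fin m ⊕ Fin n) :=
  fun e => if h : padicValNat p (e : ℕ) < n
    then FreeAlgebra.ι R (Sum.inr ⟨padicValNat p (e : ℕ), h⟩) else 0

/-- The defining relations of the truncated `p`-typical algebra `B_{m,n}(R)`:
`[x_i, x_{i'}] = 0`, `[y_j, y_{j'}] = 0` and
`[y_j, x_i] = c_{p^i, p^j}(x_0, …, x_{i-1}, y_0, …, y_{j-1})`. -/
inductive BmnRel (R : Type*) [CommRing R] (p : ℕ)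
    (c : ℕ+ → ℕ+ → MvPolynomial (ℕ+ ⊕ₗ ℕ+) ℤ) (m n : ℕ) :
    FreeAlgebra R (Fin m ⊕ Fin n) → FreeAlgebra R (Fin m ⊕ Fin n) → Prop
  | xx (i i' : Fin m) : BmnRel R p c m n
      (FreeAlgebra.ι R (Sum.inl i) * FreeAlgebra.ι R (Sum.inl i'))
      (FreeAlgebra.ι R (Sum.inl i') * FreeAlgebra.ι R (Sum.inl i))
  | yy (j j' : Fin n) : BmnRel R p c m n
      (FreeAlgebra.ι R (Sum.inr j) * FreeAlgebra.ι R (Sum.inr j'))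
      (FreeAlgebra.ι R (Sum.inr j') * FreeAlgebra.ι R (Sum.inr j))
  | yx (i : Fin m) (j : Fin n) : BmnRel R p c m n
      (FreeAlgebra.ι R (Sum.inr j) * FreeAlgebra.ι R (Sum.inl i))
      (FreeAlgebra.ι R (Sum.inl i) * FreeAlgebra.ι R (Sum.inr j) +
        cEval (sxm R p m n) (syn R p m n) (c (ppow p (i : ℕ)) (ppow p (j : ℕ))))

/-- The truncated `p`-typical algebra `B_{m,n}(R)`. -/
abbrev Bmn (R : Type*) [CommRing R] (p : ℕ) (c : ℕ+ → ℕ+ → MvPolynomial (ℕ+ ⊕ₗ ℕ+) ℤ)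
    (m n : ℕ) : Type _ := RingQuot (BmnRel R p c m n)

/-- The generator `x_i` of `B_{m,n}(R)`. -/
def gx (R : Type*) [CommRing R] (p : ℕ) (c : ℕ+ → ℕ+ → MvPolynomial (ℕ+ ⊕ₗ ℕ+) ℤ)
    (m n : ℕ) (i : Fin m) : Bmn R p c m n :=
  RingQuot.mkAlgHom R (BmnRel R p c m n) (FreeAlgebra.ι R (Sum.inl i))

/-- The generator `y_j` of `B_{m,n}(R)`. -/
def gy (R : Type*) [CommRing R] (p : ℕ) (c : ℕ+ → ℕ+ → MvPolynomial (ℕ+ ⊕ₗ ℕ+) ℤ)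
    (m n : ℕ) (j : Fin n) : Bmn R p c m n :=
  RingQuot.mkAlgHom R (BmnRel R p c m n) (FreeAlgebra.ι R (Sum.inr j))
/-- The relations `x_i^{p^n} = a_i`, `y_j^{p^m} = b_j` defining `A_{((a,b))_{p^m,p^n}}`. -/
inductive ASRel (K : Type*) [Field K] (p : ℕ) [Fact p.Prime]
    (c : ℕ+ → ℕ+ → MvPolynomial (ℕ+ ⊕ₗ ℕ+) ℤ) (m n : ℕ)
    (a : TruncatedWittVector p m K) (b : TruncatedWittVector p n K) :
    Bmn K p c m n → Bmn K p c m n → Prop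
  | xa (i : Fin m) : ASRel K p c m n a b
      (gx K p c m n i ^ p ^ n) (algebraMap K (Bmn K p c m n) (a.coeff i))
  | yb (j : Fin n) : ASRel K p c m n a b
      (gy K p c m n j ^ p ^ m) (algebraMap K (Bmn K p c m n) (b.coeff j))

/-- The central simple algebra `A_{((a,b))_{p^m,p^n}}`. -/
abbrev Asymb (K : Type*) [Field K] (p : ℕ) [Fact p.Prime]
    (c : ℕ+ → ℕ+ → MvPolynomial (ℕ+ ⊕ₗ ℕ+) ℤ) (m n : ℕ)
    (a : TruncatedWittVector p m K) (b : TruncatedWittVector p n K) : Type _ :=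
  RingQuot (ASRel K p c m n a b)

/-- The image of the generator `x_i` in `A_{((a,b))_{p^m,p^n}}`. -/
def aX (K : Type*) [Field K] (p : ℕ) [Fact p.Prime]
    (c : ℕ+ → ℕ+ → MvPolynomial (ℕ+ ⊕ₗ ℕ+) ℤ) (m n : ℕ)
    (a : TruncatedWittVector p m K) (b : TruncatedWittVector p n K) (i : Fin m) :
    Asymb K p c m n a b :=
  RingQuot.mkAlgHom K (ASRel K p c m n a b) (gx K p c m n i)

/-- The image of the generator `y_j` in `A_{((a,b))_{p^m,p^n}}`. -/
def aY (K : Type*) [Field K] (p : ℕ) [Fact p.Prime]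
    (c : ℕ+ → ℕ+ → MvPolynomial (ℕ+ ⊕ₗ ℕ+) ℤ) (m n : ℕ)
    (a : TruncatedWittVector p m K) (b : TruncatedWittVector p n K) (j : Fin n) :
    Asymb K p c m n a b :=
  RingQuot.mkAlgHom K (ASRel K p c m n a b) (gy K p c m n j)

/-- Two `K`-algebras are Brauer equivalent if they become isomorphic after tensoring with
matrix algebras, i.e. `M_r(A) ≅ M_s(B)` for some `r, s ≥ 1`. -/
def BrauerEquiv (K : Type*) [Field K] (A B : Type*) [Ring A] [Algebra K A]
    [Ring B] [Algebra K B] : Prop :=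
  ∃ r s : ℕ, 0 < r ∧ 0 < s ∧
    Nonempty (Matrix (Fin r) (Fin r) A ≃ₐ[K] Matrix (Fin s) (Fin s) B)


open scoped TensorProduct

/-- The Frobenius `F` of truncated `p`-typical Witt vectors over a ring of characteristic
`p`: it raises each component to the `p`-th power. -/
def twFrob {p : ℕ} [Fact p.Prime] {K : Type*} [CommRing K] {k : ℕ}
    (x : TruncatedWittVector p k K) : TruncatedWittVector p k K :=
  TruncatedWittVector.mk p fun i => x.coeff i ^ p

/-- The Verschiebung `V` of truncated `p`-typical Witt vectors (as an operator
`W_k → W_k`): it shifts the components, `(x_0, …, x_{k−1}) ↦ (0, x_0, …, x_{k−2})`. -/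
def twVer {p : ℕ} [Fact p.Prime] {K : Type*} [CommRing K] {k : ℕ}
    (x : TruncatedWittVector p k K) : TruncatedWittVector p k K :=
  TruncatedWittVector.mk p fun i =>
    if h : (i : ℕ) = 0 then 0 else x.coeff ⟨(i : ℕ) - 1, by omega⟩

/-- The Teichmüller lift `[b] = (b, 0, …, 0) ∈ W_k(K)` of `b ∈ K`. -/
def twTeich (p : ℕ) [Fact p.Prime] {K : Type*} [CommRing K] (k : ℕ) (b : K) :
    TruncatedWittVector p k K :=
  TruncatedWittVector.mk p fun i => if (i : ℕ) = 0 then b else 0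

/-- The element `∑_i a_i·db_i` of the module `Ω¹(W_n(K))` of absolute Kähler differentials
attached to a list of pairs `(a_i, b_i)` of truncated Witt vectors. -/
def omegaSum (p : ℕ) [Fact p.Prime] (K : Type*) [Field K] (n : ℕ)
    (L : List (TruncatedWittVector p n K × TruncatedWittVector p n K)) :
    KaehlerDifferential ℤ (TruncatedWittVector p n K) :=
  (L.map fun ab =>
    ab.1 • (KaehlerDifferential.D ℤ (TruncatedWittVector p n K)) ab.2).sum

/-- The subgroup of `Ω¹(W_n(K))` generated by all `Fa·db − a·d(Vb)` (`a, b ∈ W_n(K)`) and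
all `℘([a])·[b]⁻¹·d[b]` (`a ∈ K`, `b ∈ K^×`), where `[·]` is the Teichmüller lift and
`℘ = F − id`. -/
def symbolRelations (p : ℕ) [Fact p.Prime] (K : Type*) [Field K] [CharP K p] (n : ℕ) :
    AddSubgroup (KaehlerDifferential ℤ (TruncatedWittVector p n K)) :=
  AddSubgroup.closure
    ({x | ∃ a b : TruncatedWittVector p n K,
        x = twFrob a • (KaehlerDifferential.D ℤ (TruncatedWittVector p n K)) b -
          a • (KaehlerDifferential.D ℤ (TruncatedWittVector p n K)) (twVer b)} ∪
     {x | ∃ (a : K) (b : Kˣ),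
        x = ((twFrob (twTeich p n a) - twTeich p n a) * twTeich p n ((b⁻¹ : Kˣ) : K)) •
          (KaehlerDifferential.D ℤ (TruncatedWittVector p n K)) (twTeich p n (b : K))})

/-- The tensor product `⊗_i A_{((a_i, b_i))_{p^n}}` attached to a list of pairs
`(a_i, b_i)` of truncated Witt vectors; it represents the sum `∑_i ((a_i, b_i))_{p^n}`
in the Brauer group.  (The empty list gives `K`, representing `0 ∈ Br(K)`.) -/
abbrev tensorList (p : ℕ) [Fact p.Prime] (K : Type*) [Field K] (n : ℕ)
    (c : ℕ+ → ℕ+ → MvPolynomial (ℕ+ ⊕ₗ ℕ+) ℤ)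
    (L : List (TruncatedWittVector p n K × TruncatedWittVector p n K)) : Type _ :=
  ⨂[K] (i : Fin L.length), Asymb K p c n n (L.get i).1 (L.get i).2

set_option maxSynthPendingDepth 3
set_option autoImplicit false

universe u v w

open scoped TensorProduct

section Density

variable {K : Type*} [Field K] {V : Type*} [AddCommGroup V] [Module K V]

/-- Burnside's theorem: a subalgebra of `End V` acting irreducibly on a finite-dimensional space
with only scalar commutants is everything. -/
theorem Subalgebra.eq_top_of_irreducible [FiniteDimensional K V] [Nontrivial V]
    (B : Subalgebra K (Module.End K V))
    (hs : ∀ W : Submodule K V, (∀ b ∈ B, ∀ w ∈ W, b w ∈ W) → W = ⊥ ∨ W = ⊤)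
    (he : ∀ f : Module.End K V, (∀ b ∈ B, f * b = b * f) → ∃ c : K, ∀ v, f v = c • v) :
    B = ⊤ := by
  classical
  have hsimple : IsSimpleModule B V := by
    rw [isSimpleModule_iff]
    refine { eq_bot_or_eq_top := fun W => ?_ }
    let W' : Submodule K V :=
      { carrier := W
        add_mem' := W.add_mem
        zero_mem' := W.zero_mem
        smul_mem' := fun c x hx => by
          have := W.smul_mem (algebraMap K B c) hx
          exact this }
    rcases hs W' (fun b hb w hw => W.smul_mem (⟨b, hb⟩ : B) hw) with h | h
    · left
      ext x
      have : x ∈ W' ↔ x ∈ (⊥ : Submodule K V) := by rw [h]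
      rw [Submodule.mem_bot] at this ⊢
      exact this
    · right
      ext x
      have : x ∈ W' ↔ x ∈ (⊤ : Submodule K V) := by rw [h]
      exact iff_of_true (this.2 trivial) trivial
  rw [eq_top_iff]
  intro f _
  let F : Module.End (Module.End B V) V :=
    { toFun := f
      map_add' := f.map_add
      map_smul' := fun e x => by
        let e' : Module.End K V :=
          { toFun := e
            map_add' := e.map_add
            map_smul' := fun c x => e.map_smul (algebraMap K B c) x }
        obtain ⟨c, hc⟩ := he e' (fun b hb => by
          ext x
          exact e.map_smul (⟨b, hb⟩ : B) x)
        have h1 : e x = c • x := hc x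
        have h2 : e (f x) = c • f x := hc (f x)
        simp only [Module.End.smul_def, RingHom.id_apply, h1, h2, map_smul] }
  let bs := Module.finBasis K V
  obtain ⟨r, hr⟩ := jacobson_density (R := B) F (Finset.univ.image bs)
  have : f = (r : Module.End K V) := by
    refine bs.ext fun i => ?_
    exact hr (bs i) (Finset.mem_image_of_mem _ (Finset.mem_univ i))
  rw [this]
  exact r.2

end Density

/-- A finite-dimensional central simple algebra, characterised by the surjectivity of
`A ⊗ Aᵒᵖ → End A`. -/
structure IsCSA (K : Type*) [Field K] (A : Type*) [Ring A] [Algebra K A] : Prop where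
  fd : FiniteDimensional K A
  nontriv : Nontrivial A
  surj : Function.Surjective (AlgHom.mulLeftRight K A)

namespace IsCSA

variable {K : Type*} [Field K] {A B : Type*} [Ring A] [Algebra K A] [Ring B] [Algebra K B]

theorem induct_lr (P : Module.End K A → Prop) (h0 : P 0) (hadd : ∀ f g, P f → P g → P (f + g))
    (hlr : ∀ a b, P (LinearMap.mulLeft K a * LinearMap.mulRight K b))
    (t : A ⊗[K] Aᵐᵒᵖ) : P (AlgHom.mulLeftRight K A t) := by
  induction t using TensorProduct.induction_on with
  | zero => simpa using h0
  | tmul a b =>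
    have : AlgHom.mulLeftRight K A (a ⊗ₜ b) =
        LinearMap.mulLeft K a * LinearMap.mulRight K b.unop := by
      ext x; simp [AlgHom.mulLeftRight_apply, mul_assoc]
    rw [this]; exact hlr _ _
  | add x y hx hy => rw [map_add]; exact hadd _ _ hx hy

theorem mem_range_lr (a b : A) :
    LinearMap.mulLeft K a * LinearMap.mulRight K b ∈ (AlgHom.mulLeftRight K A).range :=
  ⟨a ⊗ₜ MulOpposite.op b, by
    ext x; simp [AlgHom.mulLeftRight_apply, mul_assoc]⟩

theorem mulLeft_mem_range_lr (a : A) :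
    LinearMap.mulLeft K a ∈ (AlgHom.mulLeftRight K A).range :=
  ⟨a ⊗ₜ 1, by ext x; simp [AlgHom.mulLeftRight_apply]⟩

theorem mulRight_mem_range_lr (a : A) :
    LinearMap.mulRight K a ∈ (AlgHom.mulLeftRight K A).range :=
  ⟨1 ⊗ₜ MulOpposite.op a, by ext x; simp [AlgHom.mulLeftRight_apply]⟩

theorem of_central_simple [FiniteDimensional K A] (hc : Subalgebra.center K A = ⊥)
    (hs : IsSimpleRing A) : IsCSA K A := by
  have hn : Nontrivial A := inferInstance
  refine ⟨inferInstance, hn, ?_⟩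
  have : (AlgHom.mulLeftRight K A).range = ⊤ := by
    refine Subalgebra.eq_top_of_irreducible _ (fun W hW => ?_) (fun f hf => ?_)
    · let I : TwoSidedIdeal A := TwoSidedIdeal.mk' (W : Set A) W.zero_mem
        (fun ha hb => W.add_mem ha hb) (fun ha => W.neg_mem ha)
        (fun {x y} hy => hW _ (mulLeft_mem_range_lr x) _ hy)
        (fun {x y} hx => hW _ (mulRight_mem_range_lr y) _ hx)
      have hI : ∀ x, x ∈ I ↔ x ∈ W := fun x => by
        exact TwoSidedIdeal.mem_mk' _ _ _ _ _ _ x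
      rcases hs.simple.eq_bot_or_eq_top I with h | h
      · left; ext x; rw [← hI, h]; simp
      · right; ext x; rw [← hI, h]; simp
    · have h1 : ∀ a, f a = f 1 * a := fun a => by
        have := LinearMap.congr_fun (hf _ (mulRight_mem_range_lr a)) 1
        simpa using this
      have h2 : ∀ a, f a = a * f 1 := fun a => by
        have := LinearMap.congr_fun (hf _ (mulLeft_mem_range_lr a)) 1
        simpa using this
      have : f 1 ∈ Subalgebra.center K A := by
        rw [Subalgebra.mem_center_iff]; intro b; rw [← h1, ← h2]
      rw [hc, Algebra.mem_bot] at this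
      obtain ⟨c, hc⟩ := this
      exact ⟨c, fun v => by rw [h1, ← hc, Algebra.smul_def]⟩
  intro f
  have hf : f ∈ (AlgHom.mulLeftRight K A).range := by rw [this]; trivial
  exact hf

theorem isSimple (h : IsCSA K A) : IsSimpleRing A := by
  have := h.nontriv
  have := h.fd
  refine ⟨⟨fun I => ?_⟩⟩
  have hst : ∀ f : Module.End K A, ∀ x ∈ I, f x ∈ I := by
    intro f
    obtain ⟨t, rfl⟩ := h.surj f
    refine induct_lr (fun f => ∀ x ∈ I, f x ∈ I) (by simp [I.zero_mem])
      (fun f g hf hg x hx => I.add_mem (hf x hx) (hg x hx)) (fun a b x hx => ?_) t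
    exact I.mul_mem_left _ _ (I.mul_mem_right _ _ hx)
  by_cases hI : I = ⊥
  · exact Or.inl hI
  · right
    have : ∃ x ∈ I, x ≠ 0 := by
      by_contra! hcon
      exact hI (le_antisymm (fun x hx => by simpa using hcon x hx) bot_le)
    obtain ⟨x, hx, hx0⟩ := this
    rw [eq_top_iff]
    intro y _
    obtain ⟨f, hf⟩ : ∃ f : Module.End K A, f x = y := by
      obtain ⟨φ, hφ⟩ := Module.Projective.exists_dual_eq_one K hx0
      exact ⟨φ.smulRight y, by simp [hφ]⟩
    rw [← hf]
    exact hst f x hx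

theorem center_eq (h : IsCSA K A) {z : A} (hz : ∀ a, z * a = a * z) : ∃ c : K, z = algebraMap K A c := by
  have := h.nontriv
  have := h.fd
  have hcomm : ∀ (f : Module.End K A) (a : A), f (z * a) = z * f a := by
    intro f
    obtain ⟨t, rfl⟩ := h.surj f
    refine induct_lr (fun f => ∀ a, f (z * a) = z * f a) (by simp) (fun f g hf hg a => ?_)
      (fun a b x => ?_) t
    · simp only [LinearMap.add_apply, hf a, hg a, mul_add]
    · simp only [Module.End.mul_apply, LinearMap.mulLeft_apply, LinearMap.mulRight_apply,
        ← mul_assoc, hz a]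
  obtain ⟨φ, hφ⟩ := Module.Projective.exists_dual_eq_one K (one_ne_zero (α := A))
  have h1 := hcomm (φ.smulRight (1 : A)) 1
  simp only [mul_one, LinearMap.smulRight_apply, hφ, one_smul] at h1
  exact ⟨φ z, by rw [Algebra.algebraMap_eq_smul_one]; exact h1.symm⟩

theorem isAzumaya (h : IsCSA K A) : IsAzumaya K A := by
  have := h.nontriv
  have := h.fd
  refine { bij := ?_ }
  have hd : Module.finrank K (A ⊗[K] Aᵐᵒᵖ) = Module.finrank K (Module.End K A) := by
    rw [Module.finrank_tensorProduct, Module.finrank_linearMap,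
      (MulOpposite.opLinearEquiv K (M := A)).finrank_eq]
  exact ⟨(LinearMap.injective_iff_surjective_of_finrank_eq_finrank
    (f := (AlgHom.mulLeftRight K A).toLinearMap) hd).2 h.surj, h.surj⟩

theorem of_isAzumaya (h : IsAzumaya K A) : IsCSA K A :=
  ⟨h.toFinite, (FaithfulSMul.algebraMap_injective K A).nontrivial, h.bij.2⟩

theorem of_algEquiv (h : IsCSA K A) (e : A ≃ₐ[K] B) : IsCSA K B :=
  have := h.isAzumaya
  of_isAzumaya (IsAzumaya.of_AlgEquiv K A B e)

theorem matrix (n : Type*) [Fintype n] [DecidableEq n] [Nonempty n] : IsCSA K (Matrix n n K) :=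
  of_isAzumaya (IsAzumaya.matrix K n)

theorem self : IsCSA K K := of_isAzumaya (IsAzumaya.id K)

theorem end' (V : Type*) [AddCommGroup V] [Module K V] [FiniteDimensional K V] [Nontrivial V] :
    IsCSA K (Module.End K V) := by
  have b := Module.finBasis K V
  have : Nonempty (Fin (Module.finrank K V)) := ⟨⟨0, Module.finrank_pos⟩⟩
  exact (matrix (Fin (Module.finrank K V))).of_algEquiv (algEquivMatrix b).symm

theorem op (h : IsCSA K A) : IsCSA K Aᵐᵒᵖ := by
  have := h.nontriv
  have := h.fd
  refine ⟨inferInstance, inferInstance, fun f => ?_⟩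
  let o := MulOpposite.opLinearEquiv K (M := A)
  obtain ⟨t, ht⟩ := h.surj (o.symm.conj f)
  have key : ∀ t, o.conj (AlgHom.mulLeftRight K A t) ∈ (AlgHom.mulLeftRight K Aᵐᵒᵖ).range :=
    induct_lr (fun g => o.conj g ∈ (AlgHom.mulLeftRight K Aᵐᵒᵖ).range)
      (by rw [map_zero]; exact Subalgebra.zero_mem _)
      (fun f g hf hg => by rw [map_add]; exact Subalgebra.add_mem _ hf hg)
      (fun a b => by
        convert mem_range_lr (K := K) (MulOpposite.op b) (MulOpposite.op a) using 1
        ext x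
        simp [o, LinearEquiv.conj_apply, mul_assoc])
  have := key t
  rw [ht] at this
  change f ∈ (AlgHom.mulLeftRight K Aᵐᵒᵖ).range
  have hf : f = o.conj (o.symm.conj f) := by
    ext x
    simp [LinearEquiv.conj_apply]
  rw [hf]
  exact this

theorem tensor (hA : IsCSA K A) (hB : IsCSA K B) : IsCSA K (A ⊗[K] B) := by
  have := hA.nontriv
  have := hA.fd
  have := hB.nontriv
  have := hB.fd
  refine ⟨inferInstance, inferInstance, fun f => ?_⟩
  change f ∈ (AlgHom.mulLeftRight K (A ⊗[K] B)).range
  have hmap : ∀ (φ : Module.End K A) (ψ : Module.End K B),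
      TensorProduct.map φ ψ ∈ (AlgHom.mulLeftRight K (A ⊗[K] B)).range := by
    intro φ ψ
    obtain ⟨s, rfl⟩ := hA.surj φ
    obtain ⟨t, rfl⟩ := hB.surj ψ
    refine induct_lr (fun φ => TensorProduct.map φ _ ∈ _)
      (by rw [TensorProduct.map_zero_left]; exact Subalgebra.zero_mem _)
      (fun f g hf hg => by rw [TensorProduct.map_add_left]; exact Subalgebra.add_mem _ hf hg)
      (fun a a' => ?_) s
    refine induct_lr (fun ψ => TensorProduct.map _ ψ ∈ _)
      (by rw [TensorProduct.map_zero_right]; exact Subalgebra.zero_mem _)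
      (fun f g hf hg => by rw [TensorProduct.map_add_right]; exact Subalgebra.add_mem _ hf hg)
      (fun b b' => ?_) t
    convert mem_range_lr (K := K) (a ⊗ₜ[K] b) (a' ⊗ₜ[K] b') using 1
    ext x y
    simp
  obtain ⟨t, rfl⟩ := (homTensorHomEquiv K A B A B).surjective f
  induction t using TensorProduct.induction_on with
  | zero => rw [map_zero]; exact Subalgebra.zero_mem _
  | tmul φ ψ => simpa using hmap φ ψ
  | add x y hx hy => rw [map_add]; exact Subalgebra.add_mem _ hx hy

/-- Descent along a (left) tensor factor. -/
theorem of_tensor_right {E : Type*} [Ring E] [Algebra K E] [Nontrivial E] [FiniteDimensional K A]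
    (h : ∀ f : Module.End K A, ∃ s : List ((E ⊗[K] A) × (E ⊗[K] A)),
      ∀ x : A, (1 : E) ⊗ₜ[K] f x = (s.map fun u => u.1 * ((1 : E) ⊗ₜ[K] x) * u.2).sum)
    (hn : Nontrivial A) : IsCSA K A := by
  refine ⟨inferInstance, hn, fun f => ?_⟩
  change f ∈ (AlgHom.mulLeftRight K A).range
  obtain ⟨s, hs⟩ := h f
  obtain ⟨φ, hφ⟩ := Module.Projective.exists_dual_eq_one K (one_ne_zero (α := E))
  let ev : E ⊗[K] A →ₗ[K] A := (TensorProduct.lid K A).toLinearMap ∘ₗ TensorProduct.map φ .id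
  have hf : f = (s.map fun u => ev ∘ₗ LinearMap.mulLeft K u.1 ∘ₗ LinearMap.mulRight K u.2 ∘ₗ
      TensorProduct.mk K E A 1).sum := by
    ext x
    have := congrArg ev (hs x)
    simp only [ev, map_list_sum, LinearMap.comp_apply, TensorProduct.map_tmul, hφ,
      LinearEquiv.coe_coe, TensorProduct.lid_tmul, one_smul, LinearMap.id_apply] at this
    rw [this]
    have hsum : ∀ L : List (Module.End K A), L.sum x = (L.map fun g => g x).sum := fun L => by
      induction L with
      | nil => simp
      | cons g L ih => simp [ih]
    rw [hsum]
    simp [ev, mul_assoc, Function.comp_def]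
  rw [hf]
  have key : ∀ u v : E ⊗[K] A, ev ∘ₗ LinearMap.mulLeft K u ∘ₗ LinearMap.mulRight K v ∘ₗ
      TensorProduct.mk K E A 1 ∈ (AlgHom.mulLeftRight K A).range := by
    intro u v
    induction u using TensorProduct.induction_on with
    | zero =>
      convert Subalgebra.zero_mem _ using 1
      ext x; simp
    | add u u' hu hu' =>
      have e : ev ∘ₗ LinearMap.mulLeft K (u + u') ∘ₗ LinearMap.mulRight K v ∘ₗ
          TensorProduct.mk K E A 1 = ev ∘ₗ LinearMap.mulLeft K u ∘ₗ LinearMap.mulRight K v ∘ₗ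
          TensorProduct.mk K E A 1 + ev ∘ₗ LinearMap.mulLeft K u' ∘ₗ LinearMap.mulRight K v ∘ₗ
          TensorProduct.mk K E A 1 := by
        ext x; simp [add_mul]
      rw [e]
      exact Subalgebra.add_mem _ hu hu'
    | tmul e a =>
      induction v using TensorProduct.induction_on with
      | zero =>
        convert Subalgebra.zero_mem _ using 1
        ext x; simp
      | add v v' hv hv' =>
        have e : ev ∘ₗ LinearMap.mulLeft K (e ⊗ₜ[K] a) ∘ₗ LinearMap.mulRight K (v + v') ∘ₗ
            TensorProduct.mk K E A 1 = ev ∘ₗ LinearMap.mulLeft K (e ⊗ₜ[K] a) ∘ₗ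
            LinearMap.mulRight K v ∘ₗ TensorProduct.mk K E A 1 + ev ∘ₗ
            LinearMap.mulLeft K (e ⊗ₜ[K] a) ∘ₗ LinearMap.mulRight K v' ∘ₗ
            TensorProduct.mk K E A 1 := by
          ext x; simp [mul_add]
        rw [e]
        exact Subalgebra.add_mem _ hv hv'
      | tmul e' a' =>
        convert Subalgebra.smul_mem _ (mem_range_lr (K := K) a a') (φ (e * e')) using 1
        ext x; simp [ev]
  refine Subalgebra.list_sum_mem _ fun g hg => ?_
  obtain ⟨u, -, rfl⟩ := List.mem_map.1 hg
  exact key u.1 u.2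

end IsCSA

namespace IsCSA

variable {K : Type*} [Field K] {A B : Type*} [Ring A] [Algebra K A] [Ring B] [Algebra K B]

theorem injective (hA : IsCSA K A) [Nontrivial B] (f : A →ₐ[K] B) : Function.Injective f :=
  have := hA.isSimple
  f.toRingHom.injective

theorem bijective (hA : IsCSA K A) [Nontrivial B] [FiniteDimensional K B] (f : A →ₐ[K] B)
    (h : Module.finrank K B ≤ Module.finrank K A) : Function.Bijective f := by
  have := hA.fd
  have hi := hA.injective f
  refine ⟨hi, ?_⟩
  have h2 : Module.finrank K A = Module.finrank K B :=
    le_antisymm (LinearMap.finrank_le_finrank_of_injective (f := f.toLinearMap) hi) h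
  exact (LinearMap.injective_iff_surjective_of_finrank_eq_finrank (f := f.toLinearMap) h2).1 hi

theorem algEquiv (hA : IsCSA K A) [Nontrivial B] [FiniteDimensional K B] (f : A →ₐ[K] B)
    (h : Module.finrank K B ≤ Module.finrank K A) : Nonempty (A ≃ₐ[K] B) :=
  ⟨AlgEquiv.ofBijective f (hA.bijective f h)⟩

/-- A representation of a central simple algebra of dimension `d ^ 2` on a nonzero space of
dimension at most `d` identifies it with the full endomorphism algebra. -/
theorem algEquiv_end (hA : IsCSA K A) {V : Type*} [AddCommGroup V] [Module K V]
    [FiniteDimensional K V] [Nontrivial V] (f : A →ₐ[K] Module.End K V)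
    (h : Module.finrank K V ^ 2 ≤ Module.finrank K A) : Nonempty (A ≃ₐ[K] Module.End K V) :=
  hA.algEquiv f (by rwa [Module.finrank_linearMap, ← sq])

theorem mulLeft_mem_range_lr_mul {f : Module.End K A} (a : A)
    (hf : f ∈ (AlgHom.mulLeftRight K A).range) :
    LinearMap.mulLeft K a * f ∈ (AlgHom.mulLeftRight K A).range :=
  Subalgebra.mul_mem _ (mulLeft_mem_range_lr a) hf

theorem baseChange (hA : IsCSA K A) (E : Type*) [Field E] [Algebra K E] : IsCSA E (E ⊗[K] A) := by
  have := hA.nontriv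
  have := hA.fd
  refine ⟨inferInstance, inferInstance, fun f => ?_⟩
  change f ∈ (AlgHom.mulLeftRight E (E ⊗[K] A)).range
  have hbc : ∀ g : Module.End K A,
      LinearMap.baseChange E g ∈ (AlgHom.mulLeftRight E (E ⊗[K] A)).range := by
    intro g
    obtain ⟨s, rfl⟩ := hA.surj g
    refine induct_lr (fun φ => LinearMap.baseChange E φ ∈ _) ?_ ?_ ?_ s
    · rw [LinearMap.baseChange_zero]; exact Subalgebra.zero_mem _
    · intro f g hf hg; rw [LinearMap.baseChange_add]; exact Subalgebra.add_mem _ hf hg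
    · intro a b
      convert mem_range_lr (K := E) ((1 : E) ⊗ₜ[K] a) ((1 : E) ⊗ₜ[K] b) using 1
      ext x; simp
  let b := Module.finBasis K A
  have : f = ∑ i, LinearMap.mulLeft E (f (1 ⊗ₜ b i)) *
      LinearMap.baseChange E ((b.coord i).smulRight (1 : A)) := by
    ext x
    simp only [TensorProduct.AlgebraTensorModule.curry_apply, TensorProduct.curry_apply,
      LinearMap.coe_restrictScalars, LinearMap.sum_apply, Module.End.mul_apply,
      LinearMap.baseChange_tmul, LinearMap.smulRight_apply, LinearMap.mulLeft_apply,
      Module.Basis.coord_apply]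
    conv_lhs => rw [← b.sum_repr x]
    rw [TensorProduct.tmul_sum, map_sum]
    refine Finset.sum_congr rfl fun i _ => ?_
    rw [TensorProduct.tmul_smul, TensorProduct.tmul_smul, mul_smul_comm,
      ← Algebra.TensorProduct.one_def, mul_one]
    rw [← algebraMap_smul E, map_smul, algebraMap_smul]
  rw [this]
  exact Subalgebra.sum_mem _ fun i _ => mulLeft_mem_range_lr_mul _ (hbc _)

theorem of_baseChange [FiniteDimensional K A] (E : Type*) [Field E] [Algebra K E]
    (h : IsCSA E (E ⊗[K] A)) : IsCSA K A := by
  classical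
  have hn : Nontrivial A := by
    by_contra hcon
    rw [not_nontrivial_iff_subsingleton] at hcon
    have h1 : (1 : E ⊗[K] A) = 0 := by
      rw [Algebra.TensorProduct.one_def, Subsingleton.elim (1 : A) 0, TensorProduct.tmul_zero]
    have := h.nontriv
    exact one_ne_zero h1
  refine of_tensor_right (E := E) (fun f => ?_) hn
  obtain ⟨t, ht⟩ := h.surj (LinearMap.baseChange E f)
  have key : ∀ t, ∃ s : List ((E ⊗[K] A) × (E ⊗[K] A)), ∀ x,
      AlgHom.mulLeftRight E (E ⊗[K] A) t x = (s.map fun u => u.1 * x * u.2).sum := by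
    intro t
    refine induct_lr (fun g => ∃ s : List ((E ⊗[K] A) × (E ⊗[K] A)), ∀ x,
      g x = (s.map fun u => u.1 * x * u.2).sum) ⟨[], by simp⟩ ?_ ?_ t
    · rintro f g ⟨s, hs⟩ ⟨s', hs'⟩
      exact ⟨s ++ s', fun x => by simp [hs, hs']⟩
    · intro a b
      exact ⟨[(a, b)], fun x => by simp [mul_assoc]⟩
  obtain ⟨s, hs⟩ := key t
  refine ⟨s, fun x => ?_⟩
  rw [← hs, ht]
  simp

/-- Commuting representations. -/
theorem tensor_algEquiv (hA : IsCSA K A) (hB : IsCSA K B) {D : Type*} [Ring D] [Algebra K D]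
    [Nontrivial D] [FiniteDimensional K D] (f : A →ₐ[K] D) (g : B →ₐ[K] D)
    (hc : ∀ a b, Commute (f a) (g b))
    (h : Module.finrank K D ≤ Module.finrank K A * Module.finrank K B) :
    Nonempty (A ⊗[K] B ≃ₐ[K] D) :=
  (hA.tensor hB).algEquiv (Algebra.TensorProduct.lift f g hc)
    (by rwa [Module.finrank_tensorProduct])

end IsCSA

section BrauerEquiv

open Matrix

variable {K : Type*} [Field K]

theorem BrauerEquiv.of_matrix {A B : Type*} [Ring A] [Algebra K A] [Ring B] [Algebra K B]
    (ι κ : Type*) [Fintype ι] [Fintype κ] [DecidableEq ι] [DecidableEq κ] [Nonempty ι] [Nonempty κ]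
    (e : Matrix ι ι A ≃ₐ[K] Matrix κ κ B) : BrauerEquiv K A B :=
  ⟨Fintype.card ι, Fintype.card κ, Fintype.card_pos, Fintype.card_pos,
    ⟨(reindexAlgEquiv K A (Fintype.equivFin ι)).symm.trans
      (e.trans (reindexAlgEquiv K B (Fintype.equivFin κ)))⟩⟩

variable {A B C D : Type*} [Ring A] [Algebra K A] [Ring B] [Algebra K B] [Ring C] [Algebra K C]
  [Ring D] [Algebra K D]

theorem BrauerEquiv.of_algEquiv (e : A ≃ₐ[K] B) : BrauerEquiv K A B :=
  .of_matrix (Fin 1) (Fin 1) e.mapMatrix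

theorem BrauerEquiv.refl : BrauerEquiv K A A := .of_algEquiv .refl

theorem BrauerEquiv.symm (h : BrauerEquiv K A B) : BrauerEquiv K B A := by
  obtain ⟨r, s, hr, hs, ⟨e⟩⟩ := h
  exact ⟨s, r, hs, hr, ⟨e.symm⟩⟩

theorem BrauerEquiv.trans (h : BrauerEquiv K A B) (h' : BrauerEquiv K B C) :
    BrauerEquiv K A C := by
  obtain ⟨n, m, hn, hm, ⟨iso1⟩⟩ := h
  obtain ⟨p, q, hp, hq, ⟨iso2⟩⟩ := h'
  have : Nonempty (Fin p × Fin n) := ⟨(⟨0, hp⟩, ⟨0, hn⟩)⟩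
  have : Nonempty (Fin m × Fin q) := ⟨(⟨0, hm⟩, ⟨0, hq⟩)⟩
  exact .of_matrix (Fin p × Fin n) (Fin m × Fin q) <|
    (compAlgEquiv _ _ _ _).symm.trans <|
    iso1.mapMatrix (m := Fin p) |>.trans <| compAlgEquiv _ _ _ _ |>.trans <|
    reindexAlgEquiv K B (.prodComm (Fin p) (Fin m)) |>.trans <| compAlgEquiv _ _ _ _ |>.symm.trans <|
    iso2.mapMatrix.trans <| compAlgEquiv _ _ _ _

theorem BrauerEquiv.tensor (h : BrauerEquiv K A B) (h' : BrauerEquiv K C D) :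
    BrauerEquiv K (A ⊗[K] C) (B ⊗[K] D) := by
  obtain ⟨n, m, hn, hm, ⟨e⟩⟩ := h
  obtain ⟨p, q, hp, hq, ⟨e'⟩⟩ := h'
  have : Nonempty (Fin n × Fin p) := ⟨(⟨0, hn⟩, ⟨0, hp⟩)⟩
  have : Nonempty (Fin m × Fin q) := ⟨(⟨0, hm⟩, ⟨0, hq⟩)⟩
  exact .of_matrix (Fin n × Fin p) (Fin m × Fin q) <|
    (kroneckerTMulAlgEquiv (Fin n) (Fin p) K K A C).symm.trans <|
      (Algebra.TensorProduct.congr e e').trans (kroneckerTMulAlgEquiv (Fin m) (Fin q) K K B D)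

theorem BrauerEquiv.matrix (ι : Type*) [Fintype ι] [DecidableEq ι] [Nonempty ι] :
    BrauerEquiv K (Matrix ι ι A) A :=
  .of_matrix Unit ι (uniqueAlgEquiv (m := Unit) (R := K))

theorem BrauerEquiv.end' (V : Type*) [AddCommGroup V] [Module K V] [FiniteDimensional K V]
    [Nontrivial V] : BrauerEquiv K (Module.End K V) K := by
  have : Nonempty (Fin (Module.finrank K V)) := ⟨⟨0, Module.finrank_pos⟩⟩
  exact (BrauerEquiv.of_algEquiv (algEquivMatrix (Module.finBasis K V))).trans (.matrix _)

theorem BrauerEquiv.baseChange (h : BrauerEquiv K A B) (E : Type*) [Field E] [Algebra K E] :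
    BrauerEquiv E (E ⊗[K] A) (E ⊗[K] B) := by
  obtain ⟨n, m, hn, hm, ⟨e⟩⟩ := h
  have : Nonempty (Fin 1 × Fin n) := ⟨(0, ⟨0, hn⟩)⟩
  have : Nonempty (Fin 1 × Fin m) := ⟨(0, ⟨0, hm⟩)⟩
  exact .of_matrix (Fin 1 × Fin n) (Fin 1 × Fin m) <|
    (kroneckerTMulAlgEquiv (Fin 1) (Fin n) K E E A).symm.trans <|
      (Algebra.TensorProduct.congr .refl e).trans (kroneckerTMulAlgEquiv (Fin 1) (Fin m) K E E B)

theorem IsCSA.exists_algEquiv_end (hA : IsCSA K A) (h : BrauerEquiv K A K) :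
    ∃ d : ℕ, 0 < d ∧ Nonempty (A ≃ₐ[K] Module.End K (Fin d → K)) := by
  classical
  have := hA.nontriv
  have := hA.fd
  obtain ⟨r, s, hr, hs, ⟨e⟩⟩ := h
  have : Nonempty (Fin r) := ⟨⟨0, hr⟩⟩
  have : Nonempty (Fin s) := ⟨⟨0, hs⟩⟩
  let ρ : Matrix (Fin r) (Fin r) A →ₐ[K] Module.End K (Fin s → K) :=
    (Matrix.toLinAlgEquiv' : Matrix (Fin s) (Fin s) K ≃ₐ[K] _).toAlgHom.comp e.toAlgHom
  let i0 : Fin r := ⟨0, hr⟩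
  let u : Fin r → Fin r → Module.End K (Fin s → K) := fun i j => ρ (Matrix.single i j 1)
  have hu : ∀ i j k, u i j * u j k = u i k := fun i j k => by
    simp only [u, ← map_mul, Matrix.single_mul_single_same, one_mul]
  let W := LinearMap.range (u i0 i0)
  have hW : ∀ w ∈ W, u i0 i0 w = w := by
    rintro _ ⟨v, rfl⟩
    rw [← Module.End.mul_apply, hu]
  have huW : ∀ i v, u i0 i v ∈ W := fun i v => ⟨u i0 i v, by rw [← Module.End.mul_apply, hu]⟩
  let φ : (Fin s → K) →ₗ[K] (Fin r → W) :=
    LinearMap.pi fun i => (u i0 i).codRestrict W (huW i)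
  have hφ : Function.Injective φ := by
    rw [← LinearMap.ker_eq_bot, LinearMap.ker_eq_bot']
    intro v hv
    have h1 : ∀ i, u i0 i v = 0 := fun i => by
      have := congrArg Subtype.val (congrFun hv i)
      simpa [φ] using this
    have h2 : (∑ i, u i i0 * u i0 i) = 1 := by
      simp only [hu]
      simp only [u, ← map_sum]
      rw [show (∑ i, Matrix.single i i (1 : A)) = 1 from by
        exact Matrix.sum_single_one]
      simp
    have := LinearMap.congr_fun h2 v
    simpa [LinearMap.sum_apply, h1] using this.symm
  have hφ' : Function.Surjective φ := by
    intro w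
    refine ⟨∑ i, u i i0 (w i), ?_⟩
    ext1 j
    apply Subtype.ext
    have hz : ∀ i, i ≠ j → u i0 j * u i i0 = 0 := fun i hi => by
      simp only [u, ← map_mul]
      rw [Matrix.single_mul_single_of_ne _ _ _ _ hi.symm, map_zero]
    simp only [φ, LinearMap.pi_apply, LinearMap.codRestrict_apply]
    rw [map_sum, Finset.sum_eq_single j]
    · rw [← Module.End.mul_apply, hu, hW _ (w j).2]
    · intro i _ hi
      rw [← Module.End.mul_apply, hz i hi, LinearMap.zero_apply]
    · simp
  have hd := (LinearEquiv.ofBijective φ ⟨hφ, hφ'⟩).finrank_eq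
  rw [Module.finrank_fin_fun, Module.finrank_pi_fintype, Finset.sum_const, Finset.card_univ,
    Fintype.card_fin, smul_eq_mul] at hd
  have he := e.toLinearEquiv.finrank_eq
  rw [Module.finrank_matrix, Module.finrank_matrix, Module.finrank_self] at he
  simp only [Fintype.card_fin, mul_one] at he
  have hdW : Module.finrank K W ^ 2 = Module.finrank K A := by
    have : r * r * Module.finrank K W ^ 2 = r * r * Module.finrank K A := by
      rw [he]
      conv_rhs => rw [hd]
      ring
    exact Nat.eq_of_mul_eq_mul_left (by positivity) this
  have hWp : 0 < Module.finrank K W := by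
    rcases Nat.eq_zero_or_pos (Module.finrank K W) with h | h
    · rw [h, mul_zero] at hd; omega
    · exact h
  have : Nontrivial W := Module.nontrivial_of_finrank_pos hWp
  let sc : A →ₐ[K] Matrix (Fin r) (Fin r) A := Matrix.scalarAlgHom (Fin r) K
  have hcomm : ∀ a, u i0 i0 * ρ (sc a) = ρ (sc a) * u i0 i0 := fun a => by
    simp only [u, ← map_mul]
    congr 1
    ext i j
    simp only [sc, Matrix.scalarAlgHom_apply, Matrix.scalar_apply, Matrix.mul_diagonal,
      Matrix.diagonal_mul, Matrix.single_apply]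
    split_ifs <;> simp
  have hst : ∀ a, ∀ w ∈ W, ρ (sc a) w ∈ W := fun a w hw =>
    ⟨ρ (sc a) w, by rw [← Module.End.mul_apply, hcomm, Module.End.mul_apply, hW w hw]⟩
  let f : A →ₐ[K] Module.End K W := AlgHom.ofLinearMap
    { toFun := fun a => (ρ (sc a)).restrict (hst a)
      map_add' := fun a b => by ext w; simp [LinearMap.restrict_apply]
      map_smul' := fun a b => by ext w; simp [LinearMap.restrict_apply] }
    (by ext w; simp [LinearMap.restrict_apply])
    (fun a b => by ext w; simp [LinearMap.restrict_apply])
  obtain ⟨g⟩ := hA.algEquiv_end f hdW.le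
  exact ⟨Module.finrank K W, hWp, ⟨g.trans ((Module.finBasis K W).equivFun.conjAlgEquiv K)⟩⟩

end BrauerEquiv

/-- Bundled finite-dimensional central simple algebras. -/
structure CSAlg (K : Type u) [Field K] : Type (u + 1) where
  carrier : Type u
  [ring : Ring carrier]
  [algebra : Algebra K carrier]
  isCSA : IsCSA K carrier

attribute [instance] CSAlg.ring CSAlg.algebra

/-- Brauer equivalence as a setoid. -/
def brauerSetoid (K : Type u) [Field K] : Setoid (CSAlg K) where
  r A B := BrauerEquiv K A.carrier B.carrier
  iseqv := ⟨fun _ => .refl, fun h => h.symm, fun h h' => h.trans h'⟩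

/-- The Brauer group. -/
def Br (K : Type u) [Field K] : Type (u + 1) := Quotient (brauerSetoid K)

namespace Br

variable {K : Type u} [Field K]

theorem op_brauerEquiv {A : Type*} [Ring A] [Algebra K A] (h : IsCSA K A) :
    BrauerEquiv K (A ⊗[K] Aᵐᵒᵖ) K := by
  have := h.fd
  have := h.nontriv
  exact (BrauerEquiv.of_algEquiv (AlgEquiv.ofBijective _ h.isAzumaya.bij)).trans (.end' A)

/-- The class of a bundled central simple algebra. -/
def mk (A : CSAlg K) : Br K := Quotient.mk (brauerSetoid K) A

theorem mk_eq_iff {A B : CSAlg K} : mk A = mk B ↔ BrauerEquiv K A.carrier B.carrier :=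
  Quotient.eq (r := brauerSetoid K)

instance : Zero (Br K) := ⟨mk ⟨K, .self⟩⟩

instance : Add (Br K) :=
  ⟨Quotient.map₂ (fun A B => ⟨A.carrier ⊗[K] B.carrier, A.isCSA.tensor B.isCSA⟩)
    fun _ _ h _ _ h' => BrauerEquiv.tensor h h'⟩

theorem add_assoc' (a b c : Br K) : a + b + c = a + (b + c) := by
  induction a, b, c using Quotient.inductionOn₃ with
  | h A B C =>
    exact Quotient.sound (BrauerEquiv.of_algEquiv (Algebra.TensorProduct.assoc K K K _ _ _))

theorem zero_add' (a : Br K) : 0 + a = a := by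
  induction a using Quotient.inductionOn with
  | h A => exact Quotient.sound (BrauerEquiv.of_algEquiv (Algebra.TensorProduct.lid K _))

theorem add_comm' (a b : Br K) : a + b = b + a := by
  induction a, b using Quotient.inductionOn₂ with
  | h A B => exact Quotient.sound (BrauerEquiv.of_algEquiv (Algebra.TensorProduct.comm K _ _))

theorem exists_neg (a : Br K) : ∃ b : Br K, b + a = 0 := by
  induction a using Quotient.inductionOn with
  | h A =>
    refine ⟨mk ⟨A.carrierᵐᵒᵖ, A.isCSA.op⟩, (add_comm' _ _).trans ?_⟩
    exact Quotient.sound (op_brauerEquiv A.isCSA)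

instance : Neg (Br K) := ⟨fun a => (exists_neg a).choose⟩

instance : AddCommGroup (Br K) :=
  { AddGroup.ofLeftAxioms add_assoc' zero_add' (fun a => (exists_neg a).choose_spec) with
    add_comm := add_comm' }

/-- The class of an algebra in the Brauer group (zero when it is not central simple). -/
def cls (K : Type u) [Field K] (A : Type u) [Ring A] [Algebra K A] : Br K :=
  open Classical in if h : IsCSA K A then mk ⟨A, h⟩ else 0

variable {A B C D : Type u} [Ring A] [Algebra K A] [Ring B] [Algebra K B] [Ring C] [Algebra K C]
  [Ring D] [Algebra K D]

theorem cls_eq_mk (h : IsCSA K A) : cls K A = mk ⟨A, h⟩ := dif_pos h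

theorem cls_eq_iff (hA : IsCSA K A) (hB : IsCSA K B) : cls K A = cls K B ↔ BrauerEquiv K A B := by
  rw [cls_eq_mk hA, cls_eq_mk hB, mk_eq_iff]

theorem cls_self : cls K K = 0 := cls_eq_mk .self

theorem cls_eq_zero_iff (hA : IsCSA K A) : cls K A = 0 ↔ BrauerEquiv K A K := by
  rw [← cls_self, cls_eq_iff hA .self]

theorem cls_tensor (hA : IsCSA K A) (hB : IsCSA K B) :
    cls K (A ⊗[K] B) = cls K A + cls K B := by
  rw [cls_eq_mk hA, cls_eq_mk hB, cls_eq_mk (hA.tensor hB)]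
  rfl

theorem cls_end (V : Type u) [AddCommGroup V] [Module K V] [FiniteDimensional K V]
    [Nontrivial V] : cls K (Module.End K V) = 0 :=
  (cls_eq_zero_iff (.end' V)).2 (.end' V)

theorem cls_congr (e : A ≃ₐ[K] B) : cls K A = cls K B := by
  by_cases h : IsCSA K A
  · exact (cls_eq_iff h (h.of_algEquiv e)).2 (.of_algEquiv e)
  · have h' : ¬ IsCSA K B := fun hB => h (hB.of_algEquiv e.symm)
    rw [cls, cls, dif_neg h, dif_neg h']

theorem exists_cls (a : Br K) : ∃ (A : Type u) (_ : Ring A) (_ : Algebra K A),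
    IsCSA K A ∧ cls K A = a := by
  induction a using Quotient.inductionOn with
  | h A => exact ⟨A.carrier, A.ring, A.algebra, A.isCSA, cls_eq_mk A.isCSA⟩

theorem cls_add_eq (hA : IsCSA K A) (hB : IsCSA K B) (hC : IsCSA K C) (hD : IsCSA K D)
    (f : A →ₐ[K] C ⊗[K] D) (g : B →ₐ[K] C ⊗[K] D) (hc : ∀ a b, Commute (f a) (g b))
    (h : Module.finrank K C * Module.finrank K D ≤ Module.finrank K A * Module.finrank K B) :
    cls K A + cls K B = cls K C + cls K D := by
  have := (hC.tensor hD).nontriv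
  have := (hC.tensor hD).fd
  obtain ⟨e⟩ := hA.tensor_algEquiv hB f g hc (by rwa [Module.finrank_tensorProduct])
  rw [← cls_tensor hA hB, ← cls_tensor hC hD, cls_congr e]

theorem cls_eq_zero_of_rep (hA : IsCSA K A) {V : Type u} [AddCommGroup V] [Module K V]
    [FiniteDimensional K V] [Nontrivial V] (f : A →ₐ[K] Module.End K V)
    (h : Module.finrank K V ^ 2 ≤ Module.finrank K A) : cls K A = 0 := by
  obtain ⟨e⟩ := hA.algEquiv_end f h
  rw [cls_congr e, cls_end]

theorem exists_algEquiv_end (hA : IsCSA K A) (h : cls K A = 0) :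
    ∃ d : ℕ, 0 < d ∧ Nonempty (A ≃ₐ[K] Module.End K (Fin d → K)) :=
  hA.exists_algEquiv_end ((cls_eq_zero_iff hA).1 h)

section BaseChange

variable (E : Type u) [Field E] [Algebra K E]

/-- Base change on Brauer groups. -/
def res : Br K →+ Br E where
  toFun := Quotient.map (fun A => ⟨E ⊗[K] A.carrier, A.isCSA.baseChange E⟩)
    fun _ _ h => BrauerEquiv.baseChange h E
  map_zero' := Quotient.sound (BrauerEquiv.of_algEquiv (Algebra.TensorProduct.rid K E E))
  map_add' a b := by
    induction a, b using Quotient.inductionOn₂ with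
    | h A B =>
      refine (mk_eq_iff.2 (BrauerEquiv.symm ?_))
      have hA := A.isCSA.baseChange E
      have hB := B.isCSA.baseChange E
      have hAB := (A.isCSA.tensor B.isCSA).baseChange E
      have := hAB.nontriv
      have := hAB.fd
      obtain ⟨e⟩ := hA.tensor_algEquiv hB (D := E ⊗[K] (A.carrier ⊗[K] B.carrier))
        (Algebra.TensorProduct.map (.id E E) Algebra.TensorProduct.includeLeft)
        (Algebra.TensorProduct.map (.id E E) Algebra.TensorProduct.includeRight)
        (fun a b => by
          induction a using TensorProduct.induction_on with
          | zero => simp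
          | add x y hx hy => rw [map_add]; exact hx.add_left hy
          | tmul x a =>
            induction b using TensorProduct.induction_on with
            | zero => simp
            | add x y hx hy => rw [map_add]; exact hx.add_right hy
            | tmul y b => simp [Commute, SemiconjBy, mul_comm])
        (by simp)
      exact .of_algEquiv e

theorem res_cls (hA : IsCSA K A) : res E (cls K A) = cls E (E ⊗[K] A) := by
  rw [cls_eq_mk hA, cls_eq_mk (hA.baseChange E)]
  rfl

theorem res_res (F : Type u) [Field F] [Algebra K F] [Algebra E F] [IsScalarTower K E F]
    (a : Br K) : res F (res E a) = res F a := by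
  obtain ⟨A, _, _, hA, rfl⟩ := exists_cls a
  rw [res_cls E hA, res_cls F hA, res_cls F (hA.baseChange E)]
  have h1 := hA.baseChange F
  have h2 := (hA.baseChange E).baseChange F
  have := h2.nontriv
  have := h2.fd
  obtain ⟨e⟩ := h1.algEquiv (B := F ⊗[E] (E ⊗[K] A)) (Algebra.TensorProduct.lift
    (Algebra.ofId F (F ⊗[E] (E ⊗[K] A)))
    ((Algebra.TensorProduct.includeRight.restrictScalars K).comp
      Algebra.TensorProduct.includeRight)
    (fun x a => Algebra.commutes x _)) (by simp)
  exact (cls_congr e).symm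

end BaseChange

end Br

/-! ### Evaluation at commuting families -/

section CommEval

variable {ι : Type*} {R A : Type*} [CommRing R] [Ring A] [Algebra R A]

open scoped IsMulCommutative in
/-- A commuting family is the image of a family in a commutative algebra. -/
theorem exists_comm_model (R : Type*) {A : Type v} {ι : Type*} [CommRing R] [Ring A] [Algebra R A]
    (z : ι → A) (hz : ∀ i j, Commute (z i) (z j)) :
    ∃ (C : Type v) (_ : CommRing C) (_ : Algebra R C) (f : C →ₐ[R] A) (z' : ι → C),
      Function.Injective f ∧ (∀ i, f (z' i) = z i) ∧
      f.range = Algebra.adjoin R (Set.range z) := by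
  have hc : ∀ a ∈ Set.range z, ∀ b ∈ Set.range z, a * b = b * a := by
    rintro _ ⟨i, rfl⟩ _ ⟨j, rfl⟩; exact hz i j
  have i0 := Algebra.isMulCommutative_adjoin R hc
  let i1 : CommRing (Algebra.adjoin R (Set.range z)) := inferInstance
  refine ⟨Algebra.adjoin R (Set.range z), i1, inferInstance,
    (Algebra.adjoin R (Set.range z)).val,
    fun i => ⟨z i, Algebra.subset_adjoin ⟨i, rfl⟩⟩, Subtype.val_injective, fun _ => rfl, ?_⟩
  exact Subalgebra.range_val _

/-- Evaluation of polynomials at a commuting family. -/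
def commEval (R : Type*) [CommRing R] [Algebra R A] (z : ι → A)
    (hz : ∀ i j, Commute (z i) (z j)) : MvPolynomial ι R →ₐ[R] A :=
  let h := exists_comm_model R z hz
  letI := h.choose_spec.choose
  letI := h.choose_spec.choose_spec.choose
  h.choose_spec.choose_spec.choose_spec.choose.comp
    (MvPolynomial.aeval h.choose_spec.choose_spec.choose_spec.choose_spec.choose)

@[simp] theorem commEval_X (z : ι → A) (hz : ∀ i j, Commute (z i) (z j)) (i : ι) :
    commEval R z hz (MvPolynomial.X i) = z i := by
  have h := exists_comm_model R z hz
  unfold commEval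
  simp only [AlgHom.comp_apply, MvPolynomial.aeval_X]
  exact (exists_comm_model R z hz).choose_spec.choose_spec.choose_spec.choose_spec.choose_spec.2.1 i

theorem commEval_unique (z : ι → A) (hz : ∀ i j, Commute (z i) (z j))
    (φ : MvPolynomial ι R →ₐ[R] A) (h : ∀ i, φ (MvPolynomial.X i) = z i) : φ = commEval R z hz :=
  MvPolynomial.algHom_ext fun i => by rw [h, commEval_X]

theorem commEval_range (z : ι → A) (hz : ∀ i j, Commute (z i) (z j)) :
    (commEval R z hz).range = Algebra.adjoin R (Set.range z) := by
  rw [← Algebra.map_top, ← MvPolynomial.adjoin_range_X, AlgHom.map_adjoin, ← Set.range_comp]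
  congr 2; ext i; simp

theorem commEval_map {B : Type*} [Ring B] [Algebra R B] (φ : A →ₐ[R] B)
    (z : ι → A) (hz : ∀ i j, Commute (z i) (z j)) (w : ι → B) (hw : ∀ i j, Commute (w i) (w j))
    (h : ∀ i, φ (z i) = w i) (f : MvPolynomial ι R) :
    φ (commEval R z hz f) = commEval R w hw f :=
  DFunLike.congr_fun (commEval_unique w hw (φ.comp (commEval R z hz)) (by simp [h])) f

theorem commEval_rename {κ : Type*} (g : κ → ι) (z : ι → A) (hz : ∀ i j, Commute (z i) (z j))
    (f : MvPolynomial κ R) :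
    commEval R z hz (MvPolynomial.rename g f) =
      commEval R (fun k => z (g k)) (fun _ _ => hz _ _) f :=
  DFunLike.congr_fun (commEval_unique _ (fun _ _ => hz _ _)
    ((commEval R z hz).comp (MvPolynomial.rename g)) (by simp)) f

/-- The linear map `f ⊗ g ↦ f(X) g(Y)`. -/
def evalMul {κ : Type*} (R : Type*) [CommRing R] [Algebra R A] (X : ι → A)
    (hX : ∀ i j, Commute (X i) (X j)) (Y : κ → A) (hY : ∀ i j, Commute (Y i) (Y j)) :
    MvPolynomial ι R ⊗[R] MvPolynomial κ R →ₗ[R] A :=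
  TensorProduct.lift ((LinearMap.mul R A).compl₁₂ (commEval R X hX).toLinearMap
    (commEval R Y hY).toLinearMap)

@[simp] theorem evalMul_tmul {κ : Type*} (X : ι → A)
    (hX : ∀ i j, Commute (X i) (X j)) (Y : κ → A) (hY : ∀ i j, Commute (Y i) (Y j))
    (f : MvPolynomial ι R) (g : MvPolynomial κ R) :
    evalMul R X hX Y hY (f ⊗ₜ g) = commEval R X hX f * commEval R Y hY g := rfl

theorem evalMul_map {κ B : Type*} [Ring B] [Algebra R B] (φ : A →ₐ[R] B) (X : ι → A)
    (hX : ∀ i j, Commute (X i) (X j)) (Y : κ → A) (hY : ∀ i j, Commute (Y i) (Y j))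
    (X' : ι → B) (hX' : ∀ i j, Commute (X' i) (X' j)) (Y' : κ → B)
    (hY' : ∀ i j, Commute (Y' i) (Y' j)) (h : ∀ i, φ (X i) = X' i) (h' : ∀ i, φ (Y i) = Y' i)
    (t : MvPolynomial ι R ⊗[R] MvPolynomial κ R) :
    φ (evalMul R X hX Y hY t) = evalMul R X' hX' Y' hY' t := by
  induction t with
  | zero => simp
  | add a b ha hb => simp [ha, hb]
  | tmul f g => simp [commEval_map φ X hX X' hX' h, commEval_map φ Y hY Y' hY' h']

theorem evalMul_range {κ : Type*} (X : ι → A)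
    (hX : ∀ i j, Commute (X i) (X j)) (Y : κ → A) (hY : ∀ i j, Commute (Y i) (Y j)) :
    LinearMap.range (evalMul R X hX Y hY) =
      Subalgebra.toSubmodule (Algebra.adjoin R (Set.range X)) *
        Subalgebra.toSubmodule (Algebra.adjoin R (Set.range Y)) := by
  apply le_antisymm
  · rintro _ ⟨t, rfl⟩
    induction t with
    | zero => simp
    | add a b ha hb => rw [map_add]; exact add_mem ha hb
    | tmul f g =>
      rw [evalMul_tmul]
      refine Submodule.mul_mem_mul ?_ ?_
      · rw [← commEval_range X hX]; exact ⟨f, rfl⟩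
      · rw [← commEval_range Y hY]; exact ⟨g, rfl⟩
  · rw [Submodule.mul_le]
    rw [← commEval_range X hX, ← commEval_range Y hY]
    rintro _ ⟨f, rfl⟩ _ ⟨g, rfl⟩
    exact ⟨f ⊗ₜ g, rfl⟩

end CommEval

/-! ### Evaluation of the structure polynomials -/

section CEval

theorem map_ordProd {σ M N : Type*} [LinearOrder σ] [Monoid M] [Monoid N] (φ : M →* N)
    (x : σ → M) (e : σ →₀ ℕ) : φ (ordProd x e) = ordProd (fun i => φ (x i)) e := by
  simp [ordProd, map_list_prod, Function.comp_def]

theorem map_cEval {A B : Type*} [Ring A] [Ring B] (φ : A →+* B) (x y : ℕ+ → A)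
    (q : MvPolynomial (ℕ+ ⊕ₗ ℕ+) ℤ) :
    φ (cEval x y q) = cEval (fun i => φ (x i)) (fun i => φ (y i)) q := by
  simp only [cEval, pEval, map_sum, map_zsmul]
  refine Finset.sum_congr rfl fun e _ => ?_
  congr 1
  rw [← MonoidHom.coe_coe, map_ordProd]
  congr 1
  ext v
  rcases ofLex v with a | a <;> simp

theorem mem_vars_of_mem_support {σ R : Type*} [CommSemiring R] {q : MvPolynomial σ R} {e : σ →₀ ℕ}
    (he : e ∈ q.support) {i : σ} (hi : i ∈ e.support) : i ∈ q.vars := by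
  rw [MvPolynomial.mem_vars_iff_mem_support]; exact ⟨e, he, hi⟩

theorem cEval_congr {A : Type*} [Ring A] (x y x' y' : ℕ+ → A)
    (q : MvPolynomial (ℕ+ ⊕ₗ ℕ+) ℤ)
    (h : ∀ v ∈ q.vars, Sum.elim x y (ofLex v) = Sum.elim x' y' (ofLex v)) :
    cEval x y q = cEval x' y' q := by
  simp only [cEval, pEval]
  refine Finset.sum_congr rfl fun e he => ?_
  congr 1
  unfold ordProd
  congr 1
  refine List.map_congr_left fun i hi => ?_
  rw [Finset.mem_sort] at hi
  exact congrArg (· ^ e i) (h i (mem_vars_of_mem_support he hi))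

theorem cEval_mem {A : Type*} [Ring A] (P : Subring A) (x y : ℕ+ → A)
    (q : MvPolynomial (ℕ+ ⊕ₗ ℕ+) ℤ)
    (h : ∀ v ∈ q.vars, Sum.elim x y (ofLex v) ∈ P) :
    cEval x y q ∈ P := by
  simp only [cEval, pEval]
  refine sum_mem fun e he => zsmul_mem (list_prod_mem ?_) _
  simp only [List.mem_map, Finset.mem_sort]
  rintro _ ⟨i, hi, rfl⟩
  exact pow_mem (h i (mem_vars_of_mem_support he hi)) _

/-- The value of `c_{p^i,p^j}` at `p`-typical families. -/
def cPow {A : Type*} [Ring A] (p : ℕ) (c : ℕ+ → ℕ+ → MvPolynomial (ℕ+ ⊕ₗ ℕ+) ℤ)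
    (X Y : ℕ → A) (i j : ℕ) : A :=
  cEval (fun d => X (padicValNat p d)) (fun d => Y (padicValNat p d)) (c (ppow p i) (ppow p j))

theorem map_cPow {p : ℕ} {c : ℕ+ → ℕ+ → MvPolynomial (ℕ+ ⊕ₗ ℕ+) ℤ} {A B : Type*} [Ring A] [Ring B]
    (φ : A →+* B) (X Y : ℕ → A) (i j : ℕ) :
    φ (cPow p c X Y i j) = cPow p c (fun k => φ (X k)) (fun k => φ (Y k)) i j :=
  map_cEval φ _ _ _

theorem ppow_coe (p i : ℕ) [Fact p.Prime] : (ppow p i : ℕ) = p ^ i := by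
  unfold ppow
  rw [Nat.toPNat'_coe, if_pos (pow_pos (Fact.out : p.Prime).pos _)]

variable {p : ℕ} [Fact p.Prime] {c : ℕ+ → ℕ+ → MvPolynomial (ℕ+ ⊕ₗ ℕ+) ℤ}

theorem IsCFamily.vars_ppow (hc : IsCFamily c) {i j : ℕ} {v : ℕ+ ⊕ₗ ℕ+}
    (hv : v ∈ (c (ppow p i) (ppow p j)).vars) :
    (∃ k < i, ofLex v = Sum.inl (ppow p k)) ∨ (∃ k < j, ofLex v = Sum.inr (ppow p k)) := by
  have key : ∀ (d : ℕ+) (l : ℕ), (d : ℕ) ∣ (ppow p l : ℕ) → d ≠ ppow p l →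
      ∃ k < l, d = ppow p k := by
    intro d l h1 h2
    rw [ppow_coe, Nat.dvd_prime_pow Fact.out] at h1
    obtain ⟨k, hk, hd⟩ := h1
    have hdk : d = ppow p k := by apply PNat.coe_injective; rw [ppow_coe]; exact hd
    refine ⟨k, lt_of_le_of_ne hk ?_, hdk⟩
    rintro rfl; exact h2 hdk
  rcases (hc (ppow p i) (ppow p j)).1 v hv with ⟨d, h1, h2, h3⟩ | ⟨d, h1, h2, h3⟩
  · obtain ⟨k, hk, rfl⟩ := key d i h1 h2
    exact Or.inl ⟨k, hk, h3⟩
  · obtain ⟨k, hk, rfl⟩ := key d j h1 h2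
    exact Or.inr ⟨k, hk, h3⟩

@[simp] theorem padicVal_ppow (k : ℕ) : padicValNat p (ppow p k : ℕ) = k := by
  rw [ppow_coe, padicValNat.prime_pow]

theorem cPow_mem {A : Type*} [Ring A] (hc : IsCFamily c) (P : Subring A) {X Y : ℕ → A} {i j : ℕ}
    (hX : ∀ k < i, X k ∈ P) (hY : ∀ k < j, Y k ∈ P) : cPow p c X Y i j ∈ P := by
  refine cEval_mem P _ _ _ fun v hv => ?_
  rcases hc.vars_ppow hv with ⟨k, hk, h⟩ | ⟨k, hk, h⟩ <;> rw [h]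
  · simpa using hX k hk
  · simpa using hY k hk

theorem cPow_congr {A : Type*} [Ring A] (hc : IsCFamily c) {X Y X' Y' : ℕ → A} {i j : ℕ}
    (hX : ∀ k < i, X k = X' k) (hY : ∀ k < j, Y k = Y' k) :
    cPow p c X Y i j = cPow p c X' Y' i j := by
  refine cEval_congr _ _ _ _ _ fun v hv => ?_
  rcases hc.vars_ppow hv with ⟨k, hk, h⟩ | ⟨k, hk, h⟩ <;> rw [h]
  · simpa using hX k hk
  · simpa using hY k hk

end CEval

/-! ### Ghost components -/

section Ghost

/-- The ghost component `∑_{k ≤ i} p^k z_k^{p^{i-k}}` of a sequence in a ring. -/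
def gh {A : Type*} [Ring A] (p : ℕ) (z : ℕ → A) (i : ℕ) : A :=
  ∑ k ∈ Finset.range (i + 1), (p : A) ^ k * z k ^ p ^ (i - k)

theorem map_gh {A B : Type*} [Ring A] [Ring B] (φ : A →+* B) (p : ℕ) (z : ℕ → A) (i : ℕ) :
    φ (gh p z i) = gh p (fun k => φ (z k)) i := by
  simp [gh, map_sum]

theorem gh_coeff {C : Type*} [CommRing C] (p : ℕ) [Fact p.Prime] (x : WittVector p C) (i : ℕ) :
    gh p x.coeff i = WittVector.ghostComponent i x := by
  rw [WittVector.ghostComponent_apply, wittPolynomial_eq_sum_C_mul_X_pow]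
  simp [gh, map_sum]

variable {A : Type*} [Ring A] {p : ℕ}

theorem gh_succ_top (z : ℕ → A) (i : ℕ) :
    gh p z i = (∑ k ∈ Finset.range i, (p : A) ^ k * z k ^ p ^ (i - k)) + (p : A) ^ i * z i := by
  rw [gh, Finset.sum_range_succ]; simp

theorem Commute.gh_right {a : A} {z : ℕ → A} {i : ℕ} (h : ∀ k ≤ i, Commute a (z k)) :
    Commute a (gh p z i) := by
  refine Commute.sum_right _ _ _ fun k hk => ?_
  refine Commute.mul_right ((Nat.cast_commute p a).symm.pow_right k) ((h k ?_).pow_right _)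
  exact Nat.lt_succ_iff.mp (Finset.mem_range.mp hk)

theorem Commute.of_gh_right [Algebra ℚ A] [Fact p.Prime] {a : A} {z : ℕ → A} {n : ℕ}
    (h : ∀ i < n, Commute a (gh p z i)) : ∀ i < n, Commute a (z i) := by
  intro i
  induction i using Nat.strong_induction_on with
  | _ i ih =>
    intro hi
    have h1 := h i hi
    rw [gh_succ_top] at h1
    have h2 : Commute a (∑ k ∈ Finset.range i, (p : A) ^ k * z k ^ p ^ (i - k)) := by
      refine Commute.sum_right _ _ _ fun k hk => ?_
      have hk' := Finset.mem_range.mp hk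
      exact ((Nat.cast_commute p a).symm.pow_right k).mul_right
        ((ih k hk' (hk'.trans hi)).pow_right _)
    have h3 : Commute a ((p : A) ^ i * z i) := by
      have := h1.sub_right h2
      rwa [add_sub_cancel_left] at this
    have h4 : z i = algebraMap ℚ A (((p : ℚ) ^ i)⁻¹) * ((p : A) ^ i * z i) := by
      rw [← mul_assoc]
      have : (p : A) ^ i = algebraMap ℚ A ((p : ℚ) ^ i) := by simp
      rw [this, ← map_mul, inv_mul_cancel₀, map_one, one_mul]
      exact pow_ne_zero _ (Nat.cast_ne_zero.mpr (Fact.out : p.Prime).ne_zero)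
    rw [h4]
    exact Commute.mul_right (Algebra.commutes _ a).symm h3

end Ghost

section UnGhost

variable {A : Type*} [Ring A]

theorem gh_injective [Algebra ℚ A] {p : ℕ} [Fact p.Prime] {z z' : ℕ → A}
    (h : ∀ i, gh p z i = gh p z' i) (i : ℕ) : z i = z' i := by
  induction i using Nat.strong_induction_on with
  | _ i ih =>
    have h1 := h i
    rw [gh_succ_top, gh_succ_top, Finset.sum_congr rfl (g := fun k => (p : A) ^ k * z' k ^ p ^ (i - k))
      (fun k hk => by rw [ih k (Finset.mem_range.mp hk)])] at h1
    have h2 := congrArg (fun t => algebraMap ℚ A (((p : ℚ) ^ i)⁻¹) * t) (add_left_cancel h1)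
    have h3 : (p : A) ^ i = algebraMap ℚ A ((p : ℚ) ^ i) := by simp
    have h4 : algebraMap ℚ A (((p : ℚ) ^ i)⁻¹) * (p : A) ^ i = 1 := by
      rw [h3, ← map_mul, inv_mul_cancel₀, map_one]
      exact pow_ne_zero _ (Nat.cast_ne_zero.mpr (Fact.out : p.Prime).ne_zero)
    simpa only [← mul_assoc, h4, one_mul] using h2

theorem ghost_eq_sum (g : ℕ+ → A) (k : ℕ+) :
    ghost g k = ∑ d ∈ (k : ℕ).divisors, (d : A) * g d.toPNat' ^ ((k : ℕ) / d) := by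
  rw [ghost, ← Finset.sum_attach (k : ℕ).divisors]
  refine Finset.sum_congr rfl fun d _ => ?_
  congr 3
  exact PNat.coe_injective (by simp [Nat.pos_of_mem_divisors d.2])

theorem map_ghost {B : Type*} [Ring B] (φ : A →+* B) (g : ℕ+ → A) (k : ℕ+) :
    φ (ghost g k) = ghost (fun d => φ (g d)) k := by
  simp [ghost, map_sum]

theorem ghost_ppow {p : ℕ} [Fact p.Prime] (g : ℕ+ → A) (i : ℕ) :
    ghost g (ppow p i) = gh p (fun k => g (ppow p k)) i := by
  rw [ghost_eq_sum, ppow_coe, Nat.sum_divisors_prime_pow Fact.out, gh]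
  refine Finset.sum_congr rfl fun k hk => ?_
  have hk' := Nat.lt_succ_iff.mp (Finset.mem_range.mp hk)
  rw [Nat.pow_div hk' (Fact.out : p.Prime).pos]
  simp [ppow]

variable [Algebra ℚ A]

/-- The sequence with prescribed ghost components in a `ℚ`-algebra. -/
def unghost (g : ℕ+ → A) (k : ℕ+) : A :=
  algebraMap ℚ A ((k : ℚ)⁻¹) * (g k - ∑ d ∈ (k : ℕ).properDivisors.attach,
    ((d : ℕ) : A) * unghost g (d : ℕ).toPNat' ^ ((k : ℕ) / d))
termination_by (k : ℕ)
decreasing_by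
  have h := Nat.mem_properDivisors.mp d.2
  have h0 := Nat.pos_of_dvd_of_pos h.1 k.pos
  rw [Nat.toPNat'_coe, if_pos h0]
  exact h.2

theorem ghost_unghost (g : ℕ+ → A) (k : ℕ+) : ghost (unghost g) k = g k := by
  rw [ghost_eq_sum, ← Nat.insert_self_properDivisors k.ne_zero,
    Finset.sum_insert Nat.self_notMem_properDivisors]
  have h : (k : ℕ).toPNat' = k := PNat.coe_injective (by simp)
  rw [h, Nat.div_self k.pos, pow_one, unghost, ← mul_assoc]
  have h2 : ((k : ℕ) : A) = algebraMap ℚ A ((k : ℕ) : ℚ) := by simp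
  rw [h2, ← map_mul, mul_inv_cancel₀ (by exact_mod_cast k.ne_zero), map_one, one_mul,
    Finset.sum_attach (k : ℕ).properDivisors
      (fun d => (d : A) * unghost g d.toPNat' ^ ((k : ℕ) / d))]
  abel

/-- The structure polynomials compute commutators whenever the ghost components satisfy the
canonical commutation relations. -/
theorem IsCFamily.identity {c : ℕ+ → ℕ+ → MvPolynomial (ℕ+ ⊕ₗ ℕ+) ℤ} (hc : IsCFamily c)
    (x y : ℕ+ → A) (hx : ∀ k l, Commute (ghost x k) (ghost x l))
    (hy : ∀ k l, Commute (ghost y k) (ghost y l))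
    (hyx : ∀ k l, ghost y l * ghost x k =
      ghost x k * ghost y l + if k = l then ((k : ℕ) : A) else 0) (m n : ℕ+) :
    y n * x m = x m * y n + cEval x y (c m n) := by
  let F : FreeAlgebra ℚ (ℕ+ ⊕ ℕ+) →ₐ[ℚ] A := FreeAlgebra.lift ℚ (Sum.elim x y)
  have hFx : ∀ k, F (ghost bXf k) = ghost x k := fun k => by
    rw [← AlgHom.coe_toRingHom, map_ghost]; simp [F, bXf]
  have hFy : ∀ k, F (ghost bYf k) = ghost y k := fun k => by
    rw [← AlgHom.coe_toRingHom, map_ghost]; simp [F, bYf]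
  have hF : ∀ ⦃a b⦄, BRel a b → F a = F b := by
    rintro _ _ (⟨k, l⟩ | ⟨k, l⟩ | ⟨k, l⟩)
    · simp only [map_mul, hFx]; exact hx k l
    · simp only [map_mul, hFy]; exact hy k l
    · simp only [map_mul, map_add, hFx, hFy]
      rw [hyx]; congr 1; split_ifs <;> simp
  let φ : BQ →ₐ[ℚ] A := RingQuot.liftAlgHom ℚ ⟨F, hF⟩
  have hx' : ∀ d, φ (bx d) = x d := fun d => by
    simp [φ, bx, F, bXf, RingQuot.liftAlgHom_mkAlgHom_apply]
  have hy' : ∀ d, φ (by' d) = y d := fun d => by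
    simp [φ, by', F, bYf, RingQuot.liftAlgHom_mkAlgHom_apply]
  have h := congrArg φ (hc m n).2
  rw [← AlgHom.coe_toRingHom, map_cEval] at h
  simp only [AlgHom.coe_toRingHom, map_sub, map_mul, hx', hy'] at h
  rw [h]; abel

/-- A `p`-typical version of `IsCFamily.identity`: the missing ghost components are supplied by an
auxiliary family of canonical pairs `T`, `D`. -/
theorem IsCFamily.ptypical {c : ℕ+ → ℕ+ → MvPolynomial (ℕ+ ⊕ₗ ℕ+) ℤ} (hc : IsCFamily c)
    {p : ℕ} [Fact p.Prime] (X Y : ℕ → A) (T D : ℕ+ → A)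
    (hX : ∀ i j, Commute (gh p X i) (gh p X j)) (hY : ∀ i j, Commute (gh p Y i) (gh p Y j))
    (hYX : ∀ i j, gh p Y j * gh p X i = gh p X i * gh p Y j + if i = j then (p : A) ^ i else 0)
    (hT : ∀ k l, Commute (T k) (T l)) (hD : ∀ k l, Commute (D k) (D l))
    (hDT : ∀ k l, D l * T k = T k * D l + if k = l then ((k : ℕ) : A) else 0)
    (hTX : ∀ k i, Commute (T k) (gh p X i)) (hTY : ∀ k i, Commute (T k) (gh p Y i))
    (hDX : ∀ k i, Commute (D k) (gh p X i)) (hDY : ∀ k i, Commute (D k) (gh p Y i)) (i j : ℕ) :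
    Y j * X i = X i * Y j + cPow p c X Y i j := by
  classical
  let P : ℕ+ → Prop := fun k => k = ppow p (padicValNat p k)
  let gX : ℕ+ → A := fun k => if P k then gh p X (padicValNat p k) else T k
  let gY : ℕ+ → A := fun k => if P k then gh p Y (padicValNat p k) else D k
  have hP : ∀ i, P (ppow p i) := fun i => by simp [P]
  have hx : ∀ i, unghost gX (ppow p i) = X i := gh_injective (p := p) fun i => by
    rw [← ghost_ppow, ghost_unghost]; simp [gX, hP]
  have hy : ∀ i, unghost gY (ppow p i) = Y i := gh_injective (p := p) fun i => by
    rw [← ghost_ppow, ghost_unghost]; simp [gY, hP]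
  have key := hc.identity (unghost gX) (unghost gY)
    (fun k l => by
      simp only [ghost_unghost, gX]
      split_ifs
      exacts [hX _ _, (hTX _ _).symm, hTX _ _, hT _ _])
    (fun k l => by
      simp only [ghost_unghost, gY]
      split_ifs
      exacts [hY _ _, (hDY _ _).symm, hDY _ _, hD _ _])
    (fun k l => by
      simp only [ghost_unghost, gX, gY]
      by_cases hk : P k <;> by_cases hl : P l
      · rw [if_pos hk, if_pos hl, hYX]
        congr 1
        by_cases h : k = l
        · subst h
          rw [if_pos rfl, if_pos rfl]
          conv_rhs => rw [show k = ppow p (padicValNat p k) from hk, ppow_coe]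
          simp
        · rw [if_neg h, if_neg]
          intro h'; apply h; rw [show k = _ from hk, show l = _ from hl, h']
      · have h : k ≠ l := by rintro rfl; exact hl hk
        rw [if_pos hk, if_neg hl, if_neg h, add_zero]; exact hDX _ _
      · have h : k ≠ l := by rintro rfl; exact hk hl
        rw [if_neg hk, if_pos hl, if_neg h, add_zero]; exact (hTY _ _).symm
      · rw [if_neg hk, if_neg hl, hDT]) (ppow p i) (ppow p j)
  rw [hx, hy] at key
  rw [key]
  congr 1
  refine cEval_congr _ _ _ _ _ fun v hv => ?_
  rcases hc.vars_ppow hv with ⟨k, hk, h⟩ | ⟨k, hk, h⟩ <;> rw [h] <;> simp [hx, hy]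

end UnGhost

section PUnghost

variable {A : Type*} [Ring A] [Algebra ℚ A] {p : ℕ} [Fact p.Prime]

/-- The sequence with prescribed `p`-typical ghost components in a `ℚ`-algebra. -/
def punghost (p : ℕ) [Fact p.Prime] (g : ℕ → A) (i : ℕ) : A :=
  unghost (fun k => g (padicValNat p k)) (ppow p i)

@[simp] theorem gh_punghost (g : ℕ → A) (i : ℕ) : gh p (punghost p g) i = g i := by
  unfold punghost
  rw [← ghost_ppow (p := p), ghost_unghost, padicVal_ppow]

theorem map_punghost {B : Type*} [Ring B] [Algebra ℚ B] (φ : A →+* B) (g : ℕ → A) (i : ℕ) :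
    φ (punghost p g i) = punghost p (fun k => φ (g k)) i := by
  refine gh_injective (p := p) (z := fun i => φ (punghost p g i)) (fun i => ?_) i
  rw [← map_gh, gh_punghost, gh_punghost]

theorem eq_punghost {z g : ℕ → A} (h : ∀ i, gh p z i = g i) (i : ℕ) : z i = punghost p g i :=
  gh_injective (p := p) (fun i => by rw [h, gh_punghost]) i

theorem Commute.punghost_right {a : A} {g : ℕ → A} (h : ∀ i, Commute a (g i)) (i : ℕ) :
    Commute a (punghost p g i) :=
  Commute.of_gh_right (p := p) (n := i + 1) (fun k _ => by rw [gh_punghost]; exact h k) i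
    (Nat.lt_succ_self i)

end PUnghost

/-- A faithful characteristic-zero model of the algebra generated by a family of commuting
`p`-typical canonical pairs, with auxiliary canonical pairs `T`, `D`. -/
structure Weyl (p : ℕ) (σ : Type) where
  E : Type
  [ring : Ring E]
  [alg : Algebra ℚ E]
  X : σ → ℕ → E
  Y : σ → ℕ → E
  T : ℕ+ → E
  D : ℕ+ → E
  xx : ∀ s i t j, Commute (X s i) (X t j)
  yy : ∀ s i t j, Commute (Y s i) (Y t j)
  yx_ne : ∀ s t, s ≠ t → ∀ i j, Commute (Y t j) (X s i)
  yx : ∀ s i j, gh p (Y s) j * gh p (X s) i =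
    gh p (X s) i * gh p (Y s) j + if i = j then (p : E) ^ i else 0
  tt : ∀ k l, Commute (T k) (T l)
  dd : ∀ k l, Commute (D k) (D l)
  dt : ∀ k l, D l * T k = T k * D l + if k = l then ((k : ℕ) : E) else 0
  tx : ∀ k s i, Commute (T k) (X s i)
  ty : ∀ k s i, Commute (T k) (Y s i)
  dx : ∀ k s i, Commute (D k) (X s i)
  dy : ∀ k s i, Commute (D k) (Y s i)
  inj : Function.Injective (evalMul ℤ (fun k : σ × ℕ => X k.1 k.2) (fun _ _ => xx _ _ _ _)
    (fun k : σ × ℕ => Y k.1 k.2) (fun _ _ => yy _ _ _ _))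

attribute [instance] Weyl.ring Weyl.alg

namespace Weyl

variable (ι : Type)

/-- The polynomial ring with polynomial parameters on which the Weyl algebra acts. -/
abbrev Pol : Type := MvPolynomial ι (MvPolynomial ι ℚ)

variable {ι}

/-- Multiplication operators. -/
def mulOp : Pol ι →+* Module.End ℚ (Pol ι) := (Algebra.lmul ℚ (Pol ι)).toRingHom

@[simp] theorem mulOp_apply (f g : Pol ι) : mulOp f g = f * g := rfl

/-- The partial derivative as an operator. -/
def derOp (i : ι) : Module.End ℚ (Pol ι) := (MvPolynomial.pderiv i).toLinearMap.restrictScalars ℚ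

@[simp] theorem derOp_apply (i : ι) (g : Pol ι) : derOp i g = MvPolynomial.pderiv i g := rfl

theorem derOp_comm (i j : ι) : Commute (derOp i) (derOp j) := by
  have h : ⁅(MvPolynomial.pderiv i : Derivation (MvPolynomial ι ℚ) (Pol ι) (Pol ι)),
      (MvPolynomial.pderiv j : Derivation (MvPolynomial ι ℚ) (Pol ι) (Pol ι))⁆ = 0 := by
    classical
    refine MvPolynomial.derivation_ext fun k => ?_
    rw [Derivation.commutator_apply]
    simp only [MvPolynomial.pderiv_X, Pi.single_apply, Derivation.coe_zero, Pi.zero_apply]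
    split_ifs <;> simp
  refine LinearMap.ext fun f => ?_
  have := DFunLike.congr_fun h f
  rw [Derivation.commutator_apply, Derivation.coe_zero, Pi.zero_apply, sub_eq_zero] at this
  exact this

/-- The shifted derivation `s_i + w_i ∂_i`. -/
def shOp (wt : ι → ℕ) (i : ι) : Module.End ℚ (Pol ι) :=
  mulOp (MvPolynomial.C (MvPolynomial.X i)) + (wt i : Module.End ℚ (Pol ι)) * derOp i

theorem derOp_mulC (i : ι) (r : MvPolynomial ι ℚ) :
    Commute (mulOp (MvPolynomial.C r)) (derOp i) := by
  refine LinearMap.ext fun f => ?_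
  simp [Module.End.mul_apply]

theorem shOp_comm (wt : ι → ℕ) (i j : ι) : Commute (shOp wt i) (shOp wt j) := by
  have h1 : Commute (mulOp (MvPolynomial.C (MvPolynomial.X i) : Pol ι))
    (mulOp (MvPolynomial.C (MvPolynomial.X j))) := (Commute.all _ _).map mulOp
  unfold shOp
  refine Commute.add_left (Commute.add_right h1 ?_) (Commute.add_right ?_ ?_)
  · exact (Nat.cast_commute _ _).symm.mul_right (derOp_mulC _ _)
  · exact ((Nat.cast_commute _ _).symm.mul_right (derOp_mulC _ _)).symm
  · exact (Nat.cast_commute _ _).mul_left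
      ((Nat.cast_commute (wt j) (derOp i)).symm.mul_right (derOp_comm i j))

theorem shOp_mulX [DecidableEq ι] (wt : ι → ℕ) (i j : ι) :
    shOp wt j * mulOp (MvPolynomial.X i) = mulOp (MvPolynomial.X i) * shOp wt j +
      if i = j then (wt i : Module.End ℚ (Pol ι)) else 0 := by
  refine LinearMap.ext fun f => ?_
  simp only [shOp, Module.End.mul_apply, LinearMap.add_apply, mulOp_apply, derOp_apply,
    Derivation.leibniz, MvPolynomial.pderiv_X, map_add, Module.End.natCast_apply]
  by_cases h : i = j
  · subst h
    simp [smul_eq_mul, nsmul_eq_mul]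
    ring
  · rw [if_neg h]
    simp [h, smul_eq_mul, nsmul_eq_mul]
    ring

/-- Pairs of an operator and its eigenvalue on constants. -/
def constAlg : Subalgebra ℚ (Module.End ℚ (Pol ι) × MvPolynomial ι ℚ) where
  carrier := {u | ∀ r, u.1 (MvPolynomial.C r) = MvPolynomial.C (u.2 * r)}
  mul_mem' {a b} ha hb r := by
    change a.1 (b.1 (MvPolynomial.C r)) = _
    rw [hb, ha, Prod.snd_mul, mul_assoc]
  add_mem' {a b} ha hb r := by
    change a.1 (MvPolynomial.C r) + b.1 (MvPolynomial.C r) = _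
    rw [hb, ha, Prod.snd_add, add_mul, map_add]
  algebraMap_mem' q r := by
    simp [Module.algebraMap_end_apply, Algebra.smul_def]

theorem punghost_shOp_C {p : ℕ} [Fact p.Prime] (wt : ι → ℕ) (e : ℕ → ι) (i : ℕ)
    (r : MvPolynomial ι ℚ) : punghost p (fun j => shOp wt (e j)) i (MvPolynomial.C r) =
      MvPolynomial.C (punghost p (fun j => MvPolynomial.X (e j)) i * r) := by
  have hm : ∀ j, ((shOp wt (e j), MvPolynomial.X (e j)) : _ × MvPolynomial ι ℚ) ∈ constAlg := by
    intro j r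
    simp [shOp, Module.End.mul_apply]
  let g : ℕ → constAlg (ι := ι) := fun j => ⟨_, hm j⟩
  have h := (punghost p g i).2 r
  have h1 := map_punghost (p := p)
    ((RingHom.fst (Module.End ℚ (Pol ι)) (MvPolynomial ι ℚ)).comp (constAlg (ι := ι)).val.toRingHom) g i
  have h2 := map_punghost (p := p)
    ((RingHom.snd (Module.End ℚ (Pol ι)) (MvPolynomial ι ℚ)).comp (constAlg (ι := ι)).val.toRingHom) g i
  refine (LinearMap.congr_fun h1 _).symm.trans (h.trans ?_)
  congr 2

variable (p : ℕ) [Fact p.Prime] (σ : Type)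

/-- Weights of the variables. -/
def wts : (σ × ℕ) ⊕ ℕ+ → ℕ := Sum.elim (fun k => p ^ k.2) (fun k => k)

variable {σ}

/-- The operators with ghost components the multiplication operators. -/
def opX (s : σ) : ℕ → Module.End ℚ (Pol ((σ × ℕ) ⊕ ℕ+)) :=
  punghost p fun j => mulOp (MvPolynomial.X (Sum.inl (s, j)))

/-- The operators with ghost components the shifted derivations. -/
def opY (s : σ) : ℕ → Module.End ℚ (Pol ((σ × ℕ) ⊕ ℕ+)) :=
  punghost p fun j => shOp (wts p σ) (Sum.inl (s, j))

theorem mulOp_comm {ι : Type} (f g : Pol ι) : Commute (mulOp f) (mulOp g) :=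
  (Commute.all f g).map mulOp

theorem opX_comm (s i t j) : Commute (opX p (σ := σ) s i) (opX p t j) :=
  .punghost_right (fun _ => (Commute.punghost_right (fun _ => mulOp_comm _ _) _).symm) _

theorem opY_comm (s i t j) : Commute (opY p (σ := σ) s i) (opY p t j) :=
  .punghost_right (fun _ => (Commute.punghost_right (fun _ => shOp_comm _ _ _) _).symm) _

theorem shOp_mulX_comm {ι : Type} (wt : ι → ℕ) {i j : ι} (h : i ≠ j) :
    Commute (shOp wt j) (mulOp (MvPolynomial.X i)) := by
  classical
  have := shOp_mulX wt i j
  rwa [if_neg h, add_zero] at this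

theorem op_inj : Function.Injective (evalMul ℤ (fun k : σ × ℕ => opX p k.1 k.2)
    (fun _ _ => opX_comm p _ _ _ _) (fun k : σ × ℕ => opY p k.1 k.2)
    (fun _ _ => opY_comm p _ _ _ _)) := by
  let ξ : σ × ℕ → Pol ((σ × ℕ) ⊕ ℕ+) := fun k =>
    punghost p (fun j => MvPolynomial.X (Sum.inl (k.1, j))) k.2
  let η : σ × ℕ → MvPolynomial ((σ × ℕ) ⊕ ℕ+) ℚ := fun k =>
    punghost p (fun j => MvPolynomial.X (Sum.inl (k.1, j))) k.2
  have hX : ∀ k : σ × ℕ, opX p k.1 k.2 = mulOp (ξ k) := fun k =>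
    (map_punghost (p := p) mulOp _ _).symm
  have hXe : ∀ f h, commEval ℤ (fun k : σ × ℕ => opX p k.1 k.2) (fun _ _ => opX_comm p _ _ _ _) f h
      = MvPolynomial.aeval ξ f * h := by
    intro f
    induction f using MvPolynomial.induction_on with
    | C a => intro h; simp
    | add f g hf hg => intro h; simp [hf, hg, add_mul]
    | mul_X f k hf => intro h; rw [map_mul, Module.End.mul_apply, hf]; simp [hX, mul_assoc]
  have hYe : ∀ f r, commEval ℤ (fun k : σ × ℕ => opY p k.1 k.2) (fun _ _ => opY_comm p _ _ _ _) f
      (MvPolynomial.C r) = MvPolynomial.C (MvPolynomial.aeval η f * r) := by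
    intro f
    induction f using MvPolynomial.induction_on with
    | C a => intro h; simp
    | add f g hf hg => intro h; simp [hf, hg, add_mul]
    | mul_X f k hf =>
      intro r
      rw [map_mul, Module.End.mul_apply, commEval_X, opY, punghost_shOp_C, hf,
        map_mul (MvPolynomial.aeval η), MvPolynomial.aeval_X, mul_assoc]
  let cC : MvPolynomial ((σ × ℕ) ⊕ ℕ+) ℚ →ₐ[ℤ] Pol ((σ × ℕ) ⊕ ℕ+) :=
    (MvPolynomial.C : _ →+* Pol ((σ × ℕ) ⊕ ℕ+)).toIntAlgHom
  let Ψ : MvPolynomial (σ × ℕ) ℤ ⊗[ℤ] MvPolynomial (σ × ℕ) ℤ →ₐ[ℤ] Pol ((σ × ℕ) ⊕ ℕ+) :=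
    Algebra.TensorProduct.lift (MvPolynomial.aeval ξ) (cC.comp (MvPolynomial.aeval η))
      (fun _ _ => Commute.all _ _)
  have hΨ : ∀ t, evalMul ℤ (fun k : σ × ℕ => opX p k.1 k.2)
    (fun _ _ => opX_comm p _ _ _ _) (fun k : σ × ℕ => opY p k.1 k.2)
    (fun _ _ => opY_comm p _ _ _ _) t 1 = Ψ t := by
    intro t
    induction t with
    | zero => simp
    | add a b ha hb => simp only [map_add, LinearMap.add_apply, ha, hb]
    | tmul f g =>
      rw [evalMul_tmul, Module.End.mul_apply, ← map_one MvPolynomial.C, hYe, hXe, mul_one]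
      simp only [Ψ, Algebra.TensorProduct.lift_tmul, AlgHom.comp_apply]
      rfl
  let Θ : Pol ((σ × ℕ) ⊕ ℕ+) →+* MvPolynomial ((σ × ℕ) ⊕ (σ × ℕ)) ℚ :=
    MvPolynomial.eval₂Hom (MvPolynomial.eval₂Hom MvPolynomial.C
      (Sum.elim (fun k => gh p (fun i => MvPolynomial.X (Sum.inr (k.1, i))) k.2) 0))
      (Sum.elim (fun k => gh p (fun i => MvPolynomial.X (Sum.inl (k.1, i))) k.2) 0)
  have hΘ1 : ∀ k, Θ (ξ k) = MvPolynomial.X (Sum.inl k) := by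
    intro k
    rw [show ξ k = _ from rfl, map_punghost]
    refine Eq.trans ?_ (eq_punghost (p := p) (z := fun i => MvPolynomial.X (Sum.inl (k.1, i)))
      (fun i => rfl) k.2).symm
    congr 1
    funext j
    simp [Θ]
  have hΘ2 : ∀ k, Θ (MvPolynomial.C (η k)) = MvPolynomial.X (Sum.inr k) := by
    intro k
    change (Θ.comp MvPolynomial.C) (punghost p _ k.2) = _
    rw [map_punghost]
    refine Eq.trans ?_ (eq_punghost (p := p) (z := fun i => MvPolynomial.X (Sum.inr (k.1, i)))
      (fun i => rfl) k.2).symm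
    congr 1
    funext j
    simp [Θ]
  have hc1 : Θ.comp (MvPolynomial.aeval ξ : _ →ₐ[ℤ] _).toRingHom = (MvPolynomial.map (Int.castRingHom ℚ)).comp
      ((MvPolynomial.tensorEquivSum ℤ (σ × ℕ) (σ × ℕ) ℤ).toRingHom.comp
        (Algebra.TensorProduct.includeLeft (R := ℤ) (S := ℤ)).toRingHom) :=
    MvPolynomial.ringHom_ext (fun a => by simp) (fun k => by simp [hΘ1])
  have hc2 : (Θ.comp MvPolynomial.C).comp (MvPolynomial.aeval η : _ →ₐ[ℤ] _).toRingHom =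
      (MvPolynomial.map (Int.castRingHom ℚ)).comp
      ((MvPolynomial.tensorEquivSum ℤ (σ × ℕ) (σ × ℕ) ℤ).toRingHom.comp
        (Algebra.TensorProduct.includeRight (R := ℤ) (A := MvPolynomial (σ × ℕ) ℤ)).toRingHom) :=
    MvPolynomial.ringHom_ext (fun a => by simp) (fun k => by simp [hΘ2])
  have hc : ∀ t, Θ (Ψ t) = MvPolynomial.map (Int.castRingHom ℚ)
      (MvPolynomial.tensorEquivSum ℤ (σ × ℕ) (σ × ℕ) ℤ t) := by
    intro t
    induction t with
    | zero => simp only [map_zero]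
    | add a b ha hb => simp only [map_add, ha, hb]
    | tmul f g =>
      have e : f ⊗ₜ[ℤ] g = (f ⊗ₜ[ℤ] (1 : MvPolynomial (σ × ℕ) ℤ)) * ((1 : MvPolynomial (σ × ℕ) ℤ) ⊗ₜ[ℤ] g) := by
        rw [Algebra.TensorProduct.tmul_mul_tmul, one_mul, mul_one]
      have h1 := RingHom.congr_fun hc1 f
      have h2 := RingHom.congr_fun hc2 g
      have h3 : Ψ (f ⊗ₜ[ℤ] g) = MvPolynomial.aeval ξ f * MvPolynomial.C (MvPolynomial.aeval η g) :=
        Algebra.TensorProduct.lift_tmul ..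
      rw [h3, e, map_mul, map_mul, map_mul]
      exact congrArg₂ (· * ·) h1 h2
  intro a b hab
  apply (MvPolynomial.tensorEquivSum ℤ (σ × ℕ) (σ × ℕ) ℤ).injective
  apply MvPolynomial.map_injective (Int.castRingHom ℚ) Int.cast_injective
  rw [← hc, ← hc, ← hΨ, ← hΨ, hab]

instance : Nonempty (Weyl p σ) := by
  classical
  refine ⟨{
    E := Module.End ℚ (Pol ((σ × ℕ) ⊕ ℕ+))
    X := opX p
    Y := opY p
    T := fun k => mulOp (MvPolynomial.X (Sum.inr k))
    D := fun k => shOp (wts p σ) (Sum.inr k)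
    xx := opX_comm p
    yy := opY_comm p
    inj := op_inj p
    tt := ?_
    dd := ?_
    dt := ?_
    tx := ?_
    ty := ?_
    dx := ?_
    dy := ?_
    yx_ne := ?_
    yx := ?_ }⟩
  · exact fun s t h i j => .punghost_right
      (fun _ => (Commute.punghost_right (fun _ => (shOp_mulX_comm _ (by simp [h])).symm) _).symm) _
  · intro s i j
    rw [opY, opX, gh_punghost, gh_punghost, shOp_mulX]
    simp [wts]

  · exact fun k l => mulOp_comm _ _
  · exact fun k l => shOp_comm _ _ _
  · intro k l
    rw [shOp_mulX]
    simp [wts]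
  · exact fun k s i => .punghost_right (fun _ => mulOp_comm _ _) _
  · exact fun k s i => .punghost_right (fun _ => (shOp_mulX_comm _ (by simp)).symm) _
  · exact fun k s i => .punghost_right (fun _ => (shOp_mulX_comm _ (by simp))) _
  · exact fun k s i => .punghost_right (fun _ => shOp_comm _ _ _) _

end Weyl

section Span

variable {A : Type*} [Ring A] {κ κ' : Type*}

/-- If commutators `[Y j, X i]` lie in the subring generated by all `X i` and all `Y j` of lower
rank, then the subring generated by everything consists of sums of products `f(X) g(Y)`. -/
theorem closure_le_evalMul_range (X : κ → A) (hX : ∀ i j, Commute (X i) (X j)) (Y : κ' → A)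
    (hY : ∀ i j, Commute (Y i) (Y j)) (rk : κ' → ℕ)
    (h : ∀ j i, Y j * X i - X i * Y j ∈
      Subring.closure (Set.range X ∪ Y '' {j' | rk j' < rk j})) {z : A}
    (hz : z ∈ Subring.closure (Set.range X ∪ Set.range Y)) :
    ∃ t, evalMul ℤ X hX Y hY t = z := by
  let P := Algebra.adjoin ℤ (Set.range X)
  let Q := Algebra.adjoin ℤ (Set.range Y)
  let M : Submodule ℤ A := P.toSubmodule * Q.toSubmodule
  suffices hM : z ∈ M by
    have := evalMul_range (R := ℤ) X hX Y hY
    rw [← LinearMap.mem_range, this]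
    exact hM
  have hPP : ∀ x ∈ P, ∀ y ∈ P, Commute x y := fun x hx y hy =>
    Algebra.commute_of_mem_adjoin_of_forall_mem_commute (s := Set.range X) hy
      (fun b hb => (Algebra.commute_of_mem_adjoin_of_forall_mem_commute (s := Set.range X) hx (by
        obtain ⟨i, rfl⟩ := hb
        rintro _ ⟨j, rfl⟩
        exact hX i j)).symm)
  have hMQ : ∀ a ∈ M, ∀ q ∈ Q, a * q ∈ M := by
    intro a ha q hq
    have := Submodule.mul_mem_mul ha (show q ∈ Q.toSubmodule from hq)
    rwa [show M * Q.toSubmodule = M by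
      simp only [M]; rw [mul_assoc, (Subalgebra.isIdempotentElem_toSubmodule Q).eq]] at this
  have hPM : ∀ x ∈ P, x ∈ M := fun x hx => by
    simpa using Submodule.mul_mem_mul (show x ∈ P.toSubmodule from hx) (show (1 : A) ∈ Q.toSubmodule from one_mem Q)
  have h1M : ∀ a, (∀ x ∈ P, a * x ∈ M) → a ∈ M := fun a ha => by simpa using ha 1 (one_mem P)
  let N : Subring A :=
    { carrier := {a | ∀ x ∈ P, a * x ∈ M}
      one_mem' := fun x hx => by simpa using hPM x hx
      zero_mem' := fun x _ => by simp
      add_mem' := fun {a b} ha hb x hx => by rw [add_mul]; exact add_mem (ha x hx) (hb x hx)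
      neg_mem' := fun {a} ha x hx => by rw [neg_mul]; exact neg_mem (ha x hx)
      mul_mem' := fun {a b} ha hb x hx => by
        rw [mul_assoc]
        refine Submodule.mul_induction_on (hb x hx) (fun r hr q hq => ?_) fun r s hr hs => ?_
        · rw [← mul_assoc]
          exact hMQ _ (ha r hr) q hq
        · rw [mul_add]
          exact add_mem hr hs }
  have hPN : ∀ x ∈ P, x ∈ N := fun x hx y hy => hPM _ (mul_mem hx hy)
  have hXP : ∀ i, X i ∈ P := fun i => Algebra.subset_adjoin ⟨i, rfl⟩
  have hYN : ∀ n j, rk j = n → Y j ∈ N := by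
    intro n
    induction n using Nat.strong_induction_on with
    | _ n ih =>
      intro j hj
      have hle : Subring.closure (Set.range X ∪ Y '' {j' | rk j' < rk j}) ≤ N := by
        rw [Subring.closure_le]
        rintro _ (⟨i, rfl⟩ | ⟨j', hj', rfl⟩)
        · exact hPN _ (hXP i)
        · exact ih _ (hj ▸ hj') j' rfl
      have hD : ∀ x ∈ P, Y j * x - x * Y j ∈ N := by
        intro x hx
        induction hx using Algebra.adjoin_induction with
        | mem x hx =>
          obtain ⟨i, rfl⟩ := hx
          exact hle (h j i)
        | algebraMap r =>
          rw [(Algebra.commutes r (Y j)), sub_self]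
          exact zero_mem N
        | add x y _ _ hx hy =>
          rw [mul_add, add_mul, add_sub_add_comm]
          exact add_mem hx hy
        | mul x y hx' hy' hx hy =>
          rw [show Y j * (x * y) - x * y * Y j = (Y j * x - x * Y j) * y + x * (Y j * y - y * Y j) by
            noncomm_ring]
          exact add_mem (mul_mem hx (hPN _ hy')) (mul_mem (hPN _ hx') hy)
      intro x hx
      rw [show Y j * x = (Y j * x - x * Y j) + x * Y j by abel]
      exact add_mem (h1M _ (hD x hx)) (Submodule.mul_mem_mul hx (Algebra.subset_adjoin ⟨j, rfl⟩))
  refine h1M _ ((Subring.closure_le (t := N)).2 ?_ hz)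
  rintro _ (⟨i, rfl⟩ | ⟨j, rfl⟩)
  · exact hPN _ (hXP i)
  · exact hYN _ j rfl

end Span

section Sub

theorem evalMul_rename {A : Type*} [Ring A] {R : Type*} [CommRing R] [Algebra R A]
    {ι κ ι' κ' : Type*} (g : ι' → ι) (g' : κ' → κ) (X : ι → A)
    (hX : ∀ i j, Commute (X i) (X j)) (Y : κ → A) (hY : ∀ i j, Commute (Y i) (Y j))
    (t : MvPolynomial ι' R ⊗[R] MvPolynomial κ' R) :
    evalMul R X hX Y hY (Algebra.TensorProduct.map (MvPolynomial.rename g) (MvPolynomial.rename g') t) =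
      evalMul R (fun i => X (g i)) (fun _ _ => hX _ _) (fun i => Y (g' i)) (fun _ _ => hY _ _) t := by
  induction t with
  | zero => simp only [map_zero]
  | add a b ha hb => simp only [map_add, ha, hb]
  | tmul f f' => simp [commEval_rename]

variable {p : ℕ} {σ : Type} (W : Weyl p σ) {κ κ' : Type*} 

namespace Weyl

theorem dvd_sub {g : κ → σ × ℕ} (hg : Function.Injective g) {g' : κ' → σ × ℕ}
    (hg' : Function.Injective g') (t : MvPolynomial κ ℤ ⊗[ℤ] MvPolynomial κ' ℤ)
    (u : MvPolynomial (σ × ℕ) ℤ ⊗[ℤ] MvPolynomial (σ × ℕ) ℤ)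
    (h : evalMul ℤ (fun k => W.X (g k).1 (g k).2) (fun _ _ => W.xx _ _ _ _)
      (fun k => W.Y (g' k).1 (g' k).2) (fun _ _ => W.yy _ _ _ _) t =
      p • evalMul ℤ (fun k : σ × ℕ => W.X k.1 k.2) (fun _ _ => W.xx _ _ _ _)
        (fun k : σ × ℕ => W.Y k.1 k.2) (fun _ _ => W.yy _ _ _ _) u) :
    ∃ t', t = p • t' := by
  let r := Algebra.TensorProduct.map (MvPolynomial.rename (R := ℤ) g) (MvPolynomial.rename (R := ℤ) g')
  let l := Algebra.TensorProduct.map (MvPolynomial.killCompl (R := ℤ) hg) (MvPolynomial.killCompl (R := ℤ) hg')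
  have hlr : ∀ t, l (r t) = t := fun t => by
    induction t with
    | zero => simp only [map_zero]
    | add a b ha hb => simp only [map_add, ha, hb]
    | tmul f f' => simp [l, r, MvPolynomial.killCompl_rename_app]
  have h1 := evalMul_rename (R := ℤ) g g' (fun k : σ × ℕ => W.X k.1 k.2) (fun _ _ => W.xx _ _ _ _)
    (fun k : σ × ℕ => W.Y k.1 k.2) (fun _ _ => W.yy _ _ _ _) t
  refine ⟨l u, ?_⟩
  rw [← hlr t, ← map_nsmul l]
  congr 1
  apply W.inj
  rw [h1, map_nsmul]
  exact h

end Weyl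

end Sub

section Transfer

variable {p : ℕ} {σ : Type} {c : ℕ+ → ℕ+ → MvPolynomial (ℕ+ ⊕ₗ ℕ+) ℤ}

/-- Families `X s`, `Y s` satisfying the defining relations of the truncated `p`-typical algebras
up to level `n s`, the families for different `s` commuting with each other. -/
structure IsHP {S : Type*} [Ring S] (p : ℕ) (c : ℕ+ → ℕ+ → MvPolynomial (ℕ+ ⊕ₗ ℕ+) ℤ)
    (n : σ → ℕ) (X Y : σ → ℕ → S) : Prop where
  xx : ∀ s i t j, i < n s → j < n t → Commute (X s i) (X t j)
  yy : ∀ s i t j, i < n s → j < n t → Commute (Y s i) (Y t j)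
  yx_ne : ∀ s t, s ≠ t → ∀ i j, i < n s → j < n t → Commute (Y t j) (X s i)
  yx : ∀ s i j, i < n s → j < n s →
    Y s j * X s i = X s i * Y s j + cPow p c (X s) (Y s) i j

namespace Weyl

theorem gxx [Fact p.Prime] (W : Weyl p σ) (s i t j) : Commute (gh p (W.X s) i) (gh p (W.X t) j) :=
  Commute.gh_right fun _ _ => (Commute.gh_right fun _ _ => W.xx _ _ _ _).symm

theorem gyy [Fact p.Prime] (W : Weyl p σ) (s i t j) : Commute (gh p (W.Y s) i) (gh p (W.Y t) j) :=
  Commute.gh_right fun _ _ => (Commute.gh_right fun _ _ => W.yy _ _ _ _).symm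

/-- The ring generated by the canonical pairs. -/
def U (W : Weyl p σ) : Subring W.E :=
  Subring.closure (Set.range (fun k : σ × ℕ => W.X k.1 k.2) ∪ Set.range (fun k : σ × ℕ => W.Y k.1 k.2))

theorem X_mem (W : Weyl p σ) (s i) : W.X s i ∈ W.U := Subring.subset_closure (Or.inl ⟨(s, i), rfl⟩)

theorem Y_mem (W : Weyl p σ) (s i) : W.Y s i ∈ W.U := Subring.subset_closure (Or.inr ⟨(s, i), rfl⟩)

theorem hp_yx [Fact p.Prime] (W : Weyl p σ) (hc : IsCFamily c) (s : σ) (i j : ℕ) :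
    W.Y s j * W.X s i = W.X s i * W.Y s j + cPow p c (W.X s) (W.Y s) i j :=
  hc.ptypical (W.X s) (W.Y s) W.T W.D (fun i j => W.gxx s i s j) (fun i j => W.gyy s i s j)
    (W.yx s) W.tt W.dd W.dt (fun _ _ => Commute.gh_right fun _ _ => W.tx _ _ _)
    (fun _ _ => Commute.gh_right fun _ _ => W.ty _ _ _)
    (fun _ _ => Commute.gh_right fun _ _ => W.dx _ _ _)
    (fun _ _ => Commute.gh_right fun _ _ => W.dy _ _ _) i j

theorem mem_U_iff [Fact p.Prime] (W : Weyl p σ) (hc : IsCFamily c) {z : W.E} (hz : z ∈ W.U) :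
    ∃ t, evalMul ℤ (fun k : σ × ℕ => W.X k.1 k.2) (fun _ _ => W.xx _ _ _ _)
        (fun k : σ × ℕ => W.Y k.1 k.2) (fun _ _ => W.yy _ _ _ _) t = z := by
  refine closure_le_evalMul_range _ _ _ _ (fun k => k.2) (fun k l => ?_) hz
  by_cases h : l.1 = k.1
  · obtain ⟨s, j⟩ := k
    obtain ⟨t, i⟩ := l
    obtain rfl : t = s := h
    rw [W.hp_yx hc, add_sub_cancel_left]
    exact cPow_mem hc _ (fun k _ => Subring.subset_closure (Or.inl ⟨(t, k), rfl⟩))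
      (fun k hk => Subring.subset_closure (Or.inr ⟨(t, k), hk, rfl⟩))
  · rw [(W.yx_ne l.1 k.1 h _ _).eq, sub_self]
    exact zero_mem _

end Weyl

variable {S : Type*} [Ring S] {n : σ → ℕ} {X Y : σ → ℕ → S}

/-- The ring generated by the pairs of corresponding elements. -/
def pairRing (W : Weyl p σ) (n : σ → ℕ) (X Y : σ → ℕ → S) : Subring (S × W.E) :=
  Subring.closure (Set.range (fun k : {k : σ × ℕ // k.2 < n k.1} => (X k.1.1 k.1.2, W.X k.1.1 k.1.2)) ∪
    Set.range (fun k : {k : σ × ℕ // k.2 < n k.1} => (Y k.1.1 k.1.2, W.Y k.1.1 k.1.2)))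

theorem snd_mem_of_pairRing {W : Weyl p σ} {z : S × W.E} (hz : z ∈ pairRing W n X Y) : z.2 ∈ W.U := by
  have : pairRing W n X Y ≤ W.U.comap (RingHom.snd S W.E) := by
    refine (Subring.closure_le).2 ?_
    rintro _ (⟨k, rfl⟩ | ⟨k, rfl⟩)
    · exact W.X_mem _ _
    · exact W.Y_mem _ _
  exact this hz

/-- Pairs of elements that correspond to each other modulo `p`. -/
def transfer (W : Weyl p σ) (n : σ → ℕ) (X Y : σ → ℕ → S) : Subring (S × W.E) where
  carrier := {z | ∃ u ∈ W.U, (z.1, z.2 + p * u) ∈ pairRing W n X Y}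
  zero_mem' := ⟨0, zero_mem _, by rw [mul_zero, add_zero]; exact zero_mem _⟩
  one_mem' := ⟨0, zero_mem _, by rw [mul_zero, add_zero]; exact one_mem _⟩
  add_mem' := by
    rintro a b ⟨u, hu, ha⟩ ⟨v, hv, hb⟩
    refine ⟨u + v, add_mem hu hv, ?_⟩
    convert add_mem ha hb using 1
    ext
    · rfl
    · simp only [Prod.snd_add, mul_add]; abel
  neg_mem' := by
    rintro a ⟨u, hu, ha⟩
    refine ⟨-u, neg_mem hu, ?_⟩
    convert neg_mem ha using 1
    ext
    · rfl
    · simp only [Prod.snd_neg, mul_neg]; abel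
  mul_mem' := by
    rintro a b ⟨u, hu, ha⟩ ⟨v, hv, hb⟩
    have hpU : ∀ w ∈ W.U, (p : W.E) * w ∈ W.U := fun w hw => mul_mem (natCast_mem _ _) hw
    have ha2 : a.2 ∈ W.U := by
      simpa using sub_mem (snd_mem_of_pairRing ha) (hpU u hu)
    have hb2 : b.2 ∈ W.U := by
      simpa using sub_mem (snd_mem_of_pairRing hb) (hpU v hv)
    refine ⟨a.2 * v + u * b.2 + p * (u * v), add_mem (add_mem (mul_mem ha2 hv) (mul_mem hu hb2))
      (hpU _ (mul_mem hu hv)), ?_⟩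
    convert mul_mem ha hb using 1
    ext
    · rfl
    · have e1 : a.2 * (p * v) = p * (a.2 * v) := by
        rw [← mul_assoc, ← mul_assoc, (Nat.cast_commute p a.2).eq]
      have e2 : p * u * (p * v) = p * (p * (u * v)) := by
        rw [mul_assoc (p : W.E) u, ← mul_assoc u, ← (Nat.cast_commute p u).eq, mul_assoc (p : W.E) u]
      simp only [Prod.snd_mul, mul_add, add_mul, e1, e2, mul_assoc]
      abel

theorem pairRing_le_transfer (W : Weyl p σ) : pairRing W n X Y ≤ transfer W n X Y := fun z hz =>
  ⟨0, zero_mem _, by simpa using hz⟩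

theorem X_mem_transfer (W : Weyl p σ) {s : σ} {i : ℕ} (h : i < n s) :
    (X s i, W.X s i) ∈ transfer W n X Y :=
  pairRing_le_transfer W (Subring.subset_closure (Or.inl ⟨⟨(s, i), h⟩, rfl⟩))

theorem Y_mem_transfer (W : Weyl p σ) {s : σ} {i : ℕ} (h : i < n s) :
    (Y s i, W.Y s i) ∈ transfer W n X Y :=
  pairRing_le_transfer W (Subring.subset_closure (Or.inr ⟨⟨(s, i), h⟩, rfl⟩))

theorem zero_mem_transfer (W : Weyl p σ) {u : W.E} (hu : u ∈ W.U) :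
    ((0 : S), (p : W.E) * u) ∈ transfer W n X Y :=
  ⟨-u, neg_mem hu, by rw [mul_neg, add_neg_cancel]; exact zero_mem _⟩

/-- Every relation modulo `p` between canonical pairs in characteristic zero holds between the
given families in characteristic `p`. -/
theorem eq_zero_of_transfer [Fact p.Prime] (hc : IsCFamily c) (W : Weyl p σ) (hS : (p : S) = 0)
    (h : IsHP p c n X Y) {z : S} (hz : (z, (0 : W.E)) ∈ transfer W n X Y) : z = 0 := by
  obtain ⟨u, hu, hz⟩ := hz
  rw [zero_add] at hz
  obtain ⟨t, ht⟩ := W.mem_U_iff hc hu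
  let κ := {k : σ × ℕ // k.2 < n k.1}
  let X' : κ → S × W.E := fun k => (X k.1.1 k.1.2, W.X k.1.1 k.1.2)
  let Y' : κ → S × W.E := fun k => (Y k.1.1 k.1.2, W.Y k.1.1 k.1.2)
  have hX' : ∀ i j, Commute (X' i) (X' j) := fun i j =>
    Prod.ext (h.xx _ _ _ _ i.2 j.2) (W.xx _ _ _ _)
  have hY' : ∀ i j, Commute (Y' i) (Y' j) := fun i j =>
    Prod.ext (h.yy _ _ _ _ i.2 j.2) (W.yy _ _ _ _)
  obtain ⟨r, hr⟩ := closure_le_evalMul_range X' hX' Y' hY' (fun k => k.1.2) (fun k l => by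
    obtain ⟨⟨s, j⟩, hj⟩ := k
    obtain ⟨⟨t, i⟩, hi⟩ := l
    by_cases hst : t = s
    · subst hst
      have e : Y' ⟨(t, j), hj⟩ * X' ⟨(t, i), hi⟩ - X' ⟨(t, i), hi⟩ * Y' ⟨(t, j), hj⟩ =
          cPow p c (fun k => (X t k, W.X t k)) (fun k => (Y t k, W.Y t k)) i j := by
        refine Prod.ext ?_ ?_
        · have := map_cPow (p := p) (c := c) (RingHom.fst S W.E) (fun k => (X t k, W.X t k))
            (fun k => (Y t k, W.Y t k)) i j
          refine Eq.trans ?_ this.symm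
          exact sub_eq_of_eq_add' (h.yx t i j hi hj)
        · have := map_cPow (p := p) (c := c) (RingHom.snd S W.E) (fun k => (X t k, W.X t k))
            (fun k => (Y t k, W.Y t k)) i j
          refine Eq.trans ?_ this.symm
          exact sub_eq_of_eq_add' (W.hp_yx hc t i j)
      rw [e]
      exact cPow_mem hc _
        (fun k hk => Subring.subset_closure (Or.inl ⟨⟨(t, k), lt_trans hk hi⟩, rfl⟩))
        (fun k hk => Subring.subset_closure (Or.inr ⟨⟨(t, k), lt_trans hk hj⟩, hk, rfl⟩))
    · have e : Y' ⟨(s, j), hj⟩ * X' ⟨(t, i), hi⟩ - X' ⟨(t, i), hi⟩ * Y' ⟨(s, j), hj⟩ = 0 :=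
        Prod.ext (sub_eq_zero.2 (h.yx_ne t s hst i j hi hj)) (sub_eq_zero.2 (W.yx_ne t s hst i j))
      rw [e]
      exact zero_mem _) hz
  have h2 := evalMul_map (R := ℤ) (RingHom.snd S W.E).toIntAlgHom X' hX' Y' hY'
    (fun k => W.X k.1.1 k.1.2) (fun _ _ => W.xx _ _ _ _) (fun k => W.Y k.1.1 k.1.2)
    (fun _ _ => W.yy _ _ _ _) (fun _ => rfl) (fun _ => rfl) r
  have h1 := evalMul_map (R := ℤ) (RingHom.fst S W.E).toIntAlgHom X' hX' Y' hY'
    (fun k => X k.1.1 k.1.2) (fun i j => h.xx _ _ _ _ i.2 j.2) (fun k => Y k.1.1 k.1.2)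
    (fun i j => h.yy _ _ _ _ i.2 j.2) (fun _ => rfl) (fun _ => rfl) r
  rw [hr] at h1 h2
  obtain ⟨r', rfl⟩ := W.dvd_sub (p := p) (κ := κ) (κ' := κ) (g := Subtype.val) Subtype.val_injective
    (g' := Subtype.val) Subtype.val_injective r t (by
      rw [ht, nsmul_eq_mul]
      exact h2.symm)
  rw [map_nsmul] at h1
  refine (show z = _ from h1).trans ?_
  rw [nsmul_eq_mul, hS, zero_mul]

end Transfer

/-- Formal expressions in the operations available on Witt vectors. -/
inductive WExpr (σ : Type) : Type
  | atom (s : σ) : WExpr σ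
  | add (a b : WExpr σ) : WExpr σ
  | sub (a b : WExpr σ) : WExpr σ
  | mul (a b : WExpr σ) : WExpr σ
  | F (a : WExpr σ) : WExpr σ
  | V (a : WExpr σ) : WExpr σ

namespace WExpr

variable {σ : Type} {p : ℕ} [Fact p.Prime]

/-- The value of an expression on Witt vectors. -/
def eval {C : Type*} [CommRing C] (z : σ → WittVector p C) : WExpr σ → WittVector p C
  | atom s => z s
  | add a b => eval z a + eval z b
  | sub a b => eval z a - eval z b
  | mul a b => eval z a * eval z b
  | F a => WittVector.frobenius (eval z a)
  | V a => WittVector.verschiebung (eval z a)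

/-- The value of an expression on ghost components. -/
def gEval {A : Type*} [Ring A] (p : ℕ) (g : σ → ℕ → A) : WExpr σ → ℕ → A
  | atom s, i => g s i
  | add a b, i => gEval p g a i + gEval p g b i
  | sub a b, i => gEval p g a i - gEval p g b i
  | mul a b, i => gEval p g a i * gEval p g b i
  | F a, i => gEval p g a (i + 1)
  | V _, 0 => 0
  | V a, i + 1 => p * gEval p g a i

/-- The first `m` coefficients of the value are determined by the first `n s` coefficients of the
arguments (in characteristic `p`). -/
def Valid (n : σ → ℕ) : WExpr σ → ℕ → Prop
  | atom s, m => m ≤ n s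
  | add a b, m => Valid n a m ∧ Valid n b m
  | sub a b, m => Valid n a m ∧ Valid n b m
  | mul a b, m => Valid n a m ∧ Valid n b m
  | F a, m => Valid n a m
  | V a, m => Valid n a (m - 1)

theorem _root_.WittVector.map_frobenius' {C D : Type*} [CommRing C] [CommRing D] (φ : C →+* D)
    (x : WittVector p C) :
    WittVector.map φ (WittVector.frobenius x) = WittVector.frobenius (WittVector.map φ x) := by
  ext i
  rw [WittVector.map_coeff, WittVector.coeff_frobenius, WittVector.coeff_frobenius,
    ← RingHom.toIntAlgHom_apply φ, MvPolynomial.comp_aeval_apply]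
  rfl

theorem map_eval {C D : Type*} [CommRing C] [CommRing D] (φ : C →+* D) (z : σ → WittVector p C)
    (e : WExpr σ) : WittVector.map φ (eval z e) = eval (fun s => WittVector.map φ (z s)) e := by
  induction e with
  | atom s => rfl
  | add a b ha hb => simp only [eval, map_add, ha, hb]
  | sub a b ha hb => simp only [eval, map_sub, ha, hb]
  | mul a b ha hb => simp only [eval, _root_.map_mul, ha, hb]
  | F a ha => simp only [eval, WittVector.map_frobenius', ha]
  | V a ha => simp only [eval, WittVector.map_verschiebung, ha]

theorem ghostComponent_eval {C A : Type*} [CommRing C] [Ring A] (g : C →+* A)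
    (z : σ → WittVector p C) (e : WExpr σ) (i : ℕ) :
    g (WittVector.ghostComponent i (eval z e)) =
      gEval p (fun s i => g (WittVector.ghostComponent i (z s))) e i := by
  induction e generalizing i with
  | atom s => rfl
  | add a b ha hb => simp only [eval, gEval, map_add, ha, hb]
  | sub a b ha hb => simp only [eval, gEval, map_sub, ha, hb]
  | mul a b ha hb => simp only [eval, gEval, _root_.map_mul, ha, hb]
  | F a ha => rw [eval, WittVector.ghostComponent_frobenius, ha]; rfl
  | V a ha =>
    cases i with
    | zero => rw [eval, WittVector.ghostComponent_zero_verschiebung, map_zero]; rfl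
    | succ i => rw [eval, WittVector.ghostComponent_verschiebung, _root_.map_mul, map_natCast, ha]; rfl

theorem commute_gEval {A : Type*} [Ring A] {p : ℕ} {g : σ → ℕ → A} {a : A}
    (h : ∀ s i, Commute a (g s i)) (e : WExpr σ) (i : ℕ) : Commute a (gEval p g e i) := by
  induction e generalizing i with
  | atom s => exact h s i
  | add _ _ ha hb => exact (ha i).add_right (hb i)
  | sub _ _ ha hb => exact (ha i).sub_right (hb i)
  | mul _ _ ha hb => exact (ha i).mul_right (hb i)
  | F a ha => exact ha _
  | V _ ha =>
    cases i with
    | zero => exact Commute.zero_right _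
    | succ i => exact (Nat.cast_commute p a).symm.mul_right (ha i)

section Lift

variable {C D : Type*} [CommRing C] [CommRing D] (H : Subring (C × D))

theorem rel_iff_exists_lift (m : ℕ) (α : WittVector p C) (β : WittVector p D) :
    (∀ i < m, (α.coeff i, β.coeff i) ∈ H) ↔ ∃ γ : WittVector p H,
      WittVector.truncate m (WittVector.map ((RingHom.fst C D).comp H.subtype) γ) =
        WittVector.truncate m α ∧
      WittVector.truncate m (WittVector.map ((RingHom.snd C D).comp H.subtype) γ) =
        WittVector.truncate m β := by
  classical
  constructor
  · intro h
    refine ⟨WittVector.mk p fun i => if hi : i < m then ⟨_, h i hi⟩ else 0, ?_, ?_⟩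
    · refine TruncatedWittVector.ext fun i => ?_
      rw [WittVector.coeff_truncate, WittVector.coeff_truncate]
      simp
    · refine TruncatedWittVector.ext fun i => ?_
      rw [WittVector.coeff_truncate, WittVector.coeff_truncate]
      simp
  · rintro ⟨γ, h1, h2⟩ i hi
    have h1 := congrArg (TruncatedWittVector.coeff ⟨i, hi⟩) h1
    have h2 := congrArg (TruncatedWittVector.coeff ⟨i, hi⟩) h2
    rw [WittVector.coeff_truncate, WittVector.coeff_truncate] at h1 h2
    have := (γ.coeff i).2
    convert this using 1
    exact Prod.ext h1.symm h2.symm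

theorem eval_mem [CharP C p] (hH : ∀ d, ((0 : C), (p : D) * d) ∈ H) (e : WExpr σ) {n : σ → ℕ}
    {m : ℕ} (hv : e.Valid n m) (α : σ → WittVector p C) (β : σ → WittVector p D)
    (h : ∀ s i, i < n s → ((α s).coeff i, (β s).coeff i) ∈ H) :
    ∀ i < m, ((eval α e).coeff i, (eval β e).coeff i) ∈ H := by
  induction e generalizing m with
  | atom s => exact fun i hi => h s i (lt_of_lt_of_le hi hv)
  | add a b ha hb =>
    obtain ⟨γ, h1, h2⟩ := (rel_iff_exists_lift H m _ _).1 (ha hv.1)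
    obtain ⟨δ, h3, h4⟩ := (rel_iff_exists_lift H m _ _).1 (hb hv.2)
    exact (rel_iff_exists_lift H m _ _).2 ⟨γ + δ, by simp only [eval, map_add, h1, h3],
      by simp only [eval, map_add, h2, h4]⟩
  | sub a b ha hb =>
    obtain ⟨γ, h1, h2⟩ := (rel_iff_exists_lift H m _ _).1 (ha hv.1)
    obtain ⟨δ, h3, h4⟩ := (rel_iff_exists_lift H m _ _).1 (hb hv.2)
    exact (rel_iff_exists_lift H m _ _).2 ⟨γ - δ, by simp only [eval, map_sub, h1, h3],
      by simp only [eval, map_sub, h2, h4]⟩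
  | mul a b ha hb =>
    obtain ⟨γ, h1, h2⟩ := (rel_iff_exists_lift H m _ _).1 (ha hv.1)
    obtain ⟨δ, h3, h4⟩ := (rel_iff_exists_lift H m _ _).1 (hb hv.2)
    exact (rel_iff_exists_lift H m _ _).2 ⟨γ * δ, by simp only [eval, _root_.map_mul, h1, h3],
      by simp only [eval, _root_.map_mul, h2, h4]⟩
  | F a ha =>
    intro i hi
    have h1 := add_mem (pow_mem (ha hv i hi) p) (hH (MvPolynomial.aeval (eval β a).coeff
      (WittVector.frobeniusPolyAux p i)))
    rw [eval, eval, WittVector.coeff_frobenius_charP, WittVector.coeff_frobenius,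
      WittVector.frobeniusPoly]
    simpa using h1
  | V a ha =>
    intro i hi
    cases i with
    | zero =>
      simp only [eval, WittVector.verschiebung_coeff_zero]
      exact zero_mem H
    | succ i =>
      simpa only [eval, WittVector.verschiebung_coeff_succ] using ha hv i (by omega)

theorem eval_congr [CharP C p] (e : WExpr σ) {n : σ → ℕ} {m : ℕ} (hv : e.Valid n m)
    (α β : σ → WittVector p C) (h : ∀ s i, i < n s → (α s).coeff i = (β s).coeff i) :
    ∀ i < m, (eval α e).coeff i = (eval β e).coeff i := by
  have hH := eval_mem ((RingHom.fst C C).eqLocus (RingHom.snd C C)) (p := p) (fun d => by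
    rw [CharP.cast_eq_zero, zero_mul]; exact zero_mem _) e hv α β h
  exact hH

end Lift

theorem eval_iterate_F {C : Type*} [CommRing C] [CharP C p] (z : σ → WittVector p C) (s : σ)
    (r i : ℕ) : (eval z (F^[r] (atom s))).coeff i = (z s).coeff i ^ p ^ r := by
  induction r with
  | zero => simp [eval]
  | succ r ih =>
    rw [Function.iterate_succ_apply', eval, WittVector.coeff_frobenius_charP, ih, ← pow_mul, pow_succ]

theorem gEval_iterate_F {A : Type*} [Ring A] (p : ℕ) (g : σ → ℕ → A) (s : σ) (r i : ℕ) :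
    gEval p g (F^[r] (atom s)) i = g s (i + r) := by
  induction r generalizing i with
  | zero => simp [gEval]
  | succ r ih =>
    rw [Function.iterate_succ_apply', gEval, ih]
    congr 1
    omega

theorem valid_iterate_F (n : σ → ℕ) (s : σ) (r : ℕ) : (F^[r] (atom s)).Valid n (n s) := by
  induction r with
  | zero => exact le_rfl
  | succ r ih =>
    rw [Function.iterate_succ_apply']
    exact ih

/-- Apply a power of Frobenius to each atom. -/
def bindF (k : σ → ℕ) : WExpr σ → WExpr σ
  | atom s => F^[k s] (atom s)
  | add a b => add (bindF k a) (bindF k b)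
  | sub a b => sub (bindF k a) (bindF k b)
  | mul a b => mul (bindF k a) (bindF k b)
  | F a => F (bindF k a)
  | V a => V (bindF k a)

theorem bindF_zero (e : WExpr σ) : bindF (fun _ => 0) e = e := by
  induction e with
  | atom s => rfl
  | add a b ha hb => simp only [bindF, ha, hb]
  | sub a b ha hb => simp only [bindF, ha, hb]
  | mul a b ha hb => simp only [bindF, ha, hb]
  | F a ha => simp only [bindF, ha]
  | V a ha => simp only [bindF, ha]

theorem valid_bindF (n : σ → ℕ) (k : σ → ℕ) (e : WExpr σ) (m : ℕ) :
    (bindF k e).Valid n m ↔ e.Valid n m := by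
  induction e generalizing m with
  | atom s =>
    have h : ∀ r, (F^[r] (atom s)).Valid n m ↔ m ≤ n s := fun r => by
      induction r with
      | zero => rfl
      | succ r ih => rw [Function.iterate_succ_apply']; exact ih
    exact h _
  | add a b ha hb => exact and_congr (ha m) (hb m)
  | sub a b ha hb => exact and_congr (ha m) (hb m)
  | mul a b ha hb => exact and_congr (ha m) (hb m)
  | F a ha => exact ha m
  | V a ha => exact ha _

theorem eval_bindF {C : Type*} [CommRing C] [CharP C p] (z : σ → WittVector p C) (k : σ → ℕ)
    (e : WExpr σ) :
    eval z (bindF k e) = eval (fun s => WittVector.map (iterateFrobenius C p (k s)) (z s)) e := by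
  induction e with
  | atom s =>
    ext i
    rw [bindF, eval_iterate_F, eval, WittVector.map_coeff, iterateFrobenius_def]
  | add a b ha hb => simp only [bindF, eval, ha, hb]
  | sub a b ha hb => simp only [bindF, eval, ha, hb]
  | mul a b ha hb => simp only [bindF, eval, ha, hb]
  | F a ha => simp only [bindF, eval, ha]
  | V a ha => simp only [bindF, eval, ha]

end WExpr

section New

variable {σ τ : Type} {p : ℕ}

/-- Choose between two families. -/
def pick {A : Type*} (q : σ → Bool) (X Y : σ → ℕ → A) (s : σ) (i : ℕ) : A :=
  if q s then Y s i else X s i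

/-- Canonical commutation relations of ghost components. -/
structure Canon {A : Type*} [Ring A] (p : ℕ) (gx gy : τ → ℕ → A) : Prop where
  xx : ∀ s i t j, Commute (gx s i) (gx t j)
  yy : ∀ s i t j, Commute (gy s i) (gy t j)
  yx_ne : ∀ s t, s ≠ t → ∀ i j, Commute (gy t j) (gx s i)
  yx : ∀ s i j, gy s j * gx s i = gx s i * gy s j + if i = j then (p : A) ^ i else 0

variable {c : ℕ+ → ℕ+ → MvPolynomial (ℕ+ ⊕ₗ ℕ+) ℤ}

theorem Weyl.canon [Fact p.Prime] (W : Weyl p σ) : Canon p (fun s => gh p (W.X s)) (fun s => gh p (W.Y s)) where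
  xx := W.gxx
  yy := W.gyy
  yx_ne s t h _ _ := Commute.gh_right fun _ _ => (Commute.gh_right fun _ _ => (W.yx_ne s t h _ _).symm).symm
  yx := W.yx

theorem Weyl.commute_pick (W : Weyl p σ) (q : σ → Bool) (s i t j) :
    Commute (pick q W.X W.Y s i) (pick q W.X W.Y t j) := by
  unfold pick
  by_cases h : s = t
  · subst h
    split_ifs
    · exact W.yy _ _ _ _
    · exact W.xx _ _ _ _
  · split_ifs
    · exact W.yy _ _ _ _
    · exact W.yx_ne _ _ (Ne.symm h) _ _
    · exact (W.yx_ne _ _ h _ _).symm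
    · exact W.xx _ _ _ _

theorem IsHP.commute_pick {S : Type*} [Ring S] {n : σ → ℕ} {X Y : σ → ℕ → S} (h : IsHP p c n X Y)
    (q : σ → Bool) (s i t j) (hi : i < n s) (hj : j < n t) :
    Commute (pick q X Y s i) (pick q X Y t j) := by
  unfold pick
  by_cases hst : s = t
  · subst hst
    split_ifs
    · exact h.yy _ _ _ _ hi hj
    · exact h.xx _ _ _ _ hi hj
  · split_ifs
    · exact h.yy _ _ _ _ hi hj
    · exact h.yx_ne _ _ (Ne.symm hst) _ _ hj hi
    · exact (h.yx_ne _ _ hst _ _ hi hj).symm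
    · exact h.xx _ _ _ _ hi hj

theorem gh_pick {A : Type*} [Ring A] (q : σ → Bool) (X Y : σ → ℕ → A) (s : σ) (i : ℕ) :
    gh p (pick q X Y s) i = pick q (fun s => gh p (X s)) (fun s => gh p (Y s)) s i := by
  unfold pick
  split_ifs <;> rfl

variable [Fact p.Prime] {K : Type u} [Field K] [CharP K p] {S : Type v} [Ring S] [Algebra K S] [Nontrivial S]

theorem IsHP.exists_transfer {n : σ → ℕ} {X Y : σ → ℕ → S} (h : IsHP p c n X Y) (W : Weyl p σ)
    (q : σ → Bool) (e : WExpr σ) {m : ℕ} (hv : e.Valid n m) :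
    ∃ (zS : ℕ → S) (zE : ℕ → W.E), (∀ i < m, (zS i, zE i) ∈ transfer W n X Y) ∧
      (∀ i, gh p zE i = e.gEval p (pick q (fun s => gh p (W.X s)) (fun s => gh p (W.Y s))) i) ∧
      (∀ (N : ℕ) (k : σ → ℕ) (e' : WExpr σ) (a : σ → WittVector p K), e = e'.bindF k →
        (∀ s i, i < n s → pick q X Y s i ^ p ^ (N + k s) = algebraMap K S ((a s).coeff i)) →
        ∀ i < m, zS i ^ p ^ N = algebraMap K S ((e'.eval a).coeff i)) ∧
      ∀ s r, e = WExpr.F^[r] (WExpr.atom s) → ∀ i < n s, zS i = pick q X Y s i ^ p ^ r := by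
  classical
  obtain ⟨C, _, _, f, z, hf, hfz, -⟩ := exists_comm_model K
    (fun k : σ × ℕ => if k.2 < n k.1 then pick q X Y k.1 k.2 else 0) (fun k l => by
      split_ifs with hk hl
      · exact h.commute_pick q _ _ _ _ hk hl
      · exact Commute.zero_right _
      · exact Commute.zero_left _
      · exact Commute.zero_left _)
  obtain ⟨D, _, _, g, w, hg, hgw, hgr⟩ := exists_comm_model ℤ
    (fun k : σ × ℕ => pick q W.X W.Y k.1 k.2) (fun k l => W.commute_pick q _ _ _ _)
  have : Nontrivial C := ⟨⟨0, 1, fun h01 => zero_ne_one (α := S) (by simpa using congrArg f h01)⟩⟩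
  have : CharP C p := charP_of_injective_algebraMap (algebraMap K C).injective p
  let α : σ → WittVector p C := fun s => WittVector.mk p fun i => z (s, i)
  let β : σ → WittVector p D := fun s => WittVector.mk p fun i => w (s, i)
  have hgU : ∀ d, g d ∈ W.U := by
    intro d
    have hd : g d ∈ g.range := ⟨d, rfl⟩
    rw [hgr] at hd
    generalize g d = x at hd
    induction hd using Algebra.adjoin_induction with
    | mem x hx =>
      obtain ⟨k, rfl⟩ := hx
      dsimp only [pick]
      split_ifs
      · exact W.Y_mem _ _
      · exact W.X_mem _ _
    | algebraMap r => rw [eq_intCast]; exact intCast_mem _ _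
    | add x y _ _ hx hy => exact add_mem hx hy
    | mul x y _ _ hx hy => exact mul_mem hx hy
  let H : Subring (C × D) := (transfer W n X Y).comap ((f : C →+* S).prodMap (g : D →+* W.E))
  refine ⟨fun i => f ((e.eval α).coeff i), fun i => g ((e.eval β).coeff i), ?_, ?_, ?_, ?_⟩
  · refine WExpr.eval_mem H (fun d => ?_) e hv α β fun s i hi => ?_
    · change (f 0, g (p * d)) ∈ transfer W n X Y
      rw [map_zero, map_mul, map_natCast]
      exact zero_mem_transfer W (hgU d)
    · change (f (z (s, i)), g (w (s, i))) ∈ transfer W n X Y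
      rw [hfz, hgw, if_pos hi]
      dsimp only [pick]
      split_ifs
      · exact Y_mem_transfer W hi
      · exact X_mem_transfer W hi
  · intro i
    rw [show gh p (fun i => g ((e.eval β).coeff i)) i = (g : D →+* W.E) (gh p (e.eval β).coeff i) from
      (map_gh (g : D →+* W.E) p _ i).symm, gh_coeff, WExpr.ghostComponent_eval]
    congr 1
    funext s i
    rw [← gh_coeff, map_gh, ← gh_pick]
    congr 1
    funext k
    exact hgw (s, k)
  · rintro N k e' a rfl ha i hi
    have hfr : ((e'.bindF k).eval α).coeff i ^ p ^ N = (e'.eval fun s => WittVector.map (iterateFrobenius C p N)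
        (WittVector.map (iterateFrobenius C p (k s)) (α s))).coeff i := by
      rw [WExpr.eval_bindF, ← WExpr.map_eval, WittVector.map_coeff, iterateFrobenius_def]
    rw [← map_pow, hfr, WExpr.eval_congr e' ((WExpr.valid_bindF n k e' m).1 hv) _
      (fun s => WittVector.map (algebraMap K C) (a s)) ?_ i hi,
      ← WExpr.map_eval, WittVector.map_coeff, AlgHom.commutes]
    intro s j hj
    apply hf
    rw [WittVector.map_coeff, WittVector.map_coeff, WittVector.map_coeff, iterateFrobenius_def,
      iterateFrobenius_def, ← pow_mul, ← pow_add, add_comm (k s), map_pow, AlgHom.commutes, ← ha s j hj]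
    change f (z (s, j)) ^ _ = _
    rw [hfz, if_pos hj]
  · rintro s r rfl i hi
    change f ((WExpr.eval α (WExpr.F^[r] (WExpr.atom s))).coeff i) = _
    rw [WExpr.eval_iterate_F, map_pow]
    change f (z (s, i)) ^ _ = _
    rw [hfz, if_pos hi]

/-- A substitution by Witt vector expressions that preserves the canonical commutation relations of
ghost components transforms families satisfying the relations into new such families. -/
theorem IsHP.exists_new (hc : IsCFamily c) {n : σ → ℕ} {X Y : σ → ℕ → S} (h : IsHP p c n X Y)
    (eX eY : τ → WExpr σ) (qX qY : τ → σ → Bool) (m : τ → ℕ)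
    (hvX : ∀ t, (eX t).Valid n (m t)) (hvY : ∀ t, (eY t).Valid n (m t))
    (hcan : ∀ (E : Type) [Ring E] (gx gy : σ → ℕ → E), Canon p gx gy →
      Canon p (fun t => (eX t).gEval p (pick (qX t) gx gy)) (fun t => (eY t).gEval p (pick (qY t) gx gy))) :
    ∃ X' Y' : τ → ℕ → S, IsHP p c m X' Y' ∧
      (∀ (t : τ) (N : ℕ) (k : σ → ℕ) (e : WExpr σ) (a : σ → WittVector p K), eX t = e.bindF k →
        (∀ s i, i < n s → pick (qX t) X Y s i ^ p ^ (N + k s) = algebraMap K S ((a s).coeff i)) →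
        ∀ i < m t, X' t i ^ p ^ N = algebraMap K S ((e.eval a).coeff i)) ∧
      (∀ (t : τ) (N : ℕ) (k : σ → ℕ) (e : WExpr σ) (a : σ → WittVector p K), eY t = e.bindF k →
        (∀ s i, i < n s → pick (qY t) X Y s i ^ p ^ (N + k s) = algebraMap K S ((a s).coeff i)) →
        ∀ i < m t, Y' t i ^ p ^ N = algebraMap K S ((e.eval a).coeff i)) := by
  obtain ⟨W⟩ : Nonempty (Weyl p σ) := inferInstance
  choose X' XE hX hgX hpX _ using fun t => h.exists_transfer (K := K) W (qX t) (eX t) (hvX t)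
  choose Y' YE hY hgY hpY _ using fun t => h.exists_transfer (K := K) W (qY t) (eY t) (hvY t)
  refine ⟨X', Y', ?_, hpX, hpY⟩
  have hp : (p : S) = 0 := by
    rw [← map_natCast (algebraMap K S), CharP.cast_eq_zero, map_zero]
  have hC := hcan W.E _ _ W.canon
  have hC' : Canon p (fun t => gh p (XE t)) (fun t => gh p (YE t)) := by
    convert hC using 1
    · funext t i; exact hgX t i
    · funext t i; exact hgY t i
  have key : ∀ {a b : S} {a' b' : W.E}, (a, a') ∈ transfer W n X Y → (b, b') ∈ transfer W n X Y →
      a' = b' → a = b := by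
    intro a b a' b' ha hb hab
    have h2 := sub_mem ha hb
    rw [Prod.mk_sub_mk, hab, sub_self] at h2
    exact sub_eq_zero.1 (eq_zero_of_transfer hc W hp h h2)
  have cc : ∀ {z w : ℕ → W.E}, (∀ i j, Commute (gh p z i) (gh p w j)) → ∀ i j, Commute (z i) (w j) := by
    intro z w hzw i j
    refine Commute.of_gh_right (p := p) (n := j + 1) (fun j _ => ?_) j (Nat.lt_succ_self j)
    exact (Commute.of_gh_right (p := p) (n := i + 1) (fun i _ => (hzw i j).symm) i (Nat.lt_succ_self i)).symm
  have aux : ∀ (a : W.E), (∀ s i, Commute a (W.X s i)) → (∀ s i, Commute a (W.Y s i)) →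
      ∀ (q : σ → Bool) (e : WExpr σ) i,
        Commute a (e.gEval p (pick q (fun s => gh p (W.X s)) (fun s => gh p (W.Y s))) i) := by
    intro a hx hy q e i
    refine WExpr.commute_gEval (fun s i => ?_) e i
    dsimp only [pick]
    split_ifs
    · exact Commute.gh_right fun _ _ => hy _ _
    · exact Commute.gh_right fun _ _ => hx _ _
  constructor
  · intro s i t j hi hj
    exact key (mul_mem (hX s i hi) (hX t j hj)) (mul_mem (hX t j hj) (hX s i hi))
      (cc (fun i j => hC'.xx s i t j) i j).eq
  · intro s i t j hi hj
    exact key (mul_mem (hY s i hi) (hY t j hj)) (mul_mem (hY t j hj) (hY s i hi))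
      (cc (fun i j => hC'.yy s i t j) i j).eq
  · intro s t hst i j hi hj
    exact key (mul_mem (hY t j hj) (hX s i hi)) (mul_mem (hX s i hi) (hY t j hj))
      (cc (fun j i => hC'.yx_ne s t hst i j) j i).eq
  · intro s i j hi hj
    have hcP : (cPow p c (X' s) (Y' s) i j, cPow p c (XE s) (YE s) i j) ∈ transfer W n X Y := by
      have e : (cPow p c (X' s) (Y' s) i j, cPow p c (XE s) (YE s) i j) =
          cPow p c (fun k => (X' s k, XE s k)) (fun k => (Y' s k, YE s k)) i j := Prod.ext
        (map_cPow (RingHom.fst S W.E) (fun k => (X' s k, XE s k)) (fun k => (Y' s k, YE s k)) i j).symm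
        (map_cPow (RingHom.snd S W.E) (fun k => (X' s k, XE s k)) (fun k => (Y' s k, YE s k)) i j).symm
      rw [e]
      exact cPow_mem hc _ (fun k hk => hX s k (hk.trans hi)) (fun k hk => hY s k (hk.trans hj))
    refine key (mul_mem (hY s j hj) (hX s i hi)) (add_mem (mul_mem (hX s i hi) (hY s j hj)) hcP)
      (hc.ptypical (XE s) (YE s) W.T W.D (fun i j => hC'.xx s i s j) (fun i j => hC'.yy s i s j)
      (hC'.yx s) W.tt W.dd W.dt ?_ ?_ ?_ ?_ i j)
    · intro k i
      rw [hgX]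
      exact aux _ (W.tx k) (W.ty k) _ _ _
    · intro k i
      rw [hgY]
      exact aux _ (W.tx k) (W.ty k) _ _ _
    · intro k i
      rw [hgX]
      exact aux _ (W.dx k) (W.dy k) _ _ _
    · intro k i
      rw [hgY]
      exact aux _ (W.dx k) (W.dy k) _ _ _

end New

section Powers

theorem commutator_pow {A : Type*} [Ring A] {a x : A} (h : Commute (a * x - x * a) x) (m : ℕ) :
    a * x ^ m - x ^ m * a = m • (x ^ (m - 1) * (a * x - x * a)) := by
  induction m with
  | zero => simp
  | succ m ih =>
    have h1 : a * x ^ (m + 1) - x ^ (m + 1) * a =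
        (a * x ^ m - x ^ m * a) * x + x ^ m * (a * x - x * a) := by
      rw [pow_succ]; noncomm_ring
    rw [h1, ih, succ_nsmul, Nat.add_sub_cancel]
    congr 1
    rw [smul_mul_assoc, mul_assoc, h.eq, ← mul_assoc]
    rcases m with _ | m
    · simp
    · rw [← pow_succ, Nat.add_sub_cancel]

variable {p : ℕ} [Fact p.Prime] {A : Type*} [Ring A] [Algebra ℚ A]

private theorem cancel_natCast {m : ℕ} (hm : m ≠ 0) {x y : A} (h : (m : A) * x = m * y) : x = y := by
  rw [← nsmul_eq_mul, ← nsmul_eq_mul, ← Nat.cast_smul_eq_nsmul ℚ, ← Nat.cast_smul_eq_nsmul ℚ] at h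
  exact smul_right_injective A (Nat.cast_ne_zero.2 hm : (m : ℚ) ≠ 0) h

theorem Canon.commutator_shift {X Y X' : ℕ → A}
    (h : Canon p (fun _ : Unit => gh p X) (fun _ : Unit => gh p Y)) {r : ℕ}
    (hX' : ∀ i, gh p X' i = gh p X (i + r)) (j : ℕ) {θ : A}
    (hθ : θ = ∑ k ∈ Finset.range (j + 1), (p : A) ^ k * Y (r + k) ^ p ^ (j - k)) :
    (∀ k l, Commute (θ * X' k - X' k * θ) (X' l)) ∧
    ∀ i, ∑ k ∈ Finset.range (i + 1), X' k ^ (p ^ (i - k) - 1) * (θ * X' k - X' k * θ) =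
      if i = j then 1 else 0 := by
  have hp0 : p ≠ 0 := (Fact.out : p.Prime).ne_zero
  have hY : ∀ k < r, ∀ i, Commute (Y k) (gh p X' i) := fun k hk i => by
    refine (Commute.of_gh_right (p := p) (n := r) (fun l hl => ?_) k hk).symm
    rw [hX', commute_iff_eq, h.yx () (i + r) l, if_neg (by omega), add_zero]
  have hXX : ∀ k l, Commute (X' k) (X' l) := fun k l => by
    refine Commute.of_gh_right (p := p) (n := l + 1) (fun i _ => ?_) l l.lt_succ_self
    refine (Commute.of_gh_right (p := p) (n := k + 1) (fun i' _ => ?_) k k.lt_succ_self).symm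
    rw [hX', hX']
    exact h.xx () _ () _
  have hXg : ∀ k l, Commute (X' k) (gh p X' l) := fun k l => Commute.gh_right fun _ _ => hXX _ _
  have hdec : (p : A) ^ r * θ = gh p Y (r + j) - ∑ k ∈ Finset.range r, (p : A) ^ k * Y k ^ p ^ (r + j - k) := by
    rw [eq_sub_iff_add_eq', gh, add_assoc, Finset.sum_range_add, hθ, Finset.mul_sum]
    congr 1
    refine Finset.sum_congr rfl fun k _ => ?_
    rw [pow_add, mul_assoc, Nat.add_sub_add_left]
  have hθg : ∀ i, θ * gh p X' i - gh p X' i * θ = if i = j then (p : A) ^ i else 0 := fun i => by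
    have hs : Commute (∑ k ∈ Finset.range r, (p : A) ^ k * Y k ^ p ^ (r + j - k)) (gh p X' i) :=
      Commute.sum_left _ _ _ fun k hk => Commute.mul_left ((Nat.cast_commute p _).pow_left k)
        ((hY k (Finset.mem_range.1 hk) i).pow_left _)
    have hyx := h.yx () (i + r) (r + j)
    refine cancel_natCast (m := p ^ r) (pow_ne_zero _ hp0) ?_
    push_cast
    have hpc : Commute ((p : A) ^ r) (gh p X' i) := (Nat.cast_commute p _).pow_left r
    rw [mul_sub, ← mul_assoc, ← mul_assoc, hpc.eq, mul_assoc (gh p X' i), hdec, sub_mul, mul_sub, hs.eq,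
      sub_sub_sub_cancel_right, hX', hyx, add_sub_cancel_left]
    by_cases hij : i = j
    · rw [if_pos (by omega), if_pos hij, ← pow_add, add_comm]
    · rw [if_neg (by omega), if_neg hij, mul_zero]
  have hD : ∀ k l, Commute (θ * X' k - X' k * θ) (X' l) := fun k l => by
    refine Commute.of_gh_right (p := p) (n := l + 1) (fun i _ => ?_) l l.lt_succ_self
    have h1 := hXg k i
    have h2 : Commute (X' k) (θ * gh p X' i - gh p X' i * θ) := by
      rw [hθg]
      split_ifs
      · exact (Nat.cast_commute p _).symm.pow_right i
      · exact Commute.zero_right _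
    have h3 := h2.eq
    have h1' := h1.eq
    rw [commute_iff_eq, ← sub_eq_zero]
    have : (θ * X' k - X' k * θ) * gh p X' i - gh p X' i * (θ * X' k - X' k * θ) =
        θ * (X' k * gh p X' i - gh p X' i * X' k) - (X' k * gh p X' i - gh p X' i * X' k) * θ
        - (X' k * (θ * gh p X' i - gh p X' i * θ) - (θ * gh p X' i - gh p X' i * θ) * X' k) := by
      noncomm_ring
    rw [this, h1', h3]
    simp
  refine ⟨hD, fun i => ?_⟩
  refine cancel_natCast (m := p ^ i) (pow_ne_zero _ hp0) ?_
  have := hθg i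
  rw [gh, Finset.mul_sum, Finset.sum_mul, ← Finset.sum_sub_distrib] at this
  push_cast
  rw [Finset.mul_sum, mul_ite, mul_one, mul_zero, ← this]
  refine Finset.sum_congr rfl fun k hk => ?_
  have hk : k ≤ i := Nat.lt_succ_iff.1 (Finset.mem_range.1 hk)
  have hpc : Commute ((p : A) ^ k) θ := (Nat.cast_commute p _).pow_left k
  rw [← mul_assoc θ, ← hpc.eq, mul_assoc _ θ, mul_assoc _ (X' k ^ p ^ (i - k)) θ, ← mul_sub, commutator_pow (hD k k),
    nsmul_eq_mul, ← mul_assoc, ← mul_assoc, Nat.cast_pow, ← pow_add, Nat.add_sub_cancel' hk, mul_assoc]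

end Powers

section Transferred

variable {p : ℕ} [Fact p.Prime] {c : ℕ+ → ℕ+ → MvPolynomial (ℕ+ ⊕ₗ ℕ+) ℤ}
variable {S : Type v} [Ring S] [CharP S p] [Nontrivial S]
  {n : ℕ} {X Y : ℕ → S}

theorem IsHP.commute_pow (hc : IsCFamily c) (h : IsHP p c (fun _ : Unit => n) (fun _ => X) (fun _ => Y)) {i j : ℕ}
    (hi : i < n) (hj : j < n) : Commute (Y j) (X i ^ p ^ n) ∧ Commute (X i) (Y j ^ p ^ n) := by
  have hS : (p : S) = 0 := CharP.cast_eq_zero S p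
  let _ := ZMod.algebra S p
  obtain ⟨W⟩ : Nonempty (Weyl p Unit) := inferInstance
  have hcan := W.canon
  constructor
  · obtain ⟨zS, zE, hz, hg, -, hpw⟩ := IsHP.exists_transfer (K := ZMod p) h W (fun _ => false) (WExpr.F^[n] (WExpr.atom ()))
      (WExpr.valid_iterate_F _ _ _)
    rw [show X i ^ p ^ n = zS i from (hpw () n rfl i hi).symm, commute_iff_eq, ← sub_eq_zero]
    have hE : Commute (W.Y () j) (zE i) := by
      refine Commute.of_gh_right (p := p) (n := i + 1) (fun l _ => ?_) i i.lt_succ_self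
      refine (Commute.of_gh_right (p := p) (n := n) (fun k hk => ?_) j hj).symm
      rw [hg, WExpr.gEval_iterate_F]
      change Commute (gh p (W.X ()) (l + n)) _
      rw [commute_iff_eq, hcan.yx () (l + n) k, if_neg (by omega), add_zero]
    refine eq_zero_of_transfer hc W hS h ?_
    have := sub_mem (mul_mem (Y_mem_transfer W (s := ()) hj) (hz i hi)) (mul_mem (hz i hi) (Y_mem_transfer W (s := ()) hj))
    rwa [Prod.mk_mul_mk, Prod.mk_mul_mk, Prod.mk_sub_mk, sub_eq_zero.2 hE.eq] at this
  · obtain ⟨zS, zE, hz, hg, -, hpw⟩ := IsHP.exists_transfer (K := ZMod p) h W (fun _ => true) (WExpr.F^[n] (WExpr.atom ()))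
      (WExpr.valid_iterate_F _ _ _)
    have hpw := hpw () n rfl j hj
    dsimp only [pick] at hpw
    rw [if_pos rfl] at hpw
    rw [← hpw, commute_iff_eq, ← sub_eq_zero]
    have hE : Commute (W.X () i) (zE j) := by
      refine Commute.of_gh_right (p := p) (n := j + 1) (fun l _ => ?_) j j.lt_succ_self
      refine (Commute.of_gh_right (p := p) (n := n) (fun k hk => ?_) i hi).symm
      rw [hg, WExpr.gEval_iterate_F]
      change Commute (gh p (W.Y ()) (l + n)) _
      rw [commute_iff_eq, hcan.yx () k (l + n), if_neg (by omega), add_zero]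
    refine eq_zero_of_transfer hc W hS h ?_
    have := sub_mem (mul_mem (X_mem_transfer W (s := ()) hi) (hz j hj)) (mul_mem (hz j hj) (X_mem_transfer W (s := ()) hi))
    rwa [Prod.mk_mul_mk, Prod.mk_mul_mk, Prod.mk_sub_mk, sub_eq_zero.2 hE.eq] at this

/-- The commutators of `Y r ^ p ^ j` with `p ^ r`-th powers of the `X i` commute with these powers and
invert a unitriangular matrix. -/
theorem IsHP.commutator_pow (hc : IsCFamily c) (h : IsHP p c (fun _ : Unit => n) (fun _ => X) (fun _ => Y)) {r : ℕ}
    (hr : r < n) (j : ℕ) :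
    (∀ k < n, ∀ l < n, Commute (Y r ^ p ^ j * X k ^ p ^ r - X k ^ p ^ r * Y r ^ p ^ j) (X l ^ p ^ r)) ∧
    ∀ i < n, ∑ k ∈ Finset.range (i + 1), (X k ^ p ^ r) ^ (p ^ (i - k) - 1) *
      (Y r ^ p ^ j * X k ^ p ^ r - X k ^ p ^ r * Y r ^ p ^ j) = if i = j then 1 else 0 := by
  have hS : (p : S) = 0 := CharP.cast_eq_zero S p
  let _ := ZMod.algebra S p
  obtain ⟨W⟩ : Nonempty (Weyl p Unit) := inferInstance
  obtain ⟨zS, zE, hz, hg, -, hpw⟩ := IsHP.exists_transfer (K := ZMod p) h W (fun _ => false) (WExpr.F^[r] (WExpr.atom ()))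
    (WExpr.valid_iterate_F _ _ _)
  have hpw : ∀ i < n, zS i = X i ^ p ^ r := hpw () r rfl
  obtain ⟨h1, h2⟩ := Canon.commutator_shift (X := W.X ()) (Y := W.Y ()) (X' := zE) (r := r) W.canon
    (fun i => by rw [hg, WExpr.gEval_iterate_F]; rfl) j rfl
  generalize hθ : ∑ k ∈ Finset.range (j + 1), (p : W.E) ^ k * W.Y () (r + k) ^ p ^ (j - k) = θ at h1 h2
  have hθm : (Y r ^ p ^ j, θ) ∈ transfer W (fun _ : Unit => n) (fun _ => X) (fun _ => Y) := by
    rw [Finset.sum_range_succ'] at hθ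
    have e1 := zero_mem_transfer (S := S) (n := fun _ : Unit => n) (X := fun _ => X) (Y := fun _ => Y) W
      (u := ∑ k ∈ Finset.range j, (p : W.E) ^ k * W.Y () (r + (k + 1)) ^ p ^ (j - (k + 1)))
      (sum_mem fun k _ => mul_mem (pow_mem (natCast_mem _ _) _) (pow_mem (W.Y_mem _ _) _))
    have e2 := pow_mem (Y_mem_transfer (n := fun _ : Unit => n) (X := fun _ => X) (Y := fun _ => Y) W (s := ()) hr) (p ^ j)
    have e3 := add_mem e1 e2
    rw [Prod.pow_mk, Prod.mk_add_mk, zero_add, Finset.mul_sum] at e3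
    rw [← hθ]
    convert e3 using 3
    · refine Finset.sum_congr rfl fun k _ => ?_
      rw [← mul_assoc, pow_succ']
    · simp
  have hzz : ∀ k < n, (X k ^ p ^ r, zE k) ∈ transfer W (fun _ : Unit => n) (fun _ => X) (fun _ => Y) :=
    fun k hk => hpw k hk ▸ hz k hk
  have hD : ∀ k < n, (Y r ^ p ^ j * X k ^ p ^ r - X k ^ p ^ r * Y r ^ p ^ j, θ * zE k - zE k * θ) ∈
      transfer W (fun _ : Unit => n) (fun _ => X) (fun _ => Y) := fun k hk => by
    have := sub_mem (mul_mem hθm (hzz k hk)) (mul_mem (hzz k hk) hθm)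
    rwa [Prod.mk_mul_mk, Prod.mk_mul_mk, Prod.mk_sub_mk] at this
  refine ⟨fun k hk l hl => ?_, fun i hi => ?_⟩
  · rw [commute_iff_eq, ← sub_eq_zero]
    refine eq_zero_of_transfer hc W hS h ?_
    have := sub_mem (mul_mem (hD k hk) (hzz l hl)) (mul_mem (hzz l hl) (hD k hk))
    rwa [Prod.mk_mul_mk, Prod.mk_mul_mk, Prod.mk_sub_mk, sub_eq_zero.2 (h1 k l).eq] at this
  · rw [← sub_eq_zero]
    refine eq_zero_of_transfer hc W hS h ?_
    have e1 := sum_mem (t := Finset.range (i + 1)) (S := transfer W (fun _ : Unit => n) (fun _ => X) (fun _ => Y))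
      (f := fun k => (X k ^ p ^ r, zE k) ^ (p ^ (i - k) - 1) *
        (Y r ^ p ^ j * X k ^ p ^ r - X k ^ p ^ r * Y r ^ p ^ j, θ * zE k - zE k * θ)) fun k hk =>
      mul_mem (pow_mem (hzz k (by have := Finset.mem_range.1 hk; omega)) _)
        (hD k (by have := Finset.mem_range.1 hk; omega))
    have e2 : ((if i = j then 1 else 0 : S), (if i = j then 1 else 0 : W.E)) ∈
        transfer W (fun _ : Unit => n) (fun _ => X) (fun _ => Y) := by
      split_ifs
      · exact one_mem _
      · exact zero_mem _
    have e3 := sub_mem e1 e2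
    simp only [Prod.pow_mk, Prod.mk_mul_mk] at e3
    convert e3 using 1
    ext
    · simp [Prod.fst_sum]
    · simp [Prod.snd_sum, h2]

end Transferred

section SymGen

variable {p : ℕ} {c : ℕ+ → ℕ+ → MvPolynomial (ℕ+ ⊕ₗ ℕ+) ℤ}

theorem IsHP.map {σ : Type} {n : σ → ℕ} {A B : Type*} [Ring A] [Ring B] (φ : A →+* B) {X Y : σ → ℕ → A}
    (h : IsHP p c n X Y) : IsHP p c n (fun s i => φ (X s i)) (fun s i => φ (Y s i)) where
  xx s i t j hi hj := (h.xx s i t j hi hj).map φ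
  yy s i t j hi hj := (h.yy s i t j hi hj).map φ
  yx_ne s t hst i j hi hj := (h.yx_ne s t hst i j hi hj).map φ
  yx s i j hi hj := by
    rw [← map_mul, h.yx s i j hi hj, map_add, map_mul, map_cPow]

/-- Generators satisfying the defining relations of the symbol algebra of `a` and `b`. -/
structure SymGen {K : Type*} [Field K] {S : Type*} [Ring S] [Algebra K S] (p : ℕ)
    (c : ℕ+ → ℕ+ → MvPolynomial (ℕ+ ⊕ₗ ℕ+) ℤ) (n : ℕ) (a b : WittVector p K) (X Y : ℕ → S) : Prop where
  hp : IsHP p c (fun _ : Unit => n) (fun _ => X) (fun _ => Y)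
  powX : ∀ i < n, X i ^ p ^ n = algebraMap K S (a.coeff i)
  powY : ∀ i < n, Y i ^ p ^ n = algebraMap K S (b.coeff i)

variable {K : Type u} [Field K] {n : ℕ}

theorem SymGen.map {a b : WittVector p K} {A B : Type*} [Ring A] [Ring B] [Algebra K A] [Algebra K B] (φ : A →ₐ[K] B) {X Y : ℕ → A}
    (h : SymGen p c n a b X Y) : SymGen p c n a b (fun i => φ (X i)) (fun i => φ (Y i)) where
  hp := h.hp.map φ.toRingHom
  powX i hi := by rw [← map_pow, h.powX i hi, AlgHom.commutes]
  powY i hi := by rw [← map_pow, h.powY i hi, AlgHom.commutes]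

variable [Fact p.Prime] {a b : WittVector p K}

variable (p c n a b) in
/-- The symbol algebra of two Witt vectors. -/
abbrev Asy : Type u := Asymb K p c n n (WittVector.truncate n a) (WittVector.truncate n b)

namespace Asy

variable (p c n a b) in
/-- The `X`-generators, extended by zero. -/
def X (i : ℕ) : Asy p c n a b := if h : i < n then aX K p c n n _ _ ⟨i, h⟩ else 0

variable (p c n a b) in
/-- The `Y`-generators, extended by zero. -/
def Y (i : ℕ) : Asy p c n a b := if h : i < n then aY K p c n n _ _ ⟨i, h⟩ else 0

theorem symGen : SymGen p c n a b (X p c n a b) (Y p c n a b) := by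
  let φ : FreeAlgebra K (Fin n ⊕ Fin n) →ₐ[K] Asy p c n a b :=
    (RingQuot.mkAlgHom K (ASRel K p c n n _ _)).comp (RingQuot.mkAlgHom K (BmnRel K p c n n))
  have hφ : ∀ {x y}, BmnRel K p c n n x y → φ x = φ y := fun h => by
    simp only [φ, AlgHom.comp_apply, RingQuot.mkAlgHom_rel K h]
  have hX : ∀ i (hi : i < n), X p c n a b i = φ (FreeAlgebra.ι K (Sum.inl ⟨i, hi⟩)) := fun i hi => by
    rw [X, dif_pos hi]; rfl
  have hY : ∀ i (hi : i < n), Y p c n a b i = φ (FreeAlgebra.ι K (Sum.inr ⟨i, hi⟩)) := fun i hi => by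
    rw [Y, dif_pos hi]; rfl
  refine ⟨⟨fun _ i _ j hi hj => ?_, fun _ i _ j hi hj => ?_, fun s t h => (h rfl).elim, fun _ i j hi hj => ?_⟩,
    fun i hi => ?_, fun i hi => ?_⟩
  · rw [hX i hi, hX j hj, commute_iff_eq, ← map_mul, ← map_mul, hφ (.xx _ _)]
  · rw [hY i hi, hY j hj, commute_iff_eq, ← map_mul, ← map_mul, hφ (.yy _ _)]
  · have h1 : φ (cEval (sxm K p n n) (syn K p n n) (c (ppow p i) (ppow p j))) =
        cPow p c (X p c n a b) (Y p c n a b) i j := by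
      refine (map_cEval φ.toRingHom _ _ _).trans ?_
      unfold cPow
      congr 1 <;> funext d
      · change φ (sxm K p n n d) = _
        unfold sxm
        split_ifs with h
        · exact (hX _ h).symm
        · rw [map_zero, X, dif_neg h]
      · change φ (syn K p n n d) = _
        unfold syn
        split_ifs with h
        · exact (hY _ h).symm
        · rw [map_zero, Y, dif_neg h]
    rw [← h1, hX i hi, hY j hj, ← map_mul, ← map_mul, hφ (.yx _ _), map_add]
  · rw [X, dif_pos hi, aX, ← map_pow]
    refine (RingQuot.mkAlgHom_rel K (ASRel.xa ⟨i, hi⟩)).trans ?_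
    rw [AlgHom.commutes, WittVector.coeff_truncate]
  · rw [Y, dif_pos hi, aY, ← map_pow]
    refine (RingQuot.mkAlgHom_rel K (ASRel.yb ⟨i, hi⟩)).trans ?_
    rw [AlgHom.commutes, WittVector.coeff_truncate]

variable {S : Type v} [Ring S] [Algebra K S]

theorem exists_lift (hc : IsCFamily c) {X' Y' : ℕ → S} (h : SymGen p c n a b X' Y') :
    ∃ f : Asy p c n a b →ₐ[K] S, ∀ i < n, f (X p c n a b i) = X' i ∧ f (Y p c n a b i) = Y' i := by
  let φ : FreeAlgebra K (Fin n ⊕ Fin n) →ₐ[K] S :=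
    FreeAlgebra.lift K (Sum.elim (fun i : Fin n => X' i) (fun i : Fin n => Y' i))
  have hφ : ∀ ⦃x y⦄, BmnRel K p c n n x y → φ x = φ y := by
    rintro x y (⟨i, i'⟩ | ⟨i, i'⟩ | ⟨i, j⟩)
    · simpa [φ] using (h.hp.xx () i () i' i.2 i'.2).eq
    · simpa [φ] using (h.hp.yy () i () i' i.2 i'.2).eq
    · have h1 : φ (cEval (sxm K p n n) (syn K p n n) (c (ppow p i) (ppow p j))) =
          cPow p c X' Y' i j := by
        refine (map_cEval φ.toRingHom _ _ _).trans ?_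
        refine Eq.trans (b := cPow p c (fun i => if i < n then X' i else 0) (fun i => if i < n then Y' i else 0) i j)
          ?_ (cPow_congr hc (fun k hk => if_pos (hk.trans i.2)) (fun k hk => if_pos (hk.trans j.2)))
        unfold cPow
        congr 1 <;> funext d
        · change φ (sxm K p n n d) = _
          unfold sxm
          split_ifs with h <;> simp only [φ, FreeAlgebra.lift_ι_apply, Sum.elim_inl, map_zero, h, if_true, if_false]
        · change φ (syn K p n n d) = _
          unfold syn
          split_ifs with h <;> simp only [φ, FreeAlgebra.lift_ι_apply, Sum.elim_inr, map_zero, h, if_true, if_false]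
      rw [map_add, h1]
      simpa [φ] using h.hp.yx () i j i.2 j.2
  let ψ : Bmn K p c n n →ₐ[K] S := RingQuot.liftAlgHom K ⟨φ, hφ⟩
  have hψ : ∀ x, ψ (RingQuot.mkAlgHom K _ x) = φ x := fun x => RingQuot.liftAlgHom_mkAlgHom_apply K φ hφ x
  have hψ' : ∀ ⦃x y⦄, ASRel K p c n n (WittVector.truncate n a) (WittVector.truncate n b) x y → ψ x = ψ y := by
    rintro x y (i | i)
    · rw [map_pow, gx, hψ, AlgHom.commutes, WittVector.coeff_truncate, ← h.powX i i.2]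
      simp [φ]
    · rw [map_pow, gy, hψ, AlgHom.commutes, WittVector.coeff_truncate, ← h.powY i i.2]
      simp [φ]
  refine ⟨RingQuot.liftAlgHom K ⟨ψ, hψ'⟩, fun i hi => ⟨?_, ?_⟩⟩
  · rw [X, dif_pos hi, aX]
    refine (RingQuot.liftAlgHom_mkAlgHom_apply K ψ hψ' _).trans ?_
    rw [gx, hψ]
    simp [φ]
  · rw [Y, dif_pos hi, aY]
    refine (RingQuot.liftAlgHom_mkAlgHom_apply K ψ hψ' _).trans ?_
    rw [gy, hψ]
    simp [φ]

theorem eq_top_of_mem {P : Subalgebra K (Asy p c n a b)} (hX : ∀ i < n, X p c n a b i ∈ P)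
    (hY : ∀ i < n, Y p c n a b i ∈ P) : P = ⊤ := by
  refine top_le_iff.1 fun x _ => ?_
  obtain ⟨x, rfl⟩ := RingQuot.mkAlgHom_surjective K _ x
  obtain ⟨x, rfl⟩ := RingQuot.mkAlgHom_surjective K _ x
  induction x using FreeAlgebra.induction with
  | grade0 r => simp only [AlgHom.commutes]; exact P.algebraMap_mem r
  | add x y hx hy => rw [map_add, map_add]; exact add_mem (hx trivial) (hy trivial)
  | mul x y hx hy => rw [map_mul, map_mul]; exact mul_mem (hx trivial) (hy trivial)
  | grade1 i =>
    rcases i with i | i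
    · have := hX i i.2
      rwa [X, dif_pos i.2] at this
    · have := hY i i.2
      rwa [Y, dif_pos i.2] at this

end Asy

end SymGen

section Dimension

/-- A commutative algebra generated by elements with `q`-th powers in the base is spanned by the reduced monomials. -/
theorem exists_adjoin_le_span {K : Type u} [Field K] {A : Type v} [Ring A] [Algebra K A] {n q : ℕ} (hq : 0 < q)
    (z : Fin n → A) (hz : ∀ i j, Commute (z i) (z j)) (a : Fin n → K) (hp : ∀ i, z i ^ q = algebraMap K A (a i)) :
    ∃ m : (Fin n → Fin q) → A, (Algebra.adjoin K (Set.range z)).toSubmodule ≤ Submodule.span K (Set.range m) := by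
  obtain ⟨C, _, _, f, z', hf, hfz, hr⟩ := exists_comm_model K z hz
  refine ⟨fun e => f (∏ i, z' i ^ (e i : ℕ)), ?_⟩
  have h0 : Algebra.adjoin K (Set.range z) = (Algebra.adjoin K (Set.range z')).map f := by
    rw [AlgHom.map_adjoin, ← Set.range_comp]
    congr 2
    funext i
    exact (hfz i).symm
  rw [h0]
  rintro _ ⟨x, hx, rfl⟩
  have hx : x ∈ Algebra.adjoin K (Set.range z') := hx
  rw [Algebra.adjoin_range_eq_range_aeval] at hx
  obtain ⟨g, rfl⟩ := hx
  clear hx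
  change f (MvPolynomial.aeval z' g) ∈ _
  induction g using MvPolynomial.induction_on' with
  | add g h hg hh => rw [map_add, map_add]; exact add_mem hg hh
  | monomial e r =>
    have h1 : MvPolynomial.aeval z' (MvPolynomial.monomial e r) =
        (r * ∏ i, a i ^ (e i / q)) • ∏ i, z' i ^ (e i % q) := by
      have hz' : ∀ i, z' i ^ q = algebraMap K C (a i) := fun i => hf (by
        rw [map_pow, hfz, hp, AlgHom.commutes])
      rw [MvPolynomial.aeval_monomial, Algebra.smul_def, map_mul, mul_assoc, map_prod, ← Finset.prod_mul_distrib,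
        Finsupp.prod_fintype _ _ (fun i => pow_zero _)]
      congr 1
      refine Finset.prod_congr rfl fun i _ => ?_
      rw [map_pow, ← hz', ← pow_mul, ← pow_add, Nat.div_add_mod]
    rw [h1, map_smul]
    exact Submodule.smul_mem _ _ (Submodule.subset_span ⟨fun i => ⟨e i % q, Nat.mod_lt _ hq⟩, rfl⟩)

theorem evalMul_mem {R : Type u} [CommRing R] {A : Type v} [Ring A] [Algebra R A] {κ κ' : Type*} (X : κ → A)
    (hX : ∀ i j, Commute (X i) (X j)) (Y : κ' → A) (hY : ∀ i j, Commute (Y i) (Y j)) {P Q : Submodule R A}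
    (hP : (Algebra.adjoin R (Set.range X)).toSubmodule ≤ P) (hQ : (Algebra.adjoin R (Set.range Y)).toSubmodule ≤ Q) (t) :
    evalMul R X hX Y hY t ∈ P * Q := by
  have := evalMul_range (R := R) X hX Y hY
  exact mul_le_mul' hP hQ (this ▸ LinearMap.mem_range_self _ t)

variable {p : ℕ} {c : ℕ+ → ℕ+ → MvPolynomial (ℕ+ ⊕ₗ ℕ+) ℤ}
variable [Fact p.Prime] {K : Type u} [Field K] {n : ℕ} {a b : WittVector p K}

theorem Asy.exists_span_mul (hc : IsCFamily c) :
    ∃ m : (Fin n → Fin (p ^ n)) → Asy p c n a b, ⊤ ≤ Submodule.span K (Set.range m) *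
      (Algebra.adjoin K (Set.range fun i : Fin n => Y p c n a b i)).toSubmodule := by
  have hq : 0 < p ^ n := pow_pos (Fact.out : p.Prime).pos _
  have hg := symGen (p := p) (c := c) (n := n) (a := a) (b := b)
  let x : Fin n → Asy p c n a b := fun i => X p c n a b i
  let y : Fin n → Asy p c n a b := fun i => Y p c n a b i
  have hx : ∀ i j, Commute (x i) (x j) := fun i j => hg.hp.xx () i () j i.2 j.2
  have hy : ∀ i j, Commute (y i) (y j) := fun i j => hg.hp.yy () i () j i.2 j.2
  obtain ⟨mx, hmx⟩ := exists_adjoin_le_span hq x hx (fun i => a.coeff i) (fun i => hg.powX i i.2)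
  refine ⟨mx, fun z _ => ?_⟩
  let x' : Fin n ⊕ K → Asy p c n a b := Sum.elim x (algebraMap K _)
  have hx' : ∀ i j, Commute (x' i) (x' j) := by
    rintro (i | i) (j | j)
    · exact hx i j
    · exact (Algebra.commutes _ _).symm
    · exact Algebra.commutes _ _
    · exact Algebra.commutes _ _
  have hz : z ∈ Subring.closure (Set.range x' ∪ Set.range y) := by
    let P : Subalgebra K (Asy p c n a b) :=
      { Subring.closure (Set.range x' ∪ Set.range y) with
        algebraMap_mem' := fun r => Subring.subset_closure (Or.inl ⟨Sum.inr r, rfl⟩) }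
    have : P = ⊤ := eq_top_of_mem (fun i hi => Subring.subset_closure (Or.inl ⟨Sum.inl ⟨i, hi⟩, rfl⟩))
      (fun i hi => Subring.subset_closure (Or.inr ⟨⟨i, hi⟩, rfl⟩))
    have h2 : z ∈ P := this ▸ Algebra.mem_top
    exact h2
  obtain ⟨t, rfl⟩ := closure_le_evalMul_range x' hx' y hy (fun j => (j : ℕ)) (fun j i => by
    rcases i with i | r
    · change Y p c n a b j * X p c n a b i - X p c n a b i * Y p c n a b j ∈ _
      rw [hg.hp.yx () i j i.2 j.2, add_sub_cancel_left]
      exact cPow_mem hc _ (fun k hk => Subring.subset_closure (Or.inl ⟨Sum.inl ⟨k, hk.trans i.2⟩, rfl⟩))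
        (fun k hk => Subring.subset_closure (Or.inr ⟨⟨k, hk.trans j.2⟩, hk, rfl⟩))
    · change y j * algebraMap K _ r - algebraMap K _ r * y j ∈ _
      rw [sub_eq_zero.2 (Algebra.commutes r (y j)).symm]
      exact zero_mem _) hz
  have h3 := evalMul_mem (R := ℤ) x' hx' y hy (P := (Submodule.span K (Set.range mx)).restrictScalars ℤ)
    (Q := (Algebra.adjoin K (Set.range y)).toSubmodule.restrictScalars ℤ) (fun w hw => ?_) (fun w hw => ?_) t
  · refine Submodule.mul_induction_on h3 (fun r hr s hs => ?_) fun r s hr hs => add_mem hr hs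
    exact Submodule.mul_mem_mul (show r ∈ Submodule.span K (Set.range mx) from hr)
      (show s ∈ (Algebra.adjoin K (Set.range y)).toSubmodule from hs)
  · refine hmx ?_
    have : Algebra.adjoin ℤ (Set.range x') ≤ (Algebra.adjoin K (Set.range x)).restrictScalars ℤ := by
      refine Algebra.adjoin_le ?_
      rintro _ ⟨i | r, rfl⟩
      · exact Algebra.subset_adjoin (R := K) ⟨i, rfl⟩
      · exact (Algebra.adjoin K (Set.range x)).algebraMap_mem r
    exact this hw
  · have : Algebra.adjoin ℤ (Set.range y) ≤ (Algebra.adjoin K (Set.range y)).restrictScalars ℤ :=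
      Algebra.adjoin_le fun i hi => Algebra.subset_adjoin (R := K) hi
    exact this hw

theorem Asy.exists_span (hc : IsCFamily c) :
    ∃ m : (Fin n → Fin (p ^ n)) × (Fin n → Fin (p ^ n)) → Asy p c n a b, ⊤ ≤ Submodule.span K (Set.range m) := by
  have hg := symGen (p := p) (c := c) (n := n) (a := a) (b := b)
  obtain ⟨mx, hmx⟩ := Asy.exists_span_mul (p := p) (n := n) (a := a) (b := b) hc
  obtain ⟨my, hmy⟩ := exists_adjoin_le_span (pow_pos (Fact.out : p.Prime).pos _) (fun i : Fin n => Y p c n a b i)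
    (fun i j => hg.hp.yy () i () j i.2 j.2) (fun i => b.coeff i) (fun i => hg.powY i i.2)
  refine ⟨fun e => mx e.1 * my e.2, hmx.trans ((mul_le_mul' le_rfl hmy).trans ?_)⟩
  rw [Submodule.span_mul_span]
  refine Submodule.span_mono ?_
  rintro _ ⟨_, ⟨e, rfl⟩, _, ⟨e', rfl⟩, rfl⟩
  exact ⟨(e, e'), rfl⟩

theorem Asy.finiteDimensional (hc : IsCFamily c) : FiniteDimensional K (Asy p c n a b) := by
  obtain ⟨m, hm⟩ := Asy.exists_span (p := p) (n := n) (a := a) (b := b) hc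
  exact ⟨⟨(Set.finite_range m).toFinset, by simpa using top_le_iff.1 hm⟩⟩

theorem Asy.finrank_le (hc : IsCFamily c) :
    Module.finrank K (Asy p c n a b) ≤ ((p ^ n) ^ n) * ((p ^ n) ^ n) := by
  obtain ⟨m, hm⟩ := Asy.exists_span (p := p) (n := n) (a := a) (b := b) hc
  have h := finrank_range_le_card (R := K) m
  rw [Set.finrank, top_le_iff.1 hm, finrank_top] at h
  simpa using h

end Dimension

section Nontrivial

variable {p : ℕ} {c : ℕ+ → ℕ+ → MvPolynomial (ℕ+ ⊕ₗ ℕ+) ℤ}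

theorem IsHP.of_injective (hc : IsCFamily c) [Fact p.Prime] {σ : Type} {n : σ → ℕ} {A B : Type*} [Ring A] [Ring B] {φ : A →+* B}
    (hφ : Function.Injective φ) {X Y : σ → ℕ → A} {X' Y' : σ → ℕ → B} (h : IsHP p c n X' Y')
    (hX : ∀ s, ∀ i < n s, φ (X s i) = X' s i) (hY : ∀ s, ∀ i < n s, φ (Y s i) = Y' s i) : IsHP p c n X Y where
  xx s i t j hi hj := by
    refine hφ ?_
    simpa only [map_mul, hX s i hi, hX t j hj] using (h.xx s i t j hi hj).eq
  yy s i t j hi hj := by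
    refine hφ ?_
    simpa only [map_mul, hY s i hi, hY t j hj] using (h.yy s i t j hi hj).eq
  yx_ne s t hst i j hi hj := by
    refine hφ ?_
    simpa only [map_mul, hX s i hi, hY t j hj] using (h.yx_ne s t hst i j hi hj).eq
  yx s i j hi hj := by
    refine hφ ?_
    rw [map_mul, map_add, map_mul, map_cPow, hX s i hi, hY s j hj, h.yx s i j hi hj,
      cPow_congr hc (fun k hk => hX s k (hk.trans hi)) (fun k hk => hY s k (hk.trans hj))]

variable [Fact p.Prime] {K : Type u} [Field K] {n : ℕ} {a b : WittVector p K}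

theorem Weyl.exists_functional (W : Weyl p Unit) (hc : IsCFamily c) (α β : ℕ → K) :
    ∃ ε : W.U →+ K, ε 1 = 1 ∧ (∀ i u, ε (⟨W.X () i, W.X_mem _ _⟩ * u) = α i * ε u) ∧
      ∀ i u, ε (u * ⟨W.Y () i, W.Y_mem _ _⟩) = ε u * β i := by
  let x : Unit × ℕ → W.E := fun k => W.X k.1 k.2
  let y : Unit × ℕ → W.E := fun k => W.Y k.1 k.2
  have hx : ∀ i j, Commute (x i) (x j) := fun _ _ => W.xx _ _ _ _
  have hy : ∀ i j, Commute (y i) (y j) := fun _ _ => W.yy _ _ _ _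
  let μ := evalMul ℤ x hx y hy
  have hμ : Function.Injective μ := W.inj
  have hsurj : ∀ u : W.U, ∃ t, μ t = u := fun u => W.mem_U_iff hc u.2
  choose inv hinv using hsurj
  let τ := Algebra.TensorProduct.productMap (MvPolynomial.aeval (R := ℤ) fun k : Unit × ℕ => α k.2)
    (MvPolynomial.aeval (R := ℤ) fun k : Unit × ℕ => β k.2)
  have h1 : ∀ i t, μ (MvPolynomial.X i ⊗ₜ 1 * t) = x i * μ t := fun i t => by
    induction t with
    | zero => simp
    | add s t hs ht => rw [mul_add, map_add, hs, ht, map_add, mul_add]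
    | tmul f g =>
      rw [Algebra.TensorProduct.tmul_mul_tmul, evalMul_tmul, evalMul_tmul, map_mul, commEval_X, one_mul, mul_assoc]
  have h2 : ∀ i t, μ (t * 1 ⊗ₜ MvPolynomial.X i) = μ t * y i := fun i t => by
    induction t with
    | zero => simp
    | add s t hs ht => rw [add_mul, map_add, hs, ht, map_add, add_mul]
    | tmul f g =>
      rw [Algebra.TensorProduct.tmul_mul_tmul, evalMul_tmul, evalMul_tmul, mul_one, map_mul, commEval_X, mul_assoc]
  refine ⟨⟨⟨fun u => τ (inv u), ?_⟩, fun u v => ?_⟩, ?_, fun i u => ?_, fun i u => ?_⟩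
  · rw [hμ (a₁ := inv 0) (a₂ := 0) (by rw [hinv, map_zero]; rfl), map_zero]
  · change τ (inv (u + v)) = τ (inv u) + τ (inv v)
    rw [hμ (a₁ := inv (u + v)) (a₂ := inv u + inv v) (by rw [hinv, map_add, hinv, hinv]; rfl), map_add]
  · change τ (inv 1) = 1
    rw [hμ (a₁ := inv 1) (a₂ := 1) (by
      rw [hinv, Algebra.TensorProduct.one_def, evalMul_tmul, map_one, map_one, one_mul]; rfl), map_one]
  · change τ (inv _) = _ * τ (inv u)
    rw [hμ (a₁ := inv _) (a₂ := MvPolynomial.X ((), i) ⊗ₜ 1 * inv u) (by rw [hinv, h1, hinv]; rfl), map_mul]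
    simp [τ]
  · change τ (inv _) = τ (inv u) * _
    rw [hμ (a₁ := inv _) (a₂ := inv u * 1 ⊗ₜ MvPolynomial.X ((), i)) (by rw [hinv, h2, hinv]; rfl), map_mul]
    simp [τ]

variable (K) in
/-- The right translation action of a ring on its additive functionals. -/
def dualAction (U : Type*) [Ring U] : U →+* Module.End K (U →+ K) where
  toFun r :=
    { toFun := fun φ => φ.comp (AddMonoidHom.mulRight r)
      map_add' := fun _ _ => rfl
      map_smul' := fun _ _ => rfl }
  map_one' := LinearMap.ext fun φ => AddMonoidHom.ext fun u => congrArg φ (mul_one u)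
  map_mul' r s := LinearMap.ext fun φ => AddMonoidHom.ext fun u => congrArg φ (mul_assoc u r s).symm
  map_zero' := LinearMap.ext fun φ => AddMonoidHom.ext fun u => (congrArg φ (mul_zero u)).trans (map_zero φ)
  map_add' r s := LinearMap.ext fun φ => AddMonoidHom.ext fun u => (congrArg φ (mul_add u r s)).trans (map_add φ _ _)

theorem dualAction_apply {U : Type*} [Ring U] (r : U) (φ : U →+ K) (u : U) : dualAction K U r φ u = φ (u * r) := rfl

theorem exists_symGen_of_root [CharP K p] (hc : IsCFamily c) (α β : ℕ → K) (hα : ∀ i < n, α i ^ p ^ n = a.coeff i)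
    (hβ : ∀ i < n, β i ^ p ^ n = b.coeff i) :
    ∃ (V : Type u) (_ : AddCommGroup V) (_ : Module K V) (_ : Nontrivial V) (X Y : ℕ → Module.End K V), SymGen p c n a b X Y := by
  obtain ⟨W⟩ : Nonempty (Weyl p Unit) := inferInstance
  obtain ⟨ε, hε1, hεX, hεY⟩ := W.exists_functional hc α β
  let U : Subring W.E := Subring.closure (Set.range (fun k : Fin n => W.X () k) ∪ Set.range (fun k : Fin n => W.Y () k))
  have hUle : U ≤ W.U := by
    refine (Subring.closure_le).2 ?_
    rintro _ (⟨k, rfl⟩ | ⟨k, rfl⟩)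
    · exact W.X_mem _ _
    · exact W.Y_mem _ _
  let ι := Subring.inclusion hUle
  let x : ℕ → U := fun i => if h : i < n then ⟨W.X () i, Subring.subset_closure (Or.inl ⟨⟨i, h⟩, rfl⟩)⟩ else 0
  let y : ℕ → U := fun i => if h : i < n then ⟨W.Y () i, Subring.subset_closure (Or.inr ⟨⟨i, h⟩, rfl⟩)⟩ else 0
  have hx : ∀ i < n, ι (x i) = ⟨W.X () i, W.X_mem _ _⟩ := fun i hi => by simp only [x, dif_pos hi]; rfl
  have hy : ∀ i < n, ι (y i) = ⟨W.Y () i, W.Y_mem _ _⟩ := fun i hi => by simp only [y, dif_pos hi]; rfl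
  have hU : IsHP p c (fun _ : Unit => n) (fun _ => x) (fun _ => y) :=
    IsHP.of_injective hc (φ := U.subtype) Subtype.coe_injective (X' := W.X) (Y' := W.Y)
      ⟨fun _ _ _ _ _ _ => W.xx _ _ _ _, fun _ _ _ _ _ _ => W.yy _ _ _ _, fun _ _ h => (h rfl).elim,
        fun s i j _ _ => W.hp_yx hc s i j⟩ (fun _ i hi => congrArg Subtype.val (hx i hi))
        (fun _ i hi => congrArg Subtype.val (hy i hi))
  have hgen : ∀ (P : Subring U), (∀ i < n, x i ∈ P) → (∀ i < n, y i ∈ P) → ∀ u, u ∈ P := fun P h1 h2 u => by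
    have h3 : U ≤ P.map U.subtype := by
      refine (Subring.closure_le).2 ?_
      rintro _ (⟨k, rfl⟩ | ⟨k, rfl⟩)
      · exact ⟨x k, h1 k k.2, congrArg Subtype.val (hx k k.2)⟩
      · exact ⟨y k, h2 k k.2, congrArg Subtype.val (hy k k.2)⟩
    obtain ⟨v, hv, h4⟩ := h3 u.2
    rwa [← Subtype.ext h4]
  let ε' : U →+ K := ε.comp ι.toAddMonoidHom
  have hεx : ∀ i < n, ∀ m u, ε' (x i ^ m * u) = α i ^ m * ε' u := fun i hi m u => by
    induction m with
    | zero => rw [pow_zero, pow_zero, one_mul, one_mul]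
    | succ m ih =>
      rw [pow_succ', mul_assoc, pow_succ', mul_assoc, ← ih]
      refine (congrArg ε (map_mul ι _ _)).trans ?_
      rw [hx i hi]
      exact hεX i _
  have hεy : ∀ i < n, ∀ m u, ε' (u * y i ^ m) = ε' u * β i ^ m := fun i hi m u => by
    induction m with
    | zero => rw [pow_zero, pow_zero, mul_one, mul_one]
    | succ m ih =>
      rw [pow_succ, ← mul_assoc, pow_succ, ← mul_assoc, ← ih]
      refine (congrArg ε (map_mul ι _ _)).trans ?_
      rw [hy i hi]
      exact hεY i _
  let M := U →+ K
  let ρ := dualAction K U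
  have hM := hU.map ρ
  have hε1' : ε' 1 = 1 := hε1
  have hε0 : ε' ≠ 0 := fun h => by rw [h] at hε1'; exact zero_ne_one hε1'
  have : Nontrivial M := ⟨⟨ε', 0, hε0⟩⟩
  have : CharP (Module.End K M) p := charP_of_injective_algebraMap (algebraMap K (Module.End K M)).injective p
  have hcX : ∀ i < n, ∀ u, ρ u * ρ (x i ^ p ^ n) = ρ (x i ^ p ^ n) * ρ u := fun i hi u =>
    ((Subring.mem_centralizer_iff.1 (show ρ u ∈ _ from hgen ((Subring.centralizer {ρ (x i ^ p ^ n)}).comap ρ)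
      (fun j hj => Subring.mem_centralizer_iff.2 fun z hz => by
        rw [Set.mem_singleton_iff.1 hz]
        exact (((hU.xx () i () j hi hj).pow_left _).map ρ).eq)
      (fun j hj => Subring.mem_centralizer_iff.2 fun z hz => by
        rw [Set.mem_singleton_iff.1 hz, map_pow]
        exact ((hM.commute_pow hc hi hj).1).symm.eq) u)) _ rfl).symm
  have hcY : ∀ i < n, ∀ u, ρ u * ρ (y i ^ p ^ n) = ρ (y i ^ p ^ n) * ρ u := fun i hi u =>
    ((Subring.mem_centralizer_iff.1 (show ρ u ∈ _ from hgen ((Subring.centralizer {ρ (y i ^ p ^ n)}).comap ρ)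
      (fun j hj => Subring.mem_centralizer_iff.2 fun z hz => by
        rw [Set.mem_singleton_iff.1 hz, map_pow]
        exact ((hM.commute_pow hc hj hi).2).symm.eq)
      (fun j hj => Subring.mem_centralizer_iff.2 fun z hz => by
        rw [Set.mem_singleton_iff.1 hz]
        exact (((hU.yy () i () j hi hj).pow_left _).map ρ).eq) u)) _ rfl).symm
  let V : Submodule K M :=
    { carrier := {φ | ∀ i < n, ρ (x i ^ p ^ n) φ = a.coeff i • φ ∧ ρ (y i ^ p ^ n) φ = b.coeff i • φ}
      zero_mem' := fun i _ => by simp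
      add_mem' := fun h h' i hi => by
        rw [map_add, map_add, (h i hi).1, (h i hi).2, (h' i hi).1, (h' i hi).2, smul_add, smul_add]; exact ⟨rfl, rfl⟩
      smul_mem' := fun r φ h i hi => by
        rw [map_smul, map_smul, (h i hi).1, (h i hi).2, smul_comm, smul_comm r]; exact ⟨rfl, rfl⟩ }
  have hV : ∀ u, ∀ φ ∈ V, ρ u φ ∈ V := fun u φ h i hi => by
    constructor
    · rw [← Module.End.mul_apply, ← hcX i hi, Module.End.mul_apply, (h i hi).1, map_smul]
    · rw [← Module.End.mul_apply, ← hcY i hi, Module.End.mul_apply, (h i hi).2, map_smul]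
  have hεV : ε' ∈ V := fun i hi => by
    constructor
    · refine AddMonoidHom.ext fun u => ?_
      have h1 : ρ (x i ^ p ^ n) (ρ u ε') 1 = ρ u (ρ (x i ^ p ^ n) ε') 1 := by
        rw [← Module.End.mul_apply, ← hcX i hi, Module.End.mul_apply]
      simp only [ρ, dualAction_apply, one_mul] at h1
      rw [dualAction_apply, ← h1, hεx i hi, hα i hi]
      rfl
    · refine AddMonoidHom.ext fun u => ?_
      rw [dualAction_apply, hεy i hi, hβ i hi, mul_comm]
      rfl
  let ρ' : U →+* Module.End K V :=
    { toFun := fun u => (ρ u).restrict (hV u)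
      map_one' := LinearMap.ext fun φ => Subtype.ext (by simp)
      map_mul' := fun u v => LinearMap.ext fun φ => Subtype.ext (by simp)
      map_zero' := LinearMap.ext fun φ => Subtype.ext (by simp)
      map_add' := fun u v => LinearMap.ext fun φ => Subtype.ext (by simp) }
  refine ⟨V, inferInstance, inferInstance, ⟨⟨⟨ε', hεV⟩, 0, fun h => hε0 (congrArg Subtype.val h)⟩⟩, fun i => ρ' (x i), fun i => ρ' (y i),
    hU.map ρ', fun i hi => ?_, fun i hi => ?_⟩
  · rw [← map_pow]
    exact LinearMap.ext fun φ => Subtype.ext (φ.2 i hi).1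
  · rw [← map_pow]
    exact LinearMap.ext fun φ => Subtype.ext (φ.2 i hi).2

theorem Asy.nontrivial_of_root [CharP K p] (hc : IsCFamily c) (α β : ℕ → K) (hα : ∀ i < n, α i ^ p ^ n = a.coeff i)
    (hβ : ∀ i < n, β i ^ p ^ n = b.coeff i) : Nontrivial (Asy p c n a b) := by
  obtain ⟨V, _, _, _, X, Y, h⟩ := exists_symGen_of_root hc α β hα hβ
  obtain ⟨f, -⟩ := Asy.exists_lift hc h
  exact f.toRingHom.domain_nontrivial

end Nontrivial

section Independence

theorem commEval_commutator {ι : Type*} [Fintype ι] {R A : Type*} [CommRing R] [Ring A] [Algebra R A] (x : ι → A)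
    (hx : ∀ i j, Commute (x i) (x j)) (a : A) (ha : ∀ k l, Commute (a * x k - x k * a) (x l)) (g : MvPolynomial ι R) :
    a * commEval R x hx g - commEval R x hx g * a =
      ∑ k, commEval R x hx (MvPolynomial.pderiv k g) * (a * x k - x k * a) := by
  classical
  induction g using MvPolynomial.induction_on with
  | C r =>
    have : commEval R x hx (MvPolynomial.C r) = algebraMap R A r := AlgHom.commutes _ r
    rw [this, Algebra.commutes, sub_self]
    simp
  | add f g hf hg =>
    simp only [map_add, mul_add, add_mul, Finset.sum_add_distrib, ← hf, ← hg]
    abel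
  | mul_X g i hg =>
    have h1 : ∀ k, commEval R x hx (MvPolynomial.pderiv k (g * MvPolynomial.X i)) * (a * x k - x k * a) =
        commEval R x hx (MvPolynomial.pderiv k g) * (a * x k - x k * a) * x i +
          if k = i then commEval R x hx g * (a * x i - x i * a) else 0 := fun k => by
      rw [Derivation.leibniz, smul_eq_mul, smul_eq_mul, MvPolynomial.pderiv_X, map_add, map_mul, map_mul, commEval_X,
        add_mul, mul_assoc _ (a * x k - x k * a) (x i), (ha k i).eq, add_comm]
      congr 1
      · rw [← mul_assoc]
        congr 1
        rw [← commEval_X (R := R) x hx i, ← map_mul, ← map_mul, mul_comm]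
      · split_ifs with h
        · subst h; rw [Pi.single_eq_same, map_one, mul_one]
        · rw [Pi.single_eq_of_ne (Ne.symm h), map_zero, mul_zero, zero_mul]
    rw [Finset.sum_congr rfl fun k _ => h1 k, Finset.sum_add_distrib, ← Finset.sum_mul, ← hg, map_mul, commEval_X,
      Finset.sum_ite_eq' Finset.univ i, if_pos (Finset.mem_univ i)]
    noncomm_ring

theorem commEval_expand {ι : Type*} {R A : Type*} [CommRing R] [Ring A] [Algebra R A] (x : ι → A)
    (hx : ∀ i j, Commute (x i) (x j)) (p : ℕ) (g : MvPolynomial ι R) :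
    commEval R x hx (MvPolynomial.expand p g) = commEval R (fun i => x i ^ p) (fun i j => (hx i j).pow_pow _ _) g := by
  refine DFunLike.congr_fun (commEval_unique _ _ ((commEval R x hx).comp (MvPolynomial.expand p)) fun i => ?_) g
  rw [AlgHom.comp_apply, MvPolynomial.expand_X, map_pow, commEval_X]

/-- A polynomial in characteristic `p` with vanishing partial derivatives is a polynomial in `p`-th powers. -/
theorem MvPolynomial.exists_expand_of_pderiv_eq_zero {ι K : Type*} [Field K] (p : ℕ) [CharP K p] (g : MvPolynomial ι K)
    (hg : ∀ i, MvPolynomial.pderiv i g = 0) : ∃ h, g = MvPolynomial.expand p h := by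
  classical
  have h1 : ∀ e ∈ g.support, ∀ i, p ∣ e i := fun e he i => by
    by_cases h0 : e i = 0
    · rw [h0]; exact dvd_zero p
    have h2 := congrArg (MvPolynomial.coeff (e - Finsupp.single i 1)) (hg i)
    have h3 : e - Finsupp.single i 1 + Finsupp.single i 1 = e :=
      tsub_add_cancel_of_le (Finsupp.single_le_iff.2 (Nat.one_le_iff_ne_zero.2 h0))
    rw [MvPolynomial.coeff_pderiv, h3, MvPolynomial.coeff_zero] at h2
    have h4 := (mul_eq_zero.1 h2).resolve_left (MvPolynomial.mem_support_iff.1 he)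
    rw [Finsupp.tsub_apply, Finsupp.single_eq_same] at h4
    rw [← CharP.cast_eq_zero_iff K p, ← h4, ← Nat.cast_add_one, Nat.sub_add_cancel (Nat.one_le_iff_ne_zero.2 h0)]
  choose! q hq using fun (e : ι →₀ ℕ) (he : e ∈ g.support) => (show ∃ q : ι →₀ ℕ, p • q = e from
    ⟨e.mapRange (· / p) (Nat.zero_div p), Finsupp.ext fun i => by
      simpa using Nat.mul_div_cancel' (h1 e he i)⟩)
  refine ⟨∑ e ∈ g.support, MvPolynomial.monomial (q e) (MvPolynomial.coeff e g), ?_⟩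
  conv_lhs => rw [← MvPolynomial.support_sum_monomial_coeff g]
  rw [map_sum]
  refine Finset.sum_congr rfl fun e he => ?_
  rw [MvPolynomial.expand_monomial, hq e he]

variable {p : ℕ} {c : ℕ+ → ℕ+ → MvPolynomial (ℕ+ ⊕ₗ ℕ+) ℤ}
variable [Fact p.Prime] {K : Type u} [Field K] [CharP K p] {n : ℕ} {a b : WittVector p K}
variable {M : Type v} [AddCommGroup M] [Module K M]

theorem IsHP.exists_eigenvector [Nontrivial M] {Y : ℕ → Module.End K M} (hY : ∀ i < n, ∀ j < n, Commute (Y i) (Y j)) {β : ℕ → K}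
    (hβ : ∀ i < n, Y i ^ p ^ n = algebraMap K _ (β i ^ p ^ n)) (m : ℕ) (hm : m ≤ n) : ∃ v : M, v ≠ 0 ∧ ∀ j < m, Y j v = β j • v := by
  induction m with
  | zero =>
    obtain ⟨v, hv⟩ := exists_ne (0 : M)
    exact ⟨v, hv, fun j hj => absurd hj (Nat.not_lt_zero j)⟩
  | succ m ih =>
    obtain ⟨v, hv, hvj⟩ := ih (by omega)
    have : CharP (Module.End K M) p := charP_of_injective_algebraMap (algebraMap K (Module.End K M)).injective p
    let N := Y m - algebraMap K _ (β m)
    have hN : N ^ p ^ n = 0 := by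
      rw [sub_pow_char_pow_of_commute p n (Algebra.commutes _ _).symm, hβ m (by omega), map_pow, sub_self]
    have hex : ∃ k, (N ^ k) v = 0 := ⟨p ^ n, by rw [hN, LinearMap.zero_apply]⟩
    classical
    obtain ⟨k, hk⟩ : ∃ k, Nat.find hex = k + 1 := Nat.exists_eq_succ_of_ne_zero fun h0 => hv (by
      have := Nat.find_spec hex
      rwa [h0, pow_zero, Module.End.one_apply] at this)
    refine ⟨(N ^ k) v, Nat.find_min hex (by omega), fun j hj => ?_⟩
    rcases Nat.lt_succ_iff_lt_or_eq.1 hj with hj | rfl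
    · have h1 : Commute (Y j) N := (hY j (by omega) m (by omega)).sub_right (Algebra.commutes _ _).symm
      rw [← Module.End.mul_apply, (h1.pow_right k).eq, Module.End.mul_apply, hvj j hj, map_smul]
    · have h2 := Nat.find_spec hex
      rw [hk, pow_succ', Module.End.mul_apply] at h2
      exact sub_eq_zero.1 h2

theorem IsHP.commEval_ne_zero [FiniteDimensional K M] [Nontrivial M] (hc : IsCFamily c) {X Y : ℕ → Module.End K M}
    (h : IsHP p c (fun _ : Unit => n) (fun _ => X) (fun _ => Y)) {v : M} (hv : v ≠ 0) {β : ℕ → K}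
    (hvY : ∀ j < n, Y j v = β j • v) (s r : ℕ) (hs : r + s = n)
    (hx : ∀ i j : Fin n, Commute (X i ^ p ^ r) (X j ^ p ^ r)) (N : ℕ) (g : MvPolynomial (Fin n) K)
    (hgN : ∀ e, MvPolynomial.coeff e g ≠ 0 → e.degree < N)
    (hg : ∀ e, MvPolynomial.coeff e g ≠ 0 → ∀ i, e i < p ^ s)
    (h0 : commEval K (fun i : Fin n => X i ^ p ^ r) hx g v = 0) : g = 0 := by
  have hp : p.Prime := Fact.out
  induction s generalizing r N g with
  | zero =>
    have h1 : g = MvPolynomial.C (MvPolynomial.coeff 0 g) := by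
      ext e
      rw [MvPolynomial.coeff_C]
      split_ifs with h
      · rw [h]
      · by_contra h2
        exact h (Finsupp.ext fun i => (Nat.lt_one_iff.1 (hg e h2 i)).symm)
    rw [h1] at h0 ⊢
    have h2 : commEval K (fun i : Fin n => X i ^ p ^ r) hx (MvPolynomial.C (MvPolynomial.coeff 0 g)) =
      algebraMap K _ (MvPolynomial.coeff 0 g) := AlgHom.commutes _ _
    rw [h2, Module.algebraMap_end_apply] at h0
    rw [(smul_eq_zero.1 h0).resolve_right hv, map_zero]
  | succ s ihs =>
    induction N generalizing g with
    | zero =>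
      ext e
      by_contra h1
      exact Nat.not_lt_zero _ (hgN e h1)
    | succ N ihN =>
      have : CharP (Module.End K M) p := charP_of_injective_algebraMap (algebraMap K (Module.End K M)).injective p
      let x : Fin n → Module.End K M := fun i => X i ^ p ^ r
      let θ : ℕ → Module.End K M := fun j => Y r ^ p ^ j
      let ev := commEval K x hx
      have hcomm : ∀ j, ∀ k l : Fin n, Commute (θ j * x k - x k * θ j) (x l) := fun j k l =>
        (h.commutator_pow hc (by omega) j).1 k k.2 l l.2
      have hθv : ∀ j, θ j v = β r ^ p ^ j • v := fun j => by
        have : ∀ m : ℕ, (Y r ^ m) v = β r ^ m • v := fun m => by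
          induction m with
          | zero => simp
          | succ m ih => rw [pow_succ', Module.End.mul_apply, ih, map_smul, hvY r (by omega), smul_smul, pow_succ]
        exact this _
      have hA : ∀ j, (∑ k, ev (MvPolynomial.pderiv k g) * (θ j * x k - x k * θ j)) v = 0 := fun j => by
        rw [← commEval_commutator x hx (θ j) (hcomm j) g, LinearMap.sub_apply, Module.End.mul_apply, Module.End.mul_apply, hθv,
          map_smul]
        erw [h0]
        simp
      let P : Matrix (Fin n) (Fin n) (Module.End K M) := fun i k => if k ≤ i then x k ^ (p ^ ((i : ℕ) - k) - 1) else 0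
      let Q : Matrix (Fin n) (Fin n) (Module.End K M) := fun k j => θ j * x k - x k * θ j
      have hPQ : P * Q = 1 := by
        ext1 i j
        rw [Matrix.mul_apply, Matrix.one_apply]
        have h1 := (h.commutator_pow hc (show r < n by omega) j).2 i i.2
        simp only [Fin.val_inj] at h1
        rw [← h1]
        simp only [P, Q, ite_mul, zero_mul, Fin.le_def]
        refine (Fin.sum_univ_eq_sum_range (fun k => if k ≤ (i : ℕ) then (X k ^ p ^ r) ^ (p ^ ((i : ℕ) - k) - 1) *
          (Y r ^ p ^ (j : ℕ) * X k ^ p ^ r - X k ^ p ^ r * Y r ^ p ^ (j : ℕ)) else 0) n).trans ?_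
        rw [← Finset.sum_subset (Finset.range_subset_range.2 (show (i : ℕ) + 1 ≤ n from i.2)) fun k _ hk =>
          if_neg fun hki => hk (Finset.mem_range.2 (Nat.lt_succ_of_le hki))]
        exact Finset.sum_congr rfl fun k hk => if_pos (Nat.lt_succ_iff.1 (Finset.mem_range.1 hk))
      have hQP : Q * P = 1 := mul_eq_one_symm hPQ
      have hPev : ∀ f i k, Commute (ev f) (P i k) := fun f i k => by
        simp only [P]
        split_ifs
        · rw [show x k = ev (MvPolynomial.X k) from (commEval_X _ _ _).symm, ← map_pow]
          exact (Commute.all _ _).map ev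
        · exact Commute.zero_right _
      have hPQc : ∀ i k k' j, Commute (Q k' j) (P i k) := fun i k k' j => by
        simp only [P]
        split_ifs
        · exact (hcomm j k' k).pow_right _
        · exact Commute.zero_right _
      have hd : ∀ l, MvPolynomial.pderiv l g = 0 := fun l => by
        have hco : ∀ e, MvPolynomial.coeff e (MvPolynomial.pderiv l g) ≠ 0 →
            MvPolynomial.coeff (e + Finsupp.single l 1) g ≠ 0 := fun e he h2 => he (by
          rw [MvPolynomial.coeff_pderiv, h2, zero_mul])
        refine ihN _ (fun e he => ?_) (fun e he i => ?_) ?_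
        · have := hgN _ (hco e he)
          rw [map_add, Finsupp.degree_single] at this
          omega
        · have := hg _ (hco e he) i
          rw [Finsupp.add_apply] at this
          omega
        · have h2 : ev (MvPolynomial.pderiv l g) = ∑ j, P j l * ∑ k, ev (MvPolynomial.pderiv k g) * Q k j := by
            calc ev (MvPolynomial.pderiv l g) = ∑ k, ev (MvPolynomial.pderiv k g) * (Q * P) k l := by
                  rw [hQP]
                  simp [Matrix.one_apply]
              _ = _ := by
                  simp only [Matrix.mul_apply, Finset.mul_sum]
                  rw [Finset.sum_comm]
                  refine Finset.sum_congr rfl fun j _ => Finset.sum_congr rfl fun k _ => ?_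
                  rw [← mul_assoc, ((hPev _ j l).mul_left (hPQc j l k j)).eq]
          change ev (MvPolynomial.pderiv l g) v = 0
          rw [h2, LinearMap.sum_apply]
          exact Finset.sum_eq_zero fun j _ => by rw [Module.End.mul_apply, hA, map_zero]
      obtain ⟨f, rfl⟩ := MvPolynomial.exists_expand_of_pderiv_eq_zero p g hd
      have hco : ∀ e, MvPolynomial.coeff e f ≠ 0 → MvPolynomial.coeff (p • e) (MvPolynomial.expand p f) ≠ 0 := fun e he => by
        rwa [MvPolynomial.coeff_expand_smul p hp.ne_zero]
      have hx' : ∀ i j : Fin n, Commute (X i ^ p ^ (r + 1)) (X j ^ p ^ (r + 1)) := fun i j =>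
        (h.xx () i () j i.2 j.2).pow_pow _ _
      have hf : f = 0 := by
        refine ihs (r + 1) (by omega) hx' (f.totalDegree + 1) f (fun e he => ?_) (fun e he i => ?_) ?_
        · exact Nat.lt_succ_of_le (MvPolynomial.le_totalDegree (MvPolynomial.mem_support_iff.2 he))
        · have := hg _ (hco e he) i
          rw [Finsupp.smul_apply, smul_eq_mul, pow_succ'] at this
          exact lt_of_mul_lt_mul_left this (Nat.zero_le p)
        · rw [commEval_expand] at h0
          have hfun : (fun i : Fin n => X i ^ p ^ (r + 1)) = fun i : Fin n => (X i ^ p ^ r) ^ p := by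
            funext i
            rw [← pow_mul, pow_succ]
          simp only [hfun]
          exact h0
      rw [hf, map_zero]

theorem SymGen.le_finrank [FiniteDimensional K M] [Nontrivial M] (hc : IsCFamily c) {X Y : ℕ → Module.End K M}
    (h : SymGen p c n a b X Y) {β : ℕ → K} (hβ : ∀ i < n, β i ^ p ^ n = b.coeff i) : (p ^ n) ^ n ≤ Module.finrank K M := by
  obtain ⟨v, hv, hvY⟩ := IsHP.exists_eigenvector (M := M) (n := n) (Y := Y) (β := β) (fun i hi j hj => h.hp.yy () i () j hi hj)
    (fun i hi => by rw [h.powY i hi, hβ i hi]) n le_rfl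
  have hx : ∀ i j : Fin n, Commute (X i ^ p ^ 0) (X j ^ p ^ 0) := fun i j => (h.hp.xx () i () j i.2 j.2).pow_pow _ _
  let L : MvPolynomial (Fin n) K →ₗ[K] M :=
    (LinearMap.applyₗ v).comp (commEval K (fun i : Fin n => X i ^ p ^ 0) hx).toLinearMap
  let m : (Fin n → Fin (p ^ n)) → MvPolynomial (Fin n) K := fun e =>
    MvPolynomial.basisMonomials (Fin n) K (Finsupp.equivFunOnFinite.symm fun i => (e i : ℕ))
  have hm : LinearIndependent K m := (MvPolynomial.basisMonomials (Fin n) K).linearIndependent.comp _ fun e e' he => by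
    funext i
    exact Fin.ext (congrFun (Finsupp.equivFunOnFinite.symm.injective he) i)
  have hspan : Submodule.span K (Set.range m) ≤ MvPolynomial.restrictDegree (Fin n) K (p ^ n - 1) := by
    refine Submodule.span_le.2 ?_
    rintro _ ⟨e, rfl⟩
    refine (MvPolynomial.mem_restrictDegree _ _ _).2 fun s hs i => ?_
    simp only [m, MvPolynomial.coe_basisMonomials] at hs
    rw [Finset.mem_singleton.1 (MvPolynomial.support_monomial_subset hs)]
    exact Nat.le_sub_one_of_lt (e i).2
  have hpos : 0 < p ^ n := pow_pos (Fact.out : p.Prime).pos _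
  have hL : Set.InjOn L (Submodule.span K (Set.range m)) := fun f hf g hg hfg => by
    have h1 := (MvPolynomial.mem_restrictDegree _ _ _).1 (hspan (sub_mem hf hg))
    refine sub_eq_zero.1 (h.hp.commEval_ne_zero hc hv hvY n 0 (zero_add n) hx ((f - g).totalDegree + 1) _
      (fun e he => Nat.lt_succ_of_le (MvPolynomial.le_totalDegree (MvPolynomial.mem_support_iff.2 he))) (fun e he i => ?_) ?_)
    · have := h1 e (MvPolynomial.mem_support_iff.2 he) i
      omega
    · change L (f - g) = 0
      rw [map_sub, hfg, sub_self]
  have h2 := (hm.map_injOn L hL).fintype_card_le_finrank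
  simpa using h2

end Independence

section CSA

variable {p : ℕ} {c : ℕ+ → ℕ+ → MvPolynomial (ℕ+ ⊕ₗ ℕ+) ℤ}
variable [Fact p.Prime] {K : Type u} [Field K] [CharP K p] {n : ℕ} {a b : WittVector p K}

theorem Asy.isCSA_of_isAlgClosed [IsAlgClosed K] (hc : IsCFamily c) :
    IsCSA K (Asy p c n a b) ∧ Module.finrank K (Asy p c n a b) = (p ^ n) ^ n * (p ^ n) ^ n := by
  have hq : 0 < p ^ n := pow_pos (Fact.out : p.Prime).pos _
  choose α hα using fun i => IsAlgClosed.exists_pow_nat_eq (a.coeff i) hq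
  choose β hβ using fun i => IsAlgClosed.exists_pow_nat_eq (b.coeff i) hq
  have := Asy.nontrivial_of_root (n := n) (a := a) (b := b) hc α β (fun i _ => hα i) (fun i _ => hβ i)
  have := Asy.finiteDimensional (p := p) (c := c) (n := n) (a := a) (b := b) hc
  let A := Asy p c n a b
  obtain ⟨I, hI⟩ : ∃ I : Submodule A A, IsCoatom I := (Ideal.exists_maximal A).imp fun I h => h.out
  let V := A ⧸ I
  have hsimple : IsSimpleModule A V := isSimpleModule_iff_isCoatom.2 hI
  have : Nontrivial V := IsSimpleModule.nontrivial A V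
  let f : A →ₐ[K] Module.End K V := Algebra.lsmul K K V
  have hW : ∀ W : Submodule K V, (∀ g ∈ f.range, ∀ w ∈ W, g w ∈ W) → W = ⊥ ∨ W = ⊤ := fun W hW => by
    let W' : Submodule A V := { W with smul_mem' := fun r w hw => hW (f r) ⟨r, rfl⟩ w hw }
    rcases eq_bot_or_eq_top W' with h | h
    · refine Or.inl (eq_bot_iff.2 fun w hw => ?_)
      have : w ∈ W' := hw
      rwa [h] at this
    · refine Or.inr (eq_top_iff.2 fun w hw => ?_)
      have : w ∈ W' := h ▸ Submodule.mem_top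
      exact this
  have hf : Function.Surjective f := by
    rw [← AlgHom.range_eq_top]
    refine f.range.eq_top_of_irreducible hW fun g hg => ?_
    obtain ⟨r, hr⟩ := Module.End.exists_eigenvalue g
    refine ⟨r, fun v => ?_⟩
    have h1 := (hW (g.eigenspace r) fun b hb w hw => by
      rw [Module.End.mem_eigenspace_iff] at hw ⊢
      rw [← Module.End.mul_apply, hg b hb, Module.End.mul_apply, hw, map_smul]).resolve_left hr
    exact Module.End.mem_eigenspace_iff.1 (h1 ▸ Submodule.mem_top)
  have hV := (Asy.symGen (p := p) (c := c) (n := n) (a := a) (b := b)).map f |>.le_finrank hc (fun i _ => hβ i)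
  have hle := Asy.finrank_le (p := p) (c := c) (n := n) (a := a) (b := b) hc
  have hV2 : Module.finrank K (Module.End K V) = Module.finrank K V * Module.finrank K V := Module.finrank_linearMap K K V V
  have hfin : Module.finrank K A = Module.finrank K (Module.End K V) := by
    refine le_antisymm (hle.trans ?_) (LinearMap.finrank_le_finrank_of_surjective (f := f.toLinearMap) hf)
    rw [hV2]
    exact Nat.mul_le_mul hV hV
  have hinj : Function.Injective f :=
    (LinearMap.injective_iff_surjective_of_finrank_eq_finrank (f := f.toLinearMap) hfin).2 hf
  refine ⟨(IsCSA.end' V).of_algEquiv (AlgEquiv.ofBijective f ⟨hinj, hf⟩).symm, le_antisymm hle ?_⟩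
  change _ ≤ Module.finrank K A
  rw [hfin, hV2]
  exact Nat.mul_le_mul hV hV

theorem SymGen.exists_baseChange {K : Type u} [Field K] {a b : WittVector p K} (hc : IsCFamily c) {E : Type w} [Field E] [Algebra K E]
    {S : Type v} [Ring S] [Algebra E S] {X' Y' : ℕ → S}
    (h : SymGen p c n (WittVector.map (algebraMap K E) a) (WittVector.map (algebraMap K E) b) X' Y')
    (htop : ∀ P : Subalgebra E S, (∀ i < n, X' i ∈ P) → (∀ i < n, Y' i ∈ P) → P = ⊤) :
    ∃ g : E ⊗[K] Asy p c n a b →ₐ[E] S, Function.Surjective g := by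
  let _ : Algebra K S := Algebra.compHom S (algebraMap K E)
  have : IsScalarTower K E S := IsScalarTower.of_algebraMap_eq fun _ => rfl
  have hK : SymGen (K := K) p c n a b X' Y' :=
    ⟨h.hp, fun i hi => by rw [h.powX i hi, WittVector.map_coeff]; rfl,
      fun i hi => by rw [h.powY i hi, WittVector.map_coeff]; rfl⟩
  obtain ⟨f, hf⟩ := Asy.exists_lift hc hK
  let g : E ⊗[K] Asy p c n a b →ₐ[E] S := Algebra.TensorProduct.lift (Algebra.ofId E S) f fun r x => Algebra.commutes _ _
  refine ⟨g, AlgHom.range_eq_top g |>.1 (htop _ (fun i hi => ⟨1 ⊗ₜ Asy.X p c n a b i, ?_⟩) fun i hi => ⟨1 ⊗ₜ Asy.Y p c n a b i, ?_⟩)⟩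
  · refine (Algebra.TensorProduct.lift_tmul _ _ _ _ _).trans ?_
    rw [map_one, one_mul, (hf i hi).1]
  · refine (Algebra.TensorProduct.lift_tmul _ _ _ _ _).trans ?_
    rw [map_one, one_mul, (hf i hi).2]

theorem Asy.exists_baseChange {K : Type u} [Field K] {a b : WittVector p K} (E : Type w) [Field E] [Algebra K E] (hc : IsCFamily c) :
    ∃ g : E ⊗[K] Asy p c n a b →ₐ[E] Asy p c n (WittVector.map (algebraMap K E) a) (WittVector.map (algebraMap K E) b),
      Function.Surjective g :=
  Asy.symGen.exists_baseChange hc fun _ => Asy.eq_top_of_mem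

theorem Asy.isCSA_and_finrank (hc : IsCFamily c) :
    IsCSA K (Asy p c n a b) ∧ Module.finrank K (Asy p c n a b) = (p ^ n) ^ n * (p ^ n) ^ n := by
  let E := AlgebraicClosure K
  have : CharP E p := charP_of_injective_algebraMap (algebraMap K E).injective p
  have := Asy.finiteDimensional (p := p) (c := c) (n := n) (a := a) (b := b) hc
  let a' := WittVector.map (algebraMap K E) a
  let b' := WittVector.map (algebraMap K E) b
  obtain ⟨hE, hdim⟩ := Asy.isCSA_of_isAlgClosed (p := p) (c := c) (K := E) (n := n) (a := a') (b := b') hc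
  let A' := Asy p c n a' b'
  obtain ⟨g, hg⟩ : ∃ g : E ⊗[K] Asy p c n a b →ₐ[E] A', Function.Surjective g := Asy.exists_baseChange E hc
  have hle := Asy.finrank_le (p := p) (c := c) (n := n) (a := a) (b := b) hc
  have hbase : Module.finrank E (E ⊗[K] Asy p c n a b) = Module.finrank K (Asy p c n a b) := Module.finrank_baseChange
  have := hE.fd
  have hge := LinearMap.finrank_le_finrank_of_surjective (f := g.toLinearMap) hg
  have hfin : Module.finrank E (E ⊗[K] Asy p c n a b) = Module.finrank E A' :=
    le_antisymm (by rw [hbase]; exact hle.trans hdim.ge) hge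
  have hinj : Function.Injective g :=
    (LinearMap.injective_iff_surjective_of_finrank_eq_finrank (f := g.toLinearMap) hfin).2 hg
  refine ⟨IsCSA.of_baseChange E (hE.of_algEquiv (AlgEquiv.ofBijective g ⟨hinj, hg⟩).symm), ?_⟩
  rw [← hbase, hfin, hdim]

theorem Asy.isCSA (hc : IsCFamily c) : IsCSA K (Asy p c n a b) := (Asy.isCSA_and_finrank hc).1

theorem Asy.finrank_eq (hc : IsCFamily c) : Module.finrank K (Asy p c n a b) = (p ^ n) ^ n * (p ^ n) ^ n :=
  (Asy.isCSA_and_finrank hc).2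

theorem Asy.res_cls (hc : IsCFamily c) (E : Type u) [Field E] [Algebra K E] :
    Br.res E (Br.cls K (Asy p c n a b)) =
      Br.cls E (Asy p c n (WittVector.map (algebraMap K E) a) (WittVector.map (algebraMap K E) b)) := by
  have : CharP E p := charP_of_injective_algebraMap (algebraMap K E).injective p
  have h := Asy.isCSA (a := a) (b := b) (n := n) hc
  have hE := Asy.isCSA (K := E) (a := WittVector.map (algebraMap K E) a) (b := WittVector.map (algebraMap K E) b) (n := n) hc
  obtain ⟨g, hg⟩ := Asy.exists_baseChange (a := a) (b := b) (n := n) E hc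
  have := hE.nontriv
  rw [Br.res_cls _ h]
  exact Br.cls_congr (AlgEquiv.ofBijective g ⟨(h.baseChange E).injective g, hg⟩)

end CSA

section SymFam

variable {p : ℕ} {c : ℕ+ → ℕ+ → MvPolynomial (ℕ+ ⊕ₗ ℕ+) ℤ} {σ τ : Type}

/-- Mutually commuting generators of a family of symbol algebras. -/
structure SymFam {K : Type*} [Field K] {S : Type*} [Ring S] [Algebra K S] (p : ℕ)
    (c : ℕ+ → ℕ+ → MvPolynomial (ℕ+ ⊕ₗ ℕ+) ℤ) (n : σ → ℕ) (a b : σ → WittVector p K)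
    (X Y : σ → ℕ → S) : Prop where
  hp : IsHP p c n X Y
  powX : ∀ s, ∀ i < n s, X s i ^ p ^ n s = algebraMap K S ((a s).coeff i)
  powY : ∀ s, ∀ i < n s, Y s i ^ p ^ n s = algebraMap K S ((b s).coeff i)

variable {K : Type u} [Field K] {S : Type v} [Ring S] [Algebra K S] {n : σ → ℕ}

theorem SymFam.symGen {a b : σ → WittVector p K} {X Y : σ → ℕ → S} (h : SymFam p c n a b X Y) (s : σ) :
    SymGen p c (n s) (a s) (b s) (X s) (Y s) where
  hp := ⟨fun _ i _ j => h.hp.xx s i s j, fun _ i _ j => h.hp.yy s i s j, fun _ _ h => (h rfl).elim,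
    fun _ => h.hp.yx s⟩
  powX := h.powX s
  powY := h.powY s

variable [Fact p.Prime] {a b : σ → WittVector p K}

theorem SymFam.of_commute (g : ∀ s, Asy p c (n s) (a s) (b s) →ₐ[K] S)
    (hg : ∀ s t, s ≠ t → ∀ x y, Commute (g s x) (g t y)) :
    SymFam p c n a b (fun s i => g s (Asy.X p c (n s) (a s) (b s) i))
      (fun s i => g s (Asy.Y p c (n s) (a s) (b s) i)) := by
  have h := fun s => (Asy.symGen (p := p) (c := c) (n := n s) (a := a s) (b := b s)).map (g s)
  refine ⟨⟨fun s i t j hi hj => ?_, fun s i t j hi hj => ?_, fun s t hst i j _ _ => ?_,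
    fun s i j => (h s).hp.yx () i j⟩, fun s => (h s).powX, fun s => (h s).powY⟩
  · by_cases hst : s = t
    · subst hst; exact (h s).hp.xx () i () j hi hj
    · exact hg _ _ hst _ _
  · by_cases hst : s = t
    · subst hst; exact (h s).hp.yy () i () j hi hj
    · exact hg _ _ hst _ _
  · exact hg _ _ hst.symm _ _

theorem SymFam.exists_lift (hc : IsCFamily c) {X Y : σ → ℕ → S} (h : SymFam p c n a b X Y) :
    ∃ f : ∀ s, Asy p c (n s) (a s) (b s) →ₐ[K] S, ∀ s t, s ≠ t → ∀ x y, Commute (f s x) (f t y) := by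
  choose f hf using fun s => Asy.exists_lift hc (h.symGen s)
  refine ⟨f, fun s t hst x y => ?_⟩
  have key : ∀ z : S, (∀ i < n t, Commute z (X t i)) → (∀ i < n t, Commute z (Y t i)) → Commute z (f t y) := by
    intro z hX hY
    have := Asy.eq_top_of_mem (p := p) (c := c) (n := n t) (a := a t) (b := b t)
      (P := (Subalgebra.centralizer K {z}).comap (f t))
      (fun i hi => by
        rw [Subalgebra.mem_comap, Subalgebra.mem_centralizer_iff, (hf t i hi).1]
        rintro _ rfl; exact hX i hi)
      (fun i hi => by
        rw [Subalgebra.mem_comap, Subalgebra.mem_centralizer_iff, (hf t i hi).2]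
        rintro _ rfl; exact hY i hi)
    have hy : y ∈ (Subalgebra.centralizer K {z}).comap (f t) := this ▸ Algebra.mem_top
    exact Subalgebra.mem_centralizer_iff K |>.1 hy z rfl
  have := Asy.eq_top_of_mem (p := p) (c := c) (n := n s) (a := a s) (b := b s)
    (P := (Subalgebra.centralizer K {f t y}).comap (f s))
    (fun i hi => by
      rw [Subalgebra.mem_comap, Subalgebra.mem_centralizer_iff, (hf s i hi).1]
      rintro _ rfl
      exact (key _ (fun j hj => h.hp.xx _ _ _ _ hi hj) (fun j hj => (h.hp.yx_ne _ _ hst _ _ hi hj).symm)).symm.eq)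
    (fun i hi => by
      rw [Subalgebra.mem_comap, Subalgebra.mem_centralizer_iff, (hf s i hi).2]
      rintro _ rfl
      exact (key _ (fun j hj => h.hp.yx_ne _ _ hst.symm _ _ hj hi) (fun j hj => h.hp.yy _ _ _ _ hi hj)).symm.eq)
  have hx : x ∈ (Subalgebra.centralizer K {f t y}).comap (f s) := this ▸ Algebra.mem_top
  exact (Subalgebra.mem_centralizer_iff K |>.1 hx _ rfl).symm

/-- A substitution of Witt vector expressions in a family of generators of symbol algebras. -/
theorem SymFam.exists_new [CharP K p] [Nontrivial S] (hc : IsCFamily c) {X Y : σ → ℕ → S} (h : SymFam p c n a b X Y)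
    (eX eY fX fY : τ → WExpr σ) (kX kY : τ → σ → ℕ) (qX qY : τ → σ → Bool) (m : τ → ℕ)
    (hX : ∀ t, eX t = (fX t).bindF (kX t)) (hY : ∀ t, eY t = (fY t).bindF (kY t))
    (hvX : ∀ t, (eX t).Valid n (m t)) (hvY : ∀ t, (eY t).Valid n (m t))
    (aX aY : τ → σ → WittVector p K)
    (haX : ∀ t s, ∃ d, m t + kX t s = n s + d ∧
      ∀ i, (aX t s).coeff i = (if qX t s then b s else a s).coeff i ^ p ^ d)
    (haY : ∀ t s, ∃ d, m t + kY t s = n s + d ∧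
      ∀ i, (aY t s).coeff i = (if qY t s then b s else a s).coeff i ^ p ^ d)
    (hcan : ∀ (E : Type) [Ring E] (gx gy : σ → ℕ → E), Canon p gx gy →
      Canon p (fun t => (eX t).gEval p (pick (qX t) gx gy)) (fun t => (eY t).gEval p (pick (qY t) gx gy))) :
    ∃ X' Y' : τ → ℕ → S, SymFam p c m (fun t => (fX t).eval (aX t)) (fun t => (fY t).eval (aY t)) X' Y' := by
  obtain ⟨X', Y', h1, h2, h3⟩ := h.hp.exists_new (K := K) hc eX eY qX qY m hvX hvY hcan
  have key : ∀ (q : σ → Bool) s d i, i < n s → pick q X Y s i ^ p ^ (n s + d) =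
      algebraMap K S ((if q s then b s else a s).coeff i ^ p ^ d) := by
    intro q s d i hi
    rw [pow_add, pow_mul, pick, map_pow]
    split_ifs
    · rw [h.powY s i hi]
    · rw [h.powX s i hi]
  refine ⟨X', Y', h1, fun t => h2 t (m t) (kX t) (fX t) (aX t) (hX t) fun s i hi => ?_,
    fun t => h3 t (m t) (kY t) (fY t) (aY t) (hY t) fun s i hi => ?_⟩
  · obtain ⟨d, hd, h⟩ := haX t s
    rw [hd, h, key _ _ _ _ hi]
  · obtain ⟨d, hd, h⟩ := haY t s
    rw [hd, h, key _ _ _ _ hi]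

end SymFam

section Identities

variable {p : ℕ} [Fact p.Prime] {c : ℕ+ → ℕ+ → MvPolynomial (ℕ+ ⊕ₗ ℕ+) ℤ} {K : Type u} [Field K]

variable (p c) in
/-- The class of the symbol algebra. -/
def Br.symb (n : ℕ) (a b : WittVector p K) : Br K := Br.cls K (Asy p c n a b)

variable [CharP K p]

theorem Canon.yx' {p : ℕ} {A : Type*} [Ring A] {σ : Type} {gx gy : σ → ℕ → A} [DecidableEq σ] (h : Canon p gx gy)
    (s t i j) : gy s j * gx t i = gx t i * gy s j + if s = t ∧ i = j then (p : A) ^ i else 0 := by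
  by_cases hst : s = t
  · subst hst; simpa using h.yx s i j
  · simpa [hst] using (h.yx_ne t s (Ne.symm hst) i j).eq

theorem Br.symb_pair {n a b m a' b'} {n' : Bool → ℕ} {a₁ b₁ : Bool → WittVector p K} (hc : IsCFamily c)
    (hn : n' = fun t => bif t then n else m)
    (h : ∀ (S : Type u) [Ring S] [Algebra K S] [Nontrivial S] (X Y : Bool → ℕ → S),
      SymFam p c n' (fun t => bif t then a else a')
        (fun t => bif t then b else b') X Y →
      ∃ X' Y' : Bool → ℕ → S, SymFam p c n' a₁ b₁ X' Y') :
    symb p c n a b + symb p c m a' b' = symb p c n (a₁ true) (b₁ true) + symb p c m (a₁ false) (b₁ false) := by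
  subst hn
  have hA := Asy.isCSA (a := a) (b := b) (n := n) hc
  have hA' := Asy.isCSA (a := a') (b := b') (n := m) hc
  have hB := Asy.isCSA (a := a₁ true) (b := b₁ true) (n := n) hc
  have hB' := Asy.isCSA (a := a₁ false) (b := b₁ false) (n := m) hc
  have := (hA.tensor hA').nontriv
  have h0 : SymFam p c (fun t => bif t then n else m) (fun t => bif t then a else a')
        (fun t => bif t then b else b') _ _ := SymFam.of_commute (K := K)
      (S := Asy p c n a b ⊗[K] Asy p c m a' b')
      (fun s => match s with
        | true => (Algebra.TensorProduct.includeLeft : Asy p c n a b →ₐ[K] _)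
        | false => (Algebra.TensorProduct.includeRight : Asy p c m a' b' →ₐ[K] _)) (by
      rintro (_ | _) (_ | _) hst x y
      · exact (hst rfl).elim
      · simp [commute_iff_eq, Algebra.TensorProduct.tmul_mul_tmul]
      · simp [commute_iff_eq, Algebra.TensorProduct.tmul_mul_tmul]
      · exact (hst rfl).elim)
  obtain ⟨X', Y', h1⟩ := h _ _ _ h0
  obtain ⟨f, hf⟩ := h1.exists_lift hc
  refine (Br.cls_add_eq hB hB' hA hA' (f true) (f false) (hf true false (by decide)) ?_).symm
  rw [Asy.finrank_eq hc, Asy.finrank_eq hc, Asy.finrank_eq hc, Asy.finrank_eq hc]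

theorem Br.symb_add_symb (hc : IsCFamily c) (n : ℕ) (a b a' b' : WittVector p K) :
    symb p c n a b + symb p c n a' b' = symb p c n (a - a') b + symb p c n a' (b' + b) := by
  refine symb_pair hc (n' := fun _ => n) (a₁ := fun t => ((bif t then .sub (.atom true) (.atom false) else .atom false) :
      WExpr Bool).eval fun t => bif t then a else a') (b₁ := fun t => ((bif t then .atom true else
      .add (.atom false) (.atom true)) : WExpr Bool).eval fun t => bif t then b else b') (by funext t; cases t <;> rfl)
      fun S _ _ _ X Y h => ?_
  refine h.exists_new hc (fun t => bif t then .sub (.atom true) (.atom false) else .atom false)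
    (fun t => bif t then .atom true else .add (.atom false) (.atom true)) _ _ (fun _ _ => 0) (fun _ _ => 0)
    (fun _ _ => false) (fun _ _ => true) _ (fun t => (WExpr.bindF_zero _).symm) (fun t => (WExpr.bindF_zero _).symm)
    ?_ ?_ _ _ (fun t s => ⟨0, rfl, fun i => ?_⟩) (fun t s => ⟨0, rfl, fun i => ?_⟩) ?_
  · rintro (_ | _) <;> simp [WExpr.Valid]
  · rintro (_ | _) <;> simp [WExpr.Valid]
  · simp
  · simp
  · intro E _ gx gy h
    have hxx : ∀ s i t j, gx s i * gx t j = gx t j * gx s i := fun s i t j => (h.xx s i t j).eq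
    have hyy : ∀ s i t j, gy s i * gy t j = gy t j * gy s i := fun s i t j => (h.yy s i t j).eq
    refine ⟨?_, ?_, ?_, ?_⟩
    · rintro (_ | _) i (_ | _) j <;>
        simp [pick, WExpr.gEval, commute_iff_eq, mul_sub, sub_mul, hxx]; abel
    · rintro (_ | _) i (_ | _) j <;>
        simp [pick, WExpr.gEval, commute_iff_eq, mul_add, add_mul, hyy]; abel
    · rintro (_ | _) (_ | _) hst i j <;>
        simp [pick, WExpr.gEval, commute_iff_eq, mul_sub, sub_mul, mul_add, add_mul, h.yx'] at hst ⊢; abel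
    · rintro (_ | _) i j <;>
        simp [pick, WExpr.gEval, mul_sub, sub_mul, mul_add, add_mul, h.yx'] <;> abel

theorem Br.symb_add_symb_frobenius (hc : IsCFamily c) (n : ℕ) (a b a' b' : WittVector p K) :
    symb p c n a b + symb p c n a' b' =
      symb p c n (a - WittVector.frobenius a') b + symb p c n a' (b' + WittVector.verschiebung b) := by
  refine symb_pair hc (n' := fun _ => n) (a₁ := fun t => ((bif t then .sub (.atom true) (.F (.atom false)) else .atom false) :
      WExpr Bool).eval fun t => bif t then a else a') (b₁ := fun t => ((bif t then .atom true else
      .add (.atom false) (.V (.atom true))) : WExpr Bool).eval fun t => bif t then b else b')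
      (by funext t; cases t <;> rfl) fun S _ _ _ X Y h => ?_
  refine h.exists_new hc (fun t => bif t then .sub (.atom true) (.F (.atom false)) else .atom false)
    (fun t => bif t then .atom true else .add (.atom false) (.V (.atom true))) _ _ (fun _ _ => 0) (fun _ _ => 0)
    (fun _ _ => false) (fun _ _ => true) _ (fun t => (WExpr.bindF_zero _).symm) (fun t => (WExpr.bindF_zero _).symm)
    ?_ ?_ _ _ (fun t s => ⟨0, rfl, fun i => ?_⟩) (fun t s => ⟨0, rfl, fun i => ?_⟩) ?_
  · rintro (_ | _) <;> simp [WExpr.Valid]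
  · rintro (_ | _) <;> simp [WExpr.Valid]
  · simp
  · simp
  · intro E _ gx gy h
    have hxx : ∀ s i t j, gx s i * gx t j = gx t j * gx s i := fun s i t j => (h.xx s i t j).eq
    have hyy : ∀ s i t j, gy s i * gy t j = gy t j * gy s i := fun s i t j => (h.yy s i t j).eq
    have hp : ∀ x : E, x * p = p * x := fun x => (Nat.cast_commute p x).eq.symm
    have hp' : ∀ x y : E, x * (p * y) = p * (x * y) := fun x y => by rw [← mul_assoc, hp, mul_assoc]
    refine ⟨?_, ?_, ?_, ?_⟩
    · rintro (_ | _) i (_ | _) j <;>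
        simp [pick, WExpr.gEval, commute_iff_eq, mul_sub, sub_mul, hxx] ; abel
    · rintro (_ | _) (_ | i) (_ | _) (_ | j) <;>
        simp [pick, WExpr.gEval, commute_iff_eq, mul_add, add_mul, hyy, mul_assoc, hp'] <;> abel
    · rintro (_ | _) (_ | _) hst (_ | i) (_ | j) <;>
        simp [pick, WExpr.gEval, commute_iff_eq, mul_sub, sub_mul, mul_add, add_mul, h.yx', mul_assoc, hp',
          pow_succ', @eq_comm ℕ 0] at hst ⊢ <;> abel
    · rintro (_ | _) (_ | i) (_ | j) <;>
        simp [pick, WExpr.gEval, mul_sub, sub_mul, mul_add, add_mul, h.yx', mul_assoc, hp', pow_succ'] <;> abel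

theorem Br.symb_add_symb_succ (hc : IsCFamily c) (n : ℕ) (a b a' b' : WittVector p K) :
    symb p c n a b + symb p c (n + 1) a' b' = symb p c n a (b + b') +
      symb p c (n + 1) (a' - WittVector.verschiebung (WittVector.frobenius a)) b' := by
  refine symb_pair hc (n' := fun t => bif t then n else n + 1)
      (a₁ := fun t => ((bif t then .atom true else .sub (.atom false) (.V (.atom true))) :
        WExpr Bool).eval fun s => bif s then (bif t then a else WittVector.frobenius a) else a')
      (b₁ := fun t => ((bif t then .add (.atom true) (.atom false) else .atom false) :
        WExpr Bool).eval fun s => bif s then (bif t then b else WittVector.frobenius b) else b')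
      rfl fun S _ _ _ X Y h => ?_
  refine h.exists_new hc (fun t => bif t then .atom true else .sub (.atom false) (.V (.atom true)))
    (fun t => bif t then .add (.atom true) (.F (.atom false)) else .atom false) _ _
    (fun t s => bif t then (bif s then 0 else 1) else 0) (fun t s => bif t then (bif s then 0 else 1) else 0)
    (fun _ _ => false) (fun _ _ => true) _ ?_ ?_ ?_ ?_ _ _ ?_ ?_ ?_
  · rintro (_ | _) <;> rfl
  · rintro (_ | _) <;> rfl
  · rintro (_ | _) <;> simp [WExpr.Valid]
  · rintro (_ | _) <;> simp [WExpr.Valid]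
  · rintro (_ | _) (_ | _)
    · exact ⟨0, rfl, by simp⟩
    · exact ⟨1, rfl, by simp [WittVector.coeff_frobenius_charP]⟩
    · exact ⟨0, rfl, by simp⟩
    · exact ⟨0, rfl, by simp⟩
  · rintro (_ | _) (_ | _)
    · exact ⟨0, rfl, by simp⟩
    · exact ⟨1, rfl, by simp [WittVector.coeff_frobenius_charP]⟩
    · exact ⟨0, rfl, by simp⟩
    · exact ⟨0, rfl, by simp⟩
  · intro E _ gx gy h
    have hxx : ∀ s i t j, gx s i * gx t j = gx t j * gx s i := fun s i t j => (h.xx s i t j).eq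
    have hyy : ∀ s i t j, gy s i * gy t j = gy t j * gy s i := fun s i t j => (h.yy s i t j).eq
    have hp : ∀ x : E, x * p = p * x := fun x => (Nat.cast_commute p x).eq.symm
    have hp' : ∀ x y : E, x * (p * y) = p * (x * y) := fun x y => by rw [← mul_assoc, hp, mul_assoc]
    refine ⟨?_, ?_, ?_, ?_⟩
    · rintro (_ | _) (_ | i) (_ | _) (_ | j) <;>
        simp [pick, WExpr.gEval, commute_iff_eq, mul_sub, sub_mul, hxx, mul_assoc, hp']; abel
    · rintro (_ | _) i (_ | _) j <;>
        simp [pick, WExpr.gEval, commute_iff_eq, mul_add, add_mul, hyy] ; abel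
    · rintro (_ | _) (_ | _) hst (_ | i) (_ | j) <;>
        simp [pick, WExpr.gEval, commute_iff_eq, mul_sub, sub_mul, mul_add, add_mul, h.yx', mul_assoc, hp',
          pow_succ', @eq_comm ℕ 0] at hst ⊢ <;> abel
    · rintro (_ | _) (_ | i) (_ | j) <;>
        simp [pick, WExpr.gEval, mul_sub, sub_mul, mul_add, add_mul, h.yx', mul_assoc, hp', pow_succ'] <;> abel

private theorem commute_sub_mul {E : Type*} [Ring E] {a b c d e f δ : E} (had : a * d = d * a)
    (hbe : b * e = e * b) (hcf : c * f = f * c) (hbf : b * f = f * b) (hce : c * e = e * c)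
    (haf : a * f = f * a) (hdc : d * c = c * d) (hae : a * e = e * a + δ) (hdb : d * b = b * d + δ)
    (hδ : δ * f = δ * c) : (a - b * c) * (d - e * f) = (d - e * f) * (a - b * c) := by
  have h1 : a * (e * f) = e * f * a + δ * f := by
    rw [← mul_assoc, hae, add_mul, mul_assoc, haf, ← mul_assoc]
  have h2 : d * (b * c) = b * c * d + δ * c := by
    rw [← mul_assoc, hdb, add_mul, mul_assoc, hdc, ← mul_assoc]
  have h3 : b * c * (e * f) = e * f * (b * c) := by
    have h4 : Commute (b * c) (e * f) :=
      Commute.mul_left (Commute.mul_right hbe hbf) (Commute.mul_right hce hcf)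
    exact h4
  rw [sub_mul, sub_mul, mul_sub, mul_sub, mul_sub, mul_sub, h1, h2, h3, had, hδ]
  abel

theorem Br.symb_mul_add (hc : IsCFamily c) (n : ℕ) (a b : Fin 3 → WittVector p K) :
    symb p c n (a 0) (b 0) + symb p c n (a 1) (b 1) + symb p c n (a 2) (b 2) =
      symb p c n (a 0) (b 0 - a 1 * a 2) + symb p c n (a 1) (b 1 - a 2 * a 0) +
        symb p c n (a 2) (b 2 - a 0 * a 1) := by
  let A : Fin 3 → Type u := fun s => Asy p c n (a s) (b s)
  have hA : ∀ s, IsCSA K (Asy p c n (a s) (b s)) := fun s => Asy.isCSA hc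
  have hS := ((hA 0).tensor (hA 1)).tensor (hA 2)
  have := hS.nontriv
  have h0 : SymFam p c (fun _ => n) a b _ _ := SymFam.of_commute (K := K)
      (S := (Asy p c n (a 0) (b 0) ⊗[K] Asy p c n (a 1) (b 1)) ⊗[K] Asy p c n (a 2) (b 2))
      (fun s => match s with
        | 0 => Algebra.TensorProduct.includeLeft.comp Algebra.TensorProduct.includeLeft
        | 1 => Algebra.TensorProduct.includeLeft.comp Algebra.TensorProduct.includeRight
        | 2 => Algebra.TensorProduct.includeRight) (by
      intro s t hst x y
      fin_cases s <;> fin_cases t <;> first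
        | exact (hst rfl).elim
        | simp [commute_iff_eq, Algebra.TensorProduct.tmul_mul_tmul])
  let e : Fin 3 → WExpr (Fin 3) := fun t => .sub (.atom t) (.mul (.atom (t + 1)) (.atom (t + 2)))
  obtain ⟨X', Y', h1⟩ := h0.exists_new hc (fun t => .atom t) e
    (fun t => .atom t) e (fun _ _ => 0) (fun _ _ => 0)
    (fun _ _ => false) (fun t s => t = s) (fun _ => n) (fun t => (WExpr.bindF_zero _).symm)
    (fun t => (WExpr.bindF_zero _).symm) (fun t => le_rfl) (fun t => ⟨le_rfl, le_rfl, le_rfl⟩)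
    (fun _ => a) (fun t s => if t = s then b s else a s) (fun t s => ⟨0, rfl, fun i => by simp⟩)
    (fun t s => ⟨0, rfl, fun i => by simp⟩) (by
      intro E _ gx gy h
      have hxx : ∀ s i t j, gx s i * gx t j = gx t j * gx s i := fun s i t j => (h.xx s i t j).eq
      have hyy : ∀ s i t j, gy s i * gy t j = gy t j * gy s i := fun s i t j => (h.yy s i t j).eq
      have hcomm : ∀ s t, s ≠ t → ∀ r, r ≠ s → r ≠ t → ∀ i j,
          (gy s i - gx t i * gx r i) * (gy t j - gx s j * gx r j) =
            (gy t j - gx s j * gx r j) * (gy s i - gx t i * gx r i) := by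
        intro s t hst r hrs hrt i j
        refine commute_sub_mul (δ := if j = i then (p : E) ^ j else 0) (hyy _ _ _ _) (hxx _ _ _ _) (hxx _ _ _ _) (hxx _ _ _ _)
          (hxx _ _ _ _) ?_ ?_ (h.yx _ _ _) ?_ ?_
        · simp [h.yx', hrs.symm]
        · simp [h.yx', hrt.symm]
        · rw [h.yx]
          congr 1
          split_ifs with h1 h2 h2 <;> simp_all
        · split_ifs with h1
          · rw [h1]
          · rw [zero_mul, zero_mul]
      refine ⟨fun s i t j => h.xx _ _ _ _, fun s i t j => ?_, fun s t hst i j => ?_, fun s i j => ?_⟩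
      · by_cases hst : s = t
        · subst hst
          have h3 : s ≠ s + 1 := by revert s; decide
          have h4 : s ≠ s + 2 := by revert s; decide
          simp only [e, WExpr.gEval, pick, h3, h4, decide_true, decide_false, if_true, Bool.false_eq_true, if_false]
          refine Commute.sub_left (Commute.sub_right (hyy _ _ _ _) ?_) (Commute.sub_right ?_ ?_)
          · refine Commute.mul_right (h.yx_ne _ _ h3.symm _ _) (h.yx_ne _ _ h4.symm _ _)
          · refine (Commute.mul_right (h.yx_ne _ _ h3.symm _ _) (h.yx_ne _ _ h4.symm _ _)).symm
          · exact Commute.mul_left (Commute.mul_right (h.xx _ _ _ _) (h.xx _ _ _ _))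
              (Commute.mul_right (h.xx _ _ _ _) (h.xx _ _ _ _))
        · have h3 : ∀ s : Fin 3, s ≠ s + 1 := by decide
          have h4 : ∀ s : Fin 3, s ≠ s + 2 := by decide
          simp only [e, WExpr.gEval, pick, h3, h4, decide_true, decide_false, if_true, Bool.false_eq_true, if_false]
          have h5 : (s + 1 = t ∧ t + 2 = s ∧ s + 2 = t + 1) ∨ (s + 2 = t ∧ t + 1 = s ∧ s + 1 = t + 2) := by
            revert s t; decide
          rcases h5 with ⟨h5, h6, h7⟩ | ⟨h5, h6, h7⟩
          · have := hcomm s t hst (s + 2) (h4 s).symm (by rw [h7]; exact (h3 t).symm) i j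
            rw [h5, h6, ← h7, commute_iff_eq, hxx (s + 2) j s j]
            exact this
          · have := hcomm s t hst (s + 1) (h3 s).symm (by rw [h7]; exact (h4 t).symm) i j
            rw [h5, h6, ← h7, commute_iff_eq, hxx (s + 1) i t i]
            exact this
      · have h3 : ∀ s : Fin 3, s ≠ s + 1 := by decide
        have h4 : ∀ s : Fin 3, s ≠ s + 2 := by decide
        simp only [e, WExpr.gEval, pick, h3, h4, decide_true, decide_false, if_true, Bool.false_eq_true, if_false]
        exact Commute.sub_left (h.yx_ne _ _ hst _ _) (Commute.mul_left (h.xx _ _ _ _) (h.xx _ _ _ _))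
      · have h3 : ∀ s : Fin 3, s ≠ s + 1 := by decide
        have h4 : ∀ s : Fin 3, s ≠ s + 2 := by decide
        simp only [e, WExpr.gEval, pick, h3, h4, decide_true, decide_false, if_true, Bool.false_eq_true, if_false]
        rw [sub_mul, h.yx, mul_sub, (Commute.mul_left (h.xx _ _ _ _) (h.xx _ _ _ _) :
          Commute (gx (s + 1) j * gx (s + 2) j) (gx s i)).eq]
        abel)
  have hB : ∀ s, IsCSA K (Asy p c n (a s) (b s - a (s + 1) * a (s + 2))) := fun s => Asy.isCSA hc
  have hev : ∀ t, (e t).eval (fun s => if t = s then b s else a s) = b t - a (t + 1) * a (t + 2) := by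
    intro t
    have h3 : t ≠ t + 1 := by revert t; decide
    have h4 : t ≠ t + 2 := by revert t; decide
    simp [e, WExpr.eval]
  have h2 : SymFam p c (fun _ => n) a (fun t => b t - a (t + 1) * a (t + 2)) X' Y' := by
    rw [← funext hev]
    exact h1
  obtain ⟨f, hf⟩ := h2.exists_lift hc
  have := Br.cls_add_eq ((hB 0).tensor (hB 1)) (hB 2) ((hA 0).tensor (hA 1)) (hA 2)
    (Algebra.TensorProduct.lift (f 0) (f 1) (hf 0 1 (by decide))) (f 2) (fun x y => by
      induction x using TensorProduct.induction_on with
      | zero => rw [map_zero]; exact Commute.zero_left _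
      | add x z hx hz => rw [map_add]; exact hx.add_left hz
      | tmul x z =>
        rw [Algebra.TensorProduct.lift_tmul]
        exact (hf 0 2 (by decide) _ _).mul_left (hf 1 2 (by decide) _ _)) (by
      simp only [Module.finrank_tensorProduct, Asy.finrank_eq hc, le_refl])
  rw [Br.cls_tensor (hA 0) (hA 1), Br.cls_tensor (hB 0) (hB 1)] at this
  exact this.symm

end Identities

section Split

variable {p : ℕ} [Fact p.Prime] {c : ℕ+ → ℕ+ → MvPolynomial (ℕ+ ⊕ₗ ℕ+) ℤ} {K : Type u} [Field K] [CharP K p]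

theorem Br.symb_eq_zero_of_root (hc : IsCFamily c) {n : ℕ} {a b : WittVector p K} {β : ℕ → K}
    (hβ : ∀ i < n, β i ^ p ^ n = b.coeff i) : Br.symb p c n a b = 0 := by
  have hA := Asy.isCSA (p := p) (c := c) (n := n) (a := a) (b := b) hc
  have := hA.nontriv
  have := Asy.finiteDimensional (p := p) (c := c) (n := n) (a := a) (b := b) hc
  let A := Asy p c n a b
  have : FiniteDimensional K A := this
  have hg := (Asy.symGen (p := p) (c := c) (n := n) (a := a) (b := b)).map (Algebra.lmul K A)
  obtain ⟨v, hv, hvY⟩ := IsHP.exists_eigenvector (M := A) (n := n) (β := β) (fun i hi j hj => hg.hp.yy () i () j hi hj)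
    (fun i hi => by rw [hg.powY i hi, hβ i hi]) n le_rfl
  let W : Submodule A A := Submodule.span A {v}
  have hvW : v ∈ W := Submodule.mem_span_singleton_self v
  have : Nontrivial W := ⟨⟨⟨v, hvW⟩, 0, fun h => hv (congrArg Subtype.val h)⟩⟩
  obtain ⟨m, hm⟩ := Asy.exists_span_mul (p := p) (n := n) (a := a) (b := b) hc
  have hY : ∀ y ∈ Algebra.adjoin K (Set.range fun i : Fin n => Asy.Y p c n a b i), ∃ r : K, y * v = r • v := fun y hy => by
    induction hy using Algebra.adjoin_induction with
    | mem _ h =>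
      obtain ⟨i, rfl⟩ := h
      exact ⟨β i, hvY i i.2⟩
    | algebraMap r => exact ⟨r, (Algebra.smul_def r v).symm⟩
    | add x y _ _ hx hy =>
      obtain ⟨r, hr⟩ := hx
      obtain ⟨s, hs⟩ := hy
      exact ⟨r + s, by rw [add_mul, hr, hs, add_smul]⟩
    | mul x y _ _ hx hy =>
      obtain ⟨r, hr⟩ := hx
      obtain ⟨s, hs⟩ := hy
      exact ⟨s * r, by rw [mul_assoc, hs, mul_smul_comm, hr, smul_smul]⟩
  let W' : Submodule K A := W.restrictScalars K
  have hle : W' ≤ Submodule.span K (Set.range fun e => m e * v) := fun w hw => by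
    obtain ⟨z, rfl⟩ := Submodule.mem_span_singleton.1 hw
    refine Submodule.mul_induction_on (hm (Submodule.mem_top (x := z))) (fun s hs t ht => ?_) fun s t hs ht => ?_
    · obtain ⟨r, hr⟩ := hY t ht
      rw [smul_eq_mul, mul_assoc, hr, mul_smul_comm]
      refine Submodule.smul_mem _ _ ?_
      have h1 := Submodule.mem_map_of_mem (f := LinearMap.mulRight K v) hs
      rw [Submodule.map_span, ← Set.range_comp] at h1
      exact h1
    · rw [add_smul]
      exact add_mem hs ht
  have : FiniteDimensional K W' := FiniteDimensional.finiteDimensional_submodule W'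
  have : Nontrivial W' := ‹Nontrivial W›
  let f : A →ₐ[K] Module.End K W' := Algebra.lsmul K K W
  refine cls_eq_zero_of_rep (A := A) (V := W') hA f ?_
  rw [Asy.finrank_eq hc, sq]
  have h1 : Module.finrank K W' ≤ (p ^ n) ^ n := by
    refine (Submodule.finrank_mono hle).trans ?_
    refine (finrank_range_le_card (R := K) fun e => m e * v).trans ?_
    simp
  exact Nat.mul_le_mul h1 h1

end Split

namespace Br

section Relations

variable {p : ℕ} [Fact p.Prime] {c : ℕ+ → ℕ+ → MvPolynomial (ℕ+ ⊕ₗ ℕ+) ℤ} {K : Type u} [Field K]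

open WittVector

theorem symb_congr {n : ℕ} {a b a' b' : WittVector p K} (h : truncate n a = truncate n a')
    (h' : truncate n b = truncate n b') : symb p c n a b = symb p c n a' b' := by
  change Br.cls K (Asymb K p c n n _ _) = Br.cls K (Asymb K p c n n _ _)
  rw [h, h']

variable [CharP K p]

theorem symb_zero_right (hc : IsCFamily c) (n : ℕ) (a : WittVector p K) : symb p c n a 0 = 0 :=
  symb_eq_zero_of_root hc (β := 0) fun i _ => by
    rw [Pi.zero_apply, zero_pow (pow_ne_zero _ (Fact.out : p.Prime).ne_zero), WittVector.zero_coeff]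

theorem symb_zero_left (hc : IsCFamily c) (n : ℕ) (b : WittVector p K) : symb p c n 0 b = 0 := by
  have h := symb_add_symb hc n 0 b 0 0
  simpa [symb_zero_right hc] using h

theorem symb_add_right (hc : IsCFamily c) (n : ℕ) (a b b' : WittVector p K) :
    symb p c n a (b + b') = symb p c n a b + symb p c n a b' := by
  have h := symb_add_symb hc n a b a b'
  rw [sub_self, symb_zero_left hc, zero_add, add_comm b'] at h
  exact h.symm

theorem symb_add_left (hc : IsCFamily c) (n : ℕ) (a a' b : WittVector p K) :
    symb p c n (a + a') b = symb p c n a b + symb p c n a' b := by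
  have h := symb_add_symb hc n (a + a') b a' 0
  rwa [symb_zero_right hc, zero_add, add_zero, add_sub_cancel_right] at h

/-- The symbol as a biadditive map. -/
def symbHom (hc : IsCFamily c) (n : ℕ) : WittVector p K →+ WittVector p K →+ Br K :=
  AddMonoidHom.mk' (fun a => AddMonoidHom.mk' (symb p c n a) (symb_add_right hc n a)) fun a a' => by
    ext b
    exact symb_add_left hc n a a' b

theorem symbHom_apply (hc : IsCFamily c) (n : ℕ) (a b : WittVector p K) : symbHom hc n a b = symb p c n a b := rfl

theorem symb_sub_left (hc : IsCFamily c) (n : ℕ) (a a' b : WittVector p K) :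
    symb p c n (a - a') b = symb p c n a b - symb p c n a' b := by
  simp only [← symbHom_apply hc, map_sub, AddMonoidHom.sub_apply]

theorem symb_nsmul_left (hc : IsCFamily c) (n m : ℕ) (a b : WittVector p K) :
    symb p c n (m • a) b = m • symb p c n a b := by
  simp only [← symbHom_apply hc, map_nsmul, AddMonoidHom.nsmul_apply]

theorem symb_frobenius (hc : IsCFamily c) (n : ℕ) (a b : WittVector p K) :
    symb p c n (frobenius a) b = symb p c n a (verschiebung b) := by
  have h := symb_add_symb_frobenius hc n 0 b a 0
  rwa [zero_sub, zero_add, symb_zero_right hc, symb_zero_left hc, zero_add, ← zero_sub, symb_sub_left hc,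
    symb_zero_left hc, zero_sub, eq_neg_add_iff_add_eq, add_zero] at h

theorem nsmul_symb_succ (hc : IsCFamily c) (n : ℕ) (a b : WittVector p K) :
    p • symb p c (n + 1) a b = symb p c n a b := by
  have h := symb_add_symb_succ hc n a 0 0 b
  rw [zero_sub, zero_add, symb_zero_right hc, symb_zero_left hc, zero_add, ← zero_sub, symb_sub_left hc,
    symb_zero_left hc, zero_sub, eq_comm, add_neg_eq_zero, verschiebung_frobenius, ← nsmul_eq_mul', symb_nsmul_left hc] at h
  exact h.symm

theorem symb_cyclic (hc : IsCFamily c) (n : ℕ) (a b d : WittVector p K) :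
    symb p c n a (b * d) + symb p c n b (d * a) + symb p c n d (a * b) = 0 := by
  have h := symb_mul_add hc n ![a, b, d] ![b * d, d * a, a * b]
  simpa [Fin.sum_univ_three, symb_zero_right hc] using h

theorem _root_.WittVector.truncate_iterate_verschiebung {R : Type*} [CommRing R] (n : ℕ) (b : WittVector p R) :
    truncate n (verschiebung^[n] b) = 0 := by
  have hV : ∀ m (d : WittVector p R), ∀ i < m, (verschiebung^[m] d).coeff i = 0 := fun m => by
    induction m with
    | zero => exact fun d i hi => absurd hi (Nat.not_lt_zero i)
    | succ m ih =>
      intro d i hi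
      rw [Function.iterate_succ_apply']
      rcases i with _ | i
      · exact verschiebung_coeff_zero _
      · rw [verschiebung_coeff_succ]
        exact ih d i (by omega)
  ext i
  rw [coeff_truncate, hV n b i i.2, TruncatedWittVector.coeff_zero]

theorem symb_iterate_verschiebung (hc : IsCFamily c) (n : ℕ) (a b : WittVector p K) :
    symb p c n a (verschiebung^[n] b) = 0 := by
  rw [← symb_zero_right hc n a]
  exact symb_congr rfl (by rw [truncate_iterate_verschiebung, map_zero])

theorem symb_one_left (hc : IsCFamily c) (n : ℕ) (b : WittVector p K) : symb p c n 1 b = 0 := by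
  have h : ∀ m, symb p c n 1 b = symb p c n 1 (verschiebung^[m] b) := fun m => by
    induction m with
    | zero => rfl
    | succ m ih => rw [ih, Function.iterate_succ_apply', ← symb_frobenius hc, map_one]
  rw [h n, symb_iterate_verschiebung hc]

theorem symb_comm (hc : IsCFamily c) (n : ℕ) (a b : WittVector p K) : symb p c n a b = - symb p c n b a := by
  have h := symb_cyclic hc n a b 1
  rw [symb_one_left hc, mul_one, one_mul, add_zero] at h
  exact eq_neg_of_add_eq_zero_left h

theorem symb_mul_right (hc : IsCFamily c) (n : ℕ) (a b d : WittVector p K) :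
    symb p c n a (b * d) = symb p c n (a * b) d + symb p c n (a * d) b := by
  have h := symb_cyclic hc n a b d
  rw [symb_comm hc n b, symb_comm hc n d, mul_comm d a] at h
  rw [← sub_eq_zero, ← h]
  abel

theorem nsmul_symb (hc : IsCFamily c) (n : ℕ) (a b : WittVector p K) : p ^ n • symb p c n a b = 0 := by
  induction n with
  | zero => 
    rw [pow_zero, one_smul, ← symb_zero_right hc 0 a]
    exact symb_congr rfl (by ext i; exact i.elim0)
  | succ n ih => rw [pow_succ, mul_smul, nsmul_symb_succ hc, ih]

theorem nsmul_symb_add (hc : IsCFamily c) (n m : ℕ) (a b : WittVector p K) :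
    p ^ m • symb p c (n + m) a b = symb p c n a b := by
  induction m with
  | zero => rw [pow_zero, one_smul, add_zero]
  | succ m ih => rw [pow_succ, mul_smul, ← add_assoc, nsmul_symb_succ hc, ih]

theorem symb_pow_right (hc : IsCFamily c) (n m : ℕ) (a b : WittVector p K) :
    symb p c n a (b ^ (m + 1)) = (m + 1) • symb p c n (a * b ^ m) b := by
  induction m generalizing a with
  | zero => simp
  | succ m ih => rw [pow_succ' b, symb_mul_right hc, ih, mul_assoc, ← pow_succ', succ_nsmul _ (m + 1)]

theorem _root_.WittVector.frobenius_teichmuller (x : K) :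
    frobenius (teichmuller p x) = teichmuller p (x ^ p) := by
  ext i
  rw [coeff_frobenius_charP]
  rcases i with _ | i
  · rw [teichmuller_coeff_zero, teichmuller_coeff_zero]
  · rw [teichmuller_coeff_pos _ _ _ i.succ_pos, teichmuller_coeff_pos _ _ _ i.succ_pos,
      zero_pow (Fact.out : p.Prime).ne_zero]

/-- The symbols satisfy the Artin–Schreier relation. -/
theorem symb_teichmuller (hc : IsCFamily c) (n : ℕ) (a b : K) (hb : b ≠ 0) :
    symb p c n ((frobenius (teichmuller p a) - teichmuller p a) * teichmuller p b⁻¹) (teichmuller p b) = 0 := by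
  obtain ⟨m, hm⟩ : ∃ m, p = m + 1 := Nat.exists_eq_succ_of_ne_zero (Fact.out : p.Prime).ne_zero
  have h1 : symb p c (n + 1) (frobenius (teichmuller p (a * b⁻¹))) (frobenius (teichmuller p b)) =
      symb p c n (teichmuller p (a * b⁻¹)) (teichmuller p b) := by
    rw [symb_frobenius hc, verschiebung_frobenius, ← nsmul_eq_mul', ← symbHom_apply hc, map_nsmul, symbHom_apply,
      nsmul_symb_succ hc]
  have h2 : symb p c (n + 1) (frobenius (teichmuller p (a * b⁻¹))) (frobenius (teichmuller p b)) =
      symb p c n (teichmuller p (a ^ p * b⁻¹)) (teichmuller p b) := by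
    have h3 : teichmuller p ((a * b⁻¹) ^ p) * teichmuller p b ^ m = teichmuller p (a ^ p * b⁻¹) := by
      rw [← map_pow, ← map_mul]
      congr 1
      rw [mul_pow, mul_assoc]
      congr 1
      conv_lhs => rw [hm]
      rw [pow_succ', mul_assoc, ← mul_pow, inv_mul_cancel₀ hb, one_pow, mul_one]
    rw [frobenius_teichmuller, frobenius_teichmuller, map_pow _ b]
    conv_lhs => rw [show teichmuller p b ^ p = teichmuller p b ^ (m + 1) from congrArg _ hm]
    rw [symb_pow_right hc, h3, ← hm, nsmul_symb_succ hc]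
  rw [sub_mul, frobenius_teichmuller, ← map_mul, ← map_mul, symb_sub_left hc, ← h1, ← h2, sub_self]

end Relations

end Br

section PairingDerivation

variable (R : Type u) [CommRing R] (B : Type v) [AddCommGroup B]

/-- The additive maps `R → B`, with `R` acting on the source. -/
def DualModule : Type (max u v) := R →+ B

instance : AddCommGroup (DualModule R B) := inferInstanceAs (AddCommGroup (R →+ B))

instance : Module R (DualModule R B) where
  smul r f := AddMonoidHom.comp (show R →+ B from f) (AddMonoidHom.mulLeft r)
  one_smul f := AddMonoidHom.ext fun x => congrArg (show R →+ B from f) (one_mul x)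
  mul_smul r s f := AddMonoidHom.ext fun x => congrArg (show R →+ B from f) (by
    change r * s * x = s * (r * x)
    ring)
  smul_zero r := rfl
  smul_add r f g := rfl
  add_smul r s f := AddMonoidHom.ext fun x => (congrArg (show R →+ B from f) (add_mul r s x)).trans (map_add _ _ _)
  zero_smul f := AddMonoidHom.ext fun x => (congrArg (show R →+ B from f) (zero_mul x)).trans (map_zero _)

variable {R B}

/-- The homomorphism on Kähler differentials attached to a biadditive map satisfying the Leibniz rule. -/
def KaehlerDifferential.liftPairing (s : R →+ R →+ B) (hs : ∀ a b d, s a (b * d) = s (a * b) d + s (a * d) b) :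
    KaehlerDifferential ℤ R →+ B :=
  let D : Derivation ℤ R (DualModule R B) :=
    { toFun := fun b => s.flip b
      map_add' := map_add _
      map_smul' := fun m b => map_zsmul _ m b
      map_one_eq_zero' := AddMonoidHom.ext fun a => by
        change s a 1 = 0
        simpa using hs a 1 1
      leibniz' := fun b d => AddMonoidHom.ext fun a => by
        change s a (b * d) = s (b * a) d + s (d * a) b
        rw [hs, mul_comm b, mul_comm d] }
  { toFun := fun ω => (show R →+ B from D.liftKaehlerDifferential ω) 1
    map_zero' := by rw [map_zero]; rfl
    map_add' := fun x y => by rw [map_add]; rfl }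

theorem KaehlerDifferential.liftPairing_smul_D (s : R →+ R →+ B)
    (hs : ∀ a b d, s a (b * d) = s (a * b) d + s (a * d) b) (a b : R) :
    liftPairing s hs (a • D ℤ R b) = s a b := by
  rw [liftPairing]
  simp only [AddMonoidHom.coe_mk, ZeroHom.coe_mk, map_smul, Derivation.liftKaehlerDifferential_comp_D]
  change s (a * 1) b = _
  rw [mul_one]

end PairingDerivation


section Omega

variable {p : ℕ} [Fact p.Prime] {c : ℕ+ → ℕ+ → MvPolynomial (ℕ+ ⊕ₗ ℕ+) ℤ} {K : Type u} [Field K]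

open WittVector KaehlerDifferential

theorem truncate_frobenius [CharP K p] (n : ℕ) (a : WittVector p K) :
    truncate n (frobenius a) = twFrob (truncate n a) := by
  ext i
  rw [coeff_truncate, coeff_frobenius_charP, twFrob, TruncatedWittVector.coeff_mk, coeff_truncate]

theorem truncate_verschiebung (n : ℕ) (a : WittVector p K) :
    truncate n (verschiebung a) = twVer (truncate n a) := by
  ext ⟨i, hi⟩
  rw [coeff_truncate, twVer, TruncatedWittVector.coeff_mk]
  rcases i with _ | i
  · rw [dif_pos rfl, verschiebung_coeff_zero]
  · rw [dif_neg (Nat.succ_ne_zero i), verschiebung_coeff_succ, coeff_truncate]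
    rfl

theorem truncate_teichmuller (n : ℕ) (a : K) : truncate n (teichmuller p a) = twTeich p n a := by
  ext ⟨i, hi⟩
  rw [coeff_truncate, twTeich, TruncatedWittVector.coeff_mk]
  rcases i with _ | i
  · rw [if_pos rfl, teichmuller_coeff_zero]
  · rw [if_neg (Nat.succ_ne_zero i), teichmuller_coeff_pos _ _ _ i.succ_pos]

namespace Br

variable [CharP K p]

/-- The symbol on truncated Witt vectors as a biadditive map. -/
def symbT (hc : IsCFamily c) (n : ℕ) : TruncatedWittVector p n K →+ TruncatedWittVector p n K →+ Br K :=
  AddMonoidHom.mk' (fun a => AddMonoidHom.mk' (fun b => Br.cls K (Asymb K p c n n a b)) fun b b' => by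
      obtain ⟨a, rfl⟩ := truncate_surjective p n K a
      obtain ⟨b, rfl⟩ := truncate_surjective p n K b
      obtain ⟨b', rfl⟩ := truncate_surjective p n K b'
      rw [← map_add]
      exact symb_add_right hc n a b b') fun a a' => by
    ext b
    obtain ⟨a, rfl⟩ := truncate_surjective p n K a
    obtain ⟨a', rfl⟩ := truncate_surjective p n K a'
    obtain ⟨b, rfl⟩ := truncate_surjective p n K b
    rw [← map_add]
    exact symb_add_left hc n a a' b

/-- The homomorphism `a·db ↦ ((a,b))` on differentials of truncated Witt vectors. -/
def omega (hc : IsCFamily c) (n : ℕ) : KaehlerDifferential ℤ (TruncatedWittVector p n K) →+ Br K :=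
  liftPairing (symbT hc n) fun a b d => by
    obtain ⟨a, rfl⟩ := truncate_surjective p n K a
    obtain ⟨b, rfl⟩ := truncate_surjective p n K b
    obtain ⟨d, rfl⟩ := truncate_surjective p n K d
    rw [← map_mul, ← map_mul, ← map_mul]
    exact symb_mul_right hc n a b d

theorem omega_smul_D (hc : IsCFamily c) (n : ℕ) (a b : TruncatedWittVector p n K) :
    omega hc n (a • D ℤ _ b) = Br.cls K (Asymb K p c n n a b) :=
  liftPairing_smul_D _ _ a b

theorem omega_truncate (hc : IsCFamily c) (n : ℕ) (a b : WittVector p K) :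
    omega hc n (truncate n a • D ℤ _ (truncate n b)) = symb p c n a b :=
  omega_smul_D hc n _ _

theorem symbolRelations_le_ker (hc : IsCFamily c) (n : ℕ) : symbolRelations p K n ≤ (omega hc n).ker := by
  refine (AddSubgroup.closure_le _).2 ?_
  rintro _ (⟨a, b, rfl⟩ | ⟨a, b, rfl⟩)
  · obtain ⟨a, rfl⟩ := truncate_surjective p n K a
    obtain ⟨b, rfl⟩ := truncate_surjective p n K b
    change omega hc n _ = 0
    rw [map_sub, ← truncate_frobenius, ← truncate_verschiebung, omega_truncate, omega_truncate, symb_frobenius hc, sub_self]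
  · change omega hc n _ = 0
    rw [← truncate_teichmuller, ← truncate_teichmuller, ← truncate_teichmuller, ← truncate_frobenius, ← map_sub, ← map_mul,
      omega_truncate, Units.val_inv_eq_inv_val, symb_teichmuller hc _ _ _ b.ne_zero]

end Br

theorem exists_omegaSum (n : ℕ) (ω : KaehlerDifferential ℤ (TruncatedWittVector p n K)) :
    ∃ L, omegaSum p K n L = ω := by
  have h := Submodule.mem_top (x := ω) (R := TruncatedWittVector p n K)
  rw [← span_range_derivation] at h
  induction h using Submodule.span_induction with
  | mem _ h =>
    obtain ⟨b, rfl⟩ := h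
    exact ⟨[(1, b)], by simp [omegaSum]⟩
  | zero => exact ⟨[], rfl⟩
  | add _ _ _ _ h h' =>
    obtain ⟨L, rfl⟩ := h
    obtain ⟨L', rfl⟩ := h'
    exact ⟨L ++ L', by simp [omegaSum]⟩
  | smul r _ _ h =>
    obtain ⟨L, rfl⟩ := h
    exact ⟨L.map fun x => (r * x.1, x.2), by simp [omegaSum, List.smul_sum, Function.comp_def, mul_smul]⟩

end Omega

section Relations

variable (p : ℕ) [Fact p.Prime] (K : Type u) [Field K]

open WittVector KaehlerDifferential

/-- The relations on differentials of `K` satisfied by the symbols of level one. -/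
def katoRelations : AddSubgroup (KaehlerDifferential ℤ K) :=
  AddSubgroup.closure ({x | ∃ a b : K, x = a ^ p • D ℤ K b} ∪
    {x | ∃ (a : K) (b : Kˣ), x = ((a ^ p - a) * (b : K)⁻¹) • D ℤ K (b : K)})

/-- The relations on differentials of Witt vectors satisfied by the symbols of level `n`. -/
def wittRelations (n : ℕ) : AddSubgroup (KaehlerDifferential ℤ (WittVector p K)) :=
  AddSubgroup.closure ({x | ∃ a b : WittVector p K, x = frobenius a • D ℤ _ b - a • D ℤ _ (verschiebung b)} ∪
    {x | ∃ (a : K) (b : Kˣ), x = ((frobenius (teichmuller p a) - teichmuller p a) * teichmuller p (b : K)⁻¹) •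
      D ℤ _ (teichmuller p (b : K))} ∪
    {x | ∃ a b : WittVector p K, x = verschiebung^[n] a • D ℤ _ b} ∪
    {x | ∃ a b : WittVector p K, x = a • D ℤ _ (verschiebung^[n] b)})

variable {p K}

namespace wittRelations

variable (n : ℕ)

theorem frobenius_mem (a b : WittVector p K) :
    frobenius a • D ℤ _ b - a • D ℤ _ (verschiebung b) ∈ wittRelations p K n :=
  AddSubgroup.subset_closure (Or.inl (Or.inl (Or.inl ⟨a, b, rfl⟩)))

theorem teichmuller_mem (a : K) (b : Kˣ) :
    ((frobenius (teichmuller p a) - teichmuller p a) * teichmuller p (b : K)⁻¹) •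
      D ℤ _ (teichmuller p (b : K)) ∈ wittRelations p K n :=
  AddSubgroup.subset_closure (Or.inl (Or.inl (Or.inr ⟨a, b, rfl⟩)))

theorem left_mem (a b : WittVector p K) : verschiebung^[n] a • D ℤ _ b ∈ wittRelations p K n :=
  AddSubgroup.subset_closure (Or.inl (Or.inr ⟨a, b, rfl⟩))

theorem right_mem (a b : WittVector p K) : a • D ℤ _ (verschiebung^[n] b) ∈ wittRelations p K n :=
  AddSubgroup.subset_closure (Or.inr ⟨a, b, rfl⟩)

theorem D_mem (b : WittVector p K) : D ℤ _ b ∈ wittRelations p K n := by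
  have h : ∀ m, D ℤ _ b - D ℤ _ (verschiebung^[m] b) ∈ wittRelations p K n := fun m => by
    induction m with
    | zero => simp
    | succ m ih =>
      have h1 := add_mem ih (frobenius_mem n 1 (verschiebung^[m] b))
      rwa [map_one, one_smul, one_smul, sub_add_sub_cancel, ← Function.iterate_succ_apply' (f := verschiebung)] at h1
  have h1 := right_mem n 1 b
  rw [one_smul] at h1
  simpa using add_mem (h n) h1

theorem smul_D_add_mem (a b : WittVector p K) : a • D ℤ _ b + b • D ℤ _ a ∈ wittRelations p K n := by
  rw [← Derivation.leibniz]
  exact D_mem n _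

variable [CharP K p]

theorem _root_.WittVector.exists_eq_add_verschiebung {K : Type*} [CommRing K] [CharP K p] {a b : WittVector p K}
    (h : a.coeff 0 = b.coeff 0) : ∃ d, a = b + verschiebung d := by
  have h := eq_iterate_verschiebung (x := a - b) (n := 1) fun i hi => by
    obtain rfl : i = 0 := by omega
    change constantCoeff (a - b) = 0
    rw [map_sub]
    exact sub_eq_zero.2 h
  exact ⟨_, (sub_eq_iff_eq_add'.1 h)⟩

theorem exists_nsmul_of_frobenius (a b : WittVector p K) : ∃ x, a • D ℤ _ (frobenius b) = p • x := by
  obtain ⟨d, hd⟩ := WittVector.exists_eq_add_verschiebung (teichmuller_coeff_zero p (b.coeff 0)).symm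
  rw [hd, map_add, frobenius_teichmuller, map_pow, frobenius_verschiebung, ← nsmul_eq_mul', map_add, map_nsmul,
    Derivation.leibniz_pow]
  exact ⟨a • (teichmuller p (b.coeff 0) ^ (p - 1) • D ℤ _ (teichmuller p (b.coeff 0)) + D ℤ _ d), by
    rw [← smul_add, smul_comm]⟩

theorem exists_nsmul_add {x : KaehlerDifferential ℤ (WittVector p K)} (hx : x ∈ wittRelations p K 1) :
    ∃ y, x - p • y ∈ wittRelations p K n := by
  have key (a b : WittVector p K) : ∃ y, a • D ℤ _ (verschiebung b) - p • y ∈ wittRelations p K n := by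
    obtain ⟨y, hy⟩ := exists_nsmul_of_frobenius b a
    refine ⟨-y, ?_⟩
    have h1 := sub_mem (smul_D_add_mem n (frobenius a) b) (frobenius_mem n a b)
    rw [hy] at h1
    convert h1 using 1
    rw [smul_neg]
    abel
  induction hx using AddSubgroup.closure_induction with
  | mem x h =>
    rcases h with ((⟨a, b, rfl⟩ | ⟨a, b, rfl⟩) | ⟨a, b, rfl⟩) | ⟨a, b, rfl⟩
    · exact ⟨0, by simpa using frobenius_mem n a b⟩
    · exact ⟨0, by simpa using teichmuller_mem n a b⟩
    · obtain ⟨y, hy⟩ := key b a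
      refine ⟨-y, ?_⟩
      have h1 := sub_mem (smul_D_add_mem n (verschiebung a) b) hy
      convert h1 using 1
      rw [smul_neg, Function.iterate_one]
      abel
    · exact key a b
  | zero => exact ⟨0, by simp⟩
  | add x x' _ _ h h' =>
    obtain ⟨y, hy⟩ := h
    obtain ⟨y', hy'⟩ := h'
    refine ⟨y + y', ?_⟩
    convert add_mem hy hy' using 1
    rw [smul_add]
    abel
  | neg x _ h =>
    obtain ⟨y, hy⟩ := h
    refine ⟨-y, ?_⟩
    convert neg_mem hy using 1
    rw [smul_neg]
    abel

theorem nsmul_mem_succ {x : KaehlerDifferential ℤ (WittVector p K)} (hx : x ∈ wittRelations p K n) :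
    p • x ∈ wittRelations p K (n + 1) := by
  have hV (a : WittVector p K) : p • verschiebung^[n] a = verschiebung^[n + 1] (frobenius a) := by
    rw [nsmul_eq_mul', ← verschiebung_frobenius, Function.iterate_succ_apply']
    congr 1
    exact (verschiebung_frobenius_comm.iterate_left n a).symm
  induction hx using AddSubgroup.closure_induction with
  | mem x h =>
    rcases h with ((⟨a, b, rfl⟩ | ⟨a, b, rfl⟩) | ⟨a, b, rfl⟩) | ⟨a, b, rfl⟩
    · exact nsmul_mem (frobenius_mem _ a b) p
    · exact nsmul_mem (teichmuller_mem _ a b) p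
    · rw [← smul_assoc, hV]
      exact left_mem (n + 1) _ _
    · rw [smul_comm, ← map_nsmul, hV]
      exact right_mem (n + 1) _ _
  | zero => rw [smul_zero]; exact zero_mem _
  | add x y _ _ hx hy => rw [smul_add]; exact add_mem hx hy
  | neg x _ hx => rw [smul_neg]; exact neg_mem hx

end wittRelations

namespace Br

variable {c : ℕ+ → ℕ+ → MvPolynomial (ℕ+ ⊕ₗ ℕ+) ℤ} (hc : IsCFamily c)

theorem symb_one_congr {a b a' b' : WittVector p K} (h : a.coeff 0 = a'.coeff 0) (h' : b.coeff 0 = b'.coeff 0) :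
    symb p c 1 a b = symb p c 1 a' b' :=
  symb_congr (by ext ⟨i, hi⟩; obtain rfl : i = 0 := by omega
                 simpa only [coeff_truncate] using h)
    (by ext ⟨i, hi⟩; obtain rfl : i = 0 := by omega
        simpa only [coeff_truncate] using h')

/-- The map on differentials induced by truncation of Witt vectors. -/
def omegaTruncate (n : ℕ) : KaehlerDifferential ℤ (WittVector p K) →+ KaehlerDifferential ℤ (TruncatedWittVector p n K) :=
  liftPairing (AddMonoidHom.mk' (fun a => AddMonoidHom.mk' (fun b => truncate n a • D ℤ (TruncatedWittVector p n K) (truncate n b))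
      fun b b' => by rw [map_add, map_add, smul_add]) fun a a' => by
    ext b
    change truncate n (a + a') • D ℤ (TruncatedWittVector p n K) (truncate n b) =
      truncate n a • D ℤ (TruncatedWittVector p n K) (truncate n b) +
        truncate n a' • D ℤ (TruncatedWittVector p n K) (truncate n b)
    rw [map_add, add_smul]) fun a b d => by
    change truncate n a • D ℤ (TruncatedWittVector p n K) (truncate n (b * d)) =
      truncate n (a * b) • D ℤ (TruncatedWittVector p n K) (truncate n d) +
        truncate n (a * d) • D ℤ (TruncatedWittVector p n K) (truncate n b)
    rw [map_mul (truncate n) b, map_mul (truncate n) a, map_mul (truncate n) a, Derivation.leibniz, smul_add, smul_smul, smul_smul]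

theorem omegaTruncate_smul_D (n : ℕ) (a b : WittVector p K) :
    omegaTruncate n (a • D ℤ _ b) = truncate n a • D ℤ _ (truncate n b) :=
  liftPairing_smul_D _ _ a b

theorem span_smul_D (R : Type*) [CommRing R] : AddSubgroup.closure {x | ∃ a b : R, x = a • D ℤ R b} = ⊤ := by
  refine (AddSubgroup.eq_top_iff' _).2 fun ω => ?_
  have h := Submodule.mem_top (x := ω) (R := R)
  rw [← span_range_derivation] at h
  have h1 : ∀ r : R, r • ω ∈ AddSubgroup.closure {x | ∃ a b : R, x = a • D ℤ R b} := by
    induction h using Submodule.span_induction with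
    | zero => simp
    | add _ _ _ _ h h' => exact fun r => by rw [smul_add]; exact add_mem (h r) (h' r)
    | smul s _ _ h => exact fun r => by rw [smul_smul]; exact h _
    | mem _ h =>
      obtain ⟨b, rfl⟩ := h
      exact fun r => AddSubgroup.subset_closure ⟨r, b, rfl⟩
  simpa using h1 1

theorem omegaTruncate_surjective (n : ℕ) (x : KaehlerDifferential ℤ (TruncatedWittVector p n K)) :
    ∃ y, omegaTruncate n y = x := by
  have h := AddSubgroup.mem_top x
  rw [← span_smul_D] at h
  induction h using AddSubgroup.closure_induction with
  | mem _ h =>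
    obtain ⟨a, b, rfl⟩ := h
    obtain ⟨a, rfl⟩ := truncate_surjective p n K a
    obtain ⟨b, rfl⟩ := truncate_surjective p n K b
    exact ⟨_, omegaTruncate_smul_D n a b⟩
  | zero => exact ⟨0, map_zero _⟩
  | add _ _ _ _ h h' =>
    obtain ⟨x, rfl⟩ := h
    obtain ⟨y, rfl⟩ := h'
    exact ⟨x + y, map_add _ _ _⟩
  | neg _ _ h =>
    obtain ⟨x, rfl⟩ := h
    exact ⟨-x, map_neg _ _⟩

variable [CharP K p]

/-- The symbol of level one as a biadditive map on `K`. -/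
def symbK : K →+ K →+ Br K :=
  AddMonoidHom.mk' (fun a => AddMonoidHom.mk' (fun b => symb p c 1 (teichmuller p a) (teichmuller p b)) fun b b' => by
      rw [← symb_add_right hc]
      exact symb_one_congr rfl (by simp only [add_coeff_zero, teichmuller_coeff_zero])) fun a a' => by
    ext b
    change _ = symb p c 1 _ _ + symb p c 1 _ _
    rw [← symb_add_left hc]
    exact symb_one_congr (by simp only [add_coeff_zero, teichmuller_coeff_zero]) rfl

theorem symbK_apply (a b : K) : symbK hc a b = symb p c 1 (teichmuller p a) (teichmuller p b) := rfl

theorem symb_one_eq_symbK (a b : WittVector p K) : symb p c 1 a b = symbK hc (a.coeff 0) (b.coeff 0) :=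
  symb_one_congr (teichmuller_coeff_zero p _).symm (teichmuller_coeff_zero p _).symm

/-- The homomorphism `a·db ↦ ((a,b))_p` on differentials of `K`. -/
def omegaK : KaehlerDifferential ℤ K →+ Br K :=
  liftPairing (symbK hc) fun a b d => by
    simp only [symbK_apply, map_mul, symb_mul_right hc]

theorem omegaK_smul_D (a b : K) : omegaK hc (a • D ℤ K b) = symbK hc a b := liftPairing_smul_D _ _ a b

/-- The homomorphism `a·db ↦ ((a,b))_{p^n}` on differentials of Witt vectors. -/
def omegaW (n : ℕ) : KaehlerDifferential ℤ (WittVector p K) →+ Br K :=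
  liftPairing (symbHom hc n) (symb_mul_right hc n)

theorem omegaW_smul_D (n : ℕ) (a b : WittVector p K) : omegaW hc n (a • D ℤ _ b) = symb p c n a b :=
  liftPairing_smul_D _ _ a b

theorem wittRelations_le_ker (n : ℕ) : wittRelations p K n ≤ (omegaW hc n).ker := by
  refine (AddSubgroup.closure_le _).2 ?_
  rintro _ (((⟨a, b, rfl⟩ | ⟨a, b, rfl⟩) | ⟨a, b, rfl⟩) | ⟨a, b, rfl⟩)
  · change omegaW hc n _ = 0
    rw [map_sub, omegaW_smul_D, omegaW_smul_D, symb_frobenius hc, sub_self]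
  · exact (omegaW_smul_D hc n _ _).trans (symb_teichmuller hc _ _ _ b.ne_zero)
  · refine (omegaW_smul_D hc n _ _).trans ?_
    rw [symb_comm hc, symb_iterate_verschiebung hc, neg_zero]
  · exact (omegaW_smul_D hc n _ _).trans (symb_iterate_verschiebung hc n a b)

theorem mk_smul_D_congr {a b a' b' : WittVector p K} (h : a.coeff 0 = a'.coeff 0) (h' : b.coeff 0 = b'.coeff 0) :
    (QuotientAddGroup.mk (a • D ℤ _ b) : KaehlerDifferential ℤ (WittVector p K) ⧸ wittRelations p K 1) =
      QuotientAddGroup.mk (a' • D ℤ _ b') := by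
  obtain ⟨d, rfl⟩ := WittVector.exists_eq_add_verschiebung h
  obtain ⟨e, rfl⟩ := WittVector.exists_eq_add_verschiebung h'
  refine (QuotientAddGroup.eq_iff_sub_mem.2 ?_)
  convert add_mem (wittRelations.left_mem 1 d (b' + verschiebung e)) (wittRelations.right_mem 1 a' e) using 1
  rw [Function.iterate_one, map_add, add_smul, smul_add, smul_add]
  abel

/-- The map `a·db ↦ [a]·d[b]` to differentials of Witt vectors modulo relations. -/
def liftK : KaehlerDifferential ℤ K →+ KaehlerDifferential ℤ (WittVector p K) ⧸ wittRelations p K 1 :=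
  liftPairing (AddMonoidHom.mk' (fun a => AddMonoidHom.mk' (fun b =>
      QuotientAddGroup.mk (teichmuller p a • D ℤ _ (teichmuller p b))) fun b b' => by
        rw [← QuotientAddGroup.mk_add, ← smul_add, ← map_add]
        exact mk_smul_D_congr rfl (by simp only [add_coeff_zero, teichmuller_coeff_zero])) fun a a' => by
      ext b
      change _ = (QuotientAddGroup.mk (teichmuller p a • D ℤ _ (teichmuller p b)) :
        KaehlerDifferential ℤ (WittVector p K) ⧸ wittRelations p K 1) +
          QuotientAddGroup.mk (teichmuller p a' • D ℤ _ (teichmuller p b))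
      rw [← QuotientAddGroup.mk_add, ← add_smul]
      exact mk_smul_D_congr (by simp only [add_coeff_zero, teichmuller_coeff_zero]) rfl) fun a b d => by
    change (QuotientAddGroup.mk (teichmuller p a • D ℤ _ (teichmuller p (b * d))) :
        KaehlerDifferential ℤ (WittVector p K) ⧸ wittRelations p K 1) =
      QuotientAddGroup.mk (teichmuller p (a * b) • D ℤ _ (teichmuller p d)) +
        QuotientAddGroup.mk (teichmuller p (a * d) • D ℤ _ (teichmuller p b))
    rw [← QuotientAddGroup.mk_add, map_mul (teichmuller p) b, map_mul (teichmuller p) a, map_mul (teichmuller p) a,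
      Derivation.leibniz, smul_add, smul_smul, smul_smul]

theorem liftK_smul_D (a b : K) : liftK (p := p) (a • D ℤ K b) =
    QuotientAddGroup.mk (teichmuller p a • D ℤ _ (teichmuller p b)) := liftPairing_smul_D _ _ a b

theorem katoRelations_le_ker : katoRelations p K ≤ (liftK (p := p) (K := K)).ker := by
  refine (AddSubgroup.closure_le _).2 ?_
  rintro _ (⟨a, b, rfl⟩ | ⟨a, b, rfl⟩)
  · refine (liftK_smul_D _ b).trans ((QuotientAddGroup.eq_zero_iff _).2 ?_)
    have h := add_mem (wittRelations.frobenius_mem 1 (teichmuller p a) (teichmuller p b))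
      (wittRelations.right_mem 1 (teichmuller p a) (teichmuller p b))
    rwa [Function.iterate_one, sub_add_cancel, frobenius_teichmuller] at h
  · refine (liftK_smul_D _ _).trans ?_
    rw [← (QuotientAddGroup.eq_zero_iff _).2 (wittRelations.teichmuller_mem 1 a b)]
    refine mk_smul_D_congr ?_ rfl
    rw [teichmuller_coeff_zero, mul_coeff_zero, frobenius_teichmuller]
    have h := map_sub (constantCoeff : WittVector p K →+* K) (teichmuller p (a ^ p)) (teichmuller p a)
    simp only [constantCoeff_apply, teichmuller_coeff_zero] at h
    rw [h, teichmuller_coeff_zero]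

theorem mem_wittRelations_one (hK : (omegaK (p := p) (K := K) hc).ker ≤ katoRelations p K)
    {x : KaehlerDifferential ℤ (WittVector p K)} (hx : omegaW hc 1 x = 0) : x ∈ wittRelations p K 1 := by
  have hex : ∀ x : KaehlerDifferential ℤ (WittVector p K),
      ∃ η : KaehlerDifferential ℤ K, liftK η = QuotientAddGroup.mk x ∧ omegaK hc η = omegaW hc 1 x := fun x => by
    have h := AddSubgroup.mem_top x
    rw [← span_smul_D] at h
    induction h using AddSubgroup.closure_induction with
    | mem _ h =>
      obtain ⟨a, b, rfl⟩ := h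
      refine ⟨a.coeff 0 • D ℤ K (b.coeff 0), ?_, ?_⟩
      · rw [liftK_smul_D]
        exact mk_smul_D_congr (teichmuller_coeff_zero p _) (teichmuller_coeff_zero p _)
      · rw [omegaK_smul_D, omegaW_smul_D, symb_one_eq_symbK]
    | zero => exact ⟨0, by simp, by simp⟩
    | add x y _ _ h h' =>
      obtain ⟨η, hη, h1⟩ := h
      obtain ⟨θ, hθ, h2⟩ := h'
      exact ⟨η + θ, by rw [map_add, hη, hθ]; rfl, by rw [map_add, map_add, h1, h2]⟩
    | neg x _ h =>
      obtain ⟨η, hη, h1⟩ := h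
      exact ⟨-η, by rw [map_neg, hη]; rfl, by rw [map_neg, map_neg, h1]⟩
  obtain ⟨η, h1, h2⟩ := hex x
  rw [← QuotientAddGroup.eq_zero_iff, ← h1]
  exact katoRelations_le_ker (hK (h2.trans hx))

theorem nsmul_omegaW_add (n m : ℕ) (x : KaehlerDifferential ℤ (WittVector p K)) :
    p ^ m • omegaW hc (n + m) x = omegaW hc n x := by
  have h := AddSubgroup.mem_top x
  rw [← span_smul_D] at h
  induction h using AddSubgroup.closure_induction with
  | mem _ h =>
    obtain ⟨a, b, rfl⟩ := h
    rw [omegaW_smul_D, omegaW_smul_D, nsmul_symb_add hc]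
  | zero => simp
  | add _ _ _ _ h h' => rw [map_add, smul_add, h, h', map_add]
  | neg _ _ h => rw [map_neg, smul_neg, h, map_neg]

theorem mem_wittRelations (hK : (omegaK (p := p) (K := K) hc).ker ≤ katoRelations p K) (n : ℕ) :
    ∀ x : KaehlerDifferential ℤ (WittVector p K), omegaW hc (n + 1) x = 0 → x ∈ wittRelations p K (n + 1) := by
  induction n with
  | zero => exact fun x hx => mem_wittRelations_one hc hK hx
  | succ n ih => 
    intro x hx
    have h1 : x ∈ wittRelations p K 1 := mem_wittRelations_one hc hK (by
      have h := nsmul_omegaW_add hc 1 (n + 1) x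
      rwa [add_comm 1 (n + 1), hx, smul_zero, eq_comm] at h)
    obtain ⟨y, hy⟩ := wittRelations.exists_nsmul_add (n + 1 + 1) h1
    have h2 : omegaW hc (n + 1 + 1) (x - p • y) = 0 := wittRelations_le_ker hc _ hy
    rw [map_sub, hx, zero_sub, neg_eq_zero, map_nsmul] at h2
    have h3 := ih y (by
      have h := nsmul_omegaW_add hc (n + 1) 1 y
      rwa [pow_one, h2, eq_comm] at h)
    simpa using add_mem hy (wittRelations.nsmul_mem_succ _ h3)

theorem exists_omegaW (hK : ∀ β : Br K, p • β = 0 → ∃ η, omegaK (p := p) hc η = β) (n : ℕ) :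
    ∀ β : Br K, p ^ n • β = 0 → ∃ x, omegaW (p := p) hc n x = β := by
  have hW : ∀ η : KaehlerDifferential ℤ K, ∃ x, omegaW (p := p) hc 1 x = omegaK (p := p) hc η := fun η => by
    have h := AddSubgroup.mem_top η
    rw [← span_smul_D] at h
    induction h using AddSubgroup.closure_induction with
    | mem _ h =>
      obtain ⟨a, b, rfl⟩ := h
      exact ⟨teichmuller p a • D ℤ (WittVector p K) (teichmuller p b), by rw [omegaW_smul_D, omegaK_smul_D, symbK_apply]⟩
    | zero => exact ⟨0, by simp⟩
    | add _ _ _ _ h h' =>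
      obtain ⟨x, hx⟩ := h
      obtain ⟨y, hy⟩ := h'
      exact ⟨x + y, by rw [map_add, map_add, hx, hy]⟩
    | neg _ _ h =>
      obtain ⟨x, hx⟩ := h
      exact ⟨-x, by rw [map_neg, map_neg, hx]⟩
  induction n with
  | zero => exact fun β hβ => ⟨0, by rwa [map_zero, eq_comm, ← one_smul ℕ β, ← pow_zero p]⟩
  | succ n ih =>
    intro β hβ
    have hn (x : KaehlerDifferential ℤ (WittVector p K)) : p ^ n • omegaW hc (n + 1) x = omegaW hc 1 x := by
      have h := nsmul_omegaW_add hc 1 n x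
      rwa [add_comm 1 n] at h
    have hp (x : KaehlerDifferential ℤ (WittVector p K)) : p • omegaW hc (n + 1) x = omegaW hc n x := by
      have h := nsmul_omegaW_add hc n 1 x
      rwa [pow_one] at h
    obtain ⟨η, hη⟩ := hK (p ^ n • β) (by rw [smul_smul, ← pow_succ', hβ])
    obtain ⟨x, hx⟩ := hW η
    obtain ⟨z, hz⟩ := ih (β - omegaW hc (n + 1) x) (by
      rw [smul_sub, hn, hx, hη, sub_self])
    refine ⟨x + p • z, ?_⟩
    rw [map_add, map_nsmul, hp, hz, add_sub_cancel]

theorem omega_omegaTruncate (n : ℕ) (x : KaehlerDifferential ℤ (WittVector p K)) :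
    omega hc n (omegaTruncate n x) = omegaW hc n x := by
  have h := AddSubgroup.mem_top x
  rw [← span_smul_D] at h
  induction h using AddSubgroup.closure_induction with
  | mem _ h =>
    obtain ⟨a, b, rfl⟩ := h
    rw [omegaTruncate_smul_D, omega_truncate, omegaW_smul_D]
  | zero => rw [map_zero, map_zero, map_zero]
  | add _ _ _ _ h h' => rw [map_add, map_add, h, h', map_add]
  | neg _ _ h => rw [map_neg, map_neg, h, map_neg]

theorem omegaTruncate_mem (n : ℕ) {x : KaehlerDifferential ℤ (WittVector p K)} (hx : x ∈ wittRelations p K n) :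
    omegaTruncate n x ∈ symbolRelations p K n := by
  induction hx using AddSubgroup.closure_induction with
  | mem x h =>
    rcases h with ((⟨a, b, rfl⟩ | ⟨a, b, rfl⟩) | ⟨a, b, rfl⟩) | ⟨a, b, rfl⟩
    · refine AddSubgroup.subset_closure (Or.inl ⟨truncate n a, truncate n b, ?_⟩)
      rw [map_sub, omegaTruncate_smul_D, omegaTruncate_smul_D, truncate_frobenius, truncate_verschiebung]
    · refine AddSubgroup.subset_closure (Or.inr ⟨a, b, ?_⟩)
      rw [omegaTruncate_smul_D, map_mul, map_sub, truncate_frobenius, truncate_teichmuller, truncate_teichmuller,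
        truncate_teichmuller, Units.val_inv_eq_inv_val]
    · rw [omegaTruncate_smul_D, truncate_iterate_verschiebung, zero_smul]
      exact zero_mem _
    · rw [omegaTruncate_smul_D, truncate_iterate_verschiebung, map_zero, smul_zero]
      exact zero_mem _
  | zero => rw [map_zero]; exact zero_mem _
  | add x y _ _ hx hy => rw [map_add]; exact add_mem hx hy
  | neg x _ hx => rw [map_neg]; exact neg_mem hx

theorem omega_ker (hK : (omegaK (p := p) (K := K) hc).ker ≤ katoRelations p K) {n : ℕ} (hn : 1 ≤ n) :
    (omega (K := K) hc n).ker = symbolRelations p K n := by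
  refine le_antisymm (fun x hx => ?_) (symbolRelations_le_ker hc n)
  obtain ⟨y, rfl⟩ := omegaTruncate_surjective n x
  have h : omegaW hc n y = 0 := (omega_omegaTruncate hc n y).symm.trans hx
  obtain ⟨m, rfl⟩ := Nat.exists_eq_add_of_le' hn
  exact omegaTruncate_mem _ (mem_wittRelations hc hK m y h)

theorem exists_omega (hK : ∀ β : Br K, p • β = 0 → ∃ η, omegaK (p := p) hc η = β) (n : ℕ) (β : Br K) (hβ : p ^ n • β = 0) :
    ∃ x, omega (p := p) hc n x = β := by
  obtain ⟨x, rfl⟩ := exists_omegaW hc hK n β hβ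
  exact ⟨_, omega_omegaTruncate hc n x⟩

end Br

end Relations

section Commutator

variable {S : Type*} [Ring S]

/-- The homogeneous components of `(x + f) ^ n` with respect to the degree in `f`. -/
def powComponent (x f : S) : ℕ → ℕ → S
  | 0, 0 => 1
  | 0, _ + 1 => 0
  | n + 1, 0 => x * powComponent x f n 0
  | n + 1, k + 1 => x * powComponent x f n (k + 1) + f * powComponent x f n k

theorem powComponent_of_lt (x f : S) (n k : ℕ) (h : n < k) : powComponent x f n k = 0 := by
  induction n generalizing k with
  | zero => obtain ⟨k, rfl⟩ := Nat.exists_eq_succ_of_ne_zero h.ne'; rfl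
  | succ n ih =>
    obtain ⟨k, rfl⟩ := Nat.exists_eq_succ_of_ne_zero (Nat.ne_zero_of_lt h)
    rw [Nat.succ_eq_add_one, powComponent, ih _ (by omega), ih _ (by omega), mul_zero, mul_zero, add_zero]

theorem powComponent_zero (x f : S) (n : ℕ) : powComponent x f n 0 = x ^ n := by
  induction n with
  | zero => rw [powComponent, pow_zero]
  | succ n ih => rw [powComponent, ih, pow_succ']

theorem powComponent_self (x f : S) (n : ℕ) : powComponent x f n n = f ^ n := by
  induction n with
  | zero => rw [powComponent, pow_zero]
  | succ n ih => rw [powComponent, ih, powComponent_of_lt x f n (n + 1) (by omega), mul_zero, zero_add, pow_succ']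

theorem add_pow_eq_sum_powComponent (x f : S) (n : ℕ) :
    (x + f) ^ n = ∑ k ∈ Finset.range (n + 1), powComponent x f n k := by
  induction n with
  | zero => rw [pow_zero, zero_add, Finset.sum_range_one, powComponent]
  | succ n ih =>
    rw [pow_succ', ih, add_mul, Finset.sum_range_succ' _ (n + 1)]
    simp only [powComponent, Finset.sum_add_distrib, Finset.mul_sum]
    rw [Finset.sum_range_succ (fun k => x * powComponent x f n (k + 1)), powComponent_of_lt x f n (n + 1) (by omega),
      mul_zero, add_zero, Finset.sum_range_succ' (fun k => x * powComponent x f n k)]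
    abel

theorem factorial_smul_powComponent {x h f : S} (hf : x * h - h * x = f) (hfh : Commute f h) (n k : ℕ) :
    (k.factorial : ℤ) • powComponent x f n k = (fun z => z * h - h * z)^[k] (x ^ n) := by
  have hx (z : S) (k : ℕ) : (fun z => z * h - h * z)^[k + 1] (x * z) =
      x * (fun z => z * h - h * z)^[k + 1] z + ((k + 1 : ℕ) : ℤ) • (f * (fun z => z * h - h * z)^[k] z) := by
    induction k with
    | zero =>
      simp only [zero_add, Function.iterate_one, Function.iterate_zero, id_eq, Nat.cast_one, one_smul, ← hf]
      noncomm_ring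
    | succ k ih =>
      rw [Function.iterate_succ_apply', ih]
      simp only [Function.iterate_succ_apply' _ (k + 1), Function.iterate_succ_apply' _ k]
      generalize (fun z => z * h - h * z)^[k] z = w
      push_cast
      have h1 : h * f = f * h := hfh.eq.symm
      have h2 : x * h = h * x + f := by rw [← hf]; abel
      have h3 (z : S) : h * (f * z) = f * (h * z) := by rw [← mul_assoc, h1, mul_assoc]
      have h4 (z : S) : h * (x * z) = x * (h * z) - f * z := by
        rw [← mul_assoc, ← mul_assoc x, h2, add_mul, add_sub_cancel_right]
      simp only [add_mul, sub_mul, mul_sub, mul_add, smul_mul_assoc, mul_smul_comm, mul_assoc, h3, h4, add_smul,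
        one_smul, smul_sub]
      abel
  induction n generalizing k with
  | zero =>
    rcases k with _ | k
    · simp [powComponent]
    · have h0 : (fun z => z * h - h * z)^[k + 1] (1 : S) = 0 := by
        rw [Function.iterate_succ_apply, one_mul, mul_one, sub_self]
        exact Function.iterate_fixed (by simp) k
      rw [pow_zero, h0, powComponent, smul_zero]
  | succ n ih =>
    rcases k with _ | k
    · simp [powComponent_zero]
    · rw [pow_succ', hx, ← ih, ← ih, powComponent, smul_add, mul_smul_comm, mul_smul_comm, smul_smul,
        ← Nat.cast_mul, ← Nat.factorial_succ]

/-- If `f = [x, h]` commutes with `h` and `x ^ p` commutes with `h`, then `(x + f) ^ p = x ^ p + f ^ p`. -/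
theorem add_commutator_pow_char (p : ℕ) [Fact p.Prime] [CharP S p] {x h f : S} (hf : x * h - h * x = f)
    (hfh : Commute f h) (hxp : Commute (x ^ p) h) : (x + f) ^ p = x ^ p + f ^ p := by
  have hp : p.Prime := Fact.out
  rw [add_pow_eq_sum_powComponent, Finset.sum_range_succ, powComponent_self, Finset.sum_eq_single_of_mem 0,
    powComponent_zero]
  · exact Finset.mem_range.2 hp.pos
  · intro k hk hk0
    obtain ⟨k, rfl⟩ := Nat.exists_eq_succ_of_ne_zero hk0
    have h1 := factorial_smul_powComponent hf hfh p (k + 1)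
    rw [Function.iterate_succ_apply, hxp.eq, sub_self, Function.iterate_fixed (by simp) k] at h1
    have h2 : IsUnit ((((k + 1).factorial : ℕ) : ℤ) : S) := by
      have h3 : IsUnit (((k + 1).factorial : ℕ) : ZMod p) := by
        rw [ZMod.isUnit_iff_coprime, Nat.coprime_comm, Nat.coprime_iff_gcd_eq_one, ← Nat.coprime_iff_gcd_eq_one,
          hp.coprime_iff_not_dvd, hp.dvd_factorial]
        have := Finset.mem_range.1 hk
        omega
      simpa using h3.map (ZMod.castHom dvd_rfl S)
    rw [zsmul_eq_mul] at h1
    exact h2.mul_right_eq_zero.1 h1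

end Commutator

section Logarithmic

variable {p : ℕ} {K : Type*} [Field K]

theorem prod_range_add_natCast [Fact p.Prime] [CharP K p] (x : K) : ∏ k ∈ Finset.range p, (x + k) = x ^ p - x := by
  have hp : p.Prime := Fact.out
  have h : (Polynomial.X ^ p - Polynomial.X : Polynomial (ZMod p)) = ∏ a : ZMod p, (Polynomial.X - Polynomial.C a) := by
    have hr := FiniteField.roots_X_pow_card_sub_X (ZMod p)
    rw [ZMod.card] at hr
    have hd : (Polynomial.X ^ p - Polynomial.X : Polynomial (ZMod p)).natDegree = p :=
      FiniteField.X_pow_card_sub_X_natDegree_eq (ZMod p) hp.one_lt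
    rw [← Polynomial.prod_multiset_X_sub_C_of_monic_of_roots_card_eq (Polynomial.monic_X_pow_sub
      (by rw [Polynomial.degree_X]; exact_mod_cast hp.one_lt)) (by rw [hr, hd]; simp), hr]
    rfl
  have h1 := congrArg (Polynomial.eval₂ (ZMod.castHom (dvd_refl p) K) x) h
  rw [Polynomial.eval₂_sub, Polynomial.eval₂_pow, Polynomial.eval₂_X, Polynomial.eval₂_finsetProd] at h1
  rw [h1, ← Equiv.prod_comp (Equiv.neg (ZMod p)), eq_comm]
  have : NeZero p := ⟨hp.ne_zero⟩
  refine Finset.prod_bij' (fun a _ => a.val) (fun k _ => (k : ZMod p)) (fun a _ => Finset.mem_range.2 a.val_lt)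
    (fun _ _ => Finset.mem_univ _) (fun a _ => ZMod.natCast_zmod_val a)
    (fun k hk => ZMod.val_cast_of_lt (Finset.mem_range.1 hk)) fun a _ => ?_
  rw [Equiv.neg_apply, Polynomial.eval₂_sub, Polynomial.eval₂_X, Polynomial.eval₂_C, map_neg, sub_neg_eq_add,
    ← ZMod.natCast_zmod_val a, map_natCast, ZMod.natCast_zmod_val]

theorem pow_mul_pow_apply [Fact p.Prime] [CharP K p] {V : Type*} [AddCommGroup V] [Module K V] {x y : Module.End K V} (h : y * x = x * y + 1)
    {v : V} {l : K} (hv : y (x v) = l • v) : (y ^ p * x ^ p) v = (l ^ p - l) • v := by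
  have hx (n : ℕ) : y * x * x ^ n = x ^ n * (y * x + (n : Module.End K V)) := by
    induction n with
    | zero => simp
    | succ n ih =>
      rw [pow_succ, ← mul_assoc, ih, mul_assoc, mul_assoc, add_mul, mul_assoc, (Nat.cast_commute n x).eq]
      have h1 : y * (x * x) = x * (y * x) + x := by
        rw [← mul_assoc, show y * x * x = (x * y + 1) * x by rw [h], add_mul, one_mul, mul_assoc]
      rw [h1, Nat.cast_succ]
      noncomm_ring
  have key (n : ℕ) : (y ^ n * x ^ n) v = (∏ k ∈ Finset.range n, (l + k)) • v := by
    induction n with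
    | zero => simp
    | succ n ih =>
      have h1 : y ^ (n + 1) * x ^ (n + 1) = y ^ n * x ^ n * (y * x + (n : Module.End K V)) := by
        rw [mul_assoc, ← hx, pow_succ y, pow_succ' x]
        simp only [mul_assoc]
      have h2 : (y * x + (n : Module.End K V)) v = (l + n) • v := by
        rw [LinearMap.add_apply, Module.End.mul_apply, hv, Module.End.natCast_apply, add_smul, Nat.cast_smul_eq_nsmul]
      rw [h1, Module.End.mul_apply, h2, map_smul, ih, smul_smul, Finset.prod_range_succ, mul_comm]
  rw [key, prod_range_add_natCast]

section Representation

variable {ι : Type*} [Fintype ι] [DecidableEq ι]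

open MvPolynomial

/-- The polynomial of degree less than `p` in each variable with coefficients `g`. -/
def reducedPoly (g : (ι → Fin p) → K) : MvPolynomial ι K := ∑ α, C (g α) * ∏ i, X i ^ (α i : ℕ)

theorem reducedPoly_sub (g h : (ι → Fin p) → K) :
    reducedPoly (fun α => g α - h α) = reducedPoly g - reducedPoly h := by
  simp only [reducedPoly, map_sub, sub_mul, Finset.sum_sub_distrib]

theorem reducedPoly_single [NeZero p] (r : K) :
    reducedPoly (p := p) (fun α : ι → Fin p => if α = 0 then r else 0) = C r := by
  rw [reducedPoly, Finset.sum_eq_single 0 (fun α _ h => by rw [if_neg h, map_zero, zero_mul])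
    (fun h => (h (Finset.mem_univ _)).elim), if_pos rfl]
  simp

theorem X_mul_pderiv_reducedPoly (g : (ι → Fin p) → K) (i : ι) :
    X i * pderiv i (reducedPoly g) = reducedPoly fun α => ((α i : ℕ) : K) * g α := by
  have key (α : ι → Fin p) : X i * pderiv i (∏ j, X j ^ (α j : ℕ) : MvPolynomial ι K) =
      C ((α i : ℕ) : K) * ∏ j, X j ^ (α j : ℕ) := by
    have h : (∏ j, X j ^ (α j : ℕ) : MvPolynomial ι K) =
        monomial (Finsupp.equivFunOnFinite.symm fun j => (α j : ℕ)) 1 := by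
      rw [monomial_eq, map_one, one_mul, Finsupp.prod_fintype _ _ (fun _ => pow_zero _)]
      rfl
    rw [h, X_mul_pderiv_monomial, nsmul_eq_mul, map_natCast]
    rfl
  simp only [reducedPoly, map_sum, Finset.mul_sum, pderiv_C_mul]
  refine Finset.sum_congr rfl fun α _ => ?_
  rw [mul_left_comm, key, ← mul_assoc, ← map_mul, mul_comm (g α)]

theorem reducedPoly_pow [Fact p.Prime] [CharP K p] (g : (ι → Fin p) → K) : reducedPoly g ^ p = ∑ α, C (g α ^ p) * ∏ i, (X i ^ p) ^ (α i : ℕ) := by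
  rw [reducedPoly, sum_pow_char]
  refine Finset.sum_congr rfl fun α _ => ?_
  rw [mul_pow, ← map_pow, ← Finset.prod_pow]
  simp only [← pow_mul, mul_comm]

variable {V : Type*} [AddCommGroup V] [Module K V]

theorem exists_logarithmic [Fact p.Prime] [CharP K p] {a b : ι → K} {x y : ι → Module.End K V} (hxx : ∀ i j, Commute (x i) (x j))
    (hyy : ∀ i j, Commute (y i) (y j)) (hxy : ∀ i j, y i * x j = x j * y i + if i = j then 1 else 0)
    (hx : ∀ i, x i ^ p = algebraMap K _ (a i)) (hy : ∀ i, y i ^ p = algebraMap K _ (b i)) (hb0 : ∀ i, b i ≠ 0)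
    (hb : ∀ g : (ι → Fin p) → K, ∑ α, g α ^ p * ∏ i, b i ^ (α i : ℕ) = 0 → g = 0)
    (hV : Module.finrank K V = p ^ Fintype.card ι) :
    ∃ (l : ι → K) (h : (ι → Fin p) → K), ∀ i,
      b i * a i = l i ^ p - l i + ∑ α, ((α i : ℕ) : K) * h α ^ p * ∏ j, b j ^ (α j : ℕ) := by
  have hp : p.Prime := Fact.out
  have : NeZero p := ⟨hp.ne_zero⟩
  have hVpos : 0 < Module.finrank K V := by rw [hV]; exact pow_pos hp.pos _
  have : Nontrivial V := Module.nontrivial_of_finrank_pos hVpos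
  have : FiniteDimensional K V := FiniteDimensional.of_finrank_pos hVpos
  have : CharP (Module.End K V) p := charP_of_injective_algebraMap (FaithfulSMul.algebraMap_injective K (Module.End K V)) p
  obtain ⟨v, hv⟩ := exists_ne (0 : V)
  let φ := commEval K y hyy
  have hφX (i : ι) : φ (X i) = y i := commEval_X y hyy i
  have hφC (r : K) : φ (C r) = algebraMap K _ r := φ.commutes r
  have hφ (f g : MvPolynomial ι K) : Commute (φ f) (φ g) := by
    rw [Commute, SemiconjBy, ← map_mul, ← map_mul, mul_comm]
  have hpow (g : (ι → Fin p) → K) : φ (reducedPoly g) ^ p = algebraMap K _ (∑ α, g α ^ p * ∏ i, b i ^ (α i : ℕ)) := by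
    have h1 (s : Finset ι) (α : ι → Fin p) :
        φ (∏ i ∈ s, (X i ^ p) ^ (α i : ℕ)) = algebraMap K _ (∏ i ∈ s, b i ^ (α i : ℕ)) := by
      induction s using Finset.induction_on with
      | empty => rw [Finset.prod_empty, Finset.prod_empty, map_one, map_one]
      | insert i s hi ih =>
        rw [Finset.prod_insert hi, Finset.prod_insert hi, map_mul, ih, map_pow, map_pow, hφX, hy, map_mul, map_pow]
    rw [← map_pow, reducedPoly_pow, map_sum, map_sum]
    exact Finset.sum_congr rfl fun α _ => by rw [map_mul, h1, hφC, map_mul]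
  have hinj (g : (ι → Fin p) → K) (hg : φ (reducedPoly g) v = 0) : g = 0 := by
    refine hb g ?_
    have h1 : (φ (reducedPoly g) ^ p) v = 0 := by
      rw [← pow_sub_one_mul hp.ne_zero, Module.End.mul_apply, hg, map_zero]
    rw [hpow, Module.algebraMap_end_apply] at h1
    exact (smul_eq_zero.1 h1).resolve_right hv
  have happ (g : (ι → Fin p) → K) :
      φ (reducedPoly g) v = Fintype.linearCombination K (fun α => φ (∏ i, X i ^ ((α : ι → Fin p) i : ℕ)) v) g := by
    rw [Fintype.linearCombination_apply, reducedPoly, map_sum, LinearMap.sum_apply]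
    refine Finset.sum_congr rfl fun α _ => ?_
    rw [map_mul, hφC, Module.End.mul_apply, Module.algebraMap_end_apply]
  have hsurj (w : V) : ∃ g : (ι → Fin p) → K, φ (reducedPoly g) v = w := by
    have hbij := LinearMap.injective_iff_surjective_of_finrank_eq_finrank
      (f := Fintype.linearCombination K (fun α => φ (∏ i, X i ^ ((α : ι → Fin p) i : ℕ)) v))
      (by rw [Module.finrank_fintype_fun_eq_card, hV]; simp)
    obtain ⟨g, hg⟩ := hbij.1 ((injective_iff_map_eq_zero _).2 fun g hg => hinj g (by rw [happ, hg])) w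
    exact ⟨g, by rw [happ, hg]⟩
  have hz (i : ι) (f : MvPolynomial ι K) :
      y i * x i * φ f - φ f * (y i * x i) = -φ (X i * pderiv i f) := by
    have h1 (k : ι) : y i * x i * y k - y k * (y i * x i) = -if i = k then y i else 0 := by
      rw [← mul_assoc, (hyy k i).eq, mul_assoc, mul_assoc, hxy k i, mul_add, ← sub_sub, sub_self, zero_sub]
      rcases eq_or_ne i k with rfl | hik
      · simp
      · rw [if_neg hik, if_neg hik.symm, mul_zero]
    have h2 := commEval_commutator y hyy (y i * x i) (fun k l => by
      rw [h1]
      split_ifs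
      · exact (hyy _ _).neg_left
      · rw [neg_zero]; exact Commute.zero_left _) f
    refine h2.trans ?_
    rw [Finset.sum_eq_single i (fun k _ hk => by rw [h1, if_neg hk.symm, neg_zero, mul_zero])
      (fun h => (h (Finset.mem_univ _)).elim), h1, if_pos rfl, mul_neg, map_mul, hφX, ← hφX, (hφ _ _).eq]
  choose q hq using fun i => hsurj ((y i * x i) v)
  have hzz (i j : ι) : Commute (y i * x i) (y j * x j) := by
    rcases eq_or_ne i j with rfl | hij
    · exact Commute.refl _
    · have h1 : Commute (y i) (x j) := by have := hxy i j; rwa [if_neg hij, add_zero] at this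
      have h2 : Commute (y j) (x i) := by have := hxy j i; rwa [if_neg hij.symm, add_zero] at this
      exact ((hyy i j).mul_right h1).mul_left (h2.symm.mul_right (hxx i j))
  have hzφ (i : ι) (g : (ι → Fin p) → K) : (y i * x i) (φ (reducedPoly g) v) =
      φ (reducedPoly g) (φ (reducedPoly (q i)) v) - φ (reducedPoly fun α => ((α i : ℕ) : K) * g α) v := by
    have h1 := congrArg (fun f : Module.End K V => f v) (hz i (reducedPoly g))
    simp only [LinearMap.sub_apply, LinearMap.neg_apply, X_mul_pderiv_reducedPoly] at h1
    rw [Module.End.mul_apply (y i * x i), Module.End.mul_apply (φ _), ← hq, sub_eq_iff_eq_add] at h1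
    rw [h1]
    abel
  have hclosed (i j : ι) (α : ι → Fin p) : ((α i : ℕ) : K) * q j α = ((α j : ℕ) : K) * q i α := by
    have h1 := congrArg (fun f : Module.End K V => f v) (hzz i j).eq
    simp only [Module.End.mul_apply (y i * x i) (y j * x j), Module.End.mul_apply (y j * x j) (y i * x i), ← hq] at h1
    rw [hzφ, hzφ, ← Module.End.mul_apply, ← Module.End.mul_apply, (hφ _ _).eq, sub_right_inj] at h1
    have h2 := hinj (fun α => ((α i : ℕ) : K) * q j α - ((α j : ℕ) : K) * q i α) (by
      rw [reducedPoly_sub, map_sub, LinearMap.sub_apply, h1, sub_self])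
    exact sub_eq_zero.1 (congrFun h2 α)
  have hcast {α : ι → Fin p} {i : ι} (h : α i ≠ 0) : ((α i : ℕ) : K) ≠ 0 := fun h0 => by
    rw [CharP.cast_eq_zero_iff K p] at h0
    exact h (Fin.ext (Nat.eq_zero_of_dvd_of_lt h0 (α i).2))
  have hh (α : ι → Fin p) : ∃ r : K, ∀ i, ((α i : ℕ) : K) * r = if α = 0 then 0 else q i α := by
    by_cases hα : α = 0
    · exact ⟨0, fun i => by rw [if_pos hα, mul_zero]⟩
    · obtain ⟨k, hk⟩ := Function.ne_iff.1 hα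
      refine ⟨q k α / ((α k : ℕ) : K), fun i => ?_⟩
      rw [if_neg hα, ← mul_div_assoc, hclosed, mul_div_cancel_left₀ _ (hcast hk)]
  choose h hh using hh
  refine ⟨fun i => q i 0, h, fun i => ?_⟩
  have hqi : (reducedPoly fun α => ((α i : ℕ) : K) * h α) = reducedPoly (q i) - C (q i 0) := by
    rw [← reducedPoly_single (p := p), ← reducedPoly_sub]
    congr 1
    funext α
    rw [hh]
    split_ifs with h0
    · rw [h0, sub_self]
    · rw [sub_zero]
  let H := φ (reducedPoly h)
  let f := x i * H - H * x i
  have hyH : Commute (y i) H := by rw [← hφX]; exact hφ _ _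
  have hyf : y i * f = -φ (reducedPoly fun α => ((α i : ℕ) : K) * h α) := by
    rw [← X_mul_pderiv_reducedPoly, ← hz, mul_sub, ← mul_assoc, ← mul_assoc, ← mul_assoc, hyH.eq]
  have hf : f = φ (C (b i)⁻¹ * (X i ^ (p - 1) * -reducedPoly fun α => ((α i : ℕ) : K) * h α)) := by
    rw [map_mul, map_mul, map_neg, ← hyf, map_pow, hφX, hφC, ← mul_assoc (y i ^ (p - 1)),
      pow_sub_one_mul hp.ne_zero, hy, ← mul_assoc, ← map_mul, inv_mul_cancel₀ (hb0 i), map_one, one_mul]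
  have hyf' : Commute (y i) f := by rw [hf, ← hφX]; exact hφ _ _
  have hpw := add_commutator_pow_char p (x := x i) (h := H) (f := f) rfl (by rw [hf]; exact hφ _ _)
    (by rw [hx]; exact Algebra.commute_algebraMap_left _ _)
  have hyx : y i * (x i + f) = (x i + f) * y i + 1 := by
    rw [mul_add, add_mul, hyf'.eq, hxy, if_pos rfl]
    abel
  have hv' : y i ((x i + f) v) = q i 0 • v := by
    rw [← Module.End.mul_apply, mul_add, hyf, hqi, map_sub, neg_sub, hφC, LinearMap.add_apply, LinearMap.sub_apply,
      ← hq, Module.algebraMap_end_apply]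
    abel
  have hfin := pow_mul_pow_apply (p := p) hyx hv'
  have h3 : φ (reducedPoly fun α => ((α i : ℕ) : K) * h α) ^ p =
      algebraMap K _ (∑ α, ((α i : ℕ) : K) * h α ^ p * ∏ j, b j ^ (α j : ℕ)) := by
    rw [hpow]
    congr 1
    refine Finset.sum_congr rfl fun α _ => ?_
    rw [mul_pow]
    congr 2
    have := congrArg (ZMod.castHom (dvd_refl p) K) (ZMod.pow_card ((α i : ℕ) : ZMod p))
    simpa only [map_pow, map_natCast] using this
  rw [hpw, mul_add, ← hyf'.mul_pow, hyf, neg_pow, h3, hx, hy, ← map_mul] at hfin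
  have hneg : ((-1 : Module.End K V)) ^ p = -1 := neg_one_pow_char _ p
  rw [hneg, neg_one_mul, ← sub_eq_add_neg, ← map_sub, Module.algebraMap_end_apply] at hfin
  have := smul_left_injective K hv hfin
  rw [← this]
  ring

end Representation

end Logarithmic

section Differentials

open KaehlerDifferential

variable {K : Type u} [Field K]

theorem KaehlerDifferential.D_prod_pow {ι : Type*} (b : ι → K) (hb : ∀ i, b i ≠ 0) (m : ι → ℕ) (s : Finset ι) :
    D ℤ K (∏ i ∈ s, b i ^ m i) = (∏ i ∈ s, b i ^ m i) • ∑ i ∈ s, ((m i : K) * (b i)⁻¹) • D ℤ K (b i) := by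
  classical
  induction s using Finset.induction_on with
  | empty => simp
  | insert i s hi ih =>
    rw [Finset.prod_insert hi, Finset.sum_insert hi, Derivation.leibniz, ih, Derivation.leibniz_pow]
    have h1 : (m i • b i ^ (m i - 1) • D ℤ K (b i)) = (b i ^ m i * ((m i : K) * (b i)⁻¹)) • D ℤ K (b i) := by
      rw [← Nat.cast_smul_eq_nsmul K, smul_smul]
      rcases Nat.eq_zero_or_pos (m i) with h0 | h0
      · rw [h0, Nat.cast_zero, zero_mul, zero_mul, mul_zero]
      · rw [← pow_sub_one_mul h0.ne' (b i)]
        congr 1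
        field_simp [hb i]
    rw [h1, smul_smul, smul_smul, smul_add, smul_smul, add_comm]
    congr 2
    ring

theorem KaehlerDifferential.exists_sum_linearIndependent (η : KaehlerDifferential ℤ K) :
    ∃ (ι : Type u) (_ : Fintype ι) (a b : ι → K), LinearIndependent K (fun i => D ℤ K (b i)) ∧
      η = ∑ i, a i • D ℤ K (b i) := by
  obtain ⟨s, hs, hspan, hli⟩ := exists_linearIndependent K (Set.range (D ℤ K))
  have h1 : η ∈ Submodule.span K s := by
    rw [hspan, KaehlerDifferential.span_range_derivation]
    trivial
  rw [← Subtype.range_coe (s := s), Finsupp.mem_span_range_iff_exists_finsupp] at h1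
  obtain ⟨l, hl⟩ := h1
  choose f hf using fun x : s => hs x.2
  refine ⟨l.support, inferInstance, fun i => l i, fun i => f i, ?_, ?_⟩
  · simp only [hf]
    exact hli.comp _ Subtype.val_injective
  · simp only [hf]
    rw [← hl, Finsupp.sum, ← Finset.sum_coe_sort]

theorem KaehlerDifferential.eq_zero_of_sum_pow_mul_prod {p : ℕ} [Fact p.Prime] [CharP K p] {ι : Type*} [Fintype ι]
    [DecidableEq ι] {b : ι → K} (hb : LinearIndependent K fun i => D ℤ K (b i)) (g : (ι → Fin p) → K)
    (hg : ∑ α, g α ^ p * ∏ i, b i ^ (α i : ℕ) = 0) : g = 0 := by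
  classical
  have hp : p.Prime := Fact.out
  have hb0 (i : ι) : b i ≠ 0 := fun h => hb.ne_zero i (by rw [h, map_zero])
  have hpow (x : K) : D ℤ K (x ^ p) = 0 := by
    rw [Derivation.leibniz_pow, ← Nat.cast_smul_eq_nsmul K, CharP.cast_eq_zero, zero_smul]
  have hder (g : (ι → Fin p) → K) (hg : ∑ α, g α ^ p * ∏ i, b i ^ (α i : ℕ) = 0) (i : ι) :
      ∑ α, ((α i : ℕ) : K) * (g α ^ p * ∏ i, b i ^ (α i : ℕ)) = 0 := by
    have h1 := congrArg (D ℤ K) hg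
    simp only [map_sum, map_zero, Derivation.leibniz, hpow, smul_zero, add_zero, D_prod_pow b hb0,
      Finset.smul_sum, smul_smul] at h1
    rw [Finset.sum_comm] at h1
    simp only [← Finset.sum_smul] at h1
    have h2 := Fintype.linearIndependent_iff.1 hb _ h1 i
    have h3 : (∑ α : ι → Fin p, ((α i : ℕ) : K) * (g α ^ p * ∏ i, b i ^ (α i : ℕ))) * (b i)⁻¹ = 0 := by
      rw [Finset.sum_mul, ← h2]
      exact Finset.sum_congr rfl fun α _ => by ring
    exact (mul_eq_zero.1 h3).resolve_right (inv_ne_zero (hb0 i))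
  have hcast (m : ℕ) : (m : K) ^ p = m := by
    have := congrArg (ZMod.castHom (dvd_refl p) K) (ZMod.pow_card (m : ZMod p))
    simpa only [map_pow, map_natCast] using this
  induction hN : (Finset.univ.filter fun α => g α ≠ 0).card using Nat.strong_induction_on generalizing g with
  | _ N ih =>
    by_contra hne
    obtain ⟨α, hα⟩ := Function.ne_iff.1 hne
    have h1 (i : ι) : (fun β => (((β i : ℕ) : K) - ((α i : ℕ) : K)) * g β) = 0 := by
      refine ih _ ?_ _ ?_ rfl
      · rw [← hN]
        refine Finset.card_lt_card (Finset.ssubset_iff_of_subset ?_ |>.2 ⟨α, ?_, ?_⟩)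
        · intro β hβ
          rw [Finset.mem_filter] at hβ ⊢
          exact ⟨hβ.1, right_ne_zero_of_mul hβ.2⟩
        · rw [Finset.mem_filter]
          exact ⟨Finset.mem_univ _, hα⟩
        · simp
      · have h2 := hder g hg i
        have h3 : ∑ β : ι → Fin p, ((α i : ℕ) : K) * (g β ^ p * ∏ i, b i ^ (β i : ℕ)) = 0 := by
          rw [← Finset.mul_sum, hg, mul_zero]
        rw [← sub_eq_zero.2 (h2.trans h3.symm), ← Finset.sum_sub_distrib]
        refine Finset.sum_congr rfl fun β _ => ?_
        rw [mul_pow, sub_pow_char, hcast, hcast]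
        ring
    rw [Finset.sum_eq_single α (fun β _ hβ => ?_) (fun h => (h (Finset.mem_univ _)).elim)] at hg
    · rcases mul_eq_zero.1 hg with h2 | h2
      · exact hα (pow_eq_zero_iff hp.ne_zero |>.1 h2)
      · exact Finset.prod_ne_zero_iff.2 (fun i _ => pow_ne_zero _ (hb0 i)) h2
    · obtain ⟨i, hi⟩ := Function.ne_iff.1 hβ
      have h2 := congrFun (h1 i) β
      rw [Pi.zero_apply, mul_eq_zero, sub_eq_zero] at h2
      rcases h2 with h2 | h2
      · rw [CharP.natCast_eq_natCast K p, Nat.ModEq, Nat.mod_eq_of_lt (β i).2, Nat.mod_eq_of_lt (α i).2] at h2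
        exact (hi (Fin.ext h2)).elim
      · rw [h2, zero_pow hp.ne_zero, zero_mul]

end Differentials

section Injectivity

variable {p : ℕ} [Fact p.Prime] {c : ℕ+ → ℕ+ → MvPolynomial (ℕ+ ⊕ₗ ℕ+) ℤ}
variable {K : Type u} [Field K] [CharP K p]

open KaehlerDifferential

theorem SymGen.commutator {S : Type v} [Ring S] [Algebra K S] [Nontrivial S] (hc : IsCFamily c) {a b : WittVector p K}
    {X Y : ℕ → S} (h : SymGen p c 1 a b X Y) : Y 0 * X 0 = X 0 * Y 0 + 1 := by
  have : CharP S p := charP_of_injective_algebraMap (FaithfulSMul.algebraMap_injective K S) p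
  have h1 := (h.hp.commutator_pow hc one_pos 0).2 0 one_pos
  simp only [zero_add, Finset.sum_range_one, pow_zero, pow_one, Nat.sub_self, one_mul, if_true] at h1
  rw [← h1]
  abel

theorem Br.exists_isCSA_symbK (hc : IsCFamily c) (a b : K) :
    ∃ (B : Type u) (_ : Ring B) (_ : Algebra K B) (X Y : B), IsCSA K B ∧ Br.cls K B = Br.symbK (p := p) hc a b ∧
      Module.finrank K B = p * p ∧ X ^ p = algebraMap K B a ∧ Y ^ p = algebraMap K B b ∧ Y * X = X * Y + 1 := by
  let a' := WittVector.teichmuller p a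
  let b' := WittVector.teichmuller p b
  have hB : IsCSA K (Asy p c 1 a' b') := Asy.isCSA hc
  have hg : SymGen p c 1 a' b' (Asy.X p c 1 a' b') (Asy.Y p c 1 a' b') := Asy.symGen
  have := hB.nontriv
  have hX := hg.powX 0 one_pos
  have hY := hg.powY 0 one_pos
  have hf := Asy.finrank_eq (p := p) (c := c) (n := 1) (a := a') (b := b') hc
  rw [pow_one, WittVector.teichmuller_coeff_zero] at hX hY
  rw [pow_one, pow_one] at hf
  exact ⟨Asy p c 1 a' b', _, _, _, _, hB, rfl, hf, hX, hY, hg.commutator hc⟩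

theorem Br.exists_isCSA_sum_symbK (hc : IsCFamily c) {ι : Type*} [DecidableEq ι] (a b : ι → K) (s : Finset ι) :
    ∃ (A : Type u) (_ : Ring A) (_ : Algebra K A) (x y : ι → A), IsCSA K A ∧
      Br.cls K A = ∑ i ∈ s, Br.symbK (p := p) hc (a i) (b i) ∧
      Module.finrank K A = p ^ s.card * p ^ s.card ∧
      ∀ i ∈ s, x i ^ p = algebraMap K A (a i) ∧ y i ^ p = algebraMap K A (b i) ∧
        ∀ j ∈ s, Commute (x i) (x j) ∧ Commute (y i) (y j) ∧ y i * x j = x j * y i + if i = j then 1 else 0 := by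
  induction s using Finset.induction_on with
  | empty => exact ⟨K, _, _, fun _ => 0, fun _ => 0, .self, by rw [Br.cls_self, Finset.sum_empty], by simp, by simp⟩
  | insert k s hk ih =>
    obtain ⟨A, _, _, x, y, hA, hcls, hfin, hxy⟩ := ih
    obtain ⟨B, _, _, X, Y, hB, hclsB, hfB, hX, hY, hYX⟩ := Br.exists_isCSA_symbK (p := p) hc (a k) (b k)
    refine ⟨A ⊗[K] B, _, _, fun i => if i = k then 1 ⊗ₜ X else x i ⊗ₜ 1, fun i => if i = k then 1 ⊗ₜ Y else y i ⊗ₜ 1,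
      hA.tensor hB, ?_, ?_, ?_⟩
    · rw [Br.cls_tensor hA hB, hcls, hclsB, Finset.sum_insert hk, add_comm]
    · rw [Module.finrank_tensorProduct, hfin, hfB, Finset.card_insert_of_notMem hk]
      ring
    · have hne {i : ι} (hi : i ∈ s) : i ≠ k := fun h => hk (h ▸ hi)
      have hcm (a : A) (b : B) : Commute (a ⊗ₜ[K] (1 : B)) (1 ⊗ₜ b) := by
        rw [Commute, SemiconjBy, Algebra.TensorProduct.tmul_mul_tmul, Algebra.TensorProduct.tmul_mul_tmul,
          one_mul, mul_one, one_mul, mul_one]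
      have hl {u v : A} (h : Commute u v) : Commute (u ⊗ₜ[K] (1 : B)) (v ⊗ₜ 1) :=
        h.map (Algebra.TensorProduct.includeLeft : A →ₐ[K] A ⊗[K] B)
      intro i hi
      rw [Finset.mem_insert] at hi
      rcases hi with rfl | hi
      · refine ⟨by simp [hX, Algebra.TensorProduct.tmul_pow, Algebra.algebraMap_eq_smul_one,
          Algebra.TensorProduct.one_def], by simp [hY, Algebra.TensorProduct.tmul_pow, Algebra.algebraMap_eq_smul_one,
          Algebra.TensorProduct.one_def], fun j hj => ?_⟩
        rw [Finset.mem_insert] at hj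
        rcases hj with rfl | hj
        · simp only [if_true]
          refine ⟨Commute.refl _, Commute.refl _, ?_⟩
          rw [Algebra.TensorProduct.tmul_mul_tmul, Algebra.TensorProduct.tmul_mul_tmul, hYX, TensorProduct.tmul_add,
            one_mul, Algebra.TensorProduct.one_def]
        · simp only [if_neg (hne hj), if_neg (hne hj).symm, if_true, add_zero]
          exact ⟨(hcm _ _).symm, (hcm _ _).symm, (hcm _ _).symm⟩
      · obtain ⟨hx, hy, hrel⟩ := hxy i hi
        refine ⟨by simp [hx, hne hi, Algebra.TensorProduct.tmul_pow, Algebra.algebraMap_eq_smul_one,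
          Algebra.TensorProduct.one_def, TensorProduct.smul_tmul'], by simp [hy, hne hi, Algebra.TensorProduct.tmul_pow,
          Algebra.algebraMap_eq_smul_one, Algebra.TensorProduct.one_def, TensorProduct.smul_tmul'], fun j hj => ?_⟩
        rw [Finset.mem_insert] at hj
        rcases hj with rfl | hj
        · simp only [if_neg (hne hi), if_true, add_zero]
          exact ⟨hcm _ _, hcm _ _, hcm _ _⟩
        · obtain ⟨h1, h2, h3⟩ := hrel j hj
          simp only [if_neg (hne hi), if_neg (hne hj)]
          refine ⟨hl h1, hl h2, ?_⟩
          rw [Algebra.TensorProduct.tmul_mul_tmul, Algebra.TensorProduct.tmul_mul_tmul, h3, TensorProduct.add_tmul,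
            one_mul, Algebra.TensorProduct.one_def]
          split_ifs
          · rfl
          · rw [TensorProduct.zero_tmul]

theorem Br.omegaK_ker_le (hc : IsCFamily c) : (Br.omegaK (p := p) (K := K) hc).ker ≤ katoRelations p K := by
  classical
  intro η hη
  have hp : p.Prime := Fact.out
  obtain ⟨ι, _, a, b, hli, rfl⟩ := exists_sum_linearIndependent η
  have hb0 (i : ι) : b i ≠ 0 := fun h => hli.ne_zero i (by rw [h, map_zero])
  obtain ⟨A, _, _, x, y, hA, hcls, hfin, hxy⟩ := Br.exists_isCSA_sum_symbK (p := p) hc a b Finset.univ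
  rw [AddMonoidHom.mem_ker, map_sum] at hη
  simp only [Br.omegaK_smul_D] at hη
  obtain ⟨d, -, ⟨e⟩⟩ := Br.exists_algEquiv_end hA (hcls.trans hη)
  have hd : d = p ^ Fintype.card ι := by
    have h1 := e.toLinearEquiv.finrank_eq
    rw [hfin, Module.finrank_linearMap, Module.finrank_fin_fun, Finset.card_univ] at h1
    exact (Nat.mul_self_inj.1 h1).symm
  obtain ⟨l, h, hlh⟩ := exists_logarithmic (p := p) (a := a) (b := b) (x := fun i => e (x i)) (y := fun i => e (y i))
    (fun i j => ((hxy i (Finset.mem_univ _)).2.2 j (Finset.mem_univ _)).1.map e)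
    (fun i j => ((hxy i (Finset.mem_univ _)).2.2 j (Finset.mem_univ _)).2.1.map e)
    (fun i j => by
      rw [← map_mul, ← map_mul, ((hxy i (Finset.mem_univ _)).2.2 j (Finset.mem_univ _)).2.2, map_add]
      split_ifs
      · rw [map_one]
      · rw [map_zero])
    (fun i => by rw [← map_pow, (hxy i (Finset.mem_univ _)).1, AlgEquiv.commutes])
    (fun i => by rw [← map_pow, (hxy i (Finset.mem_univ _)).2.1, AlgEquiv.commutes]) hb0
    (eq_zero_of_sum_pow_mul_prod hli) (by rw [Module.finrank_fin_fun, hd])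
  have h1 : ∑ i, a i • D ℤ K (b i) = ∑ i, ((l i ^ p - l i) * (b i)⁻¹) • D ℤ K (b i) +
      ∑ α : ι → Fin p, h α ^ p • D ℤ K (∏ i, b i ^ (α i : ℕ)) := by
    simp only [D_prod_pow b hb0, Finset.smul_sum, smul_smul]
    rw [Finset.sum_comm, ← Finset.sum_add_distrib]
    refine Finset.sum_congr rfl fun i _ => ?_
    rw [← Finset.sum_smul, ← add_smul]
    congr 1
    rw [← mul_right_inj' (hb0 i), hlh, mul_add, Finset.mul_sum]
    congr 1
    · field_simp [hb0 i]
    · refine Finset.sum_congr rfl fun α _ => ?_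
      field_simp [hb0 i]
  rw [h1]
  exact add_mem (sum_mem fun i _ => AddSubgroup.subset_closure (Or.inr ⟨l i, Units.mk0 _ (hb0 i), rfl⟩))
    (sum_mem fun α _ => AddSubgroup.subset_closure (Or.inl ⟨_, _, rfl⟩))

end Injectivity

section PiTensor

variable {K : Type u} [Field K] {ι : Type} (A : ι → Type u) [∀ i, Ring (A i)]
  [∀ i, Algebra K (A i)]

theorem IsCSA.exists_model_sum [DecidableEq ι] (hA : ∀ i, IsCSA K (A i)) (s : Finset ι) :
    ∃ (B : Type u) (_ : Ring B) (_ : Algebra K B), IsCSA K B ∧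
      Br.cls K B = ∑ i ∈ s, Br.cls K (A i) ∧
      Module.finrank K B = ∏ i ∈ s, Module.finrank K (A i) ∧
      ∀ (D : Type u) [Ring D] [Algebra K D] (f : ∀ i, A i →ₐ[K] D),
        (∀ i j, i ≠ j → ∀ a b, Commute (f i a) (f j b)) →
        ∃ g : B →ₐ[K] D, ∀ d, (∀ i ∈ s, ∀ a, Commute (f i a) d) → ∀ b, Commute (g b) d := by
  induction s using Finset.induction_on with
  | empty =>
    refine ⟨K, inferInstance, inferInstance, IsCSA.self, ?_, ?_, fun D _ _ f _ => ?_⟩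
    · rw [Br.cls_self, Finset.sum_empty]
    · rw [Module.finrank_self, Finset.prod_empty]
    · exact ⟨Algebra.ofId K D, fun d _ b => Algebra.commutes b d⟩
  | insert i s hi ih =>
    obtain ⟨B, _, _, hB, hcls, hdim, hlift⟩ := ih
    refine ⟨A i ⊗[K] B, inferInstance, inferInstance, (hA i).tensor hB, ?_, ?_,
      fun D _ _ f hf => ?_⟩
    · rw [Br.cls_tensor (hA i) hB, hcls, Finset.sum_insert hi]
    · rw [Module.finrank_tensorProduct, hdim, Finset.prod_insert hi]
    · obtain ⟨g, hg⟩ := hlift D f hf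
      have hcomm : ∀ a b, Commute (f i a) (g b) := fun a b =>
        (hg (f i a) (fun j hj a' => hf j i (by rintro rfl; exact hi hj) a' a) b).symm
      refine ⟨Algebra.TensorProduct.lift (f i) g hcomm, fun d hd t => ?_⟩
      induction t using TensorProduct.induction_on with
      | zero => rw [map_zero]; exact Commute.zero_left d
      | add x y hx hy => rw [map_add]; exact hx.add_left hy
      | tmul a b =>
        rw [Algebra.TensorProduct.lift_tmul]
        exact (hd i (Finset.mem_insert_self i s) a).mul_left
          (hg d (fun j hj a' => hd j (Finset.mem_insert_of_mem hj) a') b)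

theorem finrank_piTensorProduct [∀ i, FiniteDimensional K (A i)] [Fintype ι] :
    FiniteDimensional K (⨂[K] i, A i) ∧
      Module.finrank K (⨂[K] i, A i) = ∏ i, Module.finrank K (A i) := by
  classical
  let b := Basis.piTensorProduct fun i => Module.finBasis K (A i)
  refine ⟨Module.Finite.of_basis b, ?_⟩
  rw [Module.finrank_eq_card_basis b]
  simp

variable [Fintype ι]

theorem IsCSA.exists_algEquiv_piTensorProduct (hA : ∀ i, IsCSA K (A i)) :
    ∃ (B : Type u) (_ : Ring B) (_ : Algebra K B), IsCSA K B ∧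
      Br.cls K B = ∑ i, Br.cls K (A i) ∧ Nonempty (B ≃ₐ[K] ⨂[K] i, A i) := by
  classical
  have hfd : ∀ i, FiniteDimensional K (A i) := fun i => (hA i).fd
  obtain ⟨B, _, _, hB, hcls, hdim, hlift⟩ := IsCSA.exists_model_sum A hA Finset.univ
  obtain ⟨h1, h2⟩ := finrank_piTensorProduct (K := K) A
  refine ⟨B, _, _, hB, hcls, ?_⟩
  obtain ⟨g, -⟩ := hlift (⨂[K] i, A i) (fun i => PiTensorProduct.singleAlgHom i)
    (fun i j hij a b => by
      simp only [PiTensorProduct.singleAlgHom_apply, Commute, SemiconjBy,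
        PiTensorProduct.tprod_mul_tprod]
      congr 1
      funext k
      by_cases hk : k = i
      · subst hk
        simp [Pi.mulSingle_eq_of_ne hij]
      · simp [Pi.mulSingle_eq_of_ne hk])
  have hnt : Nontrivial (⨂[K] i, A i) := by
    refine Module.nontrivial_of_finrank_pos (R := K) ?_
    rw [h2]
    refine Finset.prod_pos fun i _ => ?_
    have := (hA i).nontriv
    exact Module.finrank_pos
  exact IsCSA.algEquiv hB g (by rw [hdim, h2])

theorem IsCSA.piTensorProduct (hA : ∀ i, IsCSA K (A i)) : IsCSA K (⨂[K] i, A i) := by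
  obtain ⟨B, _, _, hB, -, ⟨e⟩⟩ := IsCSA.exists_algEquiv_piTensorProduct A hA
  exact hB.of_algEquiv e

theorem Br.cls_piTensorProduct (hA : ∀ i, IsCSA K (A i)) :
    Br.cls K (⨂[K] i, A i) = ∑ i, Br.cls K (A i) := by
  obtain ⟨B, _, _, hB, hcls, ⟨e⟩⟩ := IsCSA.exists_algEquiv_piTensorProduct A hA
  rw [← hcls, Br.cls_congr e]

end PiTensor

section Rotation

variable {p : ℕ} [Fact p.Prime] {J : Type*}

theorem ZMod.eq_const_of_periodic {f : ZMod p → J} {k : ZMod p} (hk : k ≠ 0)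
    (h : ∀ x, f (x + k) = f x) (x : ZMod p) : f x = f 0 := by
  have h1 : ∀ n : ℕ, f (n * k) = f 0 := fun n => by
    induction n with
    | zero => simp
    | succ n ih => rw [Nat.cast_succ, add_mul, one_mul, h, ih]
  have := h1 (x * k⁻¹).val
  rwa [ZMod.natCast_zmod_val, inv_mul_cancel_right₀ hk] at this

theorem exists_phase : ∃ κ : (ZMod p → J) → ZMod p, ∀ f : ZMod p → J,
    (¬ ∀ x, f x = f 0) → ∀ k, κ (fun x => f (x + k)) = κ f + k := by
  classical
  let r : Setoid (ZMod p → J) :=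
    { r := fun f g => ∃ k, ∀ x, f x = g (x + k)
      iseqv := ⟨fun f => ⟨0, fun x => by rw [add_zero]⟩,
        fun {f g} ⟨k, hk⟩ => ⟨-k, fun x => by rw [hk, neg_add_cancel_right]⟩,
        fun {f g h} ⟨k, hk⟩ ⟨l, hl⟩ => ⟨k + l, fun x => by rw [hk, hl, add_assoc]⟩⟩ }
  have hout : ∀ f : ZMod p → J, ∃ k, ∀ x, f x = (Quotient.mk r f).out (x + k) :=
    fun f => r.symm (Quotient.mk_out (s := r) f)
  choose κ hκ using hout
  refine ⟨κ, fun f hf k => ?_⟩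
  have hq : Quotient.mk r (fun x => f (x + k)) = Quotient.mk r f :=
    Quotient.sound ⟨k, fun x => rfl⟩
  have h1 := hκ (fun x => f (x + k))
  rw [hq] at h1
  by_contra hne
  apply hf
  refine ZMod.eq_const_of_periodic (k := κ (fun x => f (x + k)) - (κ f + k)) (sub_ne_zero.2 hne)
    fun x => ?_
  rw [hκ f, hκ f]
  rw [show x + (κ (fun x => f (x + k)) - (κ f + k)) + κ f =
    x - κ f - k + κ (fun x => f (x + k)) + κ f by ring,
    show x + κ f = x - κ f - k + k + κ f + κ f by ring]
  have h3 := h1 (x - k)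
  rw [sub_add_cancel, hκ f x] at h3
  rw [show x - κ f - k + k + κ f + κ f = x + κ f by ring, h3]
  exact congrArg _ (by abel)

/-- A sum over functions on `ℤ/p` equivariant for rotation is, up to a norm, the sum over the
constant functions. -/
theorem exists_sum_eq_sum_const_add_norm [Fintype J] {M : Type*} [AddCommGroup M]
    (τ : M →+ M) (m : (ZMod p → J) → M) (hm : ∀ f, m (fun x => f (x + 1)) = τ (m f)) :
    ∃ x, ∑ f, m f = ∑ j, m (fun _ => j) + ∑ k ∈ Finset.range p, τ^[k] x := by
  classical
  obtain ⟨κ, hκ⟩ := exists_phase (p := p) (J := J)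
  have hmk : ∀ (k : ℕ) f, m (fun x => f (x + k)) = τ^[k] (m f) := fun k => by
    induction k with
    | zero => intro f; simp
    | succ k ih =>
      intro f
      rw [Function.iterate_succ_apply', ← ih, ← hm]
      congr 1
      funext x
      rw [Nat.cast_succ, add_assoc, add_comm 1 (k : ZMod p)]
  let P : (ZMod p → J) → Prop := fun f => ∀ x, f x = f 0
  refine ⟨∑ f with ¬ P f ∧ κ f = 0, m f, ?_⟩
  rw [← Finset.sum_filter_add_sum_filter_not Finset.univ P]
  congr 1
  · refine Finset.sum_bij' (fun f _ => f 0) (fun j _ _ => j) (by simp) (by simp [P]) ?_ (by simp) ?_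
    · intro f hf
      funext x
      exact ((Finset.mem_filter.1 hf).2 x).symm
    · intro f hf
      congr 1
      funext x
      exact (Finset.mem_filter.1 hf).2 x
  · rw [← Finset.sum_fiberwise_of_maps_to (s := Finset.univ.filter fun f => ¬ P f)
      (t := Finset.range p) (g := fun f => (κ f).val)
      (fun f _ => Finset.mem_range.2 (ZMod.val_lt _))]
    refine Finset.sum_congr rfl fun k hk => ?_
    have hit : ∀ s : Finset (ZMod p → J), τ^[k] (∑ f ∈ s, m f) = ∑ f ∈ s, τ^[k] (m f) := by
      intro s
      exact map_sum ((show AddMonoid.End M from τ) ^ k) _ _ |>.trans rfl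
    rw [hit]
    have hP : ∀ (f : ZMod p → J) (l : ZMod p), P (fun x => f (x + l)) → P f := fun f l h x => by
      have h1 := h (x - l)
      have h2 := h (0 - l)
      simp only [sub_add_cancel] at h1 h2
      rw [h1, h2]
    refine Finset.sum_bij' (fun f _ => fun x => f (x + -(k : ZMod p)))
      (fun f _ => fun x => f (x + (k : ZMod p))) ?_ ?_ (fun f _ => by simp) (fun f _ => by simp) ?_
    · intro f hf
      simp only [Finset.mem_filter, Finset.mem_univ, true_and] at hf ⊢
      refine ⟨fun h => hf.1 (hP f _ h), ?_⟩
      rw [hκ f hf.1, ← hf.2, ZMod.natCast_zmod_val, add_neg_cancel]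
    · intro f hf
      simp only [Finset.mem_filter, Finset.mem_univ, true_and] at hf ⊢
      refine ⟨fun h => hf.1 (hP f _ h), ?_⟩
      rw [hκ f hf.1, hf.2, zero_add, ZMod.val_natCast_of_lt (Finset.mem_range.1 hk)]
    · intro f _
      rw [← hmk]
      congr 1
      funext x
      rw [add_neg_cancel_right]

end Rotation

section TensorPower

variable {K : Type u} [Field K] (p : ℕ) [Fact p.Prime] (A : Type u) [Ring A] [Algebra K A]

/-- The cyclic rotation of the `p`-th tensor power of an algebra. -/
def PiTensorProduct.rotate : (⨂[K] _ : ZMod p, A) →ₐ[K] ⨂[K] _ : ZMod p, A :=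
  PiTensorProduct.liftAlgHom
    ((MultilinearMap.domDomCongr (Equiv.addRight (1 : ZMod p))
      (PiTensorProduct.tprod K : MultilinearMap K (fun _ : ZMod p => A) _)))
    (by rw [MultilinearMap.domDomCongr_apply, PiTensorProduct.one_def]; rfl)
    (fun x y => by
      simp only [MultilinearMap.domDomCongr_apply, PiTensorProduct.tprod_mul_tprod]
      rfl)

variable {A}

theorem PiTensorProduct.rotate_tprod (a : ZMod p → A) :
    rotate (K := K) p A (tprod K a) = tprod K fun x => a (x + 1) :=
  PiTensorProduct.lift.tprod _

theorem PiTensorProduct.rotate_iterate_tprod (k : ℕ) (a : ZMod p → A) :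
    (rotate (K := K) p A)^[k] (tprod K a) = tprod K fun x => a (x + k) := by
  induction k with
  | zero => simp
  | succ k ih =>
    rw [Function.iterate_succ_apply', ih, rotate_tprod]
    congr 1
    funext x
    rw [Nat.cast_succ, add_assoc, add_comm 1 (k : ZMod p)]

theorem PiTensorProduct.rotate_iterate_char (t : ⨂[K] _ : ZMod p, A) :
    (rotate (K := K) p A)^[p] t = t := by
  have h : (rotate (K := K) p A).toLinearMap ^ p = LinearMap.id := by
    refine PiTensorProduct.ext (MultilinearMap.ext fun a => ?_)
    rw [LinearMap.compMultilinearMap_apply, LinearMap.compMultilinearMap_apply,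
      Module.End.coe_pow]
    exact (rotate_iterate_tprod p p a).trans (by simp)
  have := LinearMap.congr_fun h t
  rwa [Module.End.coe_pow] at this

/-- Any finite sum raised to the `p`-th tensor power. -/
theorem PiTensorProduct.tprod_const_sum {J : Type*} [Fintype J] (g : J → A) :
    ∃ x, (tprod K fun _ : ZMod p => ∑ j, g j) = ∑ j, (tprod K fun _ : ZMod p => g j) +
      ∑ k ∈ Finset.range p, (rotate (K := K) p A)^[k] x := by
  classical
  rw [MultilinearMap.map_sum]
  exact exists_sum_eq_sum_const_add_norm (rotate (K := K) p A : _ →+ _)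
    (fun r : ZMod p → J => tprod K fun i => g (r i))
    fun f => (rotate_tprod p fun i => g (f i)).symm

theorem PiTensorProduct.exists_of_rotate_eq [FiniteDimensional K A] (t : ⨂[K] _ : ZMod p, A)
    (ht : rotate p A t = t) : ∃ (c : Fin (Module.finrank K A) → K) (x : ⨂[K] _ : ZMod p, A),
      t = ∑ j, c j • (tprod K fun _ : ZMod p => Module.finBasis K A j) +
        ∑ k ∈ Finset.range p, (rotate p A)^[k] x := by
  classical
  let b := Basis.piTensorProduct fun _ : ZMod p => Module.finBasis K A
  have hb : ∀ f : ZMod p → Fin (Module.finrank K A),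
      b.repr t (fun x => f (x + 1)) = b.repr t f := by
    intro f
    have : (Finsupp.lapply (fun x => f (x + 1)) ∘ₗ b.repr.toLinearMap) ∘ₗ
        (rotate (K := K) p A).toLinearMap = Finsupp.lapply f ∘ₗ b.repr.toLinearMap := by
      refine PiTensorProduct.ext (MultilinearMap.ext fun a => ?_)
      simp only [LinearMap.compMultilinearMap_apply, LinearMap.comp_apply,
        AlgHom.toLinearMap_apply, rotate_tprod, LinearEquiv.coe_coe, Finsupp.lapply_apply]
      rw [Basis.piTensorProduct_repr_tprod_apply, Basis.piTensorProduct_repr_tprod_apply]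
      exact Equiv.prod_comp (Equiv.addRight (1 : ZMod p))
        fun x => (Module.finBasis K A).repr (a x) (f x)
    have h := LinearMap.congr_fun this t
    simp only [LinearMap.comp_apply, AlgHom.toLinearMap_apply, ht] at h
    exact h
  obtain ⟨x, hx⟩ := exists_sum_eq_sum_const_add_norm (rotate (K := K) p A : _ →+ _)
    (fun f : ZMod p → Fin (Module.finrank K A) => b.repr t f • b f) fun f => by
      rw [hb f, Basis.piTensorProduct_apply, Basis.piTensorProduct_apply]
      exact ((map_smul (rotate (K := K) p A) _ _).trans (congrArg (b.repr t f • ·)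
        (rotate_tprod p fun i => Module.finBasis K A (f i)))).symm
  refine ⟨fun j => b.repr t fun _ => j, x, ?_⟩
  rw [b.sum_repr] at hx
  refine hx.trans ?_
  simp only [b, Basis.piTensorProduct_apply]
  rfl

theorem PiTensorProduct.sum_rotate_ne_one [CharP K p] [Nontrivial A] (x : ⨂[K] _ : ZMod p, A) :
    ∑ k ∈ Finset.range p, (rotate p A)^[k] x ≠ 1 := by
  obtain ⟨φ, hφ⟩ := Module.Projective.exists_dual_eq_one K (one_ne_zero (α := A))
  let Φ : (⨂[K] _ : ZMod p, A) →ₗ[K] K := PiTensorProduct.lift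
    ((MultilinearMap.mkPiAlgebra K (ZMod p) K).compLinearMap fun _ => φ)
  have hΦ : ∀ a : ZMod p → A, Φ (tprod K a) = ∏ i, φ (a i) := fun a =>
    PiTensorProduct.lift.tprod a
  have h1 : Φ 1 = 1 := by
    rw [PiTensorProduct.one_def, hΦ]
    simp [hφ]
  have h2 : ∀ t, Φ (rotate p A t) = Φ t := by
    have : Φ ∘ₗ (rotate (K := K) p A).toLinearMap = Φ := by
      refine PiTensorProduct.ext (MultilinearMap.ext fun a => ?_)
      simp only [LinearMap.compMultilinearMap_apply, LinearMap.comp_apply,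
        AlgHom.toLinearMap_apply, rotate_tprod, hΦ]
      exact Equiv.prod_comp (Equiv.addRight (1 : ZMod p)) fun x => φ (a x)
    exact LinearMap.congr_fun this
  have h3 : ∀ (k : ℕ) t, Φ ((rotate p A)^[k] t) = Φ t := fun k => by
    induction k with
    | zero => intro t; rfl
    | succ k ih => intro t; rw [Function.iterate_succ_apply', h2, ih]
  intro h
  have h4 := congrArg Φ h
  rw [map_sum, h1] at h4
  simp [h3] at h4

end TensorPower

/-- The `p`-th tensor power of a central simple algebra in characteristic `p`, with its
rotation `τ` and its `p`-th power map `δ`. -/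
theorem IsCSA.exists_tensorPower {K : Type u} [Field K] (p : ℕ) [Fact p.Prime] [CharP K p]
    {A : Type u} [Ring A] [Algebra K A] [FiniteDimensional K A] (hA : IsCSA K A) :
    ∃ (T : Type u) (_ : Ring T) (_ : Algebra K T) (τ : T →ₐ[K] T) (δ : A → T), IsCSA K T ∧
      Br.cls K T = p • Br.cls K A ∧ (∀ t, τ^[p] t = t) ∧ δ 1 = 1 ∧
      (∀ a b, δ (a * b) = δ a * δ b) ∧ (∀ (r : K) a, δ (r • a) = r ^ p • δ a) ∧
      (∀ a, τ (δ a) = δ a) ∧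
      (∀ a b, ∃ x, δ (a + b) = δ a + δ b + ∑ k ∈ Finset.range p, τ^[k] x) ∧
      (∀ t, τ t = t → ∃ (c : Fin (Module.finrank K A) → K) (x : T),
        t = ∑ j, c j • δ (Module.finBasis K A j) + ∑ k ∈ Finset.range p, τ^[k] x) ∧
      ∀ x, ∑ k ∈ Finset.range p, τ^[k] x ≠ 1 := by
  have := hA.nontriv
  refine ⟨⨂[K] _ : ZMod p, A, inferInstance, inferInstance, PiTensorProduct.rotate p A,
    fun a => PiTensorProduct.tprod K fun _ => a, IsCSA.piTensorProduct _ fun _ => hA, ?_,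
    PiTensorProduct.rotate_iterate_char p, rfl, fun a b => ?_, fun r a => ?_, fun a => ?_,
    fun a b => ?_, fun t ht => ?_, PiTensorProduct.sum_rotate_ne_one p⟩
  · rw [Br.cls_piTensorProduct _ fun _ => hA, Finset.sum_const, Finset.card_univ, ZMod.card]
  · rw [PiTensorProduct.tprod_mul_tprod]; rfl
  · have := (PiTensorProduct.tprod K : MultilinearMap K (fun _ : ZMod p => A) _).map_smul_univ
      (fun _ => r) (fun _ => a)
    rw [Finset.prod_const, Finset.card_univ, ZMod.card] at this
    exact this
  · rw [PiTensorProduct.rotate_tprod]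
  · obtain ⟨x, hx⟩ := PiTensorProduct.tprod_const_sum (K := K) p fun j : Bool => cond j a b
    rw [Fintype.sum_bool, Fintype.sum_bool] at hx
    exact ⟨x, hx⟩
  · obtain ⟨c, x, h⟩ := PiTensorProduct.exists_of_rotate_eq p t ht
    exact ⟨c, x, h⟩

/-- The norm of an endomorphism for conjugation by `s`, where `s ^ p = 1`. -/
def cycNorm (p : ℕ) {R : Type*} [Ring R] (s f : R) : R :=
  ∑ k ∈ Finset.range p, s ^ k * f * s ^ (p - k)

theorem cycNorm_mul {p : ℕ} {R : Type*} [Ring R] {s g : R} (h : Commute s g) (f : R) :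
    cycNorm p s (f * g) = cycNorm p s f * g := by
  rw [cycNorm, cycNorm, Finset.sum_mul]
  refine Finset.sum_congr rfl fun k _ => ?_
  rw [mul_assoc (s ^ k * f), (h.pow_left _).eq]
  simp only [mul_assoc]

section CyclicCentralizer

variable {K : Type u} [Field K] {p : ℕ} [Fact p.Prime] {W : Type u} [AddCommGroup W]
  [Module K W]

theorem Polynomial.geom_sum_eq_sub_pow_char [CharP K p] :
    ∑ k ∈ Finset.range p, (Polynomial.X : Polynomial K) ^ k = (Polynomial.X - 1) ^ (p - 1) := by
  have hp := Fact.out (p := p.Prime)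
  have h0 : (Polynomial.X - 1 : Polynomial K) ≠ 0 := by
    simpa using Polynomial.X_sub_C_ne_zero (1 : K)
  refine mul_right_cancel₀ h0 ?_
  rw [geom_sum_mul, pow_sub_one_mul hp.ne_zero, sub_pow_char, one_pow]

theorem geom_sum_eq_sub_pow_char [CharP K p] {R : Type*} [Ring R] [Algebra K R] (s : R) :
    ∑ k ∈ Finset.range p, s ^ k = (s - 1) ^ (p - 1) := by
  have := congrArg (Polynomial.aeval s) (Polynomial.geom_sum_eq_sub_pow_char (K := K) (p := p))
  simpa using this

theorem commute_cycNorm {R : Type*} [Ring R] {s : R} (hs : s ^ p = 1) (f : R) :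
    Commute s (cycNorm p s f) := by
  have hp := Fact.out (p := p.Prime)
  obtain ⟨q, rfl⟩ := Nat.exists_eq_succ_of_ne_zero hp.ne_zero
  have h1 : s * cycNorm (q + 1) s f =
      ∑ k ∈ Finset.range (q + 1), s ^ (k + 1) * f * s ^ (q + 1 - k) := by
    rw [cycNorm, Finset.mul_sum]
    exact Finset.sum_congr rfl fun k _ => by rw [pow_succ']; simp only [mul_assoc]
  have h2 : cycNorm (q + 1) s f * s =
      ∑ k ∈ Finset.range (q + 1), s ^ k * f * s ^ (q + 1 - k + 1) := by
    rw [cycNorm, Finset.sum_mul]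
    exact Finset.sum_congr rfl fun k _ => by rw [pow_succ]; simp only [mul_assoc]
  change s * _ = _ * s
  rw [h1, h2, Finset.sum_range_succ, Finset.sum_range_succ']
  congr 1
  · refine Finset.sum_congr rfl fun k hk => ?_
    rw [show q + 1 - (k + 1) + 1 = q + 1 - k by have := Finset.mem_range.1 hk; omega]
  · simp only [Nat.succ_eq_add_one] at hs
    rw [hs, Nat.sub_zero, pow_succ s (q + 1), hs, Nat.add_sub_cancel_left]
    simp

variable [CharP K p] {s : Module.End K W}

theorem cycNorm_apply_of_fixed (f : Module.End K W) {w : W} (hw : s w = w) :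
    cycNorm p s f w = ((s - 1) ^ (p - 1)) (f w) := by
  have h : ∀ k : ℕ, (s ^ k) w = w := fun k => by
    induction k with
    | zero => rfl
    | succ k ih => rw [pow_succ, Module.End.mul_apply, hw, ih]
  rw [← geom_sum_eq_sub_pow_char (K := K) (p := p) s, cycNorm, LinearMap.sum_apply,
    LinearMap.sum_apply]
  refine Finset.sum_congr rfl fun k _ => ?_
  rw [Module.End.mul_apply, Module.End.mul_apply, h]

theorem exists_cycNorm_eq_one_of_ker_le [FiniteDimensional K W] (hs : s ^ p = 1)
    (h : LinearMap.ker (s - 1) ≤ LinearMap.range ((s - 1) ^ (p - 1))) :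
    ∃ f, cycNorm p s f = 1 := by
  have hp := Fact.out (p := p.Prime)
  obtain ⟨f, hf⟩ : ∃ f : Module.End K W, ∀ w, s w = w → ((s - 1) ^ (p - 1)) (f w) = w := by
    obtain ⟨g, hg⟩ := ((s - 1) ^ (p - 1)).rangeRestrict.exists_rightInverse_of_surjective
      (LinearMap.range_eq_top.2 (LinearMap.surjective_rangeRestrict _))
    obtain ⟨f, hf⟩ := LinearMap.exists_extend g
    refine ⟨f, fun w hw => ?_⟩
    have hw' : w ∈ LinearMap.range ((s - 1) ^ (p - 1)) := h (by simp [hw])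
    have h1 := LinearMap.congr_fun hf ⟨w, hw'⟩
    have h2 := congrArg Subtype.val (LinearMap.congr_fun hg ⟨w, hw'⟩)
    rw [LinearMap.comp_apply, Submodule.subtype_apply] at h1
    rw [h1]
    exact h2
  have hfix : ∀ w, s w = w → cycNorm p s f w = w := fun w hw => by
    rw [cycNorm_apply_of_fixed f hw, hf w hw]
  have hcomm := commute_cycNorm hs f
  have hν : (s - 1) ^ p = 0 := by
    have : CharP (Module.End K W) p ∨ Subsingleton W := by
      rcases subsingleton_or_nontrivial W with h | h
      · exact Or.inr h
      · exact Or.inl (charP_of_injective_algebraMap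
          (FaithfulSMul.algebraMap_injective K (Module.End K W)) p)
    rcases this with h | h
    · rw [sub_pow_char_of_commute _ (Commute.one_right s), hs, one_pow, sub_self]
    · exact Subsingleton.elim _ _
  have hinj : Function.Injective ⇑(cycNorm p s f : Module.End K W) := by
    rw [injective_iff_map_eq_zero]
    intro v hv
    have hall : ∀ k : ℕ, cycNorm p s f (((s - 1) ^ k) v) = 0 := fun k => by
      have hc : Commute ((s - 1) ^ k) (cycNorm p s f) :=
        (hcomm.sub_left (Commute.one_left _)).pow_left k
      rw [← Module.End.mul_apply, ← hc.eq, Module.End.mul_apply, hv, map_zero]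
    have hdown : ∀ k : ℕ, ((s - 1) ^ k) v = 0 → v = 0 := fun k => by
      induction k with
      | zero => exact fun h => h
      | succ k ih =>
        intro h
        apply ih
        have h1 : s (((s - 1) ^ k) v) = ((s - 1) ^ k) v := by
          rw [pow_succ', Module.End.mul_apply, LinearMap.sub_apply, Module.End.one_apply,
            sub_eq_zero] at h
          exact h
        rw [← hfix _ h1, hall]
    exact hdown p (by rw [hν]; rfl)
  obtain ⟨g, hg⟩ := (Module.End.isUnit_iff _).2
    ⟨hinj, LinearMap.injective_iff_surjective.1 hinj⟩
  refine ⟨f * ↑g⁻¹, ?_⟩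
  have hc : Commute s (↑g⁻¹ : Module.End K W) := by
    rw [← hg] at hcomm
    exact hcomm.units_inv_right
  rw [cycNorm_mul hc, ← hg, Units.mul_inv]

/-- The centralizer of `s` acts on the subquotient `ker ν / (ker ν ∩ im ν ^ a)` of `W`,
`ν = s - 1`, by all endomorphisms, when `ker ν ⊆ im ν ^ (a - 1)`. -/
theorem exists_centralizer_rep [FiniteDimensional K W] (hs : s ^ p = 1)
    (hN : ∀ f, cycNorm p s f ≠ 1) :
    ∃ (H : Type u) (_ : AddCommGroup H) (_ : Module K H) (_ : FiniteDimensional K H)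
      (_ : Nontrivial H) (ρ : Subalgebra.centralizer K {s} →ₐ[K] Module.End K H),
      Function.Surjective ρ ∧
      ∀ (f : Module.End K W) (c : Subalgebra.centralizer K {s}), c.1 = cycNorm p s f → ρ c = 0 := by
  classical
  have hp := Fact.out (p := p.Prime)
  obtain ⟨a, hap, hker, hnker⟩ : ∃ a, a + 1 ≤ p - 1 ∧
      LinearMap.ker (s - 1) ≤ LinearMap.range ((s - 1) ^ a) ∧
      ¬ LinearMap.ker (s - 1) ≤ LinearMap.range ((s - 1) ^ (a + 1)) := by
    have hex : ∃ a, ¬ LinearMap.ker (s - 1) ≤ LinearMap.range ((s - 1) ^ a) :=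
      ⟨p - 1, fun h => by
        obtain ⟨f, hf⟩ := exists_cycNorm_eq_one_of_ker_le hs h
        exact hN f hf⟩
    have hle : Nat.find hex ≤ p - 1 := Nat.find_min' hex fun h => by
        obtain ⟨f, hf⟩ := exists_cycNorm_eq_one_of_ker_le hs h
        exact hN f hf
    obtain ⟨a, ha⟩ : ∃ a, Nat.find hex = a + 1 := by
      refine Nat.exists_eq_succ_of_ne_zero fun h => ?_
      have := Nat.find_spec hex
      rw [h, pow_zero] at this
      exact this fun w _ => ⟨w, rfl⟩
    refine ⟨a, ha ▸ hle, ?_, ha ▸ Nat.find_spec hex⟩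
    exact not_not.1 (Nat.find_min hex (m := a) (by omega))
  set ν : Module.End K W := s - 1 with hν
  let I := LinearMap.range (ν ^ (a + 1))
  let H : Submodule K (W ⧸ I) := (LinearMap.ker ν).map I.mkQ
  have hcν : ∀ c ∈ Subalgebra.centralizer K {s}, Commute ν c := fun c hc => by
    have : Commute s c := (Subalgebra.mem_centralizer_iff K).1 hc s rfl
    exact this.sub_left (Commute.one_left c)
  have hcI : ∀ c ∈ Subalgebra.centralizer K {s}, I ≤ I.comap c := by
    rintro c hc _ ⟨w, rfl⟩
    refine ⟨c w, ?_⟩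
    exact LinearMap.congr_fun ((hcν c hc).pow_left (a + 1)).eq w
  have hcK : ∀ c ∈ Subalgebra.centralizer K {s}, ∀ w ∈ LinearMap.ker ν,
      c w ∈ LinearMap.ker ν := fun c hc w hw => by
    have := LinearMap.congr_fun (hcν c hc).eq w
    rw [Module.End.mul_apply, Module.End.mul_apply, LinearMap.mem_ker.1 hw, map_zero] at this
    exact this
  have hcH : ∀ c (hc : c ∈ Subalgebra.centralizer K {s}), ∀ h ∈ H,
      I.mapQ I c (hcI c hc) h ∈ H := by
    rintro c hc _ ⟨w, hw, rfl⟩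
    exact ⟨c w, hcK c hc w hw, rfl⟩
  have hrep : ∀ h : H, ∃ w, ∃ hw : w ∈ LinearMap.ker ν,
      h = ⟨I.mkQ w, Submodule.mem_map_of_mem hw⟩ := by
    rintro ⟨_, w, hw, rfl⟩
    exact ⟨w, hw, rfl⟩
  let ρ₀ : Subalgebra.centralizer K {s} → Module.End K H := fun c =>
    (I.mapQ I c.1 (hcI c.1 c.2)).restrict (hcH c.1 c.2)
  have hρ₀ : ∀ c w hw, ρ₀ c ⟨I.mkQ w, Submodule.mem_map_of_mem hw⟩ =
      ⟨I.mkQ (c.1 w), Submodule.mem_map_of_mem (hcK c.1 c.2 w hw)⟩ := fun c w hw => rfl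
  have hext : ∀ f g : Module.End K H, (∀ w hw, f ⟨I.mkQ w, Submodule.mem_map_of_mem hw⟩ =
      g ⟨I.mkQ w, Submodule.mem_map_of_mem hw⟩) → f = g := fun f g h => by
    refine LinearMap.ext fun x => ?_
    obtain ⟨w, hw, rfl⟩ := hrep x
    exact h w hw
  let ρ : Subalgebra.centralizer K {s} →ₐ[K] Module.End K H :=
    { toFun := ρ₀
      map_one' := hext _ _ fun w hw => rfl
      map_mul' := fun c d => hext _ _ fun w hw => rfl
      map_zero' := hext _ _ fun w hw => rfl
      map_add' := fun c d => hext _ _ fun w hw => rfl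
      commutes' := fun r => hext _ _ fun w hw => rfl }
  refine ⟨H, inferInstance, inferInstance, inferInstance, ?_, ρ, ?_, ?_⟩
  · rw [Submodule.nontrivial_iff_ne_bot]
    intro h
    refine hnker fun w hw => ?_
    have : I.mkQ w ∈ H := Submodule.mem_map_of_mem hw
    rw [h, Submodule.mem_bot, Submodule.mkQ_apply, Submodule.Quotient.mk_eq_zero] at this
    exact this
  · have hone : ∀ (φ : H →ₗ[K] K) (h : H), φ.smulRight h ∈ ρ.range := by
      intro φ h
      obtain ⟨Φ, hΦ⟩ := LinearMap.exists_extend φ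
      obtain ⟨w, hw, rfl⟩ := hrep h
      obtain ⟨u, hu⟩ := hker hw
      have hΦ0 : ∀ w, Φ (I.mkQ ((ν ^ (a + 1)) w)) = 0 := fun w => by
        have : I.mkQ ((ν ^ (a + 1)) w) = 0 := (Submodule.Quotient.mk_eq_zero I).2 ⟨w, rfl⟩
        rw [this, map_zero]
      have hu0 : (ν ^ (a + 1)) u = 0 := by
        rw [pow_succ', Module.End.mul_apply, hu]; exact hw
      let θ : Module.End K W := ∑ i ∈ Finset.range (a + 1),
        ((Φ ∘ₗ I.mkQ) ∘ₗ (ν ^ (a - i))).smulRight ((ν ^ i) u)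
      have hθ : ∀ v, θ v = ∑ i ∈ Finset.range (a + 1),
          Φ (I.mkQ ((ν ^ (a - i)) v)) • (ν ^ i) u := fun v => by
        rw [LinearMap.sum_apply]; rfl
      have hcomm : Commute ν θ := by
        refine LinearMap.ext fun v => ?_
        rw [Module.End.mul_apply, Module.End.mul_apply, hθ, hθ, map_sum, Finset.sum_range_succ,
          Finset.sum_range_succ']
        congr 1
        · refine Finset.sum_congr rfl fun i hi => ?_
          rw [map_smul, ← Module.End.mul_apply, ← Module.End.mul_apply, ← pow_succ, ← pow_succ',
            show a - (i + 1) + 1 = a - i by have := Finset.mem_range.1 hi; omega]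
        · rw [map_smul, ← Module.End.mul_apply, ← Module.End.mul_apply, ← pow_succ, ← pow_succ',
            hu0, smul_zero, Nat.sub_zero, hΦ0, zero_smul]
      have hmem : θ ∈ Subalgebra.centralizer K {s} := by
        rw [Subalgebra.mem_centralizer_iff]
        rintro _ rfl
        have := hcomm.add_left (Commute.one_left θ)
        rw [hν, sub_add_cancel] at this
        exact this
      refine ⟨⟨θ, hmem⟩, hext _ _ fun v hv => ?_⟩
      refine (hρ₀ _ v hv).trans (Subtype.ext ?_)
      have h1 : θ v = Φ (I.mkQ v) • w := by
        rw [hθ, Finset.sum_range_succ, Finset.sum_eq_zero, zero_add, Nat.sub_self, pow_zero, hu]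
        · rfl
        · intro i hi
          obtain ⟨j, hj⟩ : ∃ j, a - i = j + 1 := ⟨a - i - 1, by
            have := Finset.mem_range.1 hi; omega⟩
          rw [hj, pow_succ, Module.End.mul_apply, LinearMap.mem_ker.1 hv, map_zero, map_zero,
            map_zero, zero_smul]
      have h2 := LinearMap.congr_fun hΦ ⟨I.mkQ v, Submodule.mem_map_of_mem hv⟩
      rw [LinearMap.comp_apply, Submodule.subtype_apply] at h2
      change I.mkQ (θ v) = _
      rw [h1, map_smul, h2]
      rfl
    intro T
    let b := Module.finBasis K H
    have hT : T = ∑ i, (b.coord i).smulRight (T (b i)) := by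
      refine b.ext fun j => ?_
      rw [LinearMap.sum_apply]
      simp [Finsupp.single_apply]
    change T ∈ ρ.range
    rw [hT]
    exact Subalgebra.sum_mem _ fun i _ => hone _ _
  · intro f c hc
    refine hext _ _ fun w hw => ?_
    refine (hρ₀ _ w hw).trans (Subtype.ext ?_)
    rw [LinearMap.mem_ker, hν, LinearMap.sub_apply, Module.End.one_apply, sub_eq_zero] at hw
    change I.mkQ (c.1 w) = 0
    rw [hc, cycNorm_apply_of_fixed (p := p) f hw]
    refine (Submodule.Quotient.mk_eq_zero I).2 ⟨(ν ^ (p - 1 - (a + 1))) (f w), ?_⟩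
    rw [← Module.End.mul_apply, ← pow_add, Nat.add_sub_cancel' hap]

end CyclicCentralizer

section CyclicField

open Polynomial

variable {K : Type u} [Field K] {p : ℕ} [Fact p.Prime]

/-- In a purely inseparable extension `L = K(x)` of degree `p`, a `K`-linear form `L → K` of
which the conjugates by powers of `x` add up to (a multiple of) the identity. -/
theorem exists_linear_sum_conj {l : K} (hl : Irreducible (X ^ p - C l)) :
    ∃ π : AdjoinRoot (X ^ p - C l) →ₗ[K] K, ∀ z,
      ∑ k ∈ Finset.range p, AdjoinRoot.root (X ^ p - C l) ^ k *
        algebraMap K _ (π (AdjoinRoot.root (X ^ p - C l) ^ (p - k) * z)) = l • z := by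
  have hp := Fact.out (p := p.Prime)
  have hdeg : (X ^ p - C l).natDegree = p := natDegree_X_pow_sub_C
  let pb := AdjoinRoot.powerBasis hl.ne_zero
  have hdim : pb.dim = p := hdeg
  have hgen : pb.gen = AdjoinRoot.root (X ^ p - C l) := rfl
  set x := AdjoinRoot.root (X ^ p - C l) with hx
  have hxp : x ^ p = algebraMap K _ l := by
    have := AdjoinRoot.eval₂_root (X ^ p - C l)
    rw [eval₂_sub, eval₂_X_pow, eval₂_C, sub_eq_zero] at this
    exact this
  let π := pb.basis.coord ⟨0, by rw [hdim]; exact hp.pos⟩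
  have hπ : ∀ j, j < p → π (x ^ j) = if j = 0 then 1 else 0 := fun j hj => by
    have h1 : x ^ j = pb.basis ⟨j, by rw [hdim]; exact hj⟩ := by
      rw [PowerBasis.coe_basis, hgen]
    rw [h1, Module.Basis.coord_apply, Module.Basis.repr_self, Finsupp.single_apply]
    simp only [Fin.mk.injEq]
  have hπ' : ∀ j k, j < p → k < p → π (x ^ (p - k) * x ^ j) = if k = j then l else 0 := by
    intro j k hj hk
    rw [← pow_add]
    rcases lt_or_ge j k with h | h
    · rw [hπ _ (by omega), if_neg (by omega), if_neg (by omega)]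
    · rw [show p - k + j = p + (j - k) by omega, pow_add, hxp, ← Algebra.smul_def, map_smul,
        hπ _ (by omega)]
      by_cases hjk : k = j
      · rw [if_pos (by omega), if_pos hjk, smul_eq_mul, mul_one]
      · rw [if_neg (by omega), if_neg hjk, smul_zero]
  refine ⟨π, fun z => ?_⟩
  let F : AdjoinRoot (X ^ p - C l) →ₗ[K] AdjoinRoot (X ^ p - C l) :=
    ∑ k ∈ Finset.range p, LinearMap.mulLeft K (x ^ k) ∘ₗ Algebra.linearMap K _ ∘ₗ π ∘ₗ
      LinearMap.mulLeft K (x ^ (p - k))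
  have hF : F = l • LinearMap.id := by
    refine pb.basis.ext fun j => ?_
    have hj : (j : ℕ) < p := j.2.trans_eq hdim
    rw [PowerBasis.coe_basis, hgen, LinearMap.sum_apply, Finset.sum_eq_single (j : ℕ)]
    · simp only [LinearMap.comp_apply, LinearMap.mulLeft_apply, hπ' _ _ hj hj,
        Algebra.linearMap_apply, LinearMap.smul_apply, LinearMap.id_apply]
      rw [Algebra.smul_def, mul_comm, if_pos trivial]
    · intro k hk hkj
      simp only [LinearMap.comp_apply, LinearMap.mulLeft_apply, hπ' _ _ hj (Finset.mem_range.1 hk),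
        if_neg hkj, map_zero]
    · intro h
      exact absurd (Finset.mem_range.2 hj) h
  have := LinearMap.congr_fun hF z
  rw [LinearMap.sum_apply] at this
  exact this

theorem exists_cycNorm_eq_of_irreducible {W : Type u} [AddCommGroup W] [Module K W]
    [FiniteDimensional K W] {s : Module.End K W} {l : K} (hl : Irreducible (X ^ p - C l))
    (hs : s ^ p = algebraMap K _ l) : ∃ f, cycNorm p s f = algebraMap K _ l := by
  classical
  obtain ⟨π, hπ⟩ := exists_linear_sum_conj hl
  have := Fact.mk hl
  let L := AdjoinRoot (X ^ p - C l)
  let φ : L →ₐ[K] Module.End K W := Ideal.Quotient.liftₐ (Ideal.span {X ^ p - C l}) (aeval s) fun a ha => by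
    obtain ⟨b, rfl⟩ := Ideal.mem_span_singleton'.1 ha
    rw [map_mul, map_sub, map_pow, aeval_X, aeval_C, hs, sub_self, mul_zero]
  have hφ : φ (AdjoinRoot.root _) = s := aeval_X s
  let _ : Module L W := Module.compHom W φ.toRingHom
  have hsmul : ∀ (z : L) (w : W), z • w = φ z w := fun z w => rfl
  have : IsScalarTower K L W := ⟨fun r z w => by
    rw [hsmul, hsmul, map_smul]; rfl⟩
  have : Module.Finite L W := Module.Finite.of_restrictScalars_finite K L W
  let e := (Module.finBasis L W).equivFun
  have hes : ∀ (k : ℕ) w, e ((s ^ k) w) = AdjoinRoot.root (X ^ p - C l) ^ k • e w := fun k w => by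
    rw [← hφ, ← map_pow, ← hsmul, map_smul]
  let g : (Fin (Module.finrank L W) → L) →ₗ[K] (Fin (Module.finrank L W) → L) :=
    LinearMap.pi fun i => Algebra.linearMap K L ∘ₗ π ∘ₗ LinearMap.proj i
  let eK := e.restrictScalars K
  let f : Module.End K W := eK.symm.toLinearMap ∘ₗ g ∘ₗ eK.toLinearMap
  have hf : ∀ w, e (f w) = g (e w) := fun w => e.apply_symm_apply _
  refine ⟨f, LinearMap.ext fun w => e.injective (funext fun i => ?_)⟩
  rw [cycNorm, LinearMap.sum_apply, map_sum, Finset.sum_apply, Module.algebraMap_end_apply]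
  have h1 : e (l • w) i = l • e w i := congrFun (eK.map_smul l w) i
  rw [h1, ← hπ]
  refine Finset.sum_congr rfl fun k _ => ?_
  rw [Module.End.mul_apply, Module.End.mul_apply, hes, hf, hes]
  rfl

end CyclicField

/-- An automorphism of order `p` of `End W` without elements of norm one is the conjugation by an
element of order `p`. -/
theorem Module.End.exists_cyclic_of_algEquiv {K : Type u} [Field K] {p : ℕ} [Fact p.Prime]
    {W : Type u} [AddCommGroup W] [Module K W] [FiniteDimensional K W] [Nontrivial W]
    (σ : Module.End K W ≃ₐ[K] Module.End K W) (hσ : ∀ f, σ^[p] f = f)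
    (hN : ∀ f, ∑ k ∈ Finset.range p, σ^[k] f ≠ 1) :
    ∃ s : Module.End K W, s ^ p = 1 ∧ (∀ f, σ f = f ↔ Commute s f) ∧
      ∀ f, ∑ k ∈ Finset.range p, σ^[k] f = cycNorm p s f := by
  have hp := Fact.out (p := p.Prime)
  obtain ⟨S, hS⟩ := AlgEquiv.eq_linearEquivConjAlgEquiv σ
  let t : Module.End K W := S.toLinearMap
  let t' : Module.End K W := S.symm.toLinearMap
  have htt : t * t' = 1 := LinearMap.ext fun w => S.apply_symm_apply w
  have htt' : t' * t = 1 := LinearMap.ext fun w => S.symm_apply_apply w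
  have hσt : ∀ f, σ f = t * f * t' := fun f => by rw [hS]; rfl
  have hσk : ∀ (k : ℕ) f, σ^[k] f = t ^ k * f * t' ^ k := fun k f => by
    induction k with
    | zero => simp
    | succ k ih =>
      rw [Function.iterate_succ_apply', ih, hσt, pow_succ', pow_succ]
      simp only [mul_assoc]
  have hpow : ∀ k : ℕ, t' ^ k * t ^ k = 1 := fun k => by
    have : Commute t' t := by rw [Commute, SemiconjBy, htt, htt']
    rw [← this.mul_pow, htt', one_pow]
  have hcen : ∀ f, t ^ p * f = f * t ^ p := by
    intro f
    have h1 := hσ f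
    rw [hσk] at h1
    calc t ^ p * f = (t ^ p * f * t' ^ p) * t ^ p := by rw [mul_assoc, hpow, mul_one]
      _ = f * t ^ p := by rw [h1]
  obtain ⟨l, hl⟩ := (IsCSA.end' W).center_eq hcen
  replace hl := hl.symm
  have hl0 : l ≠ 0 := by
    rintro rfl
    rw [map_zero] at hl
    have := hpow p
    rw [← hl, mul_zero] at this
    exact zero_ne_one this
  have htk : ∀ k < p, t' ^ k = l⁻¹ • t ^ (p - k) := fun k hk => by
    have h1 : t ^ (p - k) * t ^ k = algebraMap K _ l := by
      rw [← pow_add, Nat.sub_add_cancel hk.le, hl]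
    have h2 : t ^ (p - k) = l • t' ^ k := by
      have h3 : t ^ k * t' ^ k = 1 := by
        have : Commute t t' := by rw [Commute, SemiconjBy, htt, htt']
        rw [← this.mul_pow, htt, one_pow]
      rw [← mul_one (t ^ (p - k)), ← h3, ← mul_assoc, h1, Algebra.smul_def]
    rw [h2, smul_smul, inv_mul_cancel₀ hl0, one_smul]
  have hNt : ∀ f, ∑ k ∈ Finset.range p, σ^[k] f = l⁻¹ • cycNorm p t f := fun f => by
    rw [cycNorm, Finset.smul_sum]
    refine Finset.sum_congr rfl fun k hk => ?_
    rw [hσk, htk k (Finset.mem_range.1 hk), mul_smul_comm]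
  obtain ⟨m, hm⟩ : ∃ m : K, m ^ p = l := by
    by_contra! hcon
    obtain ⟨f, hf⟩ := exists_cycNorm_eq_of_irreducible
      (X_pow_sub_C_irreducible_of_prime hp hcon) hl.symm
    apply hN f
    rw [hNt, hf, Algebra.smul_def, ← map_mul, inv_mul_cancel₀ hl0, map_one]
  have hm0 : m ≠ 0 := by
    rintro rfl
    exact hl0 (by rw [← hm, zero_pow hp.ne_zero])
  refine ⟨m⁻¹ • t, ?_, fun f => ?_, fun f => ?_⟩
  · rw [smul_pow, inv_pow, hm, ← hl, Algebra.smul_def, ← map_mul, inv_mul_cancel₀ hl0, map_one]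
  · rw [hσt]
    constructor
    · intro h
      refine Commute.smul_left ?_ _
      change t * f = f * t
      calc t * f = (t * f * t') * t := by rw [mul_assoc, htt', mul_one]
        _ = f * t := by rw [h]
    · intro h
      have h1 : Commute t f := by
        have := h.smul_left m
        rwa [smul_smul, mul_inv_cancel₀ hm0, one_smul] at this
      rw [h1.eq, mul_assoc, htt, mul_one]
  · rw [hNt, cycNorm, cycNorm, Finset.smul_sum]
    refine Finset.sum_congr rfl fun k hk => ?_
    have h1 : (m⁻¹) ^ k * (m⁻¹) ^ (p - k) = l⁻¹ := by
      rw [← pow_add, Nat.add_sub_cancel' (Finset.mem_range.1 hk).le, inv_pow, hm]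
    rw [smul_pow, smul_pow, smul_mul_assoc, smul_mul_assoc, mul_smul_comm, smul_smul, h1]

/-- A central simple algebra whose class is killed by the characteristic `p` has a
Frobenius-semilinear representation of small dimension. -/
theorem IsCSA.exists_frobenius_rep {K : Type u} [Field K] (p : ℕ) [Fact p.Prime] [CharP K p]
    {A : Type u} [Ring A] [Algebra K A] (hA : IsCSA K A) (h : p • Br.cls K A = 0) :
    ∃ (d : ℕ) (ψ : A →+* Matrix (Fin d) (Fin d) K), 0 < d ∧ d ^ 2 ≤ Module.finrank K A ∧
      ∀ (r : K) a, ψ (r • a) = r ^ p • ψ a := by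
  classical
  have := hA.fd
  have hp := Fact.out (p := p.Prime)
  obtain ⟨T, _, _, τ, δ, hT, hcls, hτ, hδ1, hδmul, hδsmul, hτδ, hδadd, hspan, hne⟩ :=
    hA.exists_tensorPower p
  obtain ⟨m, hm, ⟨E⟩⟩ := Br.exists_algEquiv_end hT (hcls.trans h)
  have : Nonempty (Fin m) := ⟨⟨0, hm⟩⟩
  let W := Fin m → K
  have hτb : Function.Bijective τ := by
    obtain ⟨q, hq⟩ := Nat.exists_eq_succ_of_ne_zero hp.ne_zero
    refine ⟨fun x y hxy => ?_, fun y => ⟨τ^[q] y, ?_⟩⟩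
    · rw [← hτ x, ← hτ y, hq, Function.iterate_succ_apply, Function.iterate_succ_apply, hxy]
    · rw [← Function.iterate_succ_apply' (f := τ), ← hq, hτ]
  let τe := AlgEquiv.ofBijective τ hτb
  let σ : Module.End K W ≃ₐ[K] Module.End K W := (E.symm.trans τe).trans E
  have hσ : ∀ t, σ (E t) = E (τ t) := fun t => by
    change E (τ (E.symm (E t))) = _
    rw [E.symm_apply_apply]
  have hσk : ∀ (k : ℕ) t, σ^[k] (E t) = E (τ^[k] t) := fun k t => by
    induction k with
    | zero => rfl
    | succ k ih => rw [Function.iterate_succ_apply', ih, hσ, Function.iterate_succ_apply']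
  obtain ⟨s, hs, hfix, hnorm⟩ := Module.End.exists_cyclic_of_algEquiv (p := p) σ
    (fun f => by rw [← E.apply_symm_apply f, hσk, hτ])
    (fun f hf => hne (E.symm f) (E.injective (by
      rw [map_sum, map_one, ← hf]
      exact Finset.sum_congr rfl fun k _ => by rw [← hσk, E.apply_symm_apply])))
  have hEN : ∀ t, E (∑ k ∈ Finset.range p, τ^[k] t) = cycNorm p s (E t) := fun t => by
    rw [map_sum, ← hnorm]
    exact Finset.sum_congr rfl fun k _ => (hσk k t).symm
  obtain ⟨H, _, _, _, _, ρ, hρ, hρN⟩ := exists_centralizer_rep hs fun f hf => hne (E.symm f)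
    (E.injective (by rw [hEN, E.apply_symm_apply, hf, map_one]))
  have hmem : ∀ t, τ t = t → E t ∈ Subalgebra.centralizer K {s} := fun t ht => by
    rw [Subalgebra.mem_centralizer_iff]
    rintro _ rfl
    exact ((hfix (E t)).1 (by rw [hσ, ht])).eq
  have hmemN : ∀ t, cycNorm p s (E t) ∈ Subalgebra.centralizer K {s} := fun t => by
    rw [Subalgebra.mem_centralizer_iff]
    rintro _ rfl
    exact (commute_cycNorm hs _).eq
  let ψ₀ : A → Module.End K H := fun a => ρ ⟨E (δ a), hmem _ (hτδ a)⟩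
  have hψ1 : ψ₀ 1 = 1 := by
    rw [← map_one ρ]
    exact congrArg ρ (Subtype.ext (by change E (δ 1) = 1; rw [hδ1, map_one]))
  have hψmul : ∀ a b, ψ₀ (a * b) = ψ₀ a * ψ₀ b := fun a b => by
    rw [← map_mul ρ]
    exact congrArg ρ (Subtype.ext (by
      change E (δ (a * b)) = E (δ a) * E (δ b); rw [hδmul, map_mul]))
  have hψsmul : ∀ (r : K) a, ψ₀ (r • a) = r ^ p • ψ₀ a := fun r a => by
    rw [← map_smul ρ]
    exact congrArg ρ (Subtype.ext (by
      change E (δ (r • a)) = r ^ p • E (δ a); rw [hδsmul, map_smul]))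
  have hψadd : ∀ a b, ψ₀ (a + b) = ψ₀ a + ψ₀ b := fun a b => by
    obtain ⟨x, hx⟩ := hδadd a b
    have h1 := hρN (E x) ⟨cycNorm p s (E x), hmemN x⟩ rfl
    rw [← map_add ρ, ← add_zero (ρ (_ + _)), ← h1, ← map_add ρ]
    exact congrArg ρ (Subtype.ext (by
      change E (δ (a + b)) = E (δ a) + E (δ b) + cycNorm p s (E x)
      rw [hx, map_add, map_add, hEN]))
  have hψ0 : ψ₀ 0 = 0 := by
    simpa [zero_pow hp.ne_zero] using hψsmul 0 0
  have hdim : Module.finrank K (Module.End K H) ≤ Module.finrank K A := by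
    have htop : Submodule.span K (Set.range fun j => ψ₀ (Module.finBasis K A j)) = ⊤ := by
      rw [eq_top_iff]
      intro g _
      obtain ⟨c, rfl⟩ := hρ g
      have hc : τ (E.symm c.1) = E.symm c.1 := E.injective (by
        rw [← hσ, E.apply_symm_apply]
        exact (hfix _).2 ((Subalgebra.mem_centralizer_iff K).1 c.2 s rfl))
      obtain ⟨r, x, hx⟩ := hspan _ hc
      have h1 := hρN (E x) ⟨cycNorm p s (E x), hmemN x⟩ rfl
      have h2 : c = ∑ j, r j • (⟨E (δ (Module.finBasis K A j)), hmem _ (hτδ _)⟩ :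
          Subalgebra.centralizer K {s}) + ⟨cycNorm p s (E x), hmemN x⟩ := by
        refine Subtype.ext ?_
        rw [← E.apply_symm_apply c.1, hx, map_add, hEN, map_sum]
        simp [map_smul]
      rw [h2, map_add, h1, add_zero, map_sum]
      refine Submodule.sum_mem _ fun j _ => ?_
      rw [map_smul]
      exact Submodule.smul_mem _ _ (Submodule.subset_span ⟨j, rfl⟩)
    rw [← finrank_top K (Module.End K H), ← htop]
    exact (finrank_range_le_card _).trans (by simp)
  let ψ₁ : A →+* Module.End K H :=
    { toFun := ψ₀
      map_one' := hψ1
      map_mul' := hψmul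
      map_zero' := hψ0
      map_add' := hψadd }
  let e := algEquivMatrix (Module.finBasis K H)
  refine ⟨Module.finrank K H, (e : _ →+* _).comp ψ₁, Module.finrank_pos, ?_, fun r a => ?_⟩
  · rwa [Module.finrank_linearMap, ← pow_two] at hdim
  · change e (ψ₀ (r • a)) = r ^ p • e (ψ₀ a)
    rw [hψsmul, map_smul]

theorem Br.cls_eq_zero_of_matrix {K : Type u} [Field K] {A : Type u} [Ring A] [Algebra K A]
    (hA : IsCSA K A) {d : ℕ} (hd : 0 < d) (f : A →ₐ[K] Matrix (Fin d) (Fin d) K)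
    (h : d ^ 2 ≤ Module.finrank K A) : Br.cls K A = 0 := by
  have : Nonempty (Fin d) := ⟨⟨0, hd⟩⟩
  let e : Matrix (Fin d) (Fin d) K ≃ₐ[K] Module.End K (Fin d → K) := Matrix.toLinAlgEquiv'
  refine Br.cls_eq_zero_of_rep hA (V := Fin d → K) ((e : _ →ₐ[K] _).comp f) ?_
  rwa [Module.finrank_fin_fun]

/-- A central simple algebra whose class is killed by the characteristic `p` is split by a
finite purely inseparable extension of exponent one. -/
theorem IsCSA.exists_finset_splitting {K : Type u} [Field K] (p : ℕ) [Fact p.Prime] [CharP K p]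
    {A : Type u} [Ring A] [Algebra K A] (hA : IsCSA K A) (h : p • Br.cls K A = 0) :
    ∃ S : Finset (AlgebraicClosure K), (∀ x ∈ S, ∃ b : K, algebraMap K _ b = x ^ p) ∧
      Br.res (IntermediateField.adjoin K (S : Set (AlgebraicClosure K))) (Br.cls K A) = 0 := by
  classical
  have := hA.fd
  obtain ⟨d, ψ, hd, hdim, hψ⟩ := hA.exists_frobenius_rep p h
  let Ω := AlgebraicClosure K
  have : CharP Ω p := charP_of_injective_algebraMap (FaithfulSMul.algebraMap_injective K Ω) p
  have : PerfectRing Ω p := PerfectField.toPerfectRing p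
  let r : K →+* Ω := ((frobeniusEquiv Ω p).symm : Ω →+* Ω).comp (algebraMap K Ω)
  have hr : ∀ x, r x ^ p = algebraMap K Ω x := fun x =>
    frobeniusEquiv_symm_pow_p Ω p (algebraMap K Ω x)
  have hrp : ∀ x, r (x ^ p) = algebraMap K Ω x := fun x => by
    rw [map_pow, hr]
  let f : A →ₐ[K] Matrix (Fin d) (Fin d) Ω :=
    { (r.mapMatrix).comp ψ with
      commutes' := fun x => by
        change r.mapMatrix (ψ (algebraMap K A x)) = _
        rw [Algebra.algebraMap_eq_smul_one, hψ, map_one]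
        ext i j
        rw [RingHom.mapMatrix_apply, Matrix.map_apply, Matrix.smul_apply, smul_eq_mul, map_mul,
          hrp, Matrix.algebraMap_matrix_apply, Matrix.one_apply]
        split_ifs <;> simp }
  have hf : ∀ a i j, f a i j = r (ψ a i j) := fun a i j => rfl
  let b := Module.finBasis K A
  let S : Finset Ω := Finset.univ.image fun x : Fin (Module.finrank K A) × Fin d × Fin d =>
    f (b x.1) x.2.1 x.2.2
  refine ⟨S, fun x hx => ?_, ?_⟩
  · obtain ⟨y, -, rfl⟩ := Finset.mem_image.1 hx
    exact ⟨ψ (b y.1) y.2.1 y.2.2, (hr _).symm⟩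
  let L := IntermediateField.adjoin K (S : Set Ω)
  change Br.res L (Br.cls K A) = 0
  have hL : ∀ a, f a ∈ (L.val.mapMatrix (m := Fin d)).range := by
    intro a
    rw [← b.sum_repr a, map_sum]
    refine Subalgebra.sum_mem _ fun k _ => ?_
    rw [map_smul]
    refine Subalgebra.smul_mem _ ?_ _
    refine ⟨Matrix.of fun i j => ⟨f (b k) i j, IntermediateField.subset_adjoin K _
      (Finset.mem_coe.2 (Finset.mem_image.2 ⟨(k, i, j), Finset.mem_univ _, rfl⟩))⟩, ?_⟩
    ext i j
    rfl
  have hinj : Function.Injective (L.val.mapMatrix (m := Fin d)) := by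
    intro M N hMN
    ext i j
    exact congrFun (congrFun hMN i) j
  let g : A →ₐ[K] Matrix (Fin d) (Fin d) L :=
    (AlgEquiv.ofInjective _ hinj).symm.toAlgHom.comp (f.codRestrict _ hL)
  let G : L ⊗[K] A →ₐ[L] Matrix (Fin d) (Fin d) L :=
    Algebra.TensorProduct.lift (Algebra.ofId L _) g fun x y => Algebra.commutes x _
  rw [Br.res_cls L hA]
  refine Br.cls_eq_zero_of_matrix (hA.baseChange L) hd G ?_
  rwa [Module.finrank_baseChange]

section WeylRelation

variable {R S : Type*} [CommRing R] [Ring S] [Algebra R S]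

theorem Polynomial.aeval_commutator {X Y : S} (h : Y * X = X * Y + 1) (f : Polynomial R) :
    Polynomial.aeval Y f * X = X * Polynomial.aeval Y f + Polynomial.aeval Y (Polynomial.derivative f) := by
  have hpow : ∀ k : ℕ, Y ^ k * X = X * Y ^ k + (k : S) * Y ^ (k - 1) := by
    intro k
    induction k with
    | zero => simp
    | succ k ih =>
      rcases Nat.eq_zero_or_pos k with rfl | hk
      · simpa using h
      · rw [pow_succ', mul_assoc, ih, mul_add, ← mul_assoc, h, ← mul_assoc, (Nat.cast_commute k Y).symm.eq,
          mul_assoc _ Y, ← pow_succ', Nat.sub_add_cancel hk, Nat.add_sub_cancel, Nat.cast_succ, add_mul, add_mul,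
          one_mul, mul_assoc, ← pow_succ', add_assoc, add_comm (Y ^ k)]
  induction f using Polynomial.induction_on' with
  | add f g hf hg =>
    simp only [map_add, add_mul, mul_add, hf, hg]
    abel
  | monomial k a =>
    rw [Polynomial.derivative_monomial, Polynomial.aeval_monomial, Polynomial.aeval_monomial, mul_assoc, hpow, mul_add,
      ← mul_assoc, Algebra.commutes a X, mul_assoc, map_mul, map_natCast, mul_assoc]

end WeylRelation

section LevelOne

variable {p : ℕ} [Fact p.Prime] {c : ℕ+ → ℕ+ → MvPolynomial (ℕ+ ⊕ₗ ℕ+) ℤ} {K : Type u} [Field K] [CharP K p]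

theorem cPow_zero_zero (hc : IsCFamily c) {S : Type v} [Ring S] [Algebra K S] (X Y : ℕ → S) :
    cPow p c X Y 0 0 = 1 := by
  have hA : ∀ {S : Type u} [Ring S] [Algebra K S] (X Y : ℕ → S),
      cPow p c X Y 0 0 = algebraMap K S (cPow p c (fun _ => 0) (fun _ => 0) 0 0) := by
    intro S _ _ X Y
    rw [map_cPow (algebraMap K S)]
    exact cPow_congr hc (by simp) (by simp)
  have hB : cPow p c (fun _ => (0 : K)) (fun _ => 0) 0 0 = 1 := by
    have h : SymGen p c 1 (0 : WittVector p K) 0 (Asy.X p c 1 (0 : WittVector p K) 0) (Asy.Y p c 1 _ _) := Asy.symGen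
    have := (Asy.isCSA (p := p) (n := 1) (a := (0 : WittVector p K)) (b := 0) hc).nontriv
    have h1 := h.commutator hc
    rw [h.hp.yx () 0 0 one_pos one_pos, add_left_cancel_iff, hA] at h1
    exact (algebraMap K _).injective (h1.trans (map_one _).symm)
  rw [← map_one (algebraMap K S), ← hB, map_cPow (algebraMap K S)]
  exact cPow_congr hc (by simp) (by simp)

theorem Br.exists_hom_symbK (hc : IsCFamily c) (a b : K) {S : Type v} [Ring S] [Algebra K S] {X Y : S}
    (hX : X ^ p = algebraMap K S a) (hY : Y ^ p = algebraMap K S b) (h : Y * X = X * Y + 1) :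
    ∃ (B : Type u) (_ : Ring B) (_ : Algebra K B), IsCSA K B ∧ Br.cls K B = Br.symbK (p := p) hc a b ∧
      Module.finrank K B = p * p ∧ Nonempty (B →ₐ[K] S) := by
  let a' := WittVector.teichmuller p a
  let b' := WittVector.teichmuller p b
  have hS : SymGen p c 1 a' b' (fun _ => X) (fun _ => Y) := by
    refine ⟨⟨fun _ _ _ _ _ _ => Commute.refl _, fun _ _ _ _ _ _ => Commute.refl _, fun s t hst => (hst rfl).elim,
      fun _ i j hi hj => ?_⟩, fun i hi => ?_, fun i hi => ?_⟩
    · obtain rfl := Nat.lt_one_iff.1 hi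
      obtain rfl := Nat.lt_one_iff.1 hj
      rw [cPow_zero_zero (K := K) hc, h]
    · obtain rfl := Nat.lt_one_iff.1 hi
      rw [pow_one, hX, WittVector.teichmuller_coeff_zero]
    · obtain rfl := Nat.lt_one_iff.1 hi
      rw [pow_one, hY, WittVector.teichmuller_coeff_zero]
  obtain ⟨f, -⟩ := Asy.exists_lift hc hS
  have hf := Asy.finrank_eq (p := p) (c := c) (n := 1) (a := a') (b := b') hc
  rw [pow_one, pow_one] at hf
  exact ⟨Asy p c 1 a' b', _, _, Asy.isCSA hc, rfl, hf, ⟨f⟩⟩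

end LevelOne

section Derivation

variable {F : Type*} [Field F] {L : Type*} [Field L] [Algebra F L] {p : ℕ}

theorem PowerBasis.exists_derivation [CharP L p] (pb : PowerBasis F L) (hdim : pb.dim = p) {b : F}
    (hb : pb.gen ^ p = algebraMap F L b) :
    ∃ δ : L →ₗ[F] L, ∀ z, δ (pb.gen * z) = pb.gen * δ z + z := by
  let δ : L →ₗ[F] L := pb.basis.constr F fun i => (i : ℕ) * pb.gen ^ ((i : ℕ) - 1)
  have hδ : ∀ k < p, δ (pb.gen ^ k) = k * pb.gen ^ (k - 1) := by
    intro k hk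
    have := pb.basis.constr_basis F (fun i => (i : ℕ) * pb.gen ^ ((i : ℕ) - 1)) ⟨k, hdim ▸ hk⟩
    rwa [pb.basis_eq_pow] at this
  have hp : p ≠ 0 := hdim ▸ pb.dim_pos.ne'
  have hδp : δ (pb.gen ^ p) = p * pb.gen ^ (p - 1) := by
    have h0 := hδ 0 (Nat.pos_of_ne_zero hp)
    rw [hb, Algebra.algebraMap_eq_smul_one, map_smul, ← pow_zero pb.gen, h0, CharP.cast_eq_zero L p]
    simp
  refine ⟨δ, fun z => ?_⟩
  suffices h : δ ∘ₗ LinearMap.mulLeft F pb.gen = LinearMap.mulLeft F pb.gen ∘ₗ δ + LinearMap.id from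
    LinearMap.congr_fun h z
  refine pb.basis.ext fun i => ?_
  have hi : (i : ℕ) < p := i.2.trans_eq hdim
  have h1 : δ (pb.gen ^ ((i : ℕ) + 1)) = ((i + 1 : ℕ) : L) * pb.gen ^ (i : ℕ) := by
    rcases (Nat.succ_le_of_lt hi).lt_or_eq with h | h
    · exact hδ _ h
    · rw [← h] at hδp
      exact hδp
  rw [pb.basis_eq_pow, LinearMap.comp_apply, LinearMap.mulLeft_apply, ← pow_succ', h1, LinearMap.add_apply,
    LinearMap.comp_apply, LinearMap.mulLeft_apply, hδ _ hi, LinearMap.id_apply, Nat.cast_succ, add_mul, one_mul]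
  rcases Nat.eq_zero_or_pos (i : ℕ) with h | h
  · simp [h]
  · rw [mul_left_comm, ← pow_succ', Nat.sub_add_cancel h]

end Derivation

section Descent

variable {p : ℕ} [Fact p.Prime] {F : Type u} [Field F] [CharP F p] {L : Type u} [Field L] [Algebra F L]

/-- The restriction of scalars of an endomorphism, as an algebra homomorphism. -/
def Module.End.restrictScalarsHom (F : Type*) {L V : Type*} [Field F] [Field L] [Algebra F L] [AddCommGroup V] [Module F V]
    [Module L V] [IsScalarTower F L V] : Module.End L V →ₐ[F] Module.End F V where
  toFun f := f.restrictScalars F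
  map_one' := rfl
  map_mul' _ _ := rfl
  map_zero' := rfl
  map_add' _ _ := rfl
  commutes' r := by
    refine LinearMap.ext fun v => ?_
    rw [IsScalarTower.algebraMap_apply F L (Module.End L V), Module.algebraMap_end_apply]
    exact algebraMap_smul L r v

/-- A representation of `L ⊗ A` yields an operator commuting with `A` and satisfying the Weyl
relation with a generator of `L`. -/
theorem exists_weyl_operator {A : Type v} [Ring A] [Algebra F A] {y : L} {δ : L →ₗ[F] L}
    (hδ : ∀ z, δ (y * z) = y * δ z + z) {V : Type w} [AddCommGroup V] [Module F V] [Module L V] [IsScalarTower F L V]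
    [Nontrivial V] (φ : L ⊗[F] A ≃ₐ[L] Module.End L V) :
    ∃ X : Module.End F V, (∀ a v, X (φ (1 ⊗ₜ a) v) = φ (1 ⊗ₜ a) (X v)) ∧ ∀ v, y • X v = X (y • v) + v := by
  obtain ⟨e, he⟩ := exists_ne (0 : V)
  obtain ⟨f, hf⟩ := Module.Projective.exists_dual_eq_one L he
  let s : V →ₗ[F] L ⊗[F] A := φ.symm.toLinearMap.restrictScalars F ∘ₗ
    (LinearMap.smulRightₗ (R := L) (M := V) (M₂ := V) f).restrictScalars F
  have hs : ∀ v, φ (s v) = f.smulRight v := fun v => φ.apply_symm_apply _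
  have hsm : ∀ t v, s (φ t v) = t * s v := by
    intro t v
    apply φ.injective
    rw [map_mul, hs, hs]
    ext w
    simp
  let D : L ⊗[F] A →ₗ[F] L ⊗[F] A := δ.rTensor A
  have hDa : ∀ a t, D (1 ⊗ₜ a * t) = 1 ⊗ₜ a * D t := by
    intro a t
    induction t with
    | zero => simp
    | add t t' h h' => rw [mul_add, map_add, h, h', map_add, mul_add]
    | tmul z a' => simp [D]
  have hDy : ∀ t, D (y • t) = y • D t + t := by
    intro t
    induction t with
    | zero => simp
    | add t t' h h' =>
      rw [smul_add, map_add, h, h', map_add, smul_add]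
      abel
    | tmul z a' => simp [D, TensorProduct.smul_tmul', hδ, TensorProduct.add_tmul]
  let X : Module.End F V :=
    { toFun := fun v => - φ (D (s v)) e
      map_add' := fun v w => by
        rw [map_add, map_add, map_add, LinearMap.add_apply, neg_add]
      map_smul' := fun r v => by
        rw [map_smul, map_smul, ← algebraMap_smul L r (D (s v)), map_smul, LinearMap.smul_apply, algebraMap_smul, smul_neg]
        rfl }
  have hX : ∀ v, X v = - φ (D (s v)) e := fun v => rfl
  refine ⟨X, fun a v => ?_, fun v => ?_⟩
  · rw [hX, hX, hsm, hDa, map_mul, Module.End.mul_apply, map_neg]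
  · have h1 : s (y • v) = y • s v := by
      have h2 : y • v = φ (y • (1 : L ⊗[F] A)) v := by
        rw [map_smul, map_one, LinearMap.smul_apply, Module.End.one_apply]
      rw [h2, hsm, Algebra.smul_mul_assoc, one_mul]
    rw [hX, hX, h1, hDy, map_add, map_smul, LinearMap.add_apply, LinearMap.smul_apply, hs, LinearMap.smulRight_apply, hf,
      one_smul, smul_neg]
    abel

theorem Br.exists_eq_symbK_of_finrank {c : ℕ+ → ℕ+ → MvPolynomial (ℕ+ ⊕ₗ ℕ+) ℤ} (hc : IsCFamily c) (pb : PowerBasis F L)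
    (hdim : pb.dim = p) {b : F} (hb : pb.gen ^ p = algebraMap F L b) {β : Br F} (h : Br.res L β = 0) :
    ∃ a, β = Br.symbK (p := p) hc a b := by
  have hp : p.Prime := Fact.out
  have := pb.finite
  have : CharP L p := charP_of_injective_algebraMap (FaithfulSMul.algebraMap_injective F L) p
  obtain ⟨δ, hδ⟩ := pb.exists_derivation hdim hb
  obtain ⟨A, _, _, hA, rfl⟩ := Br.exists_cls β
  have hAfd := hA.fd
  rw [Br.res_cls L hA] at h
  obtain ⟨d, hd, ⟨φ⟩⟩ := Br.exists_algEquiv_end (hA.baseChange L) h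
  have : Nonempty (Fin d) := ⟨⟨0, hd⟩⟩
  let V := Fin d → L
  have hfinA : Module.finrank F A = d ^ 2 := by
    rw [← Module.finrank_baseChange (R := L), φ.toLinearEquiv.finrank_eq, Module.finrank_linearMap,
      Module.finrank_fin_fun, sq]
  have hfinV : Module.finrank F V = p * d := by
    rw [← Module.finrank_mul_finrank F L V, Module.finrank_fin_fun, pb.finrank, hdim]
  obtain ⟨X, hXA, hXy⟩ := exists_weyl_operator hδ (V := V) φ
  let ι : A →ₐ[F] Module.End F V :=
    (Module.End.restrictScalarsHom F).comp ((φ.toAlgHom.restrictScalars F).comp Algebra.TensorProduct.includeRight)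
  have hι : ∀ a v, ι a v = φ (1 ⊗ₜ a) v := fun a v => rfl
  let m : L →ₐ[F] Module.End F V := Algebra.lsmul F F V
  let Y : Module.End F V := m pb.gen
  have hYX : Y * X = X * Y + 1 := LinearMap.ext hXy
  have hιX : ∀ a, Commute (ι a) X := fun a => LinearMap.ext fun v => (hXA a v).symm
  have hιm : ∀ a z, Commute (ι a) (m z) := fun a z => LinearMap.ext fun v => (φ (1 ⊗ₜ a)).map_smul z v
  have hm : ∀ f : Polynomial F, m (Polynomial.aeval pb.gen f) = Polynomial.aeval Y f := fun f =>
    (Polynomial.aeval_algHom_apply m pb.gen f).symm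
  have hXpY : Commute (X ^ p) Y := by
    have h1 : Y * X - X * Y = 1 := by rw [hYX, add_sub_cancel_left]
    have h2 := commutator_pow (a := Y) (x := X) (by rw [h1]; exact Commute.one_left _) p
    rw [← Nat.cast_smul_eq_nsmul F, CharP.cast_eq_zero, zero_smul, sub_eq_zero] at h2
    exact h2.symm
  have hXpm : ∀ z, Commute (X ^ p) (m z) := by
    intro z
    obtain ⟨f, rfl⟩ := pb.exists_eq_aeval' z
    rw [hm]
    have h1 : Algebra.adjoin F {Y} ≤ Subalgebra.centralizer F {X ^ p} := by
      rw [Algebra.adjoin_le_iff, Set.singleton_subset_iff]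
      rintro _ rfl
      exact hXpY
    exact h1 (Polynomial.aeval_mem_adjoin_singleton F Y) _ rfl
  obtain ⟨z, hz⟩ : ∃ z, X ^ p = m z := by
    let P : Module.End L V := { X ^ p with map_smul' := fun z v => LinearMap.congr_fun (hXpm z).eq v }
    have hP : ∀ t, P * φ t = φ t * P := by
      intro t
      induction t with
      | zero => rw [map_zero, mul_zero, zero_mul]
      | add t t' h h' => rw [map_add, mul_add, add_mul, h, h']
      | tmul z a =>
        have h1 : z ⊗ₜ[F] a = z • (1 ⊗ₜ a) := by rw [TensorProduct.smul_tmul', smul_eq_mul, mul_one]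
        rw [h1, map_smul, mul_smul_comm, smul_mul_assoc]
        congr 1
        exact LinearMap.ext fun v => LinearMap.congr_fun ((hιX a).pow_right p).eq.symm v
    obtain ⟨z, hz⟩ := (IsCSA.end' (K := L) V).center_eq (z := P) fun T => by
      rw [← φ.apply_symm_apply T]
      exact hP _
    exact ⟨z, LinearMap.ext fun v => LinearMap.congr_fun hz v⟩
  obtain ⟨a, rfl⟩ : ∃ a, z = algebraMap F L a := by
    obtain ⟨f, hf, rfl⟩ := pb.exists_eq_aeval z
    rw [hdim] at hf
    have h1 := Polynomial.aeval_commutator hYX f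
    rw [← hm, ← hz, ← pow_succ, ← pow_succ', left_eq_add, ← hm] at h1
    have h2 : Polynomial.aeval pb.gen (Polynomial.derivative f) = 0 :=
      (injective_iff_map_eq_zero m.toRingHom).1 m.toRingHom.injective _ h1
    have h3 : Polynomial.derivative f = 0 := by
      by_contra h3
      have h4 := pb.dim_le_natDegree_of_root h3 h2
      rw [hdim] at h4
      exact absurd (h4.trans (Polynomial.natDegree_derivative_le f)) (by omega)
    refine ⟨f.coeff 0, ?_⟩
    have h4 : f = Polynomial.C (f.coeff 0) := by
      ext k
      rw [Polynomial.coeff_C]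
      split_ifs with hk
      · rw [hk]
      · by_cases hkp : k < p
        · have h5 := congrArg (Polynomial.coeff · (k - 1)) h3
          simp only [Polynomial.coeff_derivative, Polynomial.coeff_zero, ← Nat.cast_succ,
            Nat.sub_add_cancel (Nat.pos_of_ne_zero hk), Nat.succ_eq_add_one] at h5
          refine (mul_eq_zero.1 h5).resolve_right fun h6 => ?_
          exact hk (Nat.eq_zero_of_dvd_of_lt ((CharP.cast_eq_zero_iff F p k).1 h6) hkp)
        · exact Polynomial.coeff_eq_zero_of_natDegree_lt (hf.trans_le (not_lt.1 hkp))
    conv_lhs => rw [h4]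
    rw [Polynomial.aeval_C]
  rw [AlgHom.commutes] at hz
  have hYp : Y ^ p = algebraMap F _ b := by
    rw [← map_pow, hb, AlgHom.commutes]
  let C := Subalgebra.centralizer F (Set.range ι)
  have hXC : X ∈ C := by
    rintro _ ⟨a, rfl⟩
    exact hιX a
  have hYC : Y ∈ C := by
    rintro _ ⟨a, rfl⟩
    exact hιm a _
  obtain ⟨B, _, _, hB, hcls, hfinB, ⟨f⟩⟩ := Br.exists_hom_symbK (p := p) hc a b (S := C) (X := ⟨X, hXC⟩) (Y := ⟨Y, hYC⟩)
    (Subtype.ext hz) (Subtype.ext hYp) (Subtype.ext hYX)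
  have h0 : Br.cls F A + Br.cls F B = 0 := by
    rw [← Br.cls_tensor hA hB]
    refine Br.cls_eq_zero_of_rep (hA.tensor hB) (V := V)
      (Algebra.TensorProduct.lift ι (C.val.comp f) fun x y => ?_) ?_
    · exact (f y).2 _ ⟨x, rfl⟩
    · rw [Module.finrank_tensorProduct, hfinV, hfinA, hfinB]
      exact le_of_eq (by ring)
  refine ⟨-a, ?_⟩
  rw [map_neg, AddMonoidHom.neg_apply, ← hcls]
  exact eq_neg_of_add_eq_zero_left h0

end Descent

section Surjectivity

variable {p : ℕ} [Fact p.Prime] {F : Type u} [Field F] [CharP F p]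
variable {c : ℕ+ → ℕ+ → MvPolynomial (ℕ+ ⊕ₗ ℕ+) ℤ} (hc : IsCFamily c)

namespace Br

theorem res_self {F : Type u} [Field F] (β : Br F) : res F β = β := by
  obtain ⟨A, _, _, hA, rfl⟩ := exists_cls β
  rw [res_cls F hA, cls_congr (Algebra.TensorProduct.lid F A)]

theorem eq_zero_of_res_eq_zero {F : Type u} [Field F] {L : Type u} [Field L] [Algebra F L]
    (h : Function.Surjective (algebraMap F L)) {β : Br F} (hβ : res L β = 0) : β = 0 := by
  let e : F ≃+* L := RingEquiv.ofBijective (algebraMap F L) ⟨(algebraMap F L).injective, h⟩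
  let _ : Algebra L F := e.symm.toRingHom.toAlgebra
  have : IsScalarTower F L F := .of_algebraMap_eq fun x => (e.symm_apply_apply x).symm
  rw [← res_self β, ← res_res L F, hβ, map_zero]

theorem exists_eq_symbK_of_res {L : Type u} [Field L] [Algebra F L] (pb : PowerBasis F L) {b : F}
    (hb : pb.gen ^ p = algebraMap F L b) {β : Br F} (h : res L β = 0) : ∃ a, β = symbK (p := p) hc a b := by
  have hp : p.Prime := Fact.out
  have : CharP L p := charP_of_injective_algebraMap (FaithfulSMul.algebraMap_injective F L) p
  by_cases hb' : ∃ b₀, b₀ ^ p = b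
  · obtain ⟨b₀, rfl⟩ := hb'
    have h1 : pb.gen = algebraMap F L b₀ := by
      refine frobenius_inj L p ?_
      rw [frobenius_def, frobenius_def, hb, map_pow]
    refine ⟨0, ?_⟩
    rw [map_zero, AddMonoidHom.zero_apply]
    refine eq_zero_of_res_eq_zero (fun z => ?_) h
    obtain ⟨f, rfl⟩ := pb.exists_eq_aeval' z
    exact ⟨f.eval b₀, by rw [h1, Polynomial.aeval_algebraMap_apply, Polynomial.coe_aeval_eq_eval]⟩
  · push Not at hb'
    have h1 := X_pow_sub_C_irreducible_of_prime hp hb'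
    have h2 : minpoly F pb.gen = Polynomial.X ^ p - Polynomial.C b :=
      (minpoly.eq_of_irreducible_of_monic h1 (by simp [hb]) (Polynomial.monic_X_pow_sub_C b hp.ne_zero)).symm
    refine exists_eq_symbK_of_finrank hc pb ?_ hb h
    rw [← pb.natDegree_minpoly, h2, Polynomial.natDegree_X_pow_sub_C]

theorem res_symbK (E : Type u) [Field E] [CharP E p] [Algebra F E] (a b : F) :
    res E (symbK (p := p) hc a b) = symbK hc (algebraMap F E a) (algebraMap F E b) := by
  rw [symbK_apply, symbK_apply, symb, symb, Asy.res_cls hc E, WittVector.map_teichmuller, WittVector.map_teichmuller]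

theorem symbK_pow_mul (a b : F) : symbK (p := p) hc (a ^ p * b ^ (p - 1)) b = symbK hc a b := by
  have hp : p.Prime := Fact.out
  rcases eq_or_ne b 0 with rfl | hb
  · rw [map_zero, map_zero]
  have h1 := symb_teichmuller hc 1 (a * b) b hb
  rw [symb_one_eq_symbK hc] at h1
  rw [← sub_eq_zero, ← AddMonoidHom.sub_apply, ← map_sub, ← h1]
  have h2 (u v : WittVector p F) : (u - v).coeff 0 = u.coeff 0 - v.coeff 0 := map_sub WittVector.constantCoeff u v
  congr 2
  · rw [WittVector.mul_coeff_zero, h2, WittVector.frobenius_teichmuller]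
    simp only [WittVector.teichmuller_coeff_zero]
    rw [sub_mul, mul_inv_cancel_right₀ hb, mul_pow, ← pow_sub_one_mul hp.ne_zero b, mul_assoc, mul_inv_cancel_right₀ hb]

/-- The classes killed by a purely inseparable extension of exponent one are sums of symbols: one step
of the induction. -/
theorem exists_omegaK_of_powerBasis {k L : Type u} [Field k] [Field L] [Algebra F k] [Algebra k L] [Algebra F L]
    [IsScalarTower F k L] (hk : ∀ z : k, ∃ b : F, algebraMap F k b = z ^ p)
    (ih : ∀ β : Br F, res k β = 0 → ∃ η, omegaK (p := p) hc η = β) (pb : PowerBasis k L) {b : F}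
    (hb : pb.gen ^ p = algebraMap F L b) :
    (∀ z : L, ∃ b : F, algebraMap F L b = z ^ p) ∧
      ∀ β : Br F, res L β = 0 → ∃ η, omegaK (p := p) hc η = β := by
  have : CharP k p := charP_of_injective_algebraMap (FaithfulSMul.algebraMap_injective F k) p
  have : CharP L p := charP_of_injective_algebraMap (FaithfulSMul.algebraMap_injective F L) p
  refine ⟨fun z => ?_, fun β hβ => ?_⟩
  · change z ^ p ∈ (algebraMap F L).range
    obtain ⟨f, rfl⟩ := pb.exists_eq_aeval' z
    rw [Polynomial.aeval_eq_sum_range, sum_pow_char]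
    refine Subring.sum_mem _ fun i _ => ?_
    rw [Algebra.smul_def, mul_pow, pow_right_comm, hb, ← map_pow]
    obtain ⟨b', hb'⟩ := hk (f.coeff i)
    rw [← hb', ← IsScalarTower.algebraMap_apply, ← map_pow, ← map_mul]
    exact ⟨_, rfl⟩
  · rw [← res_res k L] at hβ
    rw [IsScalarTower.algebraMap_apply F k L] at hb
    obtain ⟨a, ha⟩ := exists_eq_symbK_of_res hc pb hb hβ
    obtain ⟨a', ha'⟩ := hk a
    obtain ⟨η, hη⟩ := ih (β - symbK (p := p) hc (a' * b ^ (p - 1)) b) (by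
      rw [map_sub, res_symbK, ha, map_mul, map_pow, ha', symbK_pow_mul, sub_self])
    refine ⟨η + (a' * b ^ (p - 1)) • KaehlerDifferential.D ℤ F b, ?_⟩
    rw [map_add, omegaK_smul_D, hη, sub_add_cancel]

theorem exists_omegaK_of_res (S : Finset (AlgebraicClosure F))
    (hS : ∀ x ∈ S, ∃ b : F, algebraMap F _ b = x ^ p) (β : Br F)
    (hβ : res (IntermediateField.adjoin F (S : Set (AlgebraicClosure F))) β = 0) :
    ∃ η, omegaK (p := p) hc η = β := by
  suffices h : (∀ z : IntermediateField.adjoin F (S : Set (AlgebraicClosure F)), ∃ b : F, algebraMap F _ b = z ^ p) ∧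
      ∀ β : Br F, res (IntermediateField.adjoin F (S : Set (AlgebraicClosure F))) β = 0 →
        ∃ η, omegaK (p := p) hc η = β from h.2 β hβ
  have hbot : Function.Surjective (algebraMap F (⊥ : IntermediateField F (AlgebraicClosure F))) := fun z => by
    obtain ⟨b, hb⟩ := IntermediateField.mem_bot.1 z.2
    exact ⟨b, Subtype.ext hb⟩
  refine IntermediateField.induction_on_adjoin_finset S
    (fun k => (∀ z : k, ∃ b : F, algebraMap F k b = z ^ p) ∧
      ∀ β : Br F, res k β = 0 → ∃ η, omegaK (p := p) hc η = β) ⟨fun z => ?_, fun β hβ => ⟨0, ?_⟩⟩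
    fun k x hx hk => ?_
  · exact hbot _
  · rw [map_zero]
    exact (eq_zero_of_res_eq_zero hbot hβ).symm
  · obtain ⟨b, hb⟩ := hS x hx
    have hx_int : IsIntegral k x := (Algebra.IsAlgebraic.isAlgebraic (R := F) x).isIntegral.tower_top
    let _ : Algebra F (IntermediateField.adjoin k {x}) :=
      IntermediateField.algebra' ((IntermediateField.adjoin k {x}).restrictScalars F)
    have : IsScalarTower F k (IntermediateField.adjoin k {x}) := .of_algebraMap_eq fun _ => rfl
    let pb : PowerBasis k (IntermediateField.adjoin k {x}) := IntermediateField.adjoin.powerBasis hx_int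
    have hpb : (pb.gen : AlgebraicClosure F) = x := congrArg Subtype.val (IntermediateField.adjoin.powerBasis_gen hx_int)
    have hgen : pb.gen ^ p = algebraMap F (IntermediateField.adjoin k {x}) b := Subtype.ext (by
      change (pb.gen : AlgebraicClosure F) ^ p = algebraMap F _ b
      rw [hpb, hb])
    have key := exists_omegaK_of_powerBasis hc hk.1 hk.2 pb hgen
    exact key

theorem exists_omegaK (β : Br F) (hβ : p • β = 0) : ∃ η, omegaK (p := p) hc η = β := by
  obtain ⟨A, _, _, hA, rfl⟩ := exists_cls β
  obtain ⟨S, hS, h⟩ := hA.exists_finset_splitting p hβ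
  exact exists_omegaK_of_res hc S hS _ h

end Br

end Surjectivity

/-- Tensor powers of isomorphic algebras are isomorphic. -/
def PiTensorProduct.algCongr {ι R : Type*} [CommRing R] {A B : Type*} [Ring A] [Ring B] [Algebra R A]
    [Algebra R B] (e : A ≃ₐ[R] B) : (⨂[R] _i : ι, A) ≃ₐ[R] ⨂[R] _i : ι, B :=
  AlgEquiv.ofBijective
    (PiTensorProduct.liftAlgHom ((PiTensorProduct.tprod R).compLinearMap fun _ : ι => (e.toLinearMap : A →ₗ[R] B))
      (by
        rw [MultilinearMap.compLinearMap_apply, PiTensorProduct.one_def]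
        congr 1
        ext i
        exact map_one e)
      fun x y => by
        simp only [MultilinearMap.compLinearMap_apply, PiTensorProduct.tprod_mul_tprod]
        congr 1
        ext i
        exact map_mul e (x i) (y i))
    (PiTensorProduct.congr fun _ : ι => e.toLinearEquiv).bijective

section Assembly

variable {p : ℕ} [Fact p.Prime] {K : Type u} [Field K] [CharP K p]
variable {c : ℕ+ → ℕ+ → MvPolynomial (ℕ+ ⊕ₗ ℕ+) ℤ}

open Br

theorem isCSA_asymb (hc : IsCFamily c) (n : ℕ) (a b : TruncatedWittVector p n K) : IsCSA K (Asymb K p c n n a b) := by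
  obtain ⟨a, rfl⟩ := WittVector.truncate_surjective p n K a
  obtain ⟨b, rfl⟩ := WittVector.truncate_surjective p n K b
  exact Asy.isCSA hc

theorem isCSA_tensorList (hc : IsCFamily c) (n : ℕ)
    (L : List (TruncatedWittVector p n K × TruncatedWittVector p n K)) : IsCSA K (tensorList p K n c L) :=
  .piTensorProduct _ fun _ => isCSA_asymb hc n _ _

theorem Br.cls_tensorList (hc : IsCFamily c) (n : ℕ)
    (L : List (TruncatedWittVector p n K × TruncatedWittVector p n K)) :
    cls K (tensorList p K n c L) = omega hc n (omegaSum p K n L) := by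
  rw [cls_piTensorProduct _ fun _ => isCSA_asymb hc n _ _, omegaSum, map_list_sum, List.map_map,
    ← Fin.sum_univ_fun_getElem]
  exact Finset.sum_congr rfl fun i _ => (omega_smul_D hc n _ _).symm

theorem Br.nsmul_omega (hc : IsCFamily c) (n : ℕ) (x : KaehlerDifferential ℤ (TruncatedWittVector p n K)) :
    p ^ n • omega hc n x = 0 := by
  have hx : x ∈ (⊤ : AddSubgroup _) := trivial
  rw [← span_smul_D] at hx
  induction hx using AddSubgroup.closure_induction with
  | mem _ hx =>
    obtain ⟨a, b, rfl⟩ := hx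
    obtain ⟨a, rfl⟩ := WittVector.truncate_surjective p n K a
    obtain ⟨b, rfl⟩ := WittVector.truncate_surjective p n K b
    rw [omega_truncate, nsmul_symb hc]
  | zero => rw [map_zero, smul_zero]
  | add _ _ _ _ h h' => rw [map_add, smul_add, h, h', add_zero]
  | neg _ _ h => rw [map_neg, smul_neg, h, neg_zero]

end Assembly

set_option maxSynthPendingDepth 3 in
set_option synthInstance.maxHeartbeats 1000000 in
set_option maxHeartbeats 1000000 in
/-- Let `p` be a prime, `K` a field of characteristic `p` and `n ≥ 1`.  Let `G_n` be the
quotient of `Ω¹(W_n(K))` by the subgroup generated by all `Fa·db − a·dVb` and all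
`℘([a])·[b]⁻¹·d[b]`.  Then `a·db ↦ ((a,b))_{p^n}` induces a well-defined group isomorphism
`α_{p^n} : G_n ≃ Br(K)[p^n]` onto the `p^n`-torsion of `Br(K)`.  Concretely (elements of
`Ω¹(W_n(K))` being written as `∑ a_i db_i` and their images as tensor products of the
algebras `A_{((a_i,b_i))_{p^n}}`, equality in `Br(K)` being Brauer equivalence):
(1) two sums have the same image iff their difference lies in the subgroup of relations
(this is well-definedness together with injectivity, and the assignment is additive by
construction); (2) every image is `p^n`-torsion; (3) every finite-dimensional central
simple `K`-algebra whose Brauer class is `p^n`-torsion is Brauer equivalent to the image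
of some sum (surjectivity). -/
theorem symbol_representation_iso (p : ℕ) [Fact p.Prime] (K : Type*) [Field K] [CharP K p]
    (n : ℕ) (hn : 1 ≤ n) (c : ℕ+ → ℕ+ → MvPolynomial (ℕ+ ⊕ₗ ℕ+) ℤ) (hc : IsCFamily c) :
    (∀ L L' : List (TruncatedWittVector p n K × TruncatedWittVector p n K),
      omegaSum p K n L - omegaSum p K n L' ∈ symbolRelations p K n ↔
        BrauerEquiv K (tensorList p K n c L) (tensorList p K n c L')) ∧
    (∀ L : List (TruncatedWittVector p n K × TruncatedWittVector p n K),
      BrauerEquiv K (⨂[K] (_i : Fin (p ^ n)), tensorList p K n c L) K) ∧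
    (∀ (A : Type*) [Ring A] [Algebra K A], FiniteDimensional K A →
      Subalgebra.center K A = ⊥ → IsSimpleRing A →
      BrauerEquiv K (⨂[K] (_i : Fin (p ^ n)), A) K →
      ∃ L : List (TruncatedWittVector p n K × TruncatedWittVector p n K),
        BrauerEquiv K A (tensorList p K n c L)) := by
  refine ⟨fun L L' => ?_, fun L => ?_, fun A _ _ hfd hcen hsim hA => ?_⟩
  · rw [← Br.omega_ker hc (Br.omegaK_ker_le hc) hn, AddMonoidHom.mem_ker, map_sub, sub_eq_zero, ← Br.cls_tensorList,
      ← Br.cls_tensorList]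
    exact Br.cls_eq_iff (isCSA_tensorList hc n L) (isCSA_tensorList hc n L')
  · have h := isCSA_tensorList hc n L
    refine (Br.cls_eq_zero_iff (.piTensorProduct _ fun _ => h)).1 ?_
    rw [Br.cls_piTensorProduct _ fun _ => h, Finset.sum_const, Finset.card_univ, Fintype.card_fin,
      Br.cls_tensorList hc, Br.nsmul_omega]
  · have hsmall : Small.{u_1} A := by
      exact small_of_injective (Module.finBasis K A).equivFun.injective
    let e : Shrink.{u_1} A ≃ₐ[K] A := Shrink.algEquiv K A
    have h : IsCSA K (Shrink.{u_1} A) := (IsCSA.of_central_simple hcen hsim).of_algEquiv e.symm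
    obtain ⟨x, hx⟩ := Br.exists_omega hc (Br.exists_omegaK hc) n (Br.cls K (Shrink.{u_1} A)) (by
      have h1 := (Br.cls_eq_zero_iff (.piTensorProduct _ fun _ : Fin (p ^ n) => h)).2
        ((BrauerEquiv.of_algEquiv (PiTensorProduct.algCongr e)).trans hA)
      rwa [Br.cls_piTensorProduct _ fun _ => h, Finset.sum_const, Finset.card_univ, Fintype.card_fin] at h1)
    obtain ⟨L, rfl⟩ := exists_omegaSum n x
    rw [← Br.cls_tensorList] at hx
    exact ⟨L, (BrauerEquiv.of_algEquiv e.symm).trans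
      ((Br.cls_eq_iff (isCSA_tensorList hc n L) h).1 hx).symm⟩

end
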